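/- Let T be a simple geodesic triangle in Y with vertices p, q, r. For all sufficiently small ε > 0, both limit segments R_q^ε and R_r^ε of T at p exist, and the Alexandrov angle of T at p in Y equals the Alexandrov angle in X between the limit segments: ∠_p^Y(q, r) = ∠_p^X(R_q^ε, R_r^ε). -/

import Mathlib

open Set Metric Filter

noncomputable section

namespace Cat2Cx

/-! ### Comparison angles -/

/-- Inverse hyperbolic cosine. -/
def arcosh (x : ℝ) : ℝ := Real.log (x + Real.sqrt (x ^ 2 - 1))

/-- The Euclidean comparison angle at the vertex of a (comparison) triangle whose adjacent
sides have lengths `a`, `b` and whose opposite side has length `c`, via the law of cosines. -/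
def euclCompAngle (a b c : ℝ) : ℝ :=
  Real.arccos ((a ^ 2 + b ^ 2 - c ^ 2) / (2 * a * b))

/-- The comparison angle in the model plane `M_κ²` of constant curvature `κ ≤ 0`, via the
(Euclidean or hyperbolic) law of cosines. -/
def compAngle (κ a b c : ℝ) : ℝ :=
  if κ = 0 then euclCompAngle a b c
  else
    Real.arccos
      ((Real.cosh (Real.sqrt (-κ) * a) * Real.cosh (Real.sqrt (-κ) * b) -
          Real.cosh (Real.sqrt (-κ) * c)) /
        (Real.sinh (Real.sqrt (-κ) * a) * Real.sinh (Real.sqrt (-κ) * b)))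

variable {Z : Type*}

/-! ### Geodesics with respect to a distance function -/

/-- `f` restricted to `[a,b]` is a unit-speed geodesic for the distance function `d`
(an isometric embedding of the compact interval `[a,b]`). -/
def IsGeodesicWrt (d : Z → Z → ℝ) (f : ℝ → Z) (a b : ℝ) : Prop :=
  a ≤ b ∧ ∀ s ∈ Icc a b, ∀ t ∈ Icc a b, d (f s) (f t) = |s - t|

/-- `f` is a unit-speed geodesic from `x` to `y` (for the distance function `d`),
staying inside `S`. -/
def IsGeodesicFromTo (d : Z → Z → ℝ) (S : Set Z) (f : ℝ → Z) (x y : Z) : Prop :=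
  f 0 = x ∧ f (d x y) = y ∧ IsGeodesicWrt d f 0 (d x y) ∧ MapsTo f (Icc 0 (d x y)) S

/-- `S`, with the distance function `d`, is a geodesic space. -/
def GeodesicSpaceWrt (d : Z → Z → ℝ) (S : Set Z) : Prop :=
  ∀ x ∈ S, ∀ y ∈ S, ∃ f, IsGeodesicFromTo d S f x y

/-- The geodesic segment `[x,y]`: the union of (the images of) all geodesics from `x` to `y`
inside `S`.  In a uniquely geodesic space this is the image of the unique geodesic. -/
def geodSeg (d : Z → Z → ℝ) (S : Set Z) (x y : Z) : Set Z :=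
  ⋃ f ∈ {f : ℝ → Z | IsGeodesicFromTo d S f x y}, f '' Icc 0 (d x y)

/-- `C ⊆ S` is geodesically convex with respect to `d`: every geodesic (in `S`) between two
points of `C` lies in `C`. -/
def ConvexWrtIn (d : Z → Z → ℝ) (S C : Set Z) : Prop :=
  ∀ x ∈ C, ∀ y ∈ C, geodSeg d S x y ⊆ C

/-- `C` is geodesically convex with respect to `d`. -/
abbrev ConvexWrt (d : Z → Z → ℝ) (C : Set Z) : Prop := ConvexWrtIn d univ C

/-- The geodesically convex hull of `A` with respect to `d`. -/
def convexHullWrt (d : Z → Z → ℝ) (A : Set Z) : Set Z :=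
  ⋂₀ {C | ConvexWrt d C ∧ A ⊆ C}

/-- The Alexandrov (upper) angle at `p` between two paths `σ`, `τ` issuing from `p`
(each parametrized so that `σ 0 = τ 0 = p`): the limit as `ε → 0⁺` (i.e. the infimum over
`ε > 0`) of the supremum over `0 < s, t < ε` of the Euclidean comparison angles. -/
def upperAngleWrt (d : Z → Z → ℝ) (p : Z) (σ τ : ℝ → Z) : ℝ :=
  sInf {a | ∃ ε > 0, a = sSup {b | ∃ s t : ℝ, 0 < s ∧ s < ε ∧ 0 < t ∧ t < ε ∧
      b = euclCompAngle (d p (σ s)) (d p (τ t)) (d (σ s) (τ t))}}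

/-- The CAT(κ) condition (for `κ ≤ 0`), in the angle-comparison form
(Bridson–Haefliger II.1.7(4)): `S` is geodesic and for every triple of distinct points the
Alexandrov angle between geodesics is at most the comparison angle in `M_κ²`. -/
def IsCATWrt (κ : ℝ) (d : Z → Z → ℝ) (S : Set Z) : Prop :=
  GeodesicSpaceWrt d S ∧
    ∀ p ∈ S, ∀ q ∈ S, ∀ r ∈ S, p ≠ q → p ≠ r → q ≠ r →
      ∀ σ τ : ℝ → Z, IsGeodesicFromTo d S σ p q → IsGeodesicFromTo d S τ p r →
        upperAngleWrt d p σ τ ≤ compAngle κ (d p q) (d p r) (d q r)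

/-- Completeness of `S` with respect to the distance function `d`:
every Cauchy sequence converges. -/
def CompleteWrt (d : Z → Z → ℝ) (S : Set Z) : Prop :=
  ∀ u : ℕ → Z, (∀ n, u n ∈ S) →
    (∀ ε > 0, ∃ N, ∀ m ≥ N, ∀ n ≥ N, d (u m) (u n) < ε) →
    ∃ x ∈ S, ∀ ε > 0, ∃ N, ∀ n ≥ N, d (u n) x < ε

variable {X : Type*} [MetricSpace X]

/-- `X` is a CAT(κ) metric space. -/
def IsCATSpace (κ : ℝ) (X : Type*) [MetricSpace X] : Prop :=
  IsCATWrt κ (fun x y : X => dist x y) univ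

/-- The distance function of the metric space `X`. -/
abbrev xDist (X : Type*) [MetricSpace X] : X → X → ℝ := fun x y => dist x y

/-! ### The model plane `M_κ²` and polyhedral 2-complexes -/

/-- The distance function of the model plane `M_κ²` of constant curvature `κ ≤ 0`, in global
coordinates `ℝ²`: the Euclidean distance for `κ = 0`, and for `κ < 0` the distance of the
hyperboloid model rescaled by `1/√(-κ)` (so that the curvature is `κ`). -/
def mDist (κ : ℝ) (u v : ℝ × ℝ) : ℝ :=
  if κ = 0 then Real.sqrt ((u.1 - v.1) ^ 2 + (u.2 - v.2) ^ 2)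
  else
    (1 / Real.sqrt (-κ)) *
      arcosh (Real.sqrt (1 + u.1 ^ 2 + u.2 ^ 2) * Real.sqrt (1 + v.1 ^ 2 + v.2 ^ 2) -
        u.1 * v.1 - u.2 * v.2)

/-- A convex polygonal 2-cell in `M_κ²`: the geodesically convex hull of a finite set of
points, with nonempty interior. -/
def IsPolygonalCell (κ : ℝ) (P : Set (ℝ × ℝ)) : Prop :=
  ∃ F : Finset (ℝ × ℝ), P = convexHullWrt (mDist κ) (F : Set (ℝ × ℝ)) ∧ (interior P).Nonempty

/-- The subset `S` of `X` embeds isometrically into the model plane `M_κ²`. -/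
def IsomEmbedsInModelPlane (κ : ℝ) (S : Set X) : Prop :=
  ∃ f : X → ℝ × ℝ, ∀ x ∈ S, ∀ y ∈ S, mDist κ (f x) (f y) = dist x y

/-- A locally finite `M_κ`-polyhedral 2-complex structure on the metric space `X`:
`X` is partitioned into open 2-cells (faces), open 1-cells (edges) and vertices; the closure of
each face is isometric to a compact convex polygon of the model plane `M_κ²` (so each face has
constant curvature `κ`), each edge is a geodesic arc, and the complex is locally finite. -/
structure PolyComplex2 (κ : ℝ) (X : Type*) [MetricSpace X] where
  faces : Set (Set X)
  edges : Set (Set X)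
  vertices : Set X
  faces_open : ∀ F ∈ faces, IsOpen F
  cover : ⋃₀ faces ∪ ⋃₀ edges ∪ vertices = univ
  cells_disjoint : ∀ c ∈ faces ∪ edges, ∀ c' ∈ faces ∪ edges, c ≠ c' → c ∩ c' = ∅
  cells_vertex_disjoint : ∀ c ∈ faces ∪ edges, c ∩ vertices = ∅
  face_chart : ∀ F ∈ faces, ∃ (f : X → ℝ × ℝ) (P : Set (ℝ × ℝ)),
    IsPolygonalCell κ P ∧ InjOn f (closure F) ∧ f '' closure F = P ∧ f '' F = interior P ∧
    ∀ x ∈ closure F, ∀ y ∈ closure F, mDist κ (f x) (f y) = dist x y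
  edge_geodesic : ∀ e ∈ edges, ∃ (f : ℝ → X) (L : ℝ), 0 < L ∧
    IsGeodesicWrt (fun x y : X => dist x y) f 0 L ∧ f '' Ioo 0 L = e
  edge_closure : ∀ e ∈ edges, closure e \ e ⊆ vertices
  face_closure : ∀ F ∈ faces, closure F \ F ⊆ ⋃₀ edges ∪ vertices
  locally_finite : ∀ x : X, ∃ ε > 0,
    {c | (c ∈ faces ∨ c ∈ edges) ∧ (c ∩ ball x ε).Nonempty}.Finite ∧
    (vertices ∩ ball x ε).Finite

/-! ### Simple closed curves, their interiors, and first homology -/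

/-- A simple closed curve in `X` (identified with its image). -/
structure SCC (X : Type*) [TopologicalSpace X] where
  toFun : ℝ → X
  contOn : ContinuousOn toFun (Icc 0 1)
  loop : toFun 0 = toFun 1
  inj : InjOn toFun (Ico 0 1)

/-- The image of a simple closed curve. -/
def SCC.img {X : Type*} [TopologicalSpace X] (γ : SCC X) : Set X := γ.toFun '' Icc 0 1

/-- The first singular homology class of a loop, via the Hurewicz isomorphism: the class of
the loop in the abelianization of the fundamental group (of its path component); the loop is
nullhomologous iff this class is trivial. -/
def loopClassH1 {B : Type*} [TopologicalSpace B] {x : B} (p : Path x x) :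
    Abelianization (FundamentalGroup B x) :=
  Abelianization.of (FundamentalGroup.fromPath (X := TopCat.of B) ⟦p⟧)

/-- The basepoint of a simple closed curve, regarded in a subspace `B` containing it. -/
def SCC.basePoint {X : Type*} [TopologicalSpace X] (γ : SCC X) (B : Set X)
    (h : γ.img ⊆ B) : B :=
  ⟨γ.toFun 0, h ⟨0, ⟨le_rfl, zero_le_one⟩, rfl⟩⟩

/-- The loop of a simple closed curve, as a `Path` in a subspace `B` containing it. -/
def SCC.pathIn {X : Type*} [TopologicalSpace X] (γ : SCC X) (B : Set X) (h : γ.img ⊆ B) :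
    Path (γ.basePoint B h) (γ.basePoint B h) where
  toFun t := ⟨γ.toFun t, h ⟨(t : ℝ), t.2, rfl⟩⟩
  continuous_toFun := by
    apply Continuous.subtype_mk
    exact γ.contOn.comp_continuous continuous_subtype_val fun t => t.2
  source' := by
    apply Subtype.ext
    rfl
  target' := by
    apply Subtype.ext
    exact γ.loop.symm

/-- The simple closed curve `γ` is nullhomologous in the subspace `B` of `X`:
its class in `H₁(B)` vanishes. -/
def SCC.NullhomologousIn {X : Type*} [TopologicalSpace X] (γ : SCC X) (B : Set X) : Prop :=
  ∀ h : γ.img ⊆ B, loopClassH1 (γ.pathIn B h) = 1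

/-- The interior of a simple closed curve `γ`:
`Int γ = {x ∈ X \ γ | [γ] ≠ 0 ∈ H₁(X \ {x})}`. -/
def SCC.interiorSet {X : Type*} [TopologicalSpace X] (γ : SCC X) : Set X :=
  {x | x ∉ γ.img ∧ ¬ γ.NullhomologousIn {x}ᶜ}

/-- The first singular homology of `B` vanishes: every loop in `B` is nullhomologous
(via the Hurewicz isomorphism on each path component). -/
def H1Trivial (B : Type*) [TopologicalSpace B] : Prop :=
  ∀ (x : B) (p : Path x x), loopClassH1 p = 1

/-! ### Rectifiable connectedness and the induced path metric -/

/-- `g` is a path from `x` to `y` (parametrized by `[0,1]`) inside `E`. -/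
def IsPathIn {X : Type*} [TopologicalSpace X] (E : Set X) (g : ℝ → X) (x y : X) : Prop :=
  ContinuousOn g (Icc 0 1) ∧ g 0 = x ∧ g 1 = y ∧ MapsTo g (Icc 0 1) E

/-- `E` is rectifiably connected: any two of its points are joined by a rectifiable
(finite length) path in `E`. -/
def RectConnected {X : Type*} [MetricSpace X] (E : Set X) : Prop :=
  ∀ x ∈ E, ∀ y ∈ E, ∃ g : ℝ → X, IsPathIn E g x y ∧ eVariationOn g (Icc 0 1) ≠ ⊤

/-- The induced path metric on `E`: the infimum of the lengths of rectifiable paths in `E`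
joining the two points. -/
def pathDistIn {X : Type*} [MetricSpace X] (E : Set X) (x y : X) : ℝ :=
  (⨅ g : {g : ℝ → X // IsPathIn E g x y}, eVariationOn g.1 (Icc 0 1)).toReal


universe u
/-! ### Conical neighborhoods -/


/-- The distance function of the `κ`-cone (κ ≤ 0) over a space with distance function `dL`:
a point is a pair (radius, link point), all points of radius `0` being identified (the cone
point); the distance is given by the law of cosines in curvature `κ`, with angle
`min π (dL ℓ ℓ')`. -/
def coneDist (κ : ℝ) {L : Type*} (dL : L → L → ℝ) (a b : ℝ × L) : ℝ :=
  if κ = 0 then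
    Real.sqrt (a.1 ^ 2 + b.1 ^ 2 - 2 * a.1 * b.1 * Real.cos (min Real.pi (dL a.2 b.2)))
  else
    (1 / Real.sqrt (-κ)) *
      arcosh (Real.cosh (Real.sqrt (-κ) * a.1) * Real.cosh (Real.sqrt (-κ) * b.1) -
        Real.sinh (Real.sqrt (-κ) * a.1) * Real.sinh (Real.sqrt (-κ) * b.1) *
          Real.cos (min Real.pi (dL a.2 b.2)))

/-- `V` is a conical neighborhood of `p` in `X`: an open neighborhood of `p` isometric to a
convex open subset of the `κ`-cone over a metric space (the link of `p`), the isometry taking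
`p` to the cone point. -/
def IsConicalNbhd (κ : ℝ) (p : X) (V : Set X) : Prop :=
  IsOpen V ∧ p ∈ V ∧
    ∃ (L : Type u) (dL : L → L → ℝ) (f : X → ℝ × L),
      (∀ a, dL a a = 0) ∧ (∀ a b, 0 ≤ dL a b) ∧ (∀ a b, dL a b = dL b a) ∧
      (∀ a b c, dL a c ≤ dL a b + dL b c) ∧
      (∀ x ∈ V, 0 ≤ (f x).1) ∧ (f p).1 = 0 ∧
      (∀ x ∈ V, ∀ y ∈ V, dist x y = coneDist κ dL (f x) (f y)) ∧
      (∀ x ∈ V, (f x).1 = 0 → x = p) ∧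
      ConvexWrtIn (coneDist κ dL) {w : ℝ × L | 0 ≤ w.1} (f '' V) ∧
      (∀ z ∈ f '' V, ∃ ε > 0, ∀ w : ℝ × L, 0 ≤ w.1 → coneDist κ dL z w < ε → w ∈ f '' V)

/-! ### Geodesics, triangles, and limit segments in `Y = (E, induced path metric)` -/

/-- The set `α` is (the image of) a geodesic arc of `Y = (E, pathDistIn E)`. -/
def IsYGeodesicArc (E : Set X) (α : Set X) : Prop :=
  ∃ (f : ℝ → X) (a b : ℝ), IsGeodesicWrt (pathDistIn E) f a b ∧
    MapsTo f (Icc a b) E ∧ f '' Icc a b = α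

/-- `T` is a geodesic triangle of `Y = (E, pathDistIn E)` with vertices `p`, `q`, `r`:
the union of the three `Y`-geodesics joining the vertices. -/
def IsYTriangle (E : Set X) (T : Set X) (p q r : X) : Prop :=
  p ∈ E ∧ q ∈ E ∧ r ∈ E ∧
    T = geodSeg (pathDistIn E) E p q ∪ geodSeg (pathDistIn E) E q r ∪
        geodSeg (pathDistIn E) E r p

/-- The set `γim` (a curve in `E`) is locally geodesic in `Y` at `p`: some subarc of `γim`
containing `p` in its relative interior is a geodesic of `Y`. -/
def LocallyYGeodesicAt (E γim : Set X) (p : X) : Prop :=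
  ∃ (f : ℝ → X) (a b t : ℝ), t ∈ Ioo a b ∧ f t = p ∧
    IsGeodesicWrt (pathDistIn E) f a b ∧ MapsTo f (Icc a b) E ∧ f '' Icc a b ⊆ γim

/-- `f : [0,1] → E` is the constant-speed parametrization of the `Y`-geodesic
from `x` to `y`. -/
def IsConstSpeedYGeodesic (E : Set X) (f : ℝ → X) (x y : X) : Prop :=
  f 0 = x ∧ f 1 = y ∧ MapsTo f (Icc 0 1) E ∧
    ∀ s ∈ Icc (0:ℝ) 1, ∀ t ∈ Icc (0:ℝ) 1,
      pathDistIn E (f s) (f t) = pathDistIn E x y * |s - t|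

/-- `R` is the limit segment of length `ε` at `p` of the `Y`-geodesic side from `p` to `q`:
`R` is an `X`-geodesic of length `ε` issuing from `p`, and the `X`-geodesics of length `ε`
from `p` through `σ t` (σ the `Y`-geodesic from `p` to `q`) converge uniformly to `R`
as `t → 0⁺`. -/
def IsLimitSegment (E : Set X) (p q : X) (ε : ℝ) (R : ℝ → X) : Prop :=
  0 < ε ∧ R 0 = p ∧ IsGeodesicWrt (fun x y : X => dist x y) R 0 ε ∧
    ∀ σ : ℝ → X, IsGeodesicFromTo (pathDistIn E) E σ p q →
      ∀ δ > 0, ∃ t₀ > 0, ∀ t, 0 < t → t ≤ t₀ → t ≤ pathDistIn E p q →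
        ∀ g : ℝ → X, IsGeodesicWrt (fun x y : X => dist x y) g 0 ε → g 0 = p →
          g (dist p (σ t)) = σ t → ∀ s ∈ Icc 0 ε, dist (g s) (R s) ≤ δ


end Cat2Cx

end

section

open Set Metric Filter

namespace Cat2Cx

/-! ### Upper angles -/

section Angles

variable {Z : Type*} {d : Z → Z → ℝ} {p : Z} {σ τ ρ : ℝ → Z}

theorem euclCompAngle_nonneg (a b c : ℝ) : 0 ≤ euclCompAngle a b c := Real.arccos_nonneg _

theorem euclCompAngle_le_pi (a b c : ℝ) : euclCompAngle a b c ≤ Real.pi := Real.arccos_le_pi _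

theorem bddAbove_angles (d : Z → Z → ℝ) (p : Z) (σ τ : ℝ → Z) (ε : ℝ) :
    BddAbove {b | ∃ s t : ℝ, 0 < s ∧ s < ε ∧ 0 < t ∧ t < ε ∧
      b = euclCompAngle (d p (σ s)) (d p (τ t)) (d (σ s) (τ t))} := by
  refine ⟨Real.pi, ?_⟩
  rintro b ⟨s, t, -, -, -, -, rfl⟩
  exact euclCompAngle_le_pi _ _ _

theorem angleSup_nonneg (d : Z → Z → ℝ) (p : Z) (σ τ : ℝ → Z) (ε : ℝ) :
    0 ≤ sSup {b | ∃ s t : ℝ, 0 < s ∧ s < ε ∧ 0 < t ∧ t < ε ∧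
      b = euclCompAngle (d p (σ s)) (d p (τ t)) (d (σ s) (τ t))} := by
  apply Real.sSup_nonneg
  rintro b ⟨s, t, -, -, -, -, rfl⟩
  exact euclCompAngle_nonneg _ _ _

theorem upperAngle_nonneg (d : Z → Z → ℝ) (p : Z) (σ τ : ℝ → Z) :
    0 ≤ upperAngleWrt d p σ τ := by
  apply Real.sInf_nonneg
  rintro a ⟨ε, -, rfl⟩
  exact angleSup_nonneg _ _ _ _ _

theorem upperAngle_le {A ε : ℝ} (hε : 0 < ε)
    (h : ∀ s t, 0 < s → s < ε → 0 < t → t < ε →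
      euclCompAngle (d p (σ s)) (d p (τ t)) (d (σ s) (τ t)) ≤ A) :
    upperAngleWrt d p σ τ ≤ A := by
  refine csInf_le_of_le ⟨0, ?_⟩ ⟨ε, hε, rfl⟩ ?_
  · rintro a ⟨ε, -, rfl⟩
    exact angleSup_nonneg _ _ _ _ _
  · apply csSup_le
    · exact ⟨_, ε / 2, ε / 2, by linarith, by linarith, by linarith, by linarith, rfl⟩
    · rintro b ⟨s, t, h1, h2, h3, h4, rfl⟩
      exact h s t h1 h2 h3 h4

theorem exists_forall_angle_lt {A : ℝ} (h : upperAngleWrt d p σ τ < A) :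
    ∃ ε > 0, ∀ s t, 0 < s → s < ε → 0 < t → t < ε →
      euclCompAngle (d p (σ s)) (d p (τ t)) (d (σ s) (τ t)) < A := by
  obtain ⟨a, ⟨ε, hε, rfl⟩, ha⟩ := exists_lt_of_csInf_lt
    (s := {a | ∃ ε > 0, a = sSup {b | ∃ s t : ℝ, 0 < s ∧ s < ε ∧ 0 < t ∧ t < ε ∧
      b = euclCompAngle (d p (σ s)) (d p (τ t)) (d (σ s) (τ t))}}) ⟨_, 1, one_pos, rfl⟩ h
  refine ⟨ε, hε, fun s t h1 h2 h3 h4 => lt_of_le_of_lt ?_ ha⟩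
  exact le_csSup (bddAbove_angles d p σ τ ε) ⟨s, t, h1, h2, h3, h4, rfl⟩

theorem le_upperAngle {A : ℝ}
    (h : ∀ ε > 0, ∃ s t, 0 < s ∧ s < ε ∧ 0 < t ∧ t < ε ∧
      A ≤ euclCompAngle (d p (σ s)) (d p (τ t)) (d (σ s) (τ t))) :
    A ≤ upperAngleWrt d p σ τ := by
  by_contra hlt
  obtain ⟨ε, hε, hb⟩ := exists_forall_angle_lt (not_le.mp hlt)
  obtain ⟨s, t, h1, h2, h3, h4, h5⟩ := h ε hε
  exact absurd (hb s t h1 h2 h3 h4) (not_lt.mpr h5)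

theorem upperAngle_congr {d' : Z → Z → ℝ} {σ' τ' : ℝ → Z} {ε : ℝ} (hε : 0 < ε)
    (h : ∀ s t, 0 < s → s < ε → 0 < t → t < ε →
      d p (σ s) = d' p (σ' s) ∧ d p (τ t) = d' p (τ' t) ∧ d (σ s) (τ t) = d' (σ' s) (τ' t)) :
    upperAngleWrt d p σ τ = upperAngleWrt d' p σ' τ' := by
  apply le_antisymm
  · refine le_of_forall_gt_imp_ge_of_dense fun A hA => ?_
    obtain ⟨ε', hε', hb⟩ := exists_forall_angle_lt hA
    refine upperAngle_le (lt_min hε hε') fun s t h1 h2 h3 h4 => ?_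
    obtain ⟨e1, e2, e3⟩ := h s t h1 (h2.trans_le (min_le_left _ _)) h3 (h4.trans_le (min_le_left _ _))
    rw [e1, e2, e3]
    exact (hb s t h1 (h2.trans_le (min_le_right _ _)) h3 (h4.trans_le (min_le_right _ _))).le
  · refine le_of_forall_gt_imp_ge_of_dense fun A hA => ?_
    obtain ⟨ε', hε', hb⟩ := exists_forall_angle_lt hA
    refine upperAngle_le (lt_min hε hε') fun s t h1 h2 h3 h4 => ?_
    obtain ⟨e1, e2, e3⟩ := h s t h1 (h2.trans_le (min_le_left _ _)) h3 (h4.trans_le (min_le_left _ _))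
    rw [← e1, ← e2, ← e3]
    exact (hb s t h1 (h2.trans_le (min_le_right _ _)) h3 (h4.trans_le (min_le_right _ _))).le

/-- A planar point on the segment joining two points at angles `α`, `-β` to the real axis. -/
theorem exists_split {s t α β : ℝ} (hs : 0 < s) (ht : 0 < t) (hα : 0 < α) (hβ : 0 < β)
    (hαβ : α + β < Real.pi) :
    ∃ r, 0 < r ∧ r ≤ max s t ∧
      Real.sqrt (s ^ 2 + r ^ 2 - 2 * s * r * Real.cos α) +
        Real.sqrt (r ^ 2 + t ^ 2 - 2 * r * t * Real.cos β) =
      Real.sqrt (s ^ 2 + t ^ 2 - 2 * s * t * Real.cos (α + β)) := by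
  have h1 : 0 < Real.sin α := Real.sin_pos_of_pos_of_lt_pi hα (by linarith)
  have h2 : 0 < Real.sin β := Real.sin_pos_of_pos_of_lt_pi hβ (by linarith)
  have h3 : 0 < Real.sin (α + β) := Real.sin_pos_of_pos_of_lt_pi (by linarith) hαβ
  have c1 := Real.sin_sq_add_cos_sq α
  have c2 := Real.sin_sq_add_cos_sq β
  have hD : 0 < s * Real.sin α + t * Real.sin β := by positivity
  set D := s * Real.sin α + t * Real.sin β with hDdef
  set l := t * Real.sin β / D with hl
  set m := s * Real.sin α / D with hm
  have hlm : l + m = 1 := by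
    rw [hl, hm, ← add_div, div_eq_one_iff_eq hD.ne', hDdef]; ring
  have hl0 : 0 < l := by positivity
  have hm0 : 0 < m := by positivity
  set r := s * t * Real.sin (α + β) / D with hr
  have hre : r = l * (s * Real.cos α) + m * (t * Real.cos β) := by
    rw [hr, hl, hm, Real.sin_add]; field_simp; ring
  have him : l * (s * Real.sin α) = m * (t * Real.sin β) := by
    rw [hl, hm]; field_simp
  have hr0 : 0 < r := by positivity
  refine ⟨r, hr0, ?_, ?_⟩
  · rw [hre]
    have e1 : s * Real.cos α ≤ max s t := by
      refine le_trans ?_ (le_max_left s t); nlinarith [Real.cos_le_one α]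
    have e2 : t * Real.cos β ≤ max s t := by
      refine le_trans ?_ (le_max_right s t); nlinarith [Real.cos_le_one β]
    nlinarith
  · set C := Real.sqrt (s ^ 2 + t ^ 2 - 2 * s * t * Real.cos (α + β)) with hC
    have hCsq : s ^ 2 + t ^ 2 - 2 * s * t * Real.cos (α + β) =
        (s * Real.cos α - t * Real.cos β) ^ 2 + (s * Real.sin α + t * Real.sin β) ^ 2 := by
      rw [Real.cos_add]
      linear_combination (- s^2) * c1 - t ^ 2 * c2
    have hC2 : C ^ 2 = s ^ 2 + t ^ 2 - 2 * s * t * Real.cos (α + β) :=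
      Real.sq_sqrt (by rw [hCsq]; positivity)
    have hC0 : 0 ≤ C := Real.sqrt_nonneg _
    have e1 : s ^ 2 + r ^ 2 - 2 * s * r * Real.cos α = (m * C) ^ 2 := by
      rw [mul_pow, hC2, hCsq]
      have k1 : s * Real.cos α - r = m * (s * Real.cos α - t * Real.cos β) := by
        rw [hre]; linear_combination (-(s * Real.cos α)) * hlm
      have k2 : s * Real.sin α = m * (s * Real.sin α + t * Real.sin β) := by
        rw [hm]; field_simp; exact hDdef
      have : s ^ 2 + r ^ 2 - 2 * s * r * Real.cos α =
        (s * Real.cos α - r) ^ 2 + (s * Real.sin α) ^ 2 := by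
        linear_combination (- s ^ 2) * c1
      rw [this, k1]
      conv_lhs => rw [k2]
      ring
    have e2 : r ^ 2 + t ^ 2 - 2 * r * t * Real.cos β = (l * C) ^ 2 := by
      rw [mul_pow, hC2, hCsq]
      have k1 : r - t * Real.cos β = l * (s * Real.cos α - t * Real.cos β) := by
        rw [hre]; linear_combination (t * Real.cos β) * (hlm)
      have k2 : t * Real.sin β = l * (s * Real.sin α + t * Real.sin β) := by
        rw [hl]; field_simp; exact hDdef
      have : r ^ 2 + t ^ 2 - 2 * r * t * Real.cos β =
        (r - t * Real.cos β) ^ 2 + (t * Real.sin β) ^ 2 := by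
        linear_combination (- t ^ 2) * c2
      rw [this, k1]
      conv_lhs => rw [k2]
      ring
    rw [e1, e2, Real.sqrt_sq (by positivity), Real.sqrt_sq (by positivity)]
    linear_combination C * hlm

theorem dist_lt_of_compAngle_lt {a b c α : ℝ} (ha : 0 < a) (hb : 0 < b) (hα : α ≤ Real.pi)
    (h : euclCompAngle a b c < α) : c < Real.sqrt (a ^ 2 + b ^ 2 - 2 * a * b * Real.cos α) := by
  by_contra hc
  push Not at hc
  have hα0 : 0 ≤ α := (euclCompAngle_nonneg _ _ _).trans h.le
  refine absurd h (not_lt.mpr ?_)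
  have h0 : 0 ≤ c := (Real.sqrt_nonneg _).trans hc
  have hcsq : a ^ 2 + b ^ 2 - 2 * a * b * Real.cos α ≤ c ^ 2 := (Real.sqrt_le_left h0).mp hc
  unfold euclCompAngle
  rw [← Real.arccos_cos hα0 hα]
  apply Real.arccos_le_arccos
  rw [div_le_iff₀ (by positivity)]
  linarith

theorem lt_dist_of_lt_compAngle {a b c α : ℝ} (ha : 0 < a) (hb : 0 < b) (hc : 0 ≤ c)
    (hα : 0 ≤ α)
    (h : α < euclCompAngle a b c) : Real.sqrt (a ^ 2 + b ^ 2 - 2 * a * b * Real.cos α) < c := by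
  by_contra hcc
  push Not at hcc
  have hα1 : α ≤ Real.pi := h.le.trans (euclCompAngle_le_pi _ _ _)
  refine absurd h (not_lt.mpr ?_)
  have h1 : 0 ≤ a ^ 2 + b ^ 2 - 2 * a * b * Real.cos α := by
    nlinarith [Real.cos_le_one α, sq_nonneg (a - b), mul_pos ha hb]
  have hcsq : c ^ 2 ≤ a ^ 2 + b ^ 2 - 2 * a * b * Real.cos α := by
    have := pow_le_pow_left₀ hc hcc 2
    rwa [Real.sq_sqrt h1] at this
  unfold euclCompAngle
  rw [← Real.arccos_cos hα hα1]
  apply Real.arccos_le_arccos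
  rw [le_div_iff₀ (by positivity)]
  linarith

/-- Triangle inequality for Alexandrov angles. -/
theorem upperAngle_triangle {ε₀ : ℝ} (hε₀ : 0 < ε₀)
    (hσ : ∀ s, 0 < s → s < ε₀ → d p (σ s) = s) (hτ : ∀ s, 0 < s → s < ε₀ → d p (τ s) = s)
    (hρ : ∀ s, 0 < s → s < ε₀ → d p (ρ s) = s)
    (hnn : ∀ s t, 0 < s → s < ε₀ → 0 < t → t < ε₀ → 0 ≤ d (σ s) (τ t))
    (htri : ∀ s r t, 0 < s → s < ε₀ → 0 < r → r < ε₀ → 0 < t → t < ε₀ →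
      d (σ s) (τ t) ≤ d (σ s) (ρ r) + d (ρ r) (τ t)) :
    upperAngleWrt d p σ τ ≤ upperAngleWrt d p σ ρ + upperAngleWrt d p ρ τ := by
  by_contra hcon
  push Not at hcon
  set A := upperAngleWrt d p σ ρ with hA
  set B := upperAngleWrt d p ρ τ with hB
  have hA0 : 0 ≤ A := upperAngle_nonneg _ _ _ _
  have hB0 : 0 ≤ B := upperAngle_nonneg _ _ _ _
  set C := upperAngleWrt d p σ τ with hC
  set η := (C - (A + B)) / 4 with hη
  have hη0 : 0 < η := by rw [hη]; linarith
  obtain ⟨ε₁, hε₁, h1⟩ := exists_forall_angle_lt (show upperAngleWrt d p σ ρ < A + η by linarith)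
  obtain ⟨ε₂, hε₂, h2⟩ := exists_forall_angle_lt (show upperAngleWrt d p ρ τ < B + η by linarith)
  set ε := min ε₀ (min ε₁ ε₂) with hε
  have hεpos : 0 < ε := lt_min hε₀ (lt_min hε₁ hε₂)
  have g0 : ε ≤ ε₀ := min_le_left _ _
  have g1 : ε ≤ ε₁ := (min_le_right _ _).trans (min_le_left _ _)
  have g2 : ε ≤ ε₂ := (min_le_right _ _).trans (min_le_right _ _)
  have : ∃ s t, 0 < s ∧ s < ε ∧ 0 < t ∧ t < ε ∧
      A + B + 2 * η < euclCompAngle (d p (σ s)) (d p (τ t)) (d (σ s) (τ t)) := by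
    by_contra hno
    push Not at hno
    have := upperAngle_le hεpos hno
    linarith
  obtain ⟨s, t, hs0, hs, ht0, ht, hst⟩ := this
  have hpi : A + B + 2 * η < Real.pi := hst.trans_le (euclCompAngle_le_pi _ _ _)
  obtain ⟨r, hr0, hr, hsum⟩ := exists_split hs0 ht0 (show 0 < A + η by linarith)
    (show 0 < B + η by linarith) (by linarith)
  have hrε : r < ε := hr.trans_lt (max_lt hs ht)
  have k1 := h1 s r hs0 (by linarith) hr0 (by linarith)
  have k2 := h2 r t hr0 (by linarith) ht0 (by linarith)
  rw [hσ s hs0 (by linarith), hρ r hr0 (by linarith)] at k1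
  rw [hτ t ht0 (by linarith), hρ r hr0 (by linarith)] at k2
  rw [hσ s hs0 (by linarith), hτ t ht0 (by linarith)] at hst
  have m1 := dist_lt_of_compAngle_lt hs0 hr0 (by linarith) k1
  have m2 := dist_lt_of_compAngle_lt hr0 ht0 (by linarith) k2
  have m3 := lt_dist_of_lt_compAngle hs0 ht0 (hnn s t hs0 (by linarith) ht0 (by linarith))
    (by linarith) hst
  have e : A + B + 2 * η = A + η + (B + η) := by ring
  rw [e, ← hsum] at m3
  have := htri s r t hs0 (by linarith) hr0 (by linarith) ht0 (by linarith)
  linarith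

end Angles

/-! ### Comparison of comparison angles -/

theorem cosh_sqrt_interp {u v c l : ℝ} (hl0 : 0 ≤ l) (hl1 : l ≤ 1)
    (hc : c ^ 2 = (1 - l) * u ^ 2 + l * v ^ 2) :
    Real.cosh c ≤ (1 - l) * Real.cosh u + l * Real.cosh v := by
  refine hasSum_le ?_ (Real.hasSum_cosh c)
    (((Real.hasSum_cosh u).mul_left (1 - l)).add ((Real.hasSum_cosh v).mul_left l))
  intro n
  have hconv := (convexOn_pow n).2 (x := u ^ 2) (sq_nonneg u) (y := v ^ 2) (sq_nonneg v)
    (show 0 ≤ 1 - l by linarith) hl0 (by ring)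
  simp only [smul_eq_mul] at hconv
  rw [← hc] at hconv
  have hf : (0:ℝ) < ((2 * n).factorial : ℝ) := by positivity
  have : c ^ (2 * n) ≤ (1 - l) * u ^ (2 * n) + l * v ^ (2 * n) := by
    simpa only [pow_mul] using hconv
  calc c ^ (2 * n) / ((2 * n).factorial : ℝ)
      ≤ ((1 - l) * u ^ (2 * n) + l * v ^ (2 * n)) / ((2 * n).factorial : ℝ) := by gcongr
    _ = _ := by ring

theorem compAngle_le_euclCompAngle {κ a b c : ℝ} (hκ : κ ≤ 0) (ha : 0 < a) (hb : 0 < b)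
    (h1 : |a - b| ≤ c) (h2 : c ≤ a + b) : compAngle κ a b c ≤ euclCompAngle a b c := by
  unfold compAngle
  split_ifs with h
  · exact le_rfl
  have hk : 0 < Real.sqrt (-κ) := Real.sqrt_pos.mpr (by
    have := lt_of_le_of_ne hκ h
    linarith)
  set k := Real.sqrt (-κ)
  unfold euclCompAngle
  apply Real.arccos_le_arccos
  have hsa : 0 < Real.sinh (k * a) := Real.sinh_pos_iff.mpr (by positivity)
  have hsb : 0 < Real.sinh (k * b) := Real.sinh_pos_iff.mpr (by positivity)
  have hab : 0 < a * b := mul_pos ha hb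
  have hc0 : 0 ≤ c := (abs_nonneg _).trans h1
  have hsq : (a - b) ^ 2 ≤ c ^ 2 := by
    rw [← sq_abs (a - b)]; exact pow_le_pow_left₀ (abs_nonneg _) h1 2
  have hsq2 : c ^ 2 ≤ (a + b) ^ 2 := pow_le_pow_left₀ hc0 h2 2
  set l := (c ^ 2 - (a - b) ^ 2) / (4 * (a * b)) with hl
  have hl0 : 0 ≤ l := div_nonneg (by linarith) (by positivity)
  have hl1 : l ≤ 1 := by rw [hl, div_le_one (by positivity)]; nlinarith
  have hlc : 4 * (a * b) * l = c ^ 2 - (a - b) ^ 2 := by rw [hl]; field_simp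
  have key := cosh_sqrt_interp (u := k * a - k * b) (v := k * a + k * b) (c := k * c) hl0 hl1
    (by linear_combination (-k ^ 2) * hlc)
  rw [Real.cosh_sub, Real.cosh_add] at key
  rw [le_div_iff₀ (mul_pos hsa hsb)]
  have e : (a ^ 2 + b ^ 2 - c ^ 2) / (2 * a * b) = 1 - 2 * l := by
    rw [div_eq_iff (by positivity)]; linear_combination (1:ℝ) * hlc
  rw [e]
  linarith

/-! ### Stewart's inequality -/

/-- The metric betweenness relation: `z` lies on a geodesic from `x` to `y`. -/
def Btw {X : Type*} [MetricSpace X] (x z y : X) : Prop := dist x z + dist z y = dist x y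

/-- CAT(0) spaces, through Stewart's inequality. -/
class CAT0 (X : Type*) [MetricSpace X] : Prop where
  exists_pt : ∀ (x y : X) (t : ℝ), 0 ≤ t → t ≤ 1 →
    ∃ z, dist x z = t * dist x y ∧ dist z y = (1 - t) * dist x y
  stewart : ∀ p q m r : X, Btw q m r →
    dist p m ^ 2 * dist q r + dist q m * dist m r * dist q r ≤
      dist m r * dist p q ^ 2 + dist q m * dist p r ^ 2

theorem cosAngle_mem {a b c : ℝ} (ha : 0 < a) (hb : 0 < b)
    (h1 : |a - b| ≤ c) (h2 : c ≤ a + b) :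
    -1 ≤ (a ^ 2 + b ^ 2 - c ^ 2) / (2 * a * b) ∧ (a ^ 2 + b ^ 2 - c ^ 2) / (2 * a * b) ≤ 1 := by
  have hc0 : 0 ≤ c := (abs_nonneg _).trans h1
  have hsq : (a - b) ^ 2 ≤ c ^ 2 := by
    rw [← sq_abs (a - b)]; exact pow_le_pow_left₀ (abs_nonneg _) h1 2
  have hsq2 : c ^ 2 ≤ (a + b) ^ 2 := pow_le_pow_left₀ hc0 h2 2
  constructor
  · rw [le_div_iff₀ (by positivity)]; linarith
  · rw [div_le_iff₀ (by positivity)]; linarith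

theorem stewart_of_angles {x a b u v : ℝ} (hu0 : 0 < a) (hv0 : 0 < b) (hx0 : 0 < x)
    (hu1 : |a - x| ≤ u) (hu2 : u ≤ a + x) (hv1 : |x - b| ≤ v) (hv2 : v ≤ x + b)
    (h : Real.pi ≤ euclCompAngle a x u + euclCompAngle x b v) :
    x ^ 2 * (a + b) + a * b * (a + b) ≤ b * u ^ 2 + a * v ^ 2 := by
  obtain ⟨p1, p2⟩ := cosAngle_mem hu0 hx0 hu1 hu2
  obtain ⟨q1, q2⟩ := cosAngle_mem hx0 hv0 hv1 hv2
  unfold euclCompAngle at h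
  set A := (a ^ 2 + x ^ 2 - u ^ 2) / (2 * a * x) with hA
  set B := (x ^ 2 + b ^ 2 - v ^ 2) / (2 * x * b) with hB
  have h1 : Real.pi - Real.arccos B ≤ Real.arccos A := by linarith
  rw [← Real.arccos_neg] at h1
  have h2 : A ≤ -B := by
    by_contra hlt
    push Not at hlt
    exact absurd h1 (not_le.mpr (Real.arccos_lt_arccos (by linarith) hlt p2))
  have eA : A * (2 * a * x) = a ^ 2 + x ^ 2 - u ^ 2 := by rw [hA]; field_simp
  have eB : B * (2 * x * b) = x ^ 2 + b ^ 2 - v ^ 2 := by rw [hB]; field_simp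
  have h3 : (A + B) * (2 * a * x * b) ≤ 0 :=
    mul_nonpos_of_nonpos_of_nonneg (by linarith) (by positivity)
  nlinarith

theorem upperAngle_eq_pi {X : Type*} [MetricSpace X] {m q r : X} (h : Btw q m r) (hq : m ≠ q)
    (hr : m ≠ r) {σ τ : ℝ → X} (hσ : IsGeodesicFromTo (fun x y : X => dist x y) univ σ m q)
    (hτ : IsGeodesicFromTo (fun x y : X => dist x y) univ τ m r) :
    Real.pi ≤ upperAngleWrt (fun x y : X => dist x y) m σ τ := by
  obtain ⟨s0, s1, ⟨-, s2⟩, -⟩ := hσ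
  obtain ⟨t0, t1, ⟨-, t2⟩, -⟩ := hτ
  simp only at s1 s2 t1 t2
  have hq0 := dist_pos.mpr hq
  have hr0 := dist_pos.mpr hr
  apply le_upperAngle
  intro ε hε
  set s := min (ε / 2) (min (dist m q) (dist m r)) with hs
  have hs0 : 0 < s := lt_min (by linarith) (lt_min hq0 hr0)
  have g1 : s ≤ dist m q := (min_le_right _ _).trans (min_le_left _ _)
  have g2 : s ≤ dist m r := (min_le_right _ _).trans (min_le_right _ _)
  have g3 : s < ε := (min_le_left _ _).trans_lt (by linarith)
  refine ⟨s, s, hs0, g3, hs0, g3, ?_⟩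
  have e1 : dist m (σ s) = s := by
    have := s2 0 ⟨le_rfl, hq0.le⟩ s ⟨hs0.le, g1⟩
    rw [s0] at this; rw [this]; simp [abs_of_pos hs0]
  have e2 : dist m (τ s) = s := by
    have := t2 0 ⟨le_rfl, hr0.le⟩ s ⟨hs0.le, g2⟩
    rw [t0] at this; rw [this]; simp [abs_of_pos hs0]
  have e1' : dist q (σ s) = dist m q - s := by
    have := s2 (dist m q) ⟨hq0.le, le_rfl⟩ s ⟨hs0.le, g1⟩
    rw [s1] at this; rw [this, abs_of_nonneg (by linarith)]
  have e2' : dist (τ s) r = dist m r - s := by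
    have := t2 (dist m r) ⟨hr0.le, le_rfl⟩ s ⟨hs0.le, g2⟩
    rw [t1] at this; rw [dist_comm, this, abs_of_nonneg (by linarith)]
  have e3 : dist (σ s) (τ s) = 2 * s := by
    apply le_antisymm
    · have := dist_triangle_left (σ s) (τ s) m
      linarith
    · have h1 := dist_triangle4 q (σ s) (τ s) r
      unfold Btw at h
      rw [dist_comm q m] at h
      linarith
  simp only [e1, e2, e3]
  unfold euclCompAngle
  have : (s ^ 2 + s ^ 2 - (2 * s) ^ 2) / (2 * s * s) = -1 := by field_simp; ring
  rw [this, Real.arccos_neg_one]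

theorem cat0_of_isCATSpace {κ : ℝ} (hκ : κ ≤ 0) {X : Type*} [MetricSpace X]
    (hX : IsCATSpace κ X) : CAT0 X := by
  refine ⟨fun x y t h0 h1 => ?_, fun p q m r h => ?_⟩
  · obtain ⟨f, f0, f1, ⟨-, f2⟩, -⟩ := hX.1 x trivial y trivial
    simp only at f1 f2
    have hd : 0 ≤ dist x y := dist_nonneg
    have hm : t * dist x y ∈ Icc 0 (dist x y) := ⟨by positivity, by nlinarith⟩
    refine ⟨f (t * dist x y), ?_, ?_⟩
    · have := f2 0 ⟨le_rfl, hd⟩ _ hm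
      rw [f0] at this
      rw [this, zero_sub, abs_neg, abs_of_nonneg (by positivity)]
    · have := f2 _ hm (dist x y) ⟨hd, le_rfl⟩
      rw [f1] at this
      rw [this, abs_sub_comm, abs_of_nonneg (by nlinarith)]; ring
  · by_cases hmq : m = q
    · subst hmq; simp; linarith
    by_cases hmr : m = r
    · subst hmr; simp; linarith
    by_cases hpm : p = m
    · subst hpm
      unfold Btw at h
      rw [← h, dist_self, dist_comm q p]; nlinarith
    by_cases hpq : p = q
    · subst hpq
      unfold Btw at h
      rw [← h, dist_self]; nlinarith
    by_cases hpr : p = r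
    · subst hpr
      unfold Btw at h
      rw [dist_comm p q, dist_comm p m, ← h, dist_self]; nlinarith
    have hq0 := dist_pos.mpr hmq
    have hr0 := dist_pos.mpr hmr
    have hp0 := dist_pos.mpr hpm
    obtain ⟨σ, hσ⟩ := hX.1 m trivial q trivial
    obtain ⟨τ, hτ⟩ := hX.1 m trivial r trivial
    obtain ⟨ρ, hρ⟩ := hX.1 m trivial p trivial
    have hpi := upperAngle_eq_pi h hmq hmr hσ hτ
    have geo : ∀ {y : X} {f : ℝ → X},
        IsGeodesicFromTo (fun x y : X => dist x y) univ f m y →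
        ∀ s, 0 < s → s < dist m y → dist m (f s) = s := by
      intro y f ⟨f0, _, ⟨_, f2⟩, _⟩ s hs hs'
      have := f2 0 ⟨le_rfl, hs.le.trans hs'.le⟩ s ⟨hs.le, hs'.le⟩
      simp only [f0] at this
      rw [this]; simp [abs_of_pos hs]
    have hp0' : 0 < dist m p := by rwa [dist_comm]
    have htri := upperAngle_triangle (d := fun x y : X => dist x y) (p := m) (σ := σ) (τ := τ)
      (ρ := ρ) (ε₀ := min (dist m q) (min (dist m r) (dist m p)))
      (lt_min hq0 (lt_min hr0 hp0'))
      (fun s h1 h2 => geo hσ s h1 (h2.trans_le (min_le_left _ _)))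
      (fun s h1 h2 => geo hτ s h1 (h2.trans_le ((min_le_right _ _).trans (min_le_left _ _))))
      (fun s h1 h2 => geo hρ s h1 (h2.trans_le ((min_le_right _ _).trans (min_le_right _ _))))
      (fun _ _ _ _ _ _ => dist_nonneg) (fun _ _ _ _ _ _ _ _ _ => dist_triangle _ _ _)
    have ab : ∀ a b c : X, |dist a b - dist a c| ≤ dist b c := fun a b c => by
      rw [dist_comm a b, dist_comm a c]; exact abs_dist_sub_le b c a
    have A1 := (hX.2 m trivial q trivial p trivial hmq (Ne.symm hpm) (Ne.symm hpq) σ ρ hσ hρ).trans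
          (compAngle_le_euclCompAngle hκ hq0 hp0' (ab _ _ _) (dist_triangle_left _ _ _))
    have A2 := (hX.2 m trivial p trivial r trivial (Ne.symm hpm) hmr hpr ρ τ hρ hτ).trans
          (compAngle_le_euclCompAngle hκ hp0' hr0 (ab _ _ _) (dist_triangle_left _ _ _))
    have := stewart_of_angles hq0 hr0 hp0' (ab _ _ _) (dist_triangle_left _ _ _) (ab _ _ _)
      (dist_triangle_left _ _ _) (hpi.trans (htri.trans (add_le_add A1 A2)))
    unfold Btw at h
    rw [← h, dist_comm q m, dist_comm p m, dist_comm p q]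
    exact this

/-! ### Betweenness -/

section Betweenness

variable {X : Type*} [MetricSpace X] {a b c e x y z w : X}

theorem Btw.symm (h : Btw x z y) : Btw y z x := by
  unfold Btw at *
  rw [dist_comm y z, dist_comm z x, dist_comm y x]; linarith

theorem btw_left (x y : X) : Btw x x y := by simp [Btw]

theorem btw_right (x y : X) : Btw x y y := by simp [Btw]

theorem Btw.eq_of_same (h : Btw x z x) : z = x := by
  unfold Btw at h
  rw [dist_self, dist_comm z x] at h
  exact (dist_eq_zero.mp (by linarith)).symm

theorem Btw.left_le (h : Btw x z y) : dist x z ≤ dist x y := by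
  unfold Btw at h
  linarith [dist_nonneg (x := z) (y := y)]

theorem Btw.right_le (h : Btw x z y) : dist z y ≤ dist x y := by
  unfold Btw at h
  linarith [dist_nonneg (x := x) (y := z)]

/-- `a - b - e` and `b - c - e` give `a - b - c`. -/
theorem Btw.inner (h : Btw a b e) (h' : Btw b c e) : Btw a b c := by
  unfold Btw at *
  linarith [dist_triangle a c e, dist_triangle a b c]

/-- `a - b - e` and `b - c - e` give `a - c - e`. -/
theorem Btw.outer (h : Btw a b e) (h' : Btw b c e) : Btw a c e := by
  unfold Btw at *
  linarith [dist_triangle a c e, dist_triangle a b c]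

/-- `a - c - e` and `a - b - c` give `a - b - e`. -/
theorem Btw.outer' (h : Btw a c e) (h' : Btw a b c) : Btw a b e :=
  (h.symm.outer h'.symm).symm

/-- `a - c - e` and `a - b - c` give `b - c - e`. -/
theorem Btw.inner' (h : Btw a c e) (h' : Btw a b c) : Btw b c e :=
  (h.symm.inner h'.symm).symm

theorem Btw.antisymm (h : Btw x z y) (h' : Btw x y z) : z = y := by
  unfold Btw at *
  rw [dist_comm y z] at h'
  exact dist_eq_zero.mp (by linarith [dist_nonneg (x := z) (y := y)])

theorem isClosed_btw : IsClosed {q : X × X × X | Btw q.1 q.2.1 q.2.2} :=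
  isClosed_eq (by fun_prop) (by fun_prop)

theorem btw_of_tendsto {ι : Type*} {l : Filter ι} [l.NeBot] {f g h : ι → X}
    (hf : Tendsto f l (nhds x)) (hg : Tendsto g l (nhds z)) (hh : Tendsto h l (nhds y))
    (hb : ∀ᶠ i in l, Btw (f i) (g i) (h i)) : Btw x z y :=
  isClosed_btw.mem_of_tendsto (hf.prodMk_nhds (hg.prodMk_nhds hh)) hb

/-- The geodesic segment between two points. -/
def seg (x y : X) : Set X := {z | Btw x z y}

theorem seg_comm (x y : X) : seg x y = seg y x :=
  Set.ext fun _ => ⟨Btw.symm, Btw.symm⟩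

theorem left_mem_seg (x y : X) : x ∈ seg x y := btw_left x y

theorem right_mem_seg (x y : X) : y ∈ seg x y := btw_right x y

theorem seg_self (x : X) : seg x x = {x} :=
  Set.ext fun _ => ⟨Btw.eq_of_same, fun h => by rw [h]; exact btw_left x x⟩

theorem isClosed_seg (x y : X) : IsClosed (seg x y) :=
  isClosed_eq (by fun_prop) (by fun_prop)

theorem seg_subset_of_mem_left (h : z ∈ seg x y) : seg x z ⊆ seg x y := fun _ hw => Btw.outer' h hw

theorem seg_subset_of_mem_right (h : z ∈ seg x y) : seg z y ⊆ seg x y := fun _ hw => Btw.outer h hw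

end Betweenness

/-! ### Geodesics in CAT(0) spaces -/

section Geodesics

variable {X : Type*} [MetricSpace X] [CAT0 X] {a b c e o x y z w : X} {t s : ℝ}

theorem Btw.unique (h : Btw x z y) (h' : Btw x w y) (he : dist x z = dist x w) : z = w := by
  have hs := CAT0.stewart z x w y h'
  have h1 : dist z y = dist w y := by unfold Btw at h h'; linarith
  rw [dist_comm z x, he, h1] at hs
  unfold Btw at h'
  by_cases hL : dist x y = 0
  · have e1 : dist x z = 0 := le_antisymm (by rw [← hL]; exact h.left_le) dist_nonneg
    have e2 : dist x w = 0 := he ▸ e1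
    rw [← dist_eq_zero.mp e1, ← dist_eq_zero.mp e2]
  have hL' : 0 < dist x y := lt_of_le_of_ne dist_nonneg (Ne.symm hL)
  rw [← dist_eq_zero]
  have h2 : dist z w ^ 2 * dist x y ≤ 0 := by rw [← h'] at hs ⊢; nlinarith
  have h3 : dist z w ^ 2 ≤ 0 := by
    by_contra hc
    push Not at hc
    exact absurd h2 (not_le.mpr (mul_pos hc hL'))
  exact pow_eq_zero_iff (two_ne_zero) |>.mp (le_antisymm h3 (sq_nonneg _))

/-- Clamping a real number to the unit interval. -/
noncomputable def clamp (t : ℝ) : ℝ := max 0 (min t 1)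

theorem clamp_nonneg (t : ℝ) : 0 ≤ clamp t := le_max_left _ _

theorem clamp_le_one (t : ℝ) : clamp t ≤ 1 := max_le zero_le_one (min_le_right _ _)

theorem clamp_eq (h0 : 0 ≤ t) (h1 : t ≤ 1) : clamp t = t := by
  rw [clamp, min_eq_left h1, max_eq_right h0]

/-- The point dividing the geodesic from `x` to `y` in ratio `t : 1 - t`. -/
noncomputable def pt (x y : X) (t : ℝ) : X :=
  Classical.choose (CAT0.exists_pt x y (clamp t) (clamp_nonneg t) (clamp_le_one t))

theorem dist_left_pt (x y : X) (h0 : 0 ≤ t) (h1 : t ≤ 1) :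
    dist x (pt x y t) = t * dist x y := by
  have : dist x (pt x y t) = clamp t * dist x y := (Classical.choose_spec
    (CAT0.exists_pt x y (clamp t) (clamp_nonneg t) (clamp_le_one t))).1
  rw [this, clamp_eq h0 h1]

theorem dist_pt_right (x y : X) (h0 : 0 ≤ t) (h1 : t ≤ 1) :
    dist (pt x y t) y = (1 - t) * dist x y := by
  have : dist (pt x y t) y = (1 - clamp t) * dist x y := (Classical.choose_spec
    (CAT0.exists_pt x y (clamp t) (clamp_nonneg t) (clamp_le_one t))).2
  rw [this, clamp_eq h0 h1]

theorem pt_clamp (x y : X) (t : ℝ) : pt x y (clamp t) = pt x y t := by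
  unfold pt
  have : clamp (clamp t) = clamp t := clamp_eq (clamp_nonneg t) (clamp_le_one t)
  simp only [this]

theorem btw_pt (x y : X) (t : ℝ) : Btw x (pt x y t) y := by
  rw [← pt_clamp]
  unfold Btw
  rw [dist_left_pt x y (clamp_nonneg t) (clamp_le_one t),
    dist_pt_right x y (clamp_nonneg t) (clamp_le_one t)]
  ring

theorem pt_mem_seg (x y : X) (t : ℝ) : pt x y t ∈ seg x y := btw_pt x y t

theorem eq_pt (h : Btw x z y) (h0 : 0 ≤ t) (h1 : t ≤ 1) (hd : dist x z = t * dist x y) :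
    z = pt x y t :=
  h.unique (btw_pt x y t) (by rw [hd, dist_left_pt x y h0 h1])

theorem pt_zero (x y : X) : pt x y 0 = x :=
  (eq_pt (btw_left x y) le_rfl zero_le_one (by simp)).symm

theorem pt_one (x y : X) : pt x y 1 = y :=
  (eq_pt (btw_right x y) zero_le_one le_rfl (by simp)).symm

theorem pt_self (x : X) (t : ℝ) : pt x x t = x := (btw_pt x x t).eq_of_same

theorem pt_symm (x y : X) (h0 : 0 ≤ t) (h1 : t ≤ 1) : pt x y t = pt y x (1 - t) := by
  refine eq_pt (btw_pt x y t).symm (by linarith) (by linarith) ?_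
  rw [dist_comm y, dist_pt_right x y h0 h1, dist_comm x y]

theorem Btw.exists_pt (h : Btw x z y) : ∃ t, 0 ≤ t ∧ t ≤ 1 ∧ z = pt x y t := by
  by_cases hL : dist x y = 0
  · have := dist_eq_zero.mp hL
    subst this
    exact ⟨0, le_rfl, zero_le_one, by rw [pt_zero]; exact h.eq_of_same⟩
  have hL' : 0 < dist x y := lt_of_le_of_ne dist_nonneg (Ne.symm hL)
  refine ⟨dist x z / dist x y, by positivity, (div_le_one hL').mpr h.left_le, ?_⟩
  exact eq_pt h (by positivity) ((div_le_one hL').mpr h.left_le) (by field_simp)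

theorem stewart_pt (p q r : X) (h0 : 0 ≤ t) (h1 : t ≤ 1) :
    dist p (pt q r t) ^ 2 ≤ (1 - t) * dist p q ^ 2 + t * dist p r ^ 2
      - t * (1 - t) * dist q r ^ 2 := by
  by_cases hL : dist q r = 0
  · have := dist_eq_zero.mp hL
    subst this
    rw [pt_self]; simp; linarith
  have hL' : 0 < dist q r := lt_of_le_of_ne dist_nonneg (Ne.symm hL)
  have hs := CAT0.stewart p q (pt q r t) r (btw_pt q r t)
  rw [dist_left_pt q r h0 h1, dist_pt_right q r h0 h1] at hs
  refine le_of_mul_le_mul_right ?_ hL'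
  linarith

theorem dist_pt_pt_left (o x y : X) (h0 : 0 ≤ t) (h1 : t ≤ 1) :
    dist (pt o x t) (pt o y t) ≤ t * dist x y := by
  have e1 := stewart_pt (pt o x t) o y h0 h1
  have e2 := stewart_pt y o x h0 h1
  rw [dist_comm (pt o x t) o, dist_left_pt o x h0 h1, dist_comm (pt o x t) y] at e1
  rw [dist_comm y o, dist_comm y x] at e2
  refine abs_le_of_sq_le_sq' ?_ (by positivity) |>.2
  have e3 := mul_le_mul_of_nonneg_left e2 h0
  linarith

theorem dist_pt_pt (x y x' y' : X) (h0 : 0 ≤ t) (h1 : t ≤ 1) :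
    dist (pt x y t) (pt x' y' t) ≤ (1 - t) * dist x x' + t * dist y y' := by
  have e1 := dist_pt_pt_left x y y' h0 h1
  have e2 := dist_pt_pt_left y' x x' (t := 1 - t) (by linarith) (by linarith)
  rw [← pt_symm x y' h0 h1, ← pt_symm x' y' h0 h1] at e2
  linarith [dist_triangle (pt x y t) (pt x y' t) (pt x' y' t)]

theorem dist_pt_param (x y : X) (h0 : 0 ≤ t) (h1 : t ≤ 1) (h0' : 0 ≤ s) (h1' : s ≤ 1) :
    dist (pt x y t) (pt x y s) = |t - s| * dist x y := by
  wlog hts : t ≤ s generalizing t s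
  · rw [dist_comm, abs_sub_comm]
    exact this h0' h1' h0 h1 (by linarith)
  have hd : 0 ≤ dist x y := dist_nonneg
  by_cases hs0 : s = 0
  · subst hs0
    have : t = 0 := by linarith
    subst this; simp
  have hs0' : 0 < s := lt_of_le_of_ne h0' (Ne.symm hs0)
  have hr0 : 0 ≤ t / s := by positivity
  have hr1 : t / s ≤ 1 := (div_le_one hs0').mpr hts
  have : pt x y t = pt x (pt x y s) (t / s) := by
    refine (eq_pt ((btw_pt x y s).outer' (btw_pt _ _ _)) h0 h1 ?_).symm
    rw [dist_left_pt _ _ hr0 hr1, dist_left_pt _ _ h0' h1']; field_simp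
  rw [this, dist_pt_right _ _ hr0 hr1, dist_left_pt _ _ h0' h1', abs_sub_comm,
    abs_of_nonneg (by linarith)]
  field_simp

theorem clamp_sub (s t : ℝ) : |clamp s - clamp t| ≤ |s - t| := by
  unfold clamp
  have h1 := abs_max_sub_max_le_max 0 (min s 1) 0 (min t 1)
  have h2 := abs_min_sub_min_le_max s 1 t 1
  simp only [sub_self, abs_zero] at h1 h2
  exact h1.trans (max_le (abs_nonneg _) (h2.trans (max_le le_rfl (abs_nonneg _))))

theorem continuous_pt : Continuous fun q : X × X × ℝ => pt q.1 q.2.1 q.2.2 := by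
  rw [continuous_iff_continuousAt]
  rintro ⟨x, y, t⟩
  rw [ContinuousAt, tendsto_iff_dist_tendsto_zero]
  have hb : ∀ q : X × X × ℝ, dist (pt q.1 q.2.1 q.2.2) (pt x y t) ≤
      dist q.1 x + dist q.2.1 y + |q.2.2 - t| * dist x y := by
    rintro ⟨x', y', t'⟩
    simp only
    rw [← pt_clamp x' y', ← pt_clamp x y]
    have e1 := dist_pt_pt x' y' x y (clamp_nonneg t') (clamp_le_one t')
    have e2 := dist_pt_param x y (clamp_nonneg t') (clamp_le_one t') (clamp_nonneg t)
      (clamp_le_one t)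
    have e3 : |clamp t' - clamp t| * dist x y ≤ |t' - t| * dist x y :=
      mul_le_mul_of_nonneg_right (clamp_sub t' t) dist_nonneg
    have e4 := dist_triangle (pt x' y' (clamp t')) (pt x y (clamp t')) (pt x y (clamp t))
    have e5 : (1 - clamp t') * dist x' x ≤ dist x' x := by
      nlinarith [clamp_nonneg t', dist_nonneg (x := x') (y := x)]
    have e6 : clamp t' * dist y' y ≤ dist y' y := by
      nlinarith [clamp_le_one t', dist_nonneg (x := y') (y := y)]
    linarith
  refine squeeze_zero (fun _ => dist_nonneg) hb ?_
  have : Continuous fun q : X × X × ℝ => dist q.1 x + dist q.2.1 y + |q.2.2 - t| * dist x y := by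
    fun_prop
  have h := this.tendsto (x, y, t)
  simpa using h

theorem Continuous.pt {α : Type*} [TopologicalSpace α] {f g : α → X} {u : α → ℝ}
    (hf : Continuous f) (hg : Continuous g) (hu : Continuous u) :
    Continuous fun i => pt (f i) (g i) (u i) :=
  continuous_pt.comp (hf.prodMk (hg.prodMk hu))

theorem Tendsto.pt {ι : Type*} {l : Filter ι} {f g : ι → X} {u : ι → ℝ}
    (hf : Tendsto f l (nhds x)) (hg : Tendsto g l (nhds y)) (hu : Tendsto u l (nhds t)) :
    Tendsto (fun i => Cat2Cx.pt (f i) (g i) (u i)) l (nhds (Cat2Cx.pt x y t)) :=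
  (continuous_pt.tendsto (x, y, t)).comp (hf.prodMk_nhds (hg.prodMk_nhds hu))

theorem seg_eq_image (x y : X) : seg x y = pt x y '' Icc 0 1 := by
  ext z
  constructor
  · intro h
    obtain ⟨t, h0, h1, rfl⟩ := Btw.exists_pt h
    exact ⟨t, ⟨h0, h1⟩, rfl⟩
  · rintro ⟨t, -, rfl⟩
    exact btw_pt x y t

theorem isCompact_seg (x y : X) : IsCompact (seg x y) := by
  rw [seg_eq_image]
  exact isCompact_Icc.image (Continuous.pt continuous_const continuous_const continuous_id)

theorem isPreconnected_seg (x y : X) : IsPreconnected (seg x y) := by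
  rw [seg_eq_image]
  exact isPreconnected_Icc.image _
    (Continuous.pt continuous_const continuous_const continuous_id).continuousOn

/-- Points of a segment are linearly ordered. -/
theorem Btw.order (h : Btw x z y) (h' : Btw x w y) (hd : dist x z ≤ dist x w) : Btw x z w := by
  by_cases hL : dist x w = 0
  · have : dist x z = 0 := le_antisymm (by linarith) dist_nonneg
    rw [← dist_eq_zero.mp this]; exact btw_left _ _
  have hL' : 0 < dist x w := lt_of_le_of_ne dist_nonneg (Ne.symm hL)
  have : z = pt x w (dist x z / dist x w) := by
    refine h.unique (h'.outer' (btw_pt _ _ _)) ?_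
    rw [dist_left_pt _ _ (by positivity) ((div_le_one hL').mpr hd)]; field_simp
  rw [this]; exact btw_pt _ _ _

theorem Btw.order' (h : Btw x z y) (h' : Btw x w y) (hd : dist x z ≤ dist x w) : Btw z w y :=
  h'.inner' (h.order h' hd)

theorem Btw.total (h : Btw x z y) (h' : Btw x w y) : Btw x z w ∨ Btw x w z := by
  rcases le_total (dist x z) (dist x w) with hd | hd
  · exact Or.inl (h.order h' hd)
  · exact Or.inr (h'.order h hd)

/-- The point of the segment `[x,y]` at distance `s` from `x`. -/
theorem exists_btw_dist (x y : X) (h0 : 0 ≤ s) (h1 : s ≤ dist x y) :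
    ∃ z, Btw x z y ∧ dist x z = s := by
  by_cases hL : dist x y = 0
  · exact ⟨x, btw_left _ _, by rw [dist_self]; linarith⟩
  have hL' : 0 < dist x y := lt_of_le_of_ne dist_nonneg (Ne.symm hL)
  refine ⟨pt x y (s / dist x y), btw_pt _ _ _, ?_⟩
  rw [dist_left_pt _ _ (by positivity) ((div_le_one hL').mpr h1)]; field_simp

end Geodesics

/-! ### Convex functions -/

section Convex

variable {X : Type*} [MetricSpace X] {c k : ℝ} {g h : X → ℝ} {x y z : X}

/-- `g` is convex along geodesics, with modulus of convexity `c`. -/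
def SConv (c : ℝ) (g : X → ℝ) : Prop :=
  ∀ x z y, Btw x z y →
    dist x y * g z + c * (dist x z * dist z y * dist x y) ≤ dist z y * g x + dist x z * g y

theorem SConv.add (hg : SConv c g) (hh : SConv k h) : SConv (c + k) fun x => g x + h x := by
  intro x z y hb
  have h1 := hg x z y hb
  have h2 := hh x z y hb
  simp only
  linarith

theorem SConv.const_mul (hg : SConv c g) (hk : 0 ≤ k) : SConv (k * c) fun x => k * g x := by
  intro x z y hb
  have h1 := mul_le_mul_of_nonneg_left (hg x z y hb) hk
  simp only
  linarith

theorem sConv_dist [CAT0 X] (o : X) : SConv 0 fun x : X => dist o x := by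
  intro x z y hb
  obtain ⟨t, h0, h1, rfl⟩ := hb.exists_pt
  have := dist_pt_pt o o x y h0 h1
  rw [pt_self] at this
  rw [dist_left_pt _ _ h0 h1, dist_pt_right _ _ h0 h1]
  simp only
  nlinarith [dist_nonneg (x := x) (y := y)]

theorem sConv_dist' [CAT0 X] (o : X) : SConv 0 fun x : X => dist x o := by
  simpa only [dist_comm] using sConv_dist o

theorem sConv_sq [CAT0 X] (o : X) : SConv 1 fun x : X => dist o x ^ 2 := by
  intro x z y hb
  have := CAT0.stewart o x z y hb
  simp only
  linarith

theorem SConv.le_max (hg : SConv c g) (hc : 0 ≤ c) (hb : Btw x z y) : g z ≤ max (g x) (g y) := by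
  by_cases hL : dist x y = 0
  · have := dist_eq_zero.mp hL
    subst this
    rw [hb.eq_of_same]; exact le_max_left _ _
  have hL' : 0 < dist x y := lt_of_le_of_ne dist_nonneg (Ne.symm hL)
  have h1 := hg x z y hb
  have h2 : 0 ≤ c * (dist x z * dist z y * dist x y) := by positivity
  have h3 : dist z y * g x ≤ dist z y * max (g x) (g y) :=
    mul_le_mul_of_nonneg_left (le_max_left _ _) dist_nonneg
  have h4 : dist x z * g y ≤ dist x z * max (g x) (g y) :=
    mul_le_mul_of_nonneg_left (le_max_right _ _) dist_nonneg
  refine le_of_mul_le_mul_left ?_ hL'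
  unfold Btw at hb
  have h5 : dist x y * max (g x) (g y) = dist z y * max (g x) (g y) + dist x z * max (g x) (g y) := by
    rw [← hb]; ring
  linarith

theorem SConv.lt_max (hg : SConv c g) (hc : 0 < c) (hb : Btw x z y) (hx : z ≠ x) (hy : z ≠ y) :
    g z < max (g x) (g y) := by
  have hx' : 0 < dist x z := dist_pos.mpr (Ne.symm hx)
  have hy' : 0 < dist z y := dist_pos.mpr hy
  have hL' : 0 < dist x y := by unfold Btw at hb; linarith
  have h1 := hg x z y hb
  have h2 : 0 < c * (dist x z * dist z y * dist x y) := by positivity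
  have h3 : dist z y * g x ≤ dist z y * max (g x) (g y) :=
    mul_le_mul_of_nonneg_left (le_max_left _ _) dist_nonneg
  have h4 : dist x z * g y ≤ dist x z * max (g x) (g y) :=
    mul_le_mul_of_nonneg_left (le_max_right _ _) dist_nonneg
  refine lt_of_mul_lt_mul_left ?_ hL'.le
  unfold Btw at hb
  have h5 : dist x y * max (g x) (g y) = dist z y * max (g x) (g y) + dist x z * max (g x) (g y) := by
    rw [← hb]; ring
  linarith

end Convex

/-! ### Model planes -/

/-- A distance function on the plane together with coordinates in which geodesics are straight. -/
structure ModelData (D : ℝ × ℝ → ℝ × ℝ → ℝ) (K : ℝ × ℝ → ℝ × ℝ) : Prop where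
  cont : Continuous fun q : (ℝ × ℝ) × (ℝ × ℝ) => D q.1 q.2
  nonneg : ∀ u v, 0 ≤ D u v
  symm : ∀ u v, D u v = D v u
  self : ∀ u, D u u = 0
  eq_of_zero : ∀ u v, D u v = 0 → u = v
  btw : ∀ u z v, D u z + D z v = D u v ↔ K z ∈ segment ℝ (K u) (K v)
  emb : Topology.IsOpenEmbedding K
  range_convex : Convex ℝ (range K)
  circ : ∀ w ξ, w ≠ ξ → ∀ a b, {x | D w x = a ∧ D ξ x = b}.Finite

theorem finite_of_three {α : Type*} {S : Set α}
    (h : ∀ x ∈ S, ∀ y ∈ S, ∀ z ∈ S, x ≠ y → x ≠ z → y = z) : S.Finite := by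
  by_cases h1 : ∃ x ∈ S, ∃ y ∈ S, x ≠ y
  · obtain ⟨x, hx, y, hy, hxy⟩ := h1
    refine Set.Finite.subset (Set.toFinite {x, y}) fun z hz => ?_
    by_cases hxz : x = z
    · exact Or.inl hxz.symm
    · exact Or.inr (h x hx y hy z hz hxy hxz).symm
  · push Not at h1
    exact Set.Subsingleton.finite fun x hx y hy => h1 x hx y hy

section Euclid

theorem circ_euclid {w1 w2 v1 v2 x1 x2 y1 y2 z1 z2 : ℝ} (hwv : ¬ (w1 = v1 ∧ w2 = v2))
    (h1 : (w1 - x1) ^ 2 + (w2 - x2) ^ 2 = (w1 - y1) ^ 2 + (w2 - y2) ^ 2)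
    (h2 : (w1 - x1) ^ 2 + (w2 - x2) ^ 2 = (w1 - z1) ^ 2 + (w2 - z2) ^ 2)
    (h3 : (v1 - x1) ^ 2 + (v2 - x2) ^ 2 = (v1 - y1) ^ 2 + (v2 - y2) ^ 2)
    (h4 : (v1 - x1) ^ 2 + (v2 - x2) ^ 2 = (v1 - z1) ^ 2 + (v2 - z2) ^ 2)
    (hy : ¬ (x1 = y1 ∧ x2 = y2)) (hz : ¬ (x1 = z1 ∧ x2 = z2)) : y1 = z1 ∧ y2 = z2 := by
  set e1 := w1 - v1 with he1
  set e2 := w2 - v2 with he2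
  have hE : 0 < e1 ^ 2 + e2 ^ 2 := by
    by_contra hc
    have i1 : e1 = 0 := pow_eq_zero_iff two_ne_zero |>.mp
      (le_antisymm (by linarith [sq_nonneg e2]) (sq_nonneg e1))
    have i2 : e2 = 0 := pow_eq_zero_iff two_ne_zero |>.mp
      (le_antisymm (by linarith [sq_nonneg e1]) (sq_nonneg e2))
    exact hwv ⟨by linarith, by linarith⟩
  set a := (-e2 * (y1 - x1) + e1 * (y2 - x2)) / (e1 ^ 2 + e2 ^ 2) with ha
  set b := (-e2 * (z1 - x1) + e1 * (z2 - x2)) / (e1 ^ 2 + e2 ^ 2) with hb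
  have ha' : a * (e1 ^ 2 + e2 ^ 2) = -e2 * (y1 - x1) + e1 * (y2 - x2) := div_mul_cancel₀ _ hE.ne'
  have hb' : b * (e1 ^ 2 + e2 ^ 2) = -e2 * (z1 - x1) + e1 * (z2 - x2) := div_mul_cancel₀ _ hE.ne'
  have o1 : e1 * (y1 - x1) + e2 * (y2 - x2) = 0 := by
    rw [he1, he2]; linear_combination (1/2) * h1 - (1/2) * h3
  have o2 : e1 * (z1 - x1) + e2 * (z2 - x2) = 0 := by
    rw [he1, he2]; linear_combination (1/2) * h2 - (1/2) * h4
  have y1e : y1 - x1 = -a * e2 := by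
    apply mul_left_cancel₀ hE.ne'; linear_combination e1 * o1 + e2 * ha'
  have y2e : y2 - x2 = a * e1 := by
    apply mul_left_cancel₀ hE.ne'; linear_combination e2 * o1 - e1 * ha'
  have z1e : z1 - x1 = -b * e2 := by
    apply mul_left_cancel₀ hE.ne'; linear_combination e1 * o2 + e2 * hb'
  have z2e : z2 - x2 = b * e1 := by
    apply mul_left_cancel₀ hE.ne'; linear_combination e2 * o2 - e1 * hb'
  have a0 : a ≠ 0 := by
    intro h; rw [h] at y1e y2e; exact hy ⟨by linarith, by linarith⟩
  have b0 : b ≠ 0 := by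
    intro h; rw [h] at z1e z2e; exact hz ⟨by linarith, by linarith⟩
  have q1 : a * (2 * (-(x1 - w1) * e2 + (x2 - w2) * e1) + a * (e1 ^ 2 + e2 ^ 2)) = 0 := by
    have i1 : y1 = x1 - a * e2 := by linarith
    have i2 : y2 = x2 + a * e1 := by linarith
    rw [i1, i2] at h1
    linear_combination -h1
  have q2 : b * (2 * (-(x1 - w1) * e2 + (x2 - w2) * e1) + b * (e1 ^ 2 + e2 ^ 2)) = 0 := by
    have i1 : z1 = x1 - b * e2 := by linarith
    have i2 : z2 = x2 + b * e1 := by linarith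
    rw [i1, i2] at h2
    linear_combination -h2
  have q1' := (mul_eq_zero.mp q1).resolve_left a0
  have q2' := (mul_eq_zero.mp q2).resolve_left b0
  have hab : a = b := by
    apply mul_right_cancel₀ hE.ne'; linarith
  rw [← hab] at z1e z2e
  exact ⟨by linarith, by linarith⟩

theorem modelData_euclid :
    ModelData (fun u v : ℝ × ℝ => Real.sqrt ((u.1 - v.1) ^ 2 + (u.2 - v.2) ^ 2)) id := by
  have hd : ∀ u v : ℝ × ℝ, Real.sqrt ((u.1 - v.1) ^ 2 + (u.2 - v.2) ^ 2) =
      dist (Complex.equivRealProdLm.symm u) (Complex.equivRealProdLm.symm v) := by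
    intro u v
    rw [Complex.dist_eq_re_im]; rfl
  refine ⟨by fun_prop, fun _ _ => Real.sqrt_nonneg _, fun u v => by
      rw [hd, hd, dist_comm], fun u => by simp, fun u v h => ?_, fun u z v => ?_,
      Topology.IsOpenEmbedding.id, by simpa using convex_univ, ?_⟩
  · rw [hd, dist_eq_zero] at h
    exact Complex.equivRealProdLm.symm.injective h
  · simp only [id]
    rw [hd, hd, hd, dist_add_dist_eq_iff, ← mem_segment_iff_wbtw]
    have := image_segment ℝ Complex.equivRealProdLm.symm.toLinearMap.toAffineMap u v
    change Complex.equivRealProdLm.symm.toLinearMap.toAffineMap z ∈ segment ℝ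
      (Complex.equivRealProdLm.symm.toLinearMap.toAffineMap u)
      (Complex.equivRealProdLm.symm.toLinearMap.toAffineMap v) ↔ _
    rw [← this]
    exact Function.Injective.mem_set_image Complex.equivRealProdLm.symm.injective
  · intro w v hwv a b
    apply finite_of_three
    have key : ∀ u x y : ℝ × ℝ, Real.sqrt ((u.1 - x.1) ^ 2 + (u.2 - x.2) ^ 2) =
        Real.sqrt ((u.1 - y.1) ^ 2 + (u.2 - y.2) ^ 2) →
        (u.1 - x.1) ^ 2 + (u.2 - x.2) ^ 2 = (u.1 - y.1) ^ 2 + (u.2 - y.2) ^ 2 := by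
      intro u x y h
      exact (Real.sqrt_inj (by positivity) (by positivity)).mp h
    rintro x ⟨hx1, hx2⟩ y ⟨hy1, hy2⟩ z ⟨hz1, hz2⟩ hxy hxz
    have := circ_euclid (fun h => hwv (Prod.ext h.1 h.2)) (key _ _ _ (hx1.trans hy1.symm))
      (key _ _ _ (hx1.trans hz1.symm)) (key _ _ _ (hx2.trans hy2.symm))
      (key _ _ _ (hx2.trans hz2.symm)) (fun h => hxy (Prod.ext h.1 h.2))
      (fun h => hxz (Prod.ext h.1 h.2))
    exact Prod.ext this.1 this.2

end Euclid

section Hyperbolic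

/-- The height of a point of the hyperboloid over its planar coordinates. -/
noncomputable def hgt (u : ℝ × ℝ) : ℝ := Real.sqrt (1 + u.1 ^ 2 + u.2 ^ 2)

theorem hgt_sq (u : ℝ × ℝ) : hgt u ^ 2 = 1 + u.1 ^ 2 + u.2 ^ 2 := Real.sq_sqrt (by positivity)

theorem hgt_pos (u : ℝ × ℝ) : 0 < hgt u := Real.sqrt_pos.mpr (by positivity)

theorem continuous_hgt : Continuous hgt := by unfold hgt; fun_prop

/-- The negative of the Minkowski form of two points of the hyperboloid. -/
noncomputable def hyp (u v : ℝ × ℝ) : ℝ := hgt u * hgt v - u.1 * v.1 - u.2 * v.2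

theorem hyp_comm (u v : ℝ × ℝ) : hyp u v = hyp v u := by unfold hyp; ring

theorem hyp_self (u : ℝ × ℝ) : hyp u u = 1 := by
  unfold hyp; linear_combination hgt_sq u

theorem one_le_hyp (u v : ℝ × ℝ) : 1 ≤ hyp u v := by
  have h : 1 + u.1 * v.1 + u.2 * v.2 ≤ hgt u * hgt v := by
    refine le_of_sq_le_sq ?_ (mul_pos (hgt_pos u) (hgt_pos v)).le
    rw [mul_pow, hgt_sq, hgt_sq]
    nlinarith [sq_nonneg (u.1 - v.1), sq_nonneg (u.2 - v.2), sq_nonneg (u.1 * v.2 - u.2 * v.1)]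
  unfold hyp; linarith

theorem eq_of_hyp_eq_one {u v : ℝ × ℝ} (h : hyp u v = 1) : u = v := by
  have h1 : hgt u * hgt v = 1 + u.1 * v.1 + u.2 * v.2 := by unfold hyp at h; linarith
  have h2 : (1 + u.1 ^ 2 + u.2 ^ 2) * (1 + v.1 ^ 2 + v.2 ^ 2) = (1 + u.1 * v.1 + u.2 * v.2) ^ 2 := by
    rw [← hgt_sq, ← hgt_sq, ← mul_pow, h1]
  have h3 : (u.1 - v.1) ^ 2 = 0 := by
    nlinarith [sq_nonneg (u.1 - v.1), sq_nonneg (u.2 - v.2), sq_nonneg (u.1 * v.2 - u.2 * v.1)]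
  have h4 : (u.2 - v.2) ^ 2 = 0 := by
    nlinarith [sq_nonneg (u.1 - v.1), sq_nonneg (u.2 - v.2), sq_nonneg (u.1 * v.2 - u.2 * v.1)]
  exact Prod.ext (sub_eq_zero.mp (pow_eq_zero_iff (two_ne_zero) |>.mp h3))
    (sub_eq_zero.mp (pow_eq_zero_iff (two_ne_zero) |>.mp h4))

/-- Vectors orthogonal to a timelike vector are spacelike. -/
theorem eq_zero_of_orthogonal {u : ℝ × ℝ} {n1 n2 n3 : ℝ} (h : n1 * u.1 + n2 * u.2 = n3 * hgt u)
    (hn : n1 ^ 2 + n2 ^ 2 ≤ n3 ^ 2) : n1 = 0 ∧ n2 = 0 ∧ n3 = 0 := by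
  have h1 : n3 ^ 2 * (1 + u.1 ^ 2 + u.2 ^ 2) ≤ (n1 ^ 2 + n2 ^ 2) * (u.1 ^ 2 + u.2 ^ 2) := by
    rw [← hgt_sq, ← mul_pow, ← h]
    nlinarith [sq_nonneg (n1 * u.2 - n2 * u.1)]
  have h2 : (n1 ^ 2 + n2 ^ 2) * (u.1 ^ 2 + u.2 ^ 2) ≤ n3 ^ 2 * (u.1 ^ 2 + u.2 ^ 2) :=
    mul_le_mul_of_nonneg_right hn (by positivity)
  have h3 : n3 ^ 2 ≤ 0 := by linarith
  have h4 : n1 ^ 2 ≤ 0 := by linarith [sq_nonneg n2]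
  have h5 : n2 ^ 2 ≤ 0 := by linarith [sq_nonneg n1]
  exact ⟨pow_eq_zero_iff two_ne_zero |>.mp (le_antisymm h4 (sq_nonneg _)),
    pow_eq_zero_iff two_ne_zero |>.mp (le_antisymm h5 (sq_nonneg _)),
    pow_eq_zero_iff two_ne_zero |>.mp (le_antisymm h3 (sq_nonneg _))⟩

theorem arcosh_add_iff {A B C : ℝ} (hA : 1 ≤ A) (hB : 1 ≤ B) (hC : 1 ≤ C) :
    Real.arcosh A + Real.arcosh B = Real.arcosh C ↔
      C = A * B + Real.sqrt (A ^ 2 - 1) * Real.sqrt (B ^ 2 - 1) := by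
  have hc : Real.cosh (Real.arcosh A + Real.arcosh B) =
      A * B + Real.sqrt (A ^ 2 - 1) * Real.sqrt (B ^ 2 - 1) := by
    rw [Real.cosh_add, Real.cosh_arcosh hA, Real.cosh_arcosh hB, Real.sinh_arcosh hA,
      Real.sinh_arcosh hB]
  constructor
  · intro h
    rw [← hc, h, Real.cosh_arcosh hC]
  · intro h
    rw [← hc] at h
    rw [h, Real.arcosh_cosh (add_nonneg (Real.arcosh_nonneg hA) (Real.arcosh_nonneg hB))]

/-- The Klein coordinates. -/
noncomputable def klein (u : ℝ × ℝ) : ℝ × ℝ := (u.1 / hgt u, u.2 / hgt u)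

theorem klein_mem_segment {u z v : ℝ × ℝ} : klein z ∈ segment ℝ (klein u) (klein v) ↔
    ∃ l m : ℝ, 0 ≤ l ∧ 0 ≤ m ∧ z.1 = l * u.1 + m * v.1 ∧ z.2 = l * u.2 + m * v.2 ∧
      hgt z = l * hgt u + m * hgt v := by
  have hu := hgt_pos u
  have hz := hgt_pos z
  have hv := hgt_pos v
  constructor
  · rintro ⟨a, b, ha, hb, hab, h⟩
    have h1 : a * (u.1 / hgt u) + b * (v.1 / hgt v) = z.1 / hgt z := congrArg Prod.fst h
    have h2 : a * (u.2 / hgt u) + b * (v.2 / hgt v) = z.2 / hgt z := congrArg Prod.snd h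
    refine ⟨a * hgt z / hgt u, b * hgt z / hgt v, by positivity, by positivity, ?_, ?_, ?_⟩
    · rw [eq_div_iff hz.ne'] at h1; rw [← h1]; field_simp
    · rw [eq_div_iff hz.ne'] at h2; rw [← h2]; field_simp
    · field_simp; rw [hab]
  · rintro ⟨l, m, hl, hm, h1, h2, h3⟩
    refine ⟨l * hgt u / hgt z, m * hgt v / hgt z, by positivity, by positivity, ?_, ?_⟩
    · rw [← add_div, ← h3, div_self hz.ne']
    · refine Prod.ext ?_ ?_
      · change l * hgt u / hgt z * (u.1 / hgt u) + m * hgt v / hgt z * (v.1 / hgt v) = z.1 / hgt z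
        rw [h1]; field_simp
      · change l * hgt u / hgt z * (u.2 / hgt u) + m * hgt v / hgt z * (v.2 / hgt v) = z.2 / hgt z
        rw [h2]; field_simp

theorem hyp_btw (u z v : ℝ × ℝ) :
    Real.arcosh (hyp u z) + Real.arcosh (hyp z v) = Real.arcosh (hyp u v) ↔
      klein z ∈ segment ℝ (klein u) (klein v) := by
  have hA := one_le_hyp u z
  have hB := one_le_hyp z v
  have hC := one_le_hyp u v
  have su := hgt_sq u
  have sz := hgt_sq z
  have sv := hgt_sq v
  rw [arcosh_add_iff hA hB hC, klein_mem_segment]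
  have dA : hyp u z = hgt u * hgt z - u.1 * z.1 - u.2 * z.2 := rfl
  have dB : hyp z v = hgt z * hgt v - z.1 * v.1 - z.2 * v.2 := rfl
  have dC : hyp u v = hgt u * hgt v - u.1 * v.1 - u.2 * v.2 := rfl
  set A := hyp u z
  set B := hyp z v
  set C := hyp u v
  have hA2 : 0 ≤ A ^ 2 - 1 := sub_nonneg.mpr (one_le_pow₀ hA)
  have hB2 : 0 ≤ B ^ 2 - 1 := sub_nonneg.mpr (one_le_pow₀ hB)
  have hC2 : 0 ≤ C ^ 2 - 1 := sub_nonneg.mpr (one_le_pow₀ hC)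
  constructor
  · intro h
    set S := Real.sqrt (A ^ 2 - 1) * Real.sqrt (B ^ 2 - 1) with hS
    have hS0 : 0 ≤ S := by positivity
    have hSsq : S ^ 2 = (A ^ 2 - 1) * (B ^ 2 - 1) := by
      rw [hS, mul_pow, Real.sq_sqrt hA2, Real.sq_sqrt hB2]
    have hG : (C - A * B) ^ 2 = (A ^ 2 - 1) * (B ^ 2 - 1) := by rw [← hSsq, h]; ring
    by_cases hC1 : C = 1
    · have huv : u = v := eq_of_hyp_eq_one hC1
      have hA1 : A = 1 := by
        have i1 : A * 1 ≤ A * B := mul_le_mul_of_nonneg_left hB (by linarith)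
        linarith
      have huz : u = z := eq_of_hyp_eq_one hA1
      refine ⟨1, 0, zero_le_one, le_rfl, ?_, ?_, ?_⟩ <;> rw [huz] <;> ring
    have hC1' : 1 < C := lt_of_le_of_ne hC (Ne.symm hC1)
    have hE : 0 < C ^ 2 - 1 := sub_pos.mpr (one_lt_pow₀ hC1' two_ne_zero)
    set l := (B * C - A) / (C ^ 2 - 1) with hl
    set m := (A * C - B) / (C ^ 2 - 1) with hm
    have hl' : l * (C ^ 2 - 1) = B * C - A := div_mul_cancel₀ _ hE.ne'
    have hm' : m * (C ^ 2 - 1) = A * C - B := div_mul_cancel₀ _ hE.ne'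
    have hAB : A * B ≤ C := by linarith
    have hl0 : 0 ≤ l := by
      refine div_nonneg ?_ hE.le
      have : B * C - A = B * (C - A * B) + A * (B ^ 2 - 1) := by ring
      rw [this]
      exact add_nonneg (mul_nonneg (by linarith) (by linarith)) (mul_nonneg (by linarith) hB2)
    have hm0 : 0 ≤ m := by
      refine div_nonneg ?_ hE.le
      have : A * C - B = A * (C - A * B) + B * (A ^ 2 - 1) := by ring
      rw [this]
      exact add_nonneg (mul_nonneg (by linarith) (by linarith)) (mul_nonneg (by linarith) hA2)
    have r1 : l + m * C = A := by
      apply mul_right_cancel₀ hE.ne'; linear_combination hl' + C * hm'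
    have r2 : l * C + m = B := by
      apply mul_right_cancel₀ hE.ne'; linear_combination C * hl' + hm'
    have r3 : l * A + m * B = 1 := by
      apply mul_right_cancel₀ hE.ne'; linear_combination A * hl' + B * hm' - hG
    have r4 : l ^ 2 + m ^ 2 + 2 * l * m * C = 1 := by
      linear_combination r3 + l * r1 + m * r2
    clear_value l m S A B C
    obtain ⟨e1, e2, e3⟩ := eq_zero_of_orthogonal (u := u) (n1 := z.1 - l * u.1 - m * v.1)
      (n2 := z.2 - l * u.2 - m * v.2) (n3 := hgt z - l * hgt u - m * hgt v)
      (by linear_combination r1 + l * su - m * dC + dA)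
      (by
        apply le_of_eq
        linear_combination (2 : ℝ) * r3 - r4 + l ^ 2 * (-su) - sz - m ^ 2 * sv - 2 * l * dA - 2 * m * dB
          + 2 * l * m * dC)
    exact ⟨l, m, hl0, hm0, by linarith, by linarith, by linarith⟩
  · rintro ⟨l, m, hl, hm, h1, h2, h3⟩
    have n1 : l ^ 2 + m ^ 2 + 2 * l * m * C = 1 := by
      rw [h1, h2, h3] at sz
      rw [dC]
      linear_combination sz - l ^ 2 * su - m ^ 2 * sv
    have rA : A = l + m * C := by
      rw [dA, dC, h1, h2, h3]; linear_combination l * su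
    have rB : B = l * C + m := by
      rw [dB, dC, h1, h2, h3]; linear_combination m * sv
    have e1 : A ^ 2 - 1 = m ^ 2 * (C ^ 2 - 1) := by rw [rA]; linear_combination n1
    have e2 : B ^ 2 - 1 = l ^ 2 * (C ^ 2 - 1) := by rw [rB]; linear_combination n1
    rw [e1, e2, Real.sqrt_mul (by positivity), Real.sqrt_mul (by positivity), Real.sqrt_sq hm,
      Real.sqrt_sq hl]
    have e3 := Real.mul_self_sqrt hC2
    rw [rA, rB]
    linear_combination (-C) * n1 - l * m * e3

theorem cross_param {w1 w2 w3 v1 v2 v3 x1 x2 x3 t1 t2 t3 c1 c2 c3 : ℝ}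
    (hE : 0 < c1 ^ 2 + c2 ^ 2 + c3 ^ 2)
    (hc1 : c1 = w3 * v2 - w2 * v3) (hc2 : c2 = w1 * v3 - w3 * v1) (hc3 : c3 = w1 * v2 - w2 * v1)
    (g1 : w3 * x3 - w1 * x1 - w2 * x2 = w3 * t3 - w1 * t1 - w2 * t2)
    (g2 : v3 * x3 - v1 * x1 - v2 * x2 = v3 * t3 - v1 * t1 - v2 * t2) :
    ∃ a : ℝ, t1 = x1 + a * c1 ∧ t2 = x2 + a * c2 ∧ t3 = x3 + a * c3 := by
  have p1 : c2 * (t3 - x3) = c3 * (t2 - x2) := by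
    rw [hc2, hc3]; linear_combination v1 * g1 - w1 * g2
  have p2 : c3 * (t1 - x1) = c1 * (t3 - x3) := by
    rw [hc1, hc3]; linear_combination v2 * g1 - w2 * g2
  have p3 : c1 * (t2 - x2) = c2 * (t1 - x1) := by
    rw [hc1, hc2]; linear_combination w3 * g2 - v3 * g1
  obtain ⟨a, ha⟩ : ∃ a : ℝ, a * (c1 ^ 2 + c2 ^ 2 + c3 ^ 2) =
      c1 * (t1 - x1) + c2 * (t2 - x2) + c3 * (t3 - x3) := ⟨_, div_mul_cancel₀ _ hE.ne'⟩
  clear hc1 hc2 hc3 g1 g2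
  refine ⟨a, ?_, ?_, ?_⟩
  · apply mul_right_cancel₀ hE.ne'; linear_combination (-c1) * ha + c3 * p2 - c2 * p3
  · apply mul_right_cancel₀ hE.ne'; linear_combination (-c2) * ha - c3 * p1 + c1 * p3
  · apply mul_right_cancel₀ hE.ne'; linear_combination (-c3) * ha + c2 * p1 - c1 * p2

theorem circ_hyp {w v x y z : ℝ × ℝ} (hwv : w ≠ v) (h1 : hyp w x = hyp w y)
    (h2 : hyp w x = hyp w z) (h3 : hyp v x = hyp v y) (h4 : hyp v x = hyp v z)
    (hxy : x ≠ y) (hxz : x ≠ z) : y = z := by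
  unfold hyp at h1 h2 h3 h4
  have sw := hgt_sq w
  have sv := hgt_sq v
  have sx := hgt_sq x
  have sy := hgt_sq y
  have sz := hgt_sq z
  obtain ⟨c1, hc1⟩ : ∃ c, c = hgt w * v.2 - w.2 * hgt v := ⟨_, rfl⟩
  obtain ⟨c2, hc2⟩ : ∃ c, c = w.1 * hgt v - hgt w * v.1 := ⟨_, rfl⟩
  obtain ⟨c3, hc3⟩ : ∃ c, c = w.1 * v.2 - w.2 * v.1 := ⟨_, rfl⟩
  have cw : c1 * w.1 + c2 * w.2 = c3 * hgt w := by rw [hc1, hc2, hc3]; ring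
  have hQ : 0 < c1 ^ 2 + c2 ^ 2 - c3 ^ 2 := by
    by_contra hcon
    obtain ⟨z1, z2, z3⟩ := eq_zero_of_orthogonal cw (by linarith)
    have k : hgt w ^ 2 = hgt v ^ 2 := by
      have k1 : hgt w * v.2 = w.2 * hgt v := by linarith
      have k2 : w.1 * hgt v = hgt w * v.1 := by linarith
      have : (w.1 ^ 2 + w.2 ^ 2) * hgt v ^ 2 = hgt w ^ 2 * (v.1 ^ 2 + v.2 ^ 2) := by
        linear_combination (w.1 * hgt v + hgt w * v.1) * k2 - (w.2 * hgt v + hgt w * v.2) * k1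
      linear_combination this + hgt v ^ 2 * sw - hgt w ^ 2 * sv
    have k' : hgt w = hgt v := by
      exact (pow_left_inj₀ (hgt_pos w).le (hgt_pos v).le two_ne_zero).mp k
    apply hwv
    rw [k'] at hc1 hc2
    have hv := (hgt_pos v).ne'
    exact Prod.ext (mul_right_cancel₀ hv (by linarith)) (mul_right_cancel₀ hv (by linarith))
  have hE : 0 < c1 ^ 2 + c2 ^ 2 + c3 ^ 2 := by linarith [sq_nonneg c3]
  have para : ∀ t : ℝ × ℝ, hgt w * hgt x - w.1 * x.1 - w.2 * x.2 =
      hgt w * hgt t - w.1 * t.1 - w.2 * t.2 →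
      hgt v * hgt x - v.1 * x.1 - v.2 * x.2 = hgt v * hgt t - v.1 * t.1 - v.2 * t.2 →
      ∃ a : ℝ, t.1 = x.1 + a * c1 ∧ t.2 = x.2 + a * c2 ∧ hgt t = hgt x + a * c3 :=
    fun t g1 g2 => cross_param hE hc1 hc2 hc3 g1 g2
  obtain ⟨a, ya, yb, yc⟩ := para y h1 h3
  obtain ⟨b, za, zb, zc⟩ := para z h2 h4
  have a0 : a ≠ 0 := by
    rintro rfl; exact hxy (Prod.ext (by linarith) (by linarith))
  have b0 : b ≠ 0 := by
    rintro rfl; exact hxz (Prod.ext (by linarith) (by linarith))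
  have q1 : a * (2 * (x.1 * c1 + x.2 * c2 - hgt x * c3) + a * (c1 ^ 2 + c2 ^ 2 - c3 ^ 2)) = 0 := by
    rw [ya, yb, yc] at sy
    linear_combination sx - sy
  have q2 : b * (2 * (x.1 * c1 + x.2 * c2 - hgt x * c3) + b * (c1 ^ 2 + c2 ^ 2 - c3 ^ 2)) = 0 := by
    rw [za, zb, zc] at sz
    linear_combination sx - sz
  have q1' := (mul_eq_zero.mp q1).resolve_left a0
  have q2' := (mul_eq_zero.mp q2).resolve_left b0
  have hab : a = b := by
    apply mul_right_cancel₀ hQ.ne'; linarith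
  rw [← hab] at za zb
  exact Prod.ext (by linarith) (by linarith)

theorem klein_norm (u : ℝ × ℝ) : (klein u).1 ^ 2 + (klein u).2 ^ 2 < 1 := by
  have hu := hgt_pos u
  change (u.1 / hgt u) ^ 2 + (u.2 / hgt u) ^ 2 < 1
  rw [div_pow, div_pow, ← add_div, div_lt_one (by positivity), hgt_sq]; linarith

/-- The inverse of the Klein coordinates. -/
noncomputable def kleinInv (k : ℝ × ℝ) : ℝ × ℝ :=
  (k.1 / Real.sqrt (1 - k.1 ^ 2 - k.2 ^ 2), k.2 / Real.sqrt (1 - k.1 ^ 2 - k.2 ^ 2))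

theorem kleinInv_klein (u : ℝ × ℝ) : kleinInv (klein u) = u := by
  have hu := hgt_pos u
  have : Real.sqrt (1 - (klein u).1 ^ 2 - (klein u).2 ^ 2) = 1 / hgt u := by
    rw [Real.sqrt_eq_iff_mul_self_eq_of_pos (by positivity)]
    change 1 / hgt u * (1 / hgt u) = 1 - (u.1 / hgt u) ^ 2 - (u.2 / hgt u) ^ 2
    field_simp
    linarith [hgt_sq u]
  unfold kleinInv
  rw [this]
  refine Prod.ext ?_ ?_
  · change u.1 / hgt u / (1 / hgt u) = u.1; field_simp
  · change u.2 / hgt u / (1 / hgt u) = u.2; field_simp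

theorem klein_kleinInv {k : ℝ × ℝ} (hk : k.1 ^ 2 + k.2 ^ 2 < 1) : klein (kleinInv k) = k := by
  set s := Real.sqrt (1 - k.1 ^ 2 - k.2 ^ 2) with hs
  have hs0 : 0 < s := Real.sqrt_pos.mpr (by linarith)
  have hs2 : s ^ 2 = 1 - k.1 ^ 2 - k.2 ^ 2 := Real.sq_sqrt (by linarith)
  have hh : hgt (kleinInv k) = 1 / s := by
    unfold hgt
    rw [Real.sqrt_eq_iff_mul_self_eq_of_pos (by positivity)]
    change 1 / s * (1 / s) = 1 + (k.1 / s) ^ 2 + (k.2 / s) ^ 2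
    field_simp
    linarith
  unfold klein
  rw [hh]
  refine Prod.ext ?_ ?_
  · change k.1 / s / (1 / s) = k.1; field_simp
  · change k.2 / s / (1 / s) = k.2; field_simp

theorem range_klein : range klein = {k : ℝ × ℝ | k.1 ^ 2 + k.2 ^ 2 < 1} := by
  ext k
  constructor
  · rintro ⟨u, rfl⟩; exact klein_norm u
  · intro hk; exact ⟨kleinInv k, klein_kleinInv hk⟩

theorem continuous_klein : Continuous klein := by
  unfold klein
  exact (continuous_fst.div continuous_hgt fun u => (hgt_pos u).ne').prodMk
    (continuous_snd.div continuous_hgt fun u => (hgt_pos u).ne')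

theorem isOpen_disc : IsOpen {k : ℝ × ℝ | k.1 ^ 2 + k.2 ^ 2 < 1} :=
  isOpen_lt (by fun_prop) continuous_const

theorem isOpenEmbedding_klein : Topology.IsOpenEmbedding klein := by
  refine Topology.IsOpenEmbedding.of_continuous_injective_isOpenMap continuous_klein
    (Function.LeftInverse.injective kleinInv_klein) fun U hU => ?_
  have : klein '' U = {k : ℝ × ℝ | k.1 ^ 2 + k.2 ^ 2 < 1} ∩ kleinInv ⁻¹' U := by
    ext k
    constructor
    · rintro ⟨u, hu, rfl⟩
      exact ⟨klein_norm u, by rw [mem_preimage, kleinInv_klein]; exact hu⟩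
    · rintro ⟨hk, hu⟩
      exact ⟨kleinInv k, hu, klein_kleinInv hk⟩
  rw [this]
  refine ContinuousOn.isOpen_inter_preimage ?_ isOpen_disc hU
  have hc : Continuous fun k : ℝ × ℝ => Real.sqrt (1 - k.1 ^ 2 - k.2 ^ 2) := by fun_prop
  have hne : ∀ k ∈ {k : ℝ × ℝ | k.1 ^ 2 + k.2 ^ 2 < 1}, Real.sqrt (1 - k.1 ^ 2 - k.2 ^ 2) ≠ 0 := by
    intro k hk
    have hk' : k.1 ^ 2 + k.2 ^ 2 < 1 := hk
    exact (Real.sqrt_pos.mpr (by linarith)).ne'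
  exact (continuous_fst.continuousOn.div hc.continuousOn hne).prodMk
    (continuous_snd.continuousOn.div hc.continuousOn hne)

theorem convex_disc : Convex ℝ {k : ℝ × ℝ | k.1 ^ 2 + k.2 ^ 2 < 1} := by
  rintro ⟨x1, x2⟩ hx ⟨y1, y2⟩ hy a b ha hb hab
  simp only [mem_ofPred_eq, Prod.smul_mk, Prod.mk_add_mk, smul_eq_mul] at *
  have hb' : b = 1 - a := by linarith
  subst hb'
  have : (a * x1 + (1 - a) * y1) ^ 2 + (a * x2 + (1 - a) * y2) ^ 2 =
    a * (x1 ^ 2 + x2 ^ 2) + (1 - a) * (y1 ^ 2 + y2 ^ 2) -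
      a * (1 - a) * ((x1 - y1) ^ 2 + (x2 - y2) ^ 2) := by ring
  have h1 : 0 ≤ a * (1 - a) * ((x1 - y1) ^ 2 + (x2 - y2) ^ 2) := by positivity
  rcases ha.eq_or_lt with h | h
  · subst h; linarith
  · nlinarith

theorem modelData_hyp {k : ℝ} (hk : 0 < k) :
    ModelData (fun u v : ℝ × ℝ => k * Real.arcosh (hyp u v)) klein := by
  refine ⟨?_, fun u v => mul_nonneg hk.le (Real.arcosh_nonneg (one_le_hyp u v)), fun u v => by
    rw [hyp_comm], fun u => by rw [hyp_self, Real.arcosh_zero, mul_zero], fun u v h => ?_,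
    fun u z v => ?_, isOpenEmbedding_klein, by rw [range_klein]; exact convex_disc, ?_⟩
  · refine continuous_const.mul (Real.continuousOn_arcosh.comp_continuous ?_ fun q =>
      one_le_hyp q.1 q.2)
    unfold hyp hgt
    fun_prop
  · have h1 := (mul_eq_zero.mp h).resolve_left hk.ne'
    exact eq_of_hyp_eq_one ((Real.arcosh_eq_zero_iff (one_le_hyp u v)).mp h1)
  · rw [← hyp_btw, ← mul_add]
    exact ⟨fun h => mul_left_cancel₀ hk.ne' h, fun h => by rw [h]⟩
  · intro w v hwv a b
    apply finite_of_three
    have key : ∀ u x y : ℝ × ℝ, k * Real.arcosh (hyp u x) = k * Real.arcosh (hyp u y) →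
        hyp u x = hyp u y := by
      intro u x y h
      have h1 := mul_left_cancel₀ hk.ne' h
      rw [← Real.cosh_arcosh (one_le_hyp u x), h1, Real.cosh_arcosh (one_le_hyp u y)]
    rintro x ⟨hx1, hx2⟩ y ⟨hy1, hy2⟩ z ⟨hz1, hz2⟩ hxy hxz
    exact circ_hyp hwv (key _ _ _ (hx1.trans hy1.symm))
      (key _ _ _ (hx1.trans hz1.symm)) (key _ _ _ (hx2.trans hy2.symm))
      (key _ _ _ (hx2.trans hz2.symm)) hxy hxz

end Hyperbolic

theorem exists_modelData {κ : ℝ} (hκ : κ ≤ 0) : ∃ K, ModelData (mDist κ) K := by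
  by_cases h : κ = 0
  · refine ⟨id, ?_⟩
    convert modelData_euclid using 1
    funext u v
    simp [mDist, h]
  · refine ⟨klein, ?_⟩
    have hk : 0 < Real.sqrt (-κ) := Real.sqrt_pos.mpr (by
      have := lt_of_le_of_ne hκ h
      linarith)
    convert modelData_hyp (k := 1 / Real.sqrt (-κ)) (by positivity) using 1
    funext u v
    simp only [mDist, h, if_false]
    rfl

/-! ### Charts of faces -/

theorem segment_total {V : Type*} [AddCommGroup V] [Module ℝ V] {u v x y : V}
    (hx : x ∈ segment ℝ u v) (hy : y ∈ segment ℝ u v) :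
    x ∈ segment ℝ u y ∨ y ∈ segment ℝ u x := by
  have key : ∀ s t : ℝ, 0 ≤ s → s ≤ t → u + s • (v - u) ∈ segment ℝ u (u + t • (v - u)) := by
    intro s t hs hst
    rw [segment_eq_image']
    rcases (hs.trans hst).eq_or_lt with h | h
    · have : s = 0 := by linarith
      exact ⟨0, ⟨le_rfl, zero_le_one⟩, by simp [this]⟩
    · refine ⟨s / t, ⟨by positivity, (div_le_one h).mpr hst⟩, ?_⟩
      simp only [add_sub_cancel_left, smul_smul, div_mul_cancel₀ _ h.ne']
  rw [segment_eq_image'] at hx hy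
  obtain ⟨s, hs, rfl⟩ := hx
  obtain ⟨t, ht, rfl⟩ := hy
  rcases le_total s t with h | h
  · exact Or.inl (key s t hs.1 h)
  · exact Or.inr (key t s ht.1 h)

namespace ModelData

variable {D : ℝ × ℝ → ℝ × ℝ → ℝ} {K : ℝ × ℝ → ℝ × ℝ}

theorem sub_eq (M : ModelData D K) {u v x y : ℝ × ℝ} (hx : K x ∈ segment ℝ (K u) (K v))
    (hy : K y ∈ segment ℝ (K u) (K v)) : D x y = |D u x - D u y| := by
  rcases segment_total hx hy with h | h
  · have h1 := (M.btw _ _ _).mpr h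
    rw [abs_of_nonpos (by linarith [M.nonneg x y])]; linarith
  · have h1 := (M.btw _ _ _).mpr h
    rw [abs_of_nonneg (by linarith [M.nonneg y x]), M.symm x y]; linarith

theorem exists_on_segment (M : ModelData D K) (u v : ℝ × ℝ) {s : ℝ} (h0 : 0 ≤ s) (h1 : s ≤ D u v) :
    ∃ z, K z ∈ segment ℝ (K u) (K v) ∧ D u z = s := by
  have hsub : segment ℝ (K u) (K v) ⊆ range K :=
    M.range_convex.segment_subset (mem_range_self _) (mem_range_self _)
  have hpre : IsPreconnected (K ⁻¹' segment ℝ (K u) (K v)) :=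
    (convex_segment (K u) (K v)).isPreconnected.preimage_of_isOpenMap M.emb.injective
      M.emb.isOpenMap hsub
  have hD : ContinuousOn (fun z => D u z) (K ⁻¹' segment ℝ (K u) (K v)) :=
    (M.cont.comp (continuous_const.prodMk continuous_id)).continuousOn
  have := hpre.intermediate_value (a := u) (b := v) (left_mem_segment ℝ _ _)
    (right_mem_segment ℝ _ _) hD
  rw [M.self] at this
  obtain ⟨z, hz, hz'⟩ := this ⟨h0, h1⟩
  exact ⟨z, hz, hz'⟩

theorem mem_geodSeg (M : ModelData D K) {u v z : ℝ × ℝ} :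
    z ∈ geodSeg D univ u v ↔ K z ∈ segment ℝ (K u) (K v) := by
  constructor
  · intro h
    simp only [geodSeg, mem_iUnion] at h
    obtain ⟨f, ⟨f0, f1, ⟨_, f2⟩, _⟩, s, hs, rfl⟩ := h
    rw [← M.btw]
    have hL := M.nonneg u v
    have e1 := f2 0 ⟨le_rfl, hL⟩ s hs
    have e2 := f2 s hs _ ⟨hL, le_rfl⟩
    rw [f0, zero_sub, abs_neg, abs_of_nonneg hs.1] at e1
    rw [f1, abs_of_nonpos (by linarith [hs.2])] at e2
    linarith
  · intro h
    have hch : ∀ s : ℝ, ∃ z, 0 ≤ s → s ≤ D u v → K z ∈ segment ℝ (K u) (K v) ∧ D u z = s := by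
      intro s
      by_cases hs : 0 ≤ s ∧ s ≤ D u v
      · obtain ⟨z, hz⟩ := M.exists_on_segment u v hs.1 hs.2
        exact ⟨z, fun _ _ => hz⟩
      · exact ⟨u, fun a b => absurd ⟨a, b⟩ hs⟩
    choose f hf using hch
    have huniq : ∀ y, K y ∈ segment ℝ (K u) (K v) → f (D u y) = y := by
      intro y hy
      have h1 := (M.btw _ _ _).mpr hy
      obtain ⟨h2, h3⟩ := hf (D u y) (M.nonneg _ _) (by linarith [M.nonneg y v])
      apply M.eq_of_zero
      rw [M.sub_eq h2 hy, h3, sub_self, abs_zero]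
    simp only [geodSeg, mem_iUnion]
    have hL := M.nonneg u v
    refine ⟨f, ⟨?_, huniq v (right_mem_segment ℝ _ _), ⟨hL, fun s hs t ht => ?_⟩,
      fun _ _ => trivial⟩, D u z, ?_, huniq z h⟩
    · have := huniq u (left_mem_segment ℝ _ _); rwa [M.self] at this
    · obtain ⟨a, b⟩ := hf s hs.1 hs.2
      obtain ⟨c, e⟩ := hf t ht.1 ht.2
      rw [M.sub_eq a c, b, e]
    · exact ⟨M.nonneg _ _, by linarith [(M.btw _ _ _).mpr h, M.nonneg z v]⟩

theorem convexWrt_iff (M : ModelData D K) {C : Set (ℝ × ℝ)} :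
    ConvexWrt D C ↔ Convex ℝ (K '' C) := by
  constructor
  · intro h
    rw [convex_iff_segment_subset]
    rintro _ ⟨u, hu, rfl⟩ _ ⟨v, hv, rfl⟩ x hx
    obtain ⟨z, rfl⟩ := M.range_convex.segment_subset (mem_range_self u) (mem_range_self v) hx
    exact ⟨z, h u hu v hv (M.mem_geodSeg.mpr hx), rfl⟩
  · intro h u hu v hv z hz
    obtain ⟨y, hy, hyz⟩ := h.segment_subset (mem_image_of_mem K hu) (mem_image_of_mem K hv)
      (M.mem_geodSeg.mp hz)
    rwa [← M.emb.injective hyz]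

theorem image_convexHullWrt (M : ModelData D K) (S : Set (ℝ × ℝ)) :
    K '' convexHullWrt D S = convexHull ℝ (K '' S) := by
  apply Subset.antisymm
  · rintro _ ⟨z, hz, rfl⟩
    have hsub : convexHull ℝ (K '' S) ⊆ range K :=
      convexHull_min (image_subset_range K S) M.range_convex
    refine hz (K ⁻¹' convexHull ℝ (K '' S)) ⟨?_, fun x hx =>
      subset_convexHull ℝ _ (mem_image_of_mem K hx)⟩
    rw [M.convexWrt_iff, image_preimage_eq_of_subset hsub]
    exact convex_convexHull ℝ _
  · refine convexHull_min (image_mono fun x hx C hC => hC.2 hx) (M.convexWrt_iff.mp ?_)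
    intro u hu v hv z hz C hC
    exact hC.1 u (hu C hC) v (hv C hC) hz

end ModelData

variable {X : Type*} [MetricSpace X]

/-- Straightening coordinates on a closed face. -/
structure FaceChart (F : Set X) (k : X → ℝ × ℝ) (A : Finset (ℝ × ℝ)) : Prop where
  compact : IsCompact (closure F)
  cont : ContinuousOn k (closure F)
  inj : InjOn k (closure F)
  image : k '' closure F = convexHull ℝ (A : Set (ℝ × ℝ))
  image_face : k '' F = interior (convexHull ℝ (A : Set (ℝ × ℝ)))
  btw : ∀ x ∈ closure F, ∀ z ∈ closure F, ∀ y ∈ closure F,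
    Btw x z y ↔ k z ∈ segment ℝ (k x) (k y)
  conv : ∀ x ∈ closure F, ∀ y ∈ closure F, ∀ z, Btw x z y → z ∈ closure F
  circ : ∀ w ∈ closure F, ∀ ξ ∈ closure F, w ≠ ξ → ∀ a b,
    {x | x ∈ closure F ∧ dist w x = a ∧ dist ξ x = b}.Finite

theorem exists_faceChart [CAT0 X] {κ : ℝ} (hκ : κ ≤ 0) (PC : PolyComplex2 κ X) {F : Set X}
    (hF : F ∈ PC.faces) : ∃ k A, FaceChart F k A := by
  classical
  obtain ⟨K, M⟩ := exists_modelData hκ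
  obtain ⟨f, P, ⟨F0, hP, hne⟩, finj, fim, fimF, fd⟩ := PC.face_chart F hF
  obtain ⟨_, x0, -, -⟩ := fimF.symm ▸ hne
  have hKP : K '' P = convexHull ℝ ((F0.image K : Finset (ℝ × ℝ)) : Set (ℝ × ℝ)) := by
    rw [hP, M.image_convexHullWrt, Finset.coe_image]
  have hPc : IsCompact P := by
    rw [M.emb.isInducing.isCompact_iff, hKP]
    exact (Finset.finite_toSet _).isCompact_convexHull ℝ
  have hsurj : ∀ u, ∃ x, u ∈ P → x ∈ closure F ∧ f x = u := by
    intro u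
    by_cases hu : u ∈ P
    · obtain ⟨x, hx, hxu⟩ := fim.symm ▸ hu
      exact ⟨x, fun _ => ⟨hx, hxu⟩⟩
    · exact ⟨x0, fun h => absurd h hu⟩
  choose g hg using hsurj
  have hPf : ∀ x ∈ closure F, f x ∈ P := fun x hx => fim ▸ mem_image_of_mem f hx
  have hgf : ∀ x ∈ closure F, g (f x) = x := fun x hx =>
    finj (hg _ (hPf x hx)).1 hx (hg _ (hPf x hx)).2
  have hgd : ∀ u ∈ P, ∀ v ∈ P, dist (g u) (g v) = mDist κ u v := by
    intro u hu v hv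
    rw [← fd _ (hg u hu).1 _ (hg v hv).1, (hg u hu).2, (hg v hv).2]
  have hgc : ContinuousOn g P := by
    intro u hu
    rw [ContinuousWithinAt, tendsto_iff_dist_tendsto_zero]
    have h1 : Tendsto (fun v => mDist κ v u) (nhdsWithin u P) (nhds (mDist κ u u)) :=
      ((M.cont.comp (continuous_id.prodMk continuous_const)).tendsto u).mono_left
        nhdsWithin_le_nhds
    rw [M.self] at h1
    refine h1.congr' ?_
    filter_upwards [self_mem_nhdsWithin] with v hv
    exact (hgd v hv u hu).symm
  have hgim : g '' P = closure F := by
    apply Subset.antisymm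
    · rintro _ ⟨u, hu, rfl⟩; exact (hg u hu).1
    · intro x hx; exact ⟨f x, hPf x hx, hgf x hx⟩
  have hfc : ContinuousOn f (closure F) := by
    rw [continuousOn_iff_isClosed]
    intro t ht
    refine ⟨g '' (P ∩ t), ((hPc.inter_right ht).image_of_continuousOn
      (hgc.mono inter_subset_left)).isClosed, ?_⟩
    ext x
    constructor
    · rintro ⟨hx1, hx2⟩
      exact ⟨⟨f x, ⟨hPf x hx2, hx1⟩, hgf x hx2⟩, hx2⟩
    · rintro ⟨⟨u, ⟨hu1, hu2⟩, rfl⟩, hx2⟩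
      refine ⟨?_, hx2⟩
      rw [mem_preimage, (hg u hu1).2]; exact hu2
  have hbtw : ∀ x ∈ closure F, ∀ z ∈ closure F, ∀ y ∈ closure F,
      Btw x z y ↔ K (f z) ∈ segment ℝ (K (f x)) (K (f y)) := by
    intro x hx z hz y hy
    rw [← M.btw, fd x hx z hz, fd z hz y hy, fd x hx y hy]; rfl
  refine ⟨fun x => K (f x), F0.image K, ⟨?_, ?_, ?_, ?_, ?_, hbtw, ?_, ?_⟩⟩
  · rw [← hgim]; exact hPc.image_of_continuousOn hgc
  · exact M.emb.continuous.comp_continuousOn hfc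
  · exact fun x hx y hy h => finj hx hy (M.emb.injective h)
  · rw [← hKP, ← fim, image_image]
  · rw [← hKP, ← image_image K f, fimF]
    apply Subset.antisymm (M.emb.isOpenMap.image_interior_subset P)
    intro y hy
    obtain ⟨x, hx, rfl⟩ := interior_subset hy
    refine ⟨x, ?_, rfl⟩
    rw [mem_interior]
    refine ⟨K ⁻¹' interior (K '' P), fun z hz => ?_, isOpen_interior.preimage M.emb.continuous, hy⟩
    exact (M.emb.injective.mem_set_image).mp (interior_subset hz)
  · intro x hx y hy z hz
    have h1 : dist x z ≤ mDist κ (f x) (f y) := by rw [fd x hx y hy]; exact hz.left_le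
    obtain ⟨u, hu, hu'⟩ := M.exists_on_segment (f x) (f y) dist_nonneg h1
    have huP : u ∈ P := by
      have hc : Convex ℝ (K '' P) := by rw [hKP]; exact convex_convexHull ℝ _
      exact (M.emb.injective.mem_set_image).mp (hc.segment_subset
        (mem_image_of_mem K (hPf x hx)) (mem_image_of_mem K (hPf y hy)) hu)
    have hgu := hg u huP
    have hb : Btw x (g u) y := (hbtw x hx _ hgu.1 y hy).mpr (by rw [hgu.2]; exact hu)
    have he : dist x (g u) = dist x z := by rw [← fd x hx _ hgu.1, hgu.2, hu']
    rw [← hb.unique hz he]; exact hgu.1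
  · intro w hw ξ hξ hne a b
    have h1 := M.circ (f w) (f ξ) (fun h => hne (finj hw hξ h)) a b
    refine Set.Finite.of_finite_image (f := f) (h1.subset ?_) (finj.mono fun x hx => hx.1)
    rintro _ ⟨x, ⟨hx, hx1, hx2⟩, rfl⟩
    exact ⟨by rw [fd w hw x hx, hx1], by rw [fd ξ hξ x hx, hx2]⟩

/-! ### Local structure of a two-dimensional complex -/

variable {X : Type*} [MetricSpace X]

/-- Geodesics do not branch inside `O`. -/
def NonBranching (O : Set X) : Prop :=
  ∀ x ∈ O, ∃ η > 0, ∀ a b b', a ≠ x → Btw a x b → Btw a x b' → dist x b = dist x b' →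
    dist x b ≤ η → b = b'

/-- The closed ball of radius `δ` about `w` is a compact cone over the sphere, which is a graph
whose singular points are the points outside of the open set `O` of surface points. -/
structure LocalCone (O : Set X) (w : X) (δ : ℝ) : Prop where
  pos : 0 < δ
  compact : IsCompact (closedBall w δ)
  ext : ∀ x, x ≠ w → dist w x ≤ δ → ∃ ξ, dist w ξ = δ ∧ Btw w x ξ
  ext_unique : ∀ x ξ ξ', x ≠ w → Btw w x ξ → Btw w x ξ' → dist w ξ = δ → dist w ξ' = δ → ξ = ξ'
  rim : ∀ ξ, dist w ξ = δ → ∀ ε > 0, ∃ r, 0 < r ∧ r < ε ∧ {x | dist w x = δ ∧ dist ξ x = r}.Finite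
  sing : {x | dist w x = δ ∧ x ∉ O}.Finite
  radial : ∀ x ∈ O, dist w x ≤ δ → ∀ y, y ≠ w → Btw w y x → y ∈ O

/-- A locally conical two-dimensional complex with set `O` of surface points. -/
structure TwoCx (O : Set X) : Prop where
  isOpen : IsOpen O
  nonBranching : NonBranching O
  localCone : ∀ w, ∃ δ₀ > 0, ∀ δ, 0 < δ → δ ≤ δ₀ → LocalCone O w δ

theorem NonBranching.along [CAT0 X] {O : Set X} (hO : NonBranching O) {w x ξ ξ' : X}
    (hwx : w ≠ x) (h : Btw w x ξ) (h' : Btw w x ξ') (hd : dist w ξ = dist w ξ')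
    (hs : ∀ y, Btw x y ξ → y ∈ O) : ξ = ξ' := by
  have hd' : dist x ξ = dist x ξ' := by unfold Btw at h h'; linarith
  set S := {t : ℝ | t ∈ Icc 0 1 ∧ pt x ξ t = pt x ξ' t} with hS
  have hclosed : IsClosed S := by
    have : S = Icc 0 1 ∩ {t | pt x ξ t = pt x ξ' t} := rfl
    rw [this]
    exact isClosed_Icc.inter (isClosed_eq
      (Continuous.pt continuous_const continuous_const continuous_id)
      (Continuous.pt continuous_const continuous_const continuous_id))
  have h0 : (0 : ℝ) ∈ S := ⟨⟨le_rfl, zero_le_one⟩, by rw [pt_zero, pt_zero]⟩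
  have hsub : Icc (0 : ℝ) 1 ⊆ S := by
    have hI := IsClosed.Icc_subset_of_forall_exists_gt (a := (0 : ℝ)) (b := 1) (s := S)
      (hclosed.inter isClosed_Icc) h0
    apply hI
    rintro t ⟨⟨ht, hte⟩, ht0, ht1⟩ y hy
    rcases eq_or_ne x ξ with hxξ | hxξ
    · have hxξ' : x = ξ' := by
        rw [← dist_eq_zero, ← hd', hxξ, dist_self]
      rw [mem_Ioi] at hy
      refine ⟨min y 1, ⟨⟨le_min (by linarith) zero_le_one, min_le_right _ _⟩, ?_⟩,
        lt_min hy ht1, min_le_left _ _⟩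
      rw [← hxξ, ← hxξ']
    have hL : 0 < dist x ξ := dist_pos.mpr hxξ
    set z := pt x ξ t with hz
    have hbz : Btw x z ξ := btw_pt _ _ _
    have hbz' : Btw x z ξ' := by rw [hte]; exact btw_pt _ _ _
    obtain ⟨η, hη, hnb⟩ := hO z (hs z hbz)
    have hwz : Btw w z ξ := h.outer hbz
    have hwz' : Btw w z ξ' := h'.outer hbz'
    have hne : w ≠ z := by
      intro hw
      have hxz : Btw w x z := h.inner hbz
      rw [hw] at hxz
      exact hwx (hw.trans hxz.eq_of_same.symm)
    rw [mem_Ioi] at hy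
    set s := min (min y 1) (t + η / dist x ξ) with hs'
    have hts : t < s := lt_min (lt_min hy ht1) (by have := div_pos hη hL; linarith)
    have hs1 : s ≤ 1 := (min_le_left _ _).trans (min_le_right _ _)
    have hs0 : 0 ≤ s := by linarith
    refine ⟨s, ⟨⟨hs0, hs1⟩, ?_⟩, hts, (min_le_left _ _).trans (min_le_left _ _)⟩
    have hzs : Btw z (pt x ξ s) ξ := hbz.order' (btw_pt _ _ _) (by
      rw [hz, dist_left_pt _ _ ht0 ht1.le, dist_left_pt _ _ hs0 hs1]
      exact mul_le_mul_of_nonneg_right hts.le hL.le)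
    have hzs' : Btw z (pt x ξ' s) ξ' := hbz'.order' (btw_pt _ _ _) (by
      rw [hte, dist_left_pt _ _ ht0 ht1.le, dist_left_pt _ _ hs0 hs1]
      exact mul_le_mul_of_nonneg_right hts.le dist_nonneg)
    have e1 : dist z (pt x ξ s) = (s - t) * dist x ξ := by
      rw [hz, dist_pt_param _ _ ht0 ht1.le hs0 hs1, abs_of_nonpos (by linarith)]; ring
    have e2 : dist z (pt x ξ' s) = (s - t) * dist x ξ := by
      rw [hte, dist_pt_param _ _ ht0 ht1.le hs0 hs1, abs_of_nonpos (by linarith), hd']; ring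
    refine hnb w _ _ hne (hwz.inner hzs) (hwz'.inner hzs') (by rw [e1, e2]) ?_
    rw [e1, ← le_div_iff₀ hL]
    linarith [min_le_right (min y 1) (t + η / dist x ξ)]
  have := (hsub ⟨zero_le_one, le_rfl⟩).2
  rwa [pt_one, pt_one] at this

/-- Extensions of a segment beyond an endpoint are comparable. -/
theorem segment_extension_total {V : Type*} [AddCommGroup V] [Module ℝ V] {a x b b' : V}
    (h : x ∈ segment ℝ a b) (h' : x ∈ segment ℝ a b') (hne : a ≠ x) :
    b ∈ segment ℝ x b' ∨ b' ∈ segment ℝ x b := by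
  have key : ∀ b, x ∈ segment ℝ a b → ∃ c : ℝ, 0 ≤ c ∧ b = x + c • (x - a) := by
    intro b hb
    rw [segment_eq_image'] at hb
    obtain ⟨s, hs, hsx⟩ := hb
    have hs0 : 0 < s := by
      rcases hs.1.eq_or_lt with h0 | h0
      · exfalso; apply hne; rw [← hsx, ← h0]; simp
      · exact h0
    have e : x - a = s • (b - a) := by rw [← hsx]; simp
    refine ⟨s⁻¹ - 1, by linarith [(one_le_inv₀ hs0).mpr hs.2], ?_⟩
    rw [sub_smul, one_smul, e, smul_smul, inv_mul_cancel₀ hs0.ne', one_smul, ← e]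
    abel
  obtain ⟨c, hc, hb⟩ := key b h
  obtain ⟨c', hc', hb'⟩ := key b' h'
  have key2 : ∀ s t : ℝ, 0 ≤ s → s ≤ t → x + s • (x - a) ∈ segment ℝ x (x + t • (x - a)) := by
    intro s t hs hst
    rw [segment_eq_image']
    rcases (hs.trans hst).eq_or_lt with h | h
    · have : s = 0 := by linarith
      exact ⟨0, ⟨le_rfl, zero_le_one⟩, by simp [this]⟩
    · refine ⟨s / t, ⟨by positivity, (div_le_one h).mpr hst⟩, ?_⟩
      simp only [add_sub_cancel_left, smul_smul, div_mul_cancel₀ _ h.ne']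
  rw [hb, hb']
  rcases le_total c c' with h | h
  · exact Or.inl (key2 _ _ hc h)
  · exact Or.inr (key2 _ _ hc' h)

namespace FaceChart

variable {F : Set X} {k : X → ℝ × ℝ} {A : Finset (ℝ × ℝ)}

theorem mem_face (C : FaceChart F k A) {x : X} (hx : x ∈ closure F)
    (hk : k x ∈ interior (convexHull ℝ (A : Set (ℝ × ℝ)))) : x ∈ F := by
  rw [← C.image_face] at hk
  obtain ⟨y, hy, hyx⟩ := hk
  rwa [← C.inj (subset_closure hy) hx hyx]

theorem radial (C : FaceChart F k A) {w x y : X} (hw : w ∈ closure F) (hx : x ∈ F)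
    (hy : Btw w y x) (hne : y ≠ w) : y ∈ F := by
  have hx' := subset_closure hx
  have hy' := C.conv w hw x hx' y hy
  apply C.mem_face hy'
  have h := (C.btw w hw y hy' x hx').mp hy
  rw [segment_eq_image'] at h
  obtain ⟨t, ht, hty⟩ := h
  simp only at hty
  have ht0 : 0 < t := by
    rcases ht.1.eq_or_lt with h0 | h0
    · exfalso; apply hne; apply C.inj hy' hw; rw [← hty, ← h0]; simp
    · exact h0
  rw [← hty]
  refine (convex_convexHull ℝ _).add_smul_sub_mem_interior ?_ ?_ ⟨ht0, ht.2⟩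
  · rw [← C.image]; exact mem_image_of_mem k hw
  · rw [← C.image_face]; exact mem_image_of_mem k hx

theorem nonBranching [CAT0 X] (C : FaceChart F k A) (hF : IsOpen F) : NonBranching F := by
  intro x hx
  obtain ⟨η, hη, hball⟩ := Metric.isOpen_iff.mp hF x hx
  refine ⟨η / 2, by positivity, fun a b b' ha hb hb' hd hle => ?_⟩
  obtain ⟨a', h1, h2⟩ := exists_btw_dist x a (s := min (η / 2) (dist x a))
    (le_min (by positivity) dist_nonneg) (min_le_right _ _)
  have ha' : a' ≠ x := by
    intro h
    rw [h, dist_self] at h2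
    have : 0 < min (η / 2) (dist x a) := lt_min (by positivity) (dist_pos.mpr ha.symm)
    linarith
  have hb1 : Btw a' x b := hb.inner' h1.symm
  have hb2 : Btw a' x b' := hb'.inner' h1.symm
  have mem : ∀ y, dist x y ≤ η / 2 → y ∈ closure F := fun y hy =>
    subset_closure (hball (by rw [mem_ball, dist_comm]; linarith))
  have ma := mem a' (by rw [h2]; exact min_le_left _ _)
  have mb := mem b hle
  have mb' := mem b' (by rw [← hd]; exact hle)
  have mx := subset_closure hx
  have hk : k a' ≠ k x := fun h => ha' (C.inj ma mx h)
  rcases segment_extension_total ((C.btw _ ma _ mx _ mb).mp hb1)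
    ((C.btw _ ma _ mx _ mb').mp hb2) hk with h | h
  · have h3 := (C.btw _ mx _ mb _ mb').mpr h
    unfold Btw at h3
    exact dist_eq_zero.mp (by linarith)
  · have h3 := (C.btw _ mx _ mb' _ mb).mpr h
    unfold Btw at h3
    exact (dist_eq_zero.mp (by linarith)).symm

/-- Rays in a polygon leave it through a face of the polygon avoiding the starting point. -/
theorem exists_exit {A : Finset (ℝ × ℝ)} {u v : ℝ × ℝ}
    (hv : v ∈ convexHull ℝ (A : Set (ℝ × ℝ))) (huv : u ≠ v) :
    ∃ e ∈ convexHull ℝ (A : Set (ℝ × ℝ)), v ∈ segment ℝ u e ∧ ∃ S ⊆ A,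
      e ∈ convexHull ℝ (S : Set (ℝ × ℝ)) ∧ u ∉ convexHull ℝ (S : Set (ℝ × ℝ)) := by
  classical
  have hcomp : IsCompact (convexHull ℝ (A : Set (ℝ × ℝ))) :=
    (Finset.finite_toSet _).isCompact_convexHull ℝ
  set φ : ℝ → ℝ × ℝ := fun t => u + t • (v - u) with hφ
  have hφc : Continuous φ := by fun_prop
  have hvu : v - u ≠ 0 := sub_ne_zero.mpr huv.symm
  set T := {t : ℝ | 1 ≤ t ∧ φ t ∈ convexHull ℝ (A : Set (ℝ × ℝ))} with hT
  have hTc : IsClosed T := isClosed_Ici.inter (hcomp.isClosed.preimage hφc)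
  have h1T : (1 : ℝ) ∈ T := ⟨le_rfl, by simpa [hφ] using hv⟩
  have hTb : BddAbove T := by
    obtain ⟨R, hR⟩ := hcomp.isBounded.exists_norm_le
    refine ⟨(R + ‖u‖) / ‖v - u‖, fun t ht => ?_⟩
    rw [le_div_iff₀ (norm_pos_iff.mpr hvu)]
    have h1 := hR _ ht.2
    have h2 : ‖t • (v - u)‖ ≤ ‖φ t‖ + ‖u‖ := by
      have : t • (v - u) = φ t - u := by simp [hφ]
      rw [this]; exact norm_sub_le _ _
    rw [norm_smul, Real.norm_eq_abs, abs_of_nonneg (by linarith [ht.1])] at h2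
    linarith
  have hmax : sSup T ∈ T := hTc.csSup_mem ⟨1, h1T⟩ hTb
  set t := sSup T with ht
  have ht1 : 1 ≤ t := hmax.1
  refine ⟨φ t, hmax.2, ?_, ?_⟩
  · rw [segment_eq_image']
    refine ⟨t⁻¹, ⟨by positivity, inv_le_one_of_one_le₀ ht1⟩, ?_⟩
    simp only [hφ, add_sub_cancel_left, smul_smul, inv_mul_cancel₀ (by linarith : t ≠ 0), one_smul,
      add_sub_cancel]
  · obtain ⟨l, hl0, hl1, hle⟩ := Finset.mem_convexHull'.mp hmax.2
    refine ⟨A.filter (fun a => 0 < l a), Finset.filter_subset _ _, ?_, ?_⟩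
    · rw [Finset.mem_convexHull']
      refine ⟨l, fun y hy => (Finset.mem_filter.mp hy).2.le, ?_, ?_⟩
      · rw [← hl1]
        refine Finset.sum_subset (Finset.filter_subset _ _) fun y hy hy' => ?_
        rw [Finset.mem_filter, not_and] at hy'
        exact le_antisymm (not_lt.mp (hy' hy)) (hl0 y hy)
      · rw [← hle]
        refine Finset.sum_subset (Finset.filter_subset _ _) fun y hy hy' => ?_
        rw [Finset.mem_filter, not_and] at hy'
        rw [le_antisymm (not_lt.mp (hy' hy)) (hl0 y hy), zero_smul]
    · intro hu'
      obtain ⟨m, hm0, hm1, hme⟩ := Finset.mem_convexHull'.mp hu'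
      set S := A.filter (fun a => 0 < l a) with hS
      have hSne : S.Nonempty := by
        rw [Finset.nonempty_iff_ne_empty]
        intro h0; rw [h0] at hm1; simp at hm1
      obtain ⟨a0, ha0, hmin⟩ := S.exists_min_image l hSne
      have hl0' : 0 < l a0 := (Finset.mem_filter.mp ha0).2
      have hmle : ∀ y ∈ S, m y ≤ 1 := fun y hy => by
        rw [← hm1]; exact Finset.single_le_sum hm0 hy
      have hsumS : ∑ y ∈ S, l y = 1 := by
        rw [← hl1]
        refine Finset.sum_subset (Finset.filter_subset _ _) fun y hy hy' => ?_
        rw [Finset.mem_filter, not_and] at hy'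
        exact le_antisymm (not_lt.mp (hy' hy)) (hl0 y hy)
      have hsumS' : ∑ y ∈ S, l y • y = φ t := by
        rw [← hle]
        refine Finset.sum_subset (Finset.filter_subset _ _) fun y hy hy' => ?_
        rw [Finset.mem_filter, not_and] at hy'
        rw [le_antisymm (not_lt.mp (hy' hy)) (hl0 y hy), zero_smul]
      set c := l a0 with hc
      have hmem : φ t + c • (φ t - u) ∈ convexHull ℝ (S : Set (ℝ × ℝ)) := by
        rw [Finset.mem_convexHull']
        refine ⟨fun y => l y + c * (l y - m y), fun y hy => ?_, ?_, ?_⟩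
        · have h1 := hmin y hy
          have h2 := hmle y hy
          have h3 : c * m y ≤ c * 1 := mul_le_mul_of_nonneg_left h2 hl0'.le
          have h4 : 0 ≤ c * l y := mul_nonneg hl0'.le (by linarith)
          linarith
        · rw [Finset.sum_add_distrib, ← Finset.mul_sum, Finset.sum_sub_distrib, hsumS, hm1]; ring
        · simp only [add_smul, mul_smul, sub_smul]
          rw [Finset.sum_add_distrib, ← Finset.smul_sum, Finset.sum_sub_distrib, hsumS', hme]
      have hTt : t + c * t ∈ T := by
        refine ⟨by nlinarith, ?_⟩
        have : φ (t + c * t) = φ t + c • (φ t - u) := by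
          simp only [hφ, add_smul, mul_smul, add_sub_cancel_left]; abel
        rw [this]
        exact convexHull_mono (Finset.coe_subset.mpr (Finset.filter_subset _ _)) hmem
      have := le_csSup hTb hTt
      have h5 : 0 < c * t := mul_pos hl0' (by linarith)
      linarith

theorem exists_far (C : FaceChart F k A) {w : X} (hw : w ∈ closure F) :
    ∃ δ > 0, ∀ x ∈ closure F, x ≠ w → ∃ e ∈ closure F, Btw w x e ∧ δ ≤ dist w e := by
  classical
  have h1 : ∀ S : Finset (ℝ × ℝ), ∃ δ > 0, k w ∉ convexHull ℝ (S : Set (ℝ × ℝ)) →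
      ∀ e ∈ closure F, k e ∈ convexHull ℝ (S : Set (ℝ × ℝ)) → δ ≤ dist w e := by
    intro S
    by_cases hS : k w ∈ convexHull ℝ (S : Set (ℝ × ℝ))
    · exact ⟨1, one_pos, fun h => absurd hS h⟩
    · have hSc : IsClosed (convexHull ℝ (S : Set (ℝ × ℝ))) :=
        ((Finset.finite_toSet _).isCompact_convexHull ℝ).isClosed
      have hcl : IsClosed (closure F ∩ k ⁻¹' convexHull ℝ (S : Set (ℝ × ℝ))) :=
        C.cont.preimage_isClosed_of_isClosed isClosed_closure hSc
      obtain ⟨δ, hδ, hb⟩ := Metric.isOpen_iff.mp hcl.isOpen_compl w (fun h => hS h.2)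
      refine ⟨δ, hδ, fun _ e he hek => ?_⟩
      by_contra hlt
      exact hb (show e ∈ ball w δ by rw [mem_ball, dist_comm]; exact not_le.mp hlt) ⟨he, hek⟩
  choose δ hδ hδ' using h1
  obtain ⟨S0, hS0, hmin⟩ := A.powerset.exists_min_image δ ⟨∅, by simp⟩
  refine ⟨δ S0, hδ S0, fun x hx hne => ?_⟩
  obtain ⟨e, he, hve, S, hSA, heS, huS⟩ := exists_exit (A := A) (u := k w) (v := k x)
    (by rw [← C.image]; exact mem_image_of_mem k hx) (fun h => hne (C.inj hx hw h.symm))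
  rw [← C.image] at he
  obtain ⟨y, hy, rfl⟩ := he
  exact ⟨y, hy, (C.btw _ hw _ hx _ hy).mpr hve,
    (hmin S (Finset.mem_powerset.mpr hSA)).trans (hδ' S huS y hy heS)⟩

end FaceChart

variable {X : Type*} [MetricSpace X]

/-- An open edge, parametrized by arc length. -/
structure EdgeChart (e : Set X) (f : ℝ → X) (L : ℝ) : Prop where
  pos : 0 < L
  dist_eq : ∀ s ∈ Icc 0 L, ∀ t ∈ Icc 0 L, dist (f s) (f t) = |s - t|
  image : f '' Ioo 0 L = e

namespace EdgeChart

variable {e : Set X} {f : ℝ → X} {L : ℝ}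

theorem continuousOn (C : EdgeChart e f L) : ContinuousOn f (Icc 0 L) := by
  have : LipschitzOnWith 1 f (Icc 0 L) := LipschitzOnWith.of_dist_le_mul fun s hs t ht => by
    rw [C.dist_eq s hs t ht]; simp [Real.dist_eq]
  exact this.continuousOn

theorem closure_eq (C : EdgeChart e f L) : closure e = f '' Icc 0 L := by
  apply Subset.antisymm
  · apply closure_minimal
    · rw [← C.image]; exact image_mono Ioo_subset_Icc_self
    · exact (isCompact_Icc.image_of_continuousOn C.continuousOn).isClosed
  · rw [← C.image, ← closure_Ioo C.pos.ne]
    exact ContinuousOn.image_closure (by rw [closure_Ioo C.pos.ne]; exact C.continuousOn)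

theorem isCompact_closure (C : EdgeChart e f L) : IsCompact (closure e) := by
  rw [C.closure_eq]; exact isCompact_Icc.image_of_continuousOn C.continuousOn

theorem injOn (C : EdgeChart e f L) : InjOn f (Icc 0 L) := by
  intro s hs t ht h
  have := C.dist_eq s hs t ht
  rw [h, dist_self] at this
  linarith [abs_eq_zero.mp this.symm]

theorem endpoint_notMem (C : EdgeChart e f L) {t : ℝ} (ht : t ∈ Icc 0 L) (h : t = 0 ∨ t = L) :
    f t ∈ closure e \ e := by
  refine ⟨by rw [C.closure_eq]; exact mem_image_of_mem f ht, fun hm => ?_⟩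
  rw [← C.image] at hm
  obtain ⟨s, hs, hst⟩ := hm
  have := C.injOn (Ioo_subset_Icc_self hs) ht hst
  rcases h with h | h <;> [linarith [hs.1]; linarith [hs.2]]

theorem sphere_finite (C : EdgeChart e f L) {w : X} (hw : w ∈ closure e) (δ : ℝ) :
    {x | x ∈ closure e ∧ dist w x = δ}.Finite := by
  rw [C.closure_eq] at *
  obtain ⟨t, ht, rfl⟩ := hw
  refine Set.Finite.subset (Set.toFinite {f (t + δ), f (t - δ)}) ?_
  rintro _ ⟨⟨s, hs, rfl⟩, hd⟩
  rw [C.dist_eq t ht s hs] at hd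
  rcases abs_choice (t - s) with h | h
  · right; rw [mem_singleton_iff]; congr 1; linarith
  · left; congr 1; linarith

theorem ext_unique (C : EdgeChart e f L) {w x ξ ξ' : X} (hw : w ∈ closure e) (hx : x ∈ closure e)
    (h1 : ξ ∈ closure e) (h2 : ξ' ∈ closure e) (hne : x ≠ w) (hb : Btw w x ξ) (hb' : Btw w x ξ')
    (hd : dist w ξ = dist w ξ') : ξ = ξ' := by
  rw [C.closure_eq] at *
  obtain ⟨t0, m0, rfl⟩ := hw
  obtain ⟨t1, m1, rfl⟩ := hx
  obtain ⟨t2, m2, rfl⟩ := h1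
  obtain ⟨t3, m3, rfl⟩ := h2
  unfold Btw at hb hb'
  rw [C.dist_eq _ m0 _ m1, C.dist_eq _ m1 _ m2, C.dist_eq _ m0 _ m2] at hb
  rw [C.dist_eq _ m0 _ m1, C.dist_eq _ m1 _ m3, C.dist_eq _ m0 _ m3] at hb'
  rw [C.dist_eq _ m0 _ m2, C.dist_eq _ m0 _ m3] at hd
  have ht : t1 ≠ t0 := fun h => hne (by rw [h])
  congr 1
  rcases lt_or_gt_of_ne ht with h | h
  · rw [abs_of_pos (by linarith)] at hb hb'
    have a2 : t2 ≤ t1 := by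
      by_contra hc
      rw [abs_of_nonpos (by linarith : t1 - t2 ≤ 0)] at hb
      rcases abs_cases (t0 - t2) with h' | h' <;> linarith
    have a3 : t3 ≤ t1 := by
      by_contra hc
      rw [abs_of_nonpos (by linarith : t1 - t3 ≤ 0)] at hb'
      rcases abs_cases (t0 - t3) with h' | h' <;> linarith
    rw [abs_of_pos (by linarith), abs_of_pos (by linarith)] at hd
    linarith
  · rw [abs_of_neg (by linarith)] at hb hb'
    have a2 : t1 ≤ t2 := by
      by_contra hc
      rw [abs_of_nonneg (by linarith : 0 ≤ t1 - t2)] at hb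
      rcases abs_cases (t0 - t2) with h' | h' <;> linarith
    have a3 : t1 ≤ t3 := by
      by_contra hc
      rw [abs_of_nonneg (by linarith : 0 ≤ t1 - t3)] at hb'
      rcases abs_cases (t0 - t3) with h' | h' <;> linarith
    rw [abs_of_neg (by linarith), abs_of_neg (by linarith)] at hd
    linarith

theorem exists_ext (C : EdgeChart e f L) {w x : X} {δ : ℝ} (hw : w ∈ closure e)
    (hx : x ∈ closure e) (hne : x ≠ w) (hδ : dist w x ≤ δ)
    (hend : ∀ y ∈ closure e \ e, y ≠ w → δ < dist w y) : ∃ ξ, dist w ξ = δ ∧ Btw w x ξ := by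
  have hx' := hx
  have hw' := hw
  rw [C.closure_eq] at hw hx
  obtain ⟨t0, m0, rfl⟩ := hw
  obtain ⟨t1, m1, rfl⟩ := hx
  have ht : t1 ≠ t0 := fun h => hne (by rw [h])
  rw [C.dist_eq _ m0 _ m1] at hδ
  have mL : L ∈ Icc 0 L := ⟨C.pos.le, le_rfl⟩
  have mZ : (0 : ℝ) ∈ Icc 0 L := ⟨le_rfl, C.pos.le⟩
  unfold Btw
  rcases lt_or_gt_of_ne ht with h | h
  · have e0 := hend (f 0) (C.endpoint_notMem mZ (Or.inl rfl)) fun he => by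
      have := C.injOn mZ m0 he
      linarith [m1.1]
    rw [C.dist_eq _ m0 _ mZ, sub_zero, abs_of_nonneg m0.1] at e0
    rw [abs_of_pos (by linarith)] at hδ
    have m2 : t0 - δ ∈ Icc 0 L := ⟨by linarith, by linarith [m0.2]⟩
    refine ⟨f (t0 - δ), ?_, ?_⟩
    · rw [C.dist_eq _ m0 _ m2, abs_of_nonneg (by linarith)]; ring
    · rw [C.dist_eq _ m0 _ m2, C.dist_eq _ m0 _ m1, C.dist_eq _ m1 _ m2, abs_of_nonneg (by linarith),
        abs_of_nonneg (by linarith), abs_of_nonneg (by linarith)]; ring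
  · have e0 := hend (f L) (C.endpoint_notMem mL (Or.inr rfl)) fun he => by
      have := C.injOn mL m0 he
      linarith [m1.2]
    rw [C.dist_eq _ m0 _ mL, abs_of_nonpos (by linarith [m0.2])] at e0
    rw [abs_of_neg (by linarith)] at hδ
    have m2 : t0 + δ ∈ Icc 0 L := ⟨by linarith [m0.1], by linarith⟩
    refine ⟨f (t0 + δ), ?_, ?_⟩
    · rw [C.dist_eq _ m0 _ m2, abs_of_nonpos (by linarith)]; ring
    · rw [C.dist_eq _ m0 _ m2, C.dist_eq _ m0 _ m1, C.dist_eq _ m1 _ m2, abs_of_nonpos (by linarith),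
        abs_of_nonpos (by linarith), abs_of_nonpos (by linarith)]; ring

end EdgeChart

namespace PolyComplex2

variable {κ : ℝ}

theorem exists_edgeChart (PC : PolyComplex2 κ X) {e : Set X} (he : e ∈ PC.edges) :
    ∃ f L, EdgeChart e f L := by
  obtain ⟨f, L, hL, ⟨_, hd⟩, him⟩ := PC.edge_geodesic e he
  exact ⟨f, L, hL, hd, him⟩

/-- A radius below which only the cells adjacent to `w` are visible. -/
structure GoodRadius (PC : PolyComplex2 κ X) (w : X) (C : Set (Set X)) (δ : ℝ) : Prop where
  vertex : ∀ v ∈ PC.vertices, v ≠ w → δ < dist w v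
  mem : ∀ c, c ∈ PC.faces ∨ c ∈ PC.edges → (c ∩ closedBall w δ).Nonempty → c ∈ C
  adj : ∀ c ∈ C, (c ∩ closedBall w δ).Nonempty → w ∈ closure c
  far : ∀ F ∈ C, F ∈ PC.faces → w ∈ closure F → ∀ x ∈ closure F, x ≠ w →
    ∃ e ∈ closure F, Btw w x e ∧ δ < dist w e

theorem GoodRadius.mono {PC : PolyComplex2 κ X} {w : X} {C : Set (Set X)} {δ δ' : ℝ}
    (h : GoodRadius PC w C δ) (hle : δ' ≤ δ) : GoodRadius PC w C δ' := by
  have hs : closedBall w δ' ⊆ closedBall w δ := closedBall_subset_closedBall hle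
  refine ⟨fun v hv hne => hle.trans_lt (h.vertex v hv hne),
    fun c hc hn => h.mem c hc (hn.mono (inter_subset_inter_right c hs)),
    fun c hc hn => h.adj c hc (hn.mono (inter_subset_inter_right c hs)),
    fun F hF hF' hw x hx hne => ?_⟩
  obtain ⟨e, he, hb, hd⟩ := h.far F hF hF' hw x hx hne
  exact ⟨e, he, hb, hle.trans_lt hd⟩

theorem exists_goodRadius [CAT0 X] (hκ : κ ≤ 0) (PC : PolyComplex2 κ X) (w : X) :
    ∃ C : Set (Set X), C.Finite ∧ (∀ c ∈ C, c ∈ PC.faces ∨ c ∈ PC.edges) ∧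
      ∃ δ > 0, GoodRadius PC w C δ := by
  obtain ⟨ε, hε, hfin, hvfin⟩ := PC.locally_finite w
  set C := {c | (c ∈ PC.faces ∨ c ∈ PC.edges) ∧ (c ∩ ball w ε).Nonempty} with hC
  refine ⟨C, hfin, fun c hc => hc.1, ?_⟩
  have hmono : ∀ (a : ℝ), 0 < a → ∀ᶠ δ in nhdsWithin (0 : ℝ) (Ioi 0), δ < a := fun a ha =>
    mem_nhdsWithin_of_mem_nhds (Iio_mem_nhds ha)
  have h1 : ∀ᶠ δ in nhdsWithin (0 : ℝ) (Ioi 0), ∀ v ∈ PC.vertices ∩ ball w ε, v ≠ w →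
      δ < dist w v := by
    rw [eventually_all_finite hvfin]
    intro v _
    by_cases hv : v = w
    · exact Eventually.of_forall fun δ h => absurd hv h
    · filter_upwards [hmono (dist w v) (dist_pos.mpr (Ne.symm hv))] with δ h _ using h
  have h2 : ∀ᶠ δ in nhdsWithin (0 : ℝ) (Ioi 0), ∀ c ∈ C, (c ∩ closedBall w δ).Nonempty →
      w ∈ closure c := by
    rw [eventually_all_finite hfin]
    intro c _
    by_cases hw : w ∈ closure c
    · exact Eventually.of_forall fun _ _ => hw
    · obtain ⟨a, ha, hb⟩ := Metric.isOpen_iff.mp isClosed_closure.isOpen_compl w hw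
      filter_upwards [hmono a ha] with δ hδ ⟨x, hx, hx'⟩
      exact absurd (subset_closure hx) (hb (closedBall_subset_ball hδ hx'))
  have h3 : ∀ᶠ δ in nhdsWithin (0 : ℝ) (Ioi 0), ∀ F ∈ C, F ∈ PC.faces → w ∈ closure F →
      ∀ x ∈ closure F, x ≠ w → ∃ e ∈ closure F, Btw w x e ∧ δ < dist w e := by
    rw [eventually_all_finite hfin]
    intro F _
    by_cases hF : F ∈ PC.faces ∧ w ∈ closure F
    · obtain ⟨k, A, ch⟩ := exists_faceChart hκ PC hF.1
      obtain ⟨a, ha, hfar⟩ := ch.exists_far hF.2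
      filter_upwards [hmono a ha] with δ hδ _ _ x hx hne
      obtain ⟨e, he, hb, hd⟩ := hfar x hx hne
      exact ⟨e, he, hb, hδ.trans_le hd⟩
    · exact Eventually.of_forall fun _ h1 h2 => absurd ⟨h1, h2⟩ hF
  have h0 : ∀ᶠ δ in nhdsWithin (0 : ℝ) (Ioi 0), δ ∈ Ioi (0 : ℝ) := self_mem_nhdsWithin
  obtain ⟨δ, hδ, hδε, g1, g2, g3⟩ :=
    (h0.and ((hmono ε hε).and (h1.and (h2.and h3)))).exists
  refine ⟨δ, hδ, ⟨fun v hv hne => ?_, fun c hc hn => ⟨hc, hn.mono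
    (inter_subset_inter_right c (closedBall_subset_ball hδε))⟩, g2, g3⟩⟩
  by_cases hvb : v ∈ ball w ε
  · exact g1 v ⟨hv, hvb⟩ hne
  · rw [mem_ball, dist_comm, not_lt] at hvb; linarith

theorem mem_cell (PC : PolyComplex2 κ X) (x : X) (hx : x ∉ PC.vertices) :
    (∃ F ∈ PC.faces, x ∈ F) ∨ (∃ e ∈ PC.edges, x ∈ e) := by
  have : x ∈ ⋃₀ PC.faces ∪ ⋃₀ PC.edges ∪ PC.vertices := by rw [PC.cover]; trivial
  rcases this with (h | h) | h
  · exact Or.inl h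
  · exact Or.inr h
  · exact absurd h hx

theorem nonBranching [CAT0 X] (hκ : κ ≤ 0) (PC : PolyComplex2 κ X) :
    NonBranching (⋃₀ PC.faces) := by
  rintro x ⟨F, hF, hx⟩
  obtain ⟨k, A, ch⟩ := exists_faceChart hκ PC hF
  exact ch.nonBranching (PC.faces_open F hF) x hx

theorem localCone [CAT0 X] (hκ : κ ≤ 0) (PC : PolyComplex2 κ X) {w : X} {C : Set (Set X)} {δ : ℝ}
    (hCfin : C.Finite) (hC : ∀ c ∈ C, c ∈ PC.faces ∨ c ∈ PC.edges)
    (G : GoodRadius PC w C δ) (hδ : 0 < δ) : LocalCone (⋃₀ PC.faces) w δ := by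
  have cell : ∀ x, x ≠ w → dist w x ≤ δ →
      (∃ F ∈ PC.faces, x ∈ F ∧ F ∈ C ∧ w ∈ closure F) ∨
      (∃ e ∈ PC.edges, x ∈ e ∧ e ∈ C ∧ w ∈ closure e) := by
    intro x hne hd
    have hb : x ∈ closedBall w δ := by rw [mem_closedBall, dist_comm]; exact hd
    have hv : x ∉ PC.vertices := fun hv => by linarith [G.vertex x hv hne]
    rcases PC.mem_cell x hv with ⟨F, hF, hx⟩ | ⟨e, he, hx⟩
    · have hm := G.mem F (Or.inl hF) ⟨x, hx, hb⟩
      exact Or.inl ⟨F, hF, hx, hm, G.adj F hm ⟨x, hx, hb⟩⟩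
    · have hm := G.mem e (Or.inr he) ⟨x, hx, hb⟩
      exact Or.inr ⟨e, he, hx, hm, G.adj e hm ⟨x, hx, hb⟩⟩
  have radialF : ∀ F ∈ PC.faces, ∀ x ∈ F, dist w x ≤ δ → ∀ y, y ≠ w → Btw w y x → y ∈ F := by
    intro F hF x hx hd y hy hb
    obtain ⟨k, A, ch⟩ := exists_faceChart hκ PC hF
    have hn : (F ∩ closedBall w δ).Nonempty :=
      ⟨x, hx, by rw [mem_closedBall, dist_comm]; exact hd⟩
    exact ch.radial (G.adj F (G.mem F (Or.inl hF) hn) hn) hx hb hy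
  have compactC : ∀ c ∈ C, IsCompact (closure c) := by
    intro c hc
    rcases hC c hc with h | h
    · obtain ⟨k, A, ch⟩ := exists_faceChart hκ PC h
      exact ch.compact
    · obtain ⟨f, L, ch⟩ := PC.exists_edgeChart h
      exact ch.isCompact_closure
  have sing : {x | dist w x = δ ∧ x ∉ ⋃₀ PC.faces}.Finite := by
    have : (⋃ e ∈ C, {x | e ∈ PC.edges ∧ w ∈ closure e ∧ x ∈ closure e ∧ dist w x = δ}).Finite := by
      refine hCfin.biUnion fun e _ => ?_
      by_cases he : e ∈ PC.edges ∧ w ∈ closure e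
      · obtain ⟨f, L, ch⟩ := PC.exists_edgeChart he.1
        exact (ch.sphere_finite he.2 δ).subset fun x hx => hx.2.2
      · exact Set.finite_empty.subset fun x hx => he ⟨hx.1, hx.2.1⟩
    refine this.subset ?_
    rintro x ⟨hx, hxO⟩
    have hne : x ≠ w := by rintro rfl; rw [dist_self] at hx; linarith
    rcases cell x hne hx.le with ⟨F, hF, hxF, -⟩ | ⟨e, he, hxe, heC, hwe⟩
    · exact absurd ⟨F, hF, hxF⟩ hxO
    · exact mem_biUnion heC ⟨he, hwe, subset_closure hxe, hx⟩
  refine ⟨hδ, ?_, ?_, ?_, ?_, sing, ?_⟩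
  · have hK : IsCompact ({w} ∪ ⋃ c ∈ C, closure c) :=
      isCompact_singleton.union (hCfin.isCompact_biUnion compactC)
    refine hK.of_isClosed_subset isClosed_closedBall fun x hx => ?_
    rw [mem_closedBall, dist_comm] at hx
    by_cases hne : x = w
    · exact Or.inl hne
    · rcases cell x hne hx with ⟨F, hF, hxF, hFC, -⟩ | ⟨e, he, hxe, heC, hwe⟩
      · exact Or.inr (mem_biUnion hFC (subset_closure hxF))
      · exact Or.inr (mem_biUnion heC (subset_closure hxe))
  · intro x hne hd
    rcases cell x hne hd with ⟨F, hF, hxF, hFC, hwF⟩ | ⟨e, he, hxe, heC, hwe⟩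
    · obtain ⟨y, hy, hb, hdy⟩ := G.far F hFC hF hwF x (subset_closure hxF) hne
      obtain ⟨ξ, h1, h2⟩ := exists_btw_dist w y hδ.le hdy.le
      exact ⟨ξ, h2, hb.order h1 (by rw [h2]; exact hd)⟩
    · obtain ⟨f, L, ch⟩ := PC.exists_edgeChart he
      exact ch.exists_ext hwe (subset_closure hxe) hne hd fun y hy hyw =>
        G.vertex y (PC.edge_closure e he hy) hyw
  · intro x ξ ξ' hne hb hb' hd hd'
    have hdx : dist w x ≤ δ := by rw [← hd]; exact hb.left_le
    have hwx : ∀ ζ, dist w ζ = δ → Btw w x ζ → ∀ y, Btw x y ζ → y ≠ w ∧ dist w y ≤ δ := by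
      intro ζ hζ hbζ y hy
      refine ⟨?_, by rw [← hζ]; exact (hbζ.outer hy).left_le⟩
      rintro rfl
      exact hne (hbζ.inner hy).eq_of_same
    have hcell : (∃ F ∈ PC.faces, x ∈ F ∧ F ∈ C ∧ w ∈ closure F) ∨
        (x ∉ ⋃₀ PC.faces ∧ ∃ e ∈ PC.edges, x ∈ e ∧ e ∈ C ∧ w ∈ closure e) := by
      by_cases hxO : x ∈ ⋃₀ PC.faces
      · obtain ⟨F, hF, hxF⟩ := hxO
        have hn : (F ∩ closedBall w δ).Nonempty :=
          ⟨x, hxF, by rw [mem_closedBall, dist_comm]; exact hdx⟩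
        have hm := G.mem F (Or.inl hF) hn
        exact Or.inl ⟨F, hF, hxF, hm, G.adj F hm hn⟩
      · exact (cell x hne hdx).imp id fun h => ⟨hxO, h⟩
    rcases hcell with ⟨F, hF, hxF, hFC, hwF⟩ | ⟨hxO, e, he, hxe, heC, hwe⟩
    · obtain ⟨k, A, ch⟩ := exists_faceChart hκ PC hF
      obtain ⟨y, hy, hby, hdy⟩ := G.far F hFC hF hwF x (subset_closure hxF) hne
      obtain ⟨ζ, h1, h2⟩ := exists_btw_dist w y hδ.le hdy.le
      have hbζ : Btw w x ζ := hby.order h1 (by rw [h2]; exact hdx)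
      have hζy : ζ ≠ y := by rintro rfl; linarith
      have hbyζ : Btw x ζ y := h1.inner' hbζ
      have hζF : ζ ∈ F := ch.radial hy hxF hbyζ.symm hζy
      have hs : ∀ z, Btw x z ζ → z ∈ ⋃₀ PC.faces := fun z hz =>
        ⟨F, hF, radialF F hF ζ hζF h2.le z (hwx ζ h2 hbζ z hz).1 (hbζ.outer hz)⟩
      have nb := PC.nonBranching hκ
      rw [← nb.along hne.symm hbζ hb (by rw [h2, hd]) hs,
        nb.along hne.symm hbζ hb' (by rw [h2, hd']) hs]
    · obtain ⟨f, L, ch⟩ := PC.exists_edgeChart he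
      have hin : ∀ ζ, dist w ζ = δ → Btw w x ζ → ζ ∈ closure e := by
        intro ζ hζ hbζ
        have hcl : IsClosed (⋃ c ∈ {c | c ∈ C ∧ c ∈ PC.edges ∧ c ≠ e}, closure c) :=
          (hCfin.subset fun c hc => hc.1).isClosed_biUnion fun c _ => isClosed_closure
        have hpre := isPreconnected_closed_iff.mp (isPreconnected_seg x ζ) (closure e) _
          isClosed_closure hcl
        have noface : ∀ y, Btw x y ζ → y ∉ ⋃₀ PC.faces := by
          rintro y hy ⟨F, hF, hyF⟩
          have hxF := radialF F hF y hyF (hwx ζ hζ hbζ y hy).2 x hne (hbζ.inner hy)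
          exact hxO ⟨F, hF, hxF⟩
        have inedge : ∀ y, Btw x y ζ → ∃ c ∈ PC.edges, y ∈ c ∧ c ∈ C := by
          intro y hy
          obtain ⟨h1, h2⟩ := hwx ζ hζ hbζ y hy
          rcases cell y h1 h2 with ⟨F, hF, hyF, -⟩ | ⟨c, hc, hyc, hcC, -⟩
          · exact absurd ⟨F, hF, hyF⟩ (noface y hy)
          · exact ⟨c, hc, hyc, hcC⟩
        by_contra hcon
        have hsub : seg x ζ ⊆ closure e ∪
            ⋃ c ∈ {c | c ∈ C ∧ c ∈ PC.edges ∧ c ≠ e}, closure c := by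
          intro y hy
          obtain ⟨c, hc, hyc, hcC⟩ := inedge y hy
          by_cases hce : c = e
          · exact Or.inl (by rw [← hce]; exact subset_closure hyc)
          · exact Or.inr (mem_biUnion (show c ∈ {c | c ∈ C ∧ c ∈ PC.edges ∧ c ≠ e} from
              ⟨hcC, hc, hce⟩) (subset_closure hyc))
        have hζ' := (hsub (right_mem_seg x ζ)).resolve_left hcon
        obtain ⟨y, hy, hy1, hy2⟩ := hpre hsub ⟨x, left_mem_seg x ζ, subset_closure hxe⟩
          ⟨ζ, right_mem_seg x ζ, hζ'⟩
        obtain ⟨h1, h2⟩ := hwx ζ hζ hbζ y hy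
        have hv : y ∉ PC.vertices := fun hv => by linarith [G.vertex y hv h1]
        have hye : y ∈ e := by
          by_contra h; exact hv (PC.edge_closure e he ⟨hy1, h⟩)
        simp only [mem_iUnion] at hy2
        obtain ⟨c, ⟨-, hc, hce⟩, hyc⟩ := hy2
        have hyc' : y ∈ c := by
          by_contra h; exact hv (PC.edge_closure c hc ⟨hyc, h⟩)
        have := PC.cells_disjoint c (Or.inr hc) e (Or.inr he) hce
        have h3 : y ∈ c ∩ e := ⟨hyc', hye⟩
        rw [this] at h3
        exact h3
      exact ch.ext_unique hwe (subset_closure hxe) (hin ξ hd hb) (hin ξ' hd' hb') hne hb hb'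
        (by rw [hd, hd'])
  · intro ξ hξ ε hε
    have hne : w ≠ ξ := by rintro rfl; rw [dist_self] at hξ; linarith
    have h1 : ∀ᶠ r in nhdsWithin (0 : ℝ) (Ioi 0), ∀ c ∈ C, ξ ∉ closure c →
        ∀ x ∈ closure c, dist ξ x ≠ r := by
      rw [eventually_all_finite hCfin]
      intro c _
      by_cases hw : ξ ∈ closure c
      · exact Eventually.of_forall fun _ h => absurd hw h
      · obtain ⟨a, ha, hb⟩ := Metric.isOpen_iff.mp isClosed_closure.isOpen_compl ξ hw
        filter_upwards [mem_nhdsWithin_of_mem_nhds (Iio_mem_nhds ha)] with r hr _ x hx hd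
        exact hb (show x ∈ ball ξ a by rw [mem_ball, dist_comm, hd]; exact hr) hx
    have h0 : ∀ᶠ r in nhdsWithin (0 : ℝ) (Ioi 0), r ∈ Ioi (0 : ℝ) := self_mem_nhdsWithin
    have hε' : ∀ᶠ r in nhdsWithin (0 : ℝ) (Ioi 0), r < ε :=
      mem_nhdsWithin_of_mem_nhds (Iio_mem_nhds hε)
    obtain ⟨r, hr, hrε, g1⟩ := (h0.and (hε'.and h1)).exists
    refine ⟨r, hr, hrε, ?_⟩
    have h2 : (⋃ F ∈ C, {x | F ∈ PC.faces ∧ w ∈ closure F ∧ ξ ∈ closure F ∧ x ∈ closure F ∧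
        dist w x = δ ∧ dist ξ x = r}).Finite := by
      refine hCfin.biUnion fun F _ => ?_
      by_cases hF : F ∈ PC.faces ∧ w ∈ closure F ∧ ξ ∈ closure F
      · obtain ⟨k, A, ch⟩ := exists_faceChart hκ PC hF.1
        exact (ch.circ w hF.2.1 ξ hF.2.2 hne δ r).subset fun x hx => hx.2.2.2
      · exact Set.finite_empty.subset fun x hx => hF ⟨hx.1, hx.2.1, hx.2.2.1⟩
    refine (sing.union h2).subset ?_
    rintro x ⟨hx, hxr⟩
    by_cases hxO : x ∈ ⋃₀ PC.faces
    · right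
      obtain ⟨F, hF, hxF⟩ := hxO
      have hn : (F ∩ closedBall w δ).Nonempty :=
        ⟨x, hxF, by rw [mem_closedBall, dist_comm]; exact hx.le⟩
      have hFC := G.mem F (Or.inl hF) hn
      refine mem_biUnion hFC ⟨hF, G.adj F hFC hn, ?_, subset_closure hxF, hx, hxr⟩
      by_contra hξF
      exact g1 F hFC hξF x (subset_closure hxF) hxr
    · exact Or.inl ⟨hx, hxO⟩
  · rintro x ⟨F, hF, hxF⟩ hd y hy hb
    exact ⟨F, hF, radialF F hF x hxF hd y hy hb⟩

theorem twoCx [CAT0 X] (hκ : κ ≤ 0) (PC : PolyComplex2 κ X) : TwoCx (⋃₀ PC.faces) := by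
  refine ⟨isOpen_sUnion PC.faces_open, PC.nonBranching hκ, fun w => ?_⟩
  obtain ⟨C, hfin, hC, δ, hδ, G⟩ := PC.exists_goodRadius hκ w
  exact ⟨δ, hδ, fun δ' h0 hle => PC.localCone hκ hfin hC (G.mono hle) h0⟩

end PolyComplex2

section Log

variable {X : Type*} [MetricSpace X]

/-- The function `m` has a continuous logarithm on `A`. -/
def HasLog {Z : Type*} [TopologicalSpace Z] (m : Z → ℂ) (A : Set Z) : Prop :=
  ∃ θ : Z → ℂ, ContinuousOn θ A ∧ ∀ x ∈ A, Complex.exp (θ x) = m x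

theorem HasLog.congr {Z : Type*} [TopologicalSpace Z] {m m' : Z → ℂ} {A : Set Z} (h : HasLog m A)
    (he : EqOn m' m A) : HasLog m' A := by
  obtain ⟨θ, hc, h⟩ := h
  exact ⟨θ, hc, fun x hx => by rw [h x hx, he hx]⟩

theorem hasLog_const {Z : Type*} [TopologicalSpace Z] {c : ℂ} (hc : c ≠ 0) (A : Set Z) :
    HasLog (fun _ => c) A :=
  ⟨fun _ => Complex.log c, continuousOn_const, fun _ _ => Complex.exp_log hc⟩

theorem hasLog_of_finite {m : X → ℂ} {A : Set X} (hA : A.Finite) (hm : ∀ x ∈ A, m x ≠ 0) :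
    HasLog m A :=
  ⟨fun x => Complex.log (m x), hA.continuousOn _, fun x hx => Complex.exp_log (hm x hx)⟩

theorem HasLog.union {m : X → ℂ} {A B : Set X} (hA : IsClosed A) (hB : IsClosed B)
    (hd : Disjoint A B) (h : HasLog m A) (h' : HasLog m B) : HasLog m (A ∪ B) := by
  classical
  obtain ⟨θ, hc, he⟩ := h
  obtain ⟨θ', hc', he'⟩ := h'
  have hB' : ∀ x ∈ B, x ∉ A := fun x hx hxA => disjoint_left.mp hd hxA hx
  refine ⟨fun x => if x ∈ A then θ x else θ' x, ?_, ?_⟩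
  · refine ContinuousOn.union_of_isClosed ?_ ?_ hA hB
    · exact hc.congr fun x hx => by simp [hx]
    · exact hc'.congr fun x hx => by simp [hB' x hx]
  · rintro x (hx | hx)
    · simp [hx, he x hx]
    · simp [hB' x hx, he' x hx]

theorem norm_one_sub_div_lt {a b : ℂ} (ha : a ≠ 0) (h : ‖b - a‖ < ‖a‖) :
    b / a ∈ Complex.slitPlane := by
  have : b / a = 1 + (b - a) / a := by field_simp; ring
  rw [this]
  apply Complex.mem_slitPlane_of_norm_lt_one
  rw [norm_div, div_lt_one (norm_pos_iff.mpr ha)]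
  exact h

theorem HasLog.of_near {Z : Type*} [TopologicalSpace Z] {f g : Z → ℂ} {A : Set Z} (h : HasLog f A)
    (hf : ContinuousOn f A) (hg : ContinuousOn g A) (hn : ∀ x ∈ A, ‖g x - f x‖ < ‖f x‖) :
    HasLog g A := by
  obtain ⟨θ, hc, he⟩ := h
  have hf0 : ∀ x ∈ A, f x ≠ 0 := fun x hx h => by
    have := hn x hx
    rw [h, norm_zero] at this
    exact absurd this (not_lt.mpr (norm_nonneg _))
  refine ⟨fun x => θ x + Complex.log (g x / f x), ?_, ?_⟩
  · exact hc.add ((hg.div hf hf0).clog fun x hx => norm_one_sub_div_lt (hf0 x hx) (hn x hx))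
  · intro x hx
    have h1 := Complex.slitPlane_ne_zero (norm_one_sub_div_lt (hf0 x hx) (hn x hx))
    rw [Complex.exp_add, he x hx, Complex.exp_log h1]
    field_simp [hf0 x hx]

/-- Subdivision of a nonvanishing homotopy over a compact set. -/
theorem exists_subdivision {A : Set X} (hA : IsCompact A) {h : X → ℝ → ℂ}
    (hc : ContinuousOn (fun q : X × ℝ => h q.1 q.2) (A ×ˢ Icc 0 1))
    (h0 : ∀ x ∈ A, ∀ t ∈ Icc (0 : ℝ) 1, h x t ≠ 0) :
    ∃ n : ℕ, 0 < n ∧ ∀ x ∈ A, ∀ s ∈ Icc (0 : ℝ) 1, ∀ t ∈ Icc (0 : ℝ) 1, |s - t| ≤ 1 / n →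
      ‖h x s - h x t‖ < ‖h x t‖ := by
  have hK : IsCompact (A ×ˢ Icc (0 : ℝ) 1) := hA.prod isCompact_Icc
  by_cases hne : (A ×ˢ Icc (0 : ℝ) 1).Nonempty
  · obtain ⟨q, hq, hmin⟩ := hK.exists_isMinOn hne hc.norm
    have hpos : 0 < ‖h q.1 q.2‖ := norm_pos_iff.mpr (h0 q.1 hq.1 q.2 hq.2)
    have hu := hK.uniformContinuousOn_of_continuous hc
    rw [Metric.uniformContinuousOn_iff] at hu
    obtain ⟨δ, hδ, hu⟩ := hu _ hpos
    obtain ⟨n, hn⟩ := exists_nat_one_div_lt hδ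
    refine ⟨n + 1, n.succ_pos, fun x hx s hs t ht hst => ?_⟩
    have h1 := hu (x, s) ⟨hx, hs⟩ (x, t) ⟨hx, ht⟩ (by
      rw [Prod.dist_eq, dist_self, Real.dist_eq]
      push_cast at hst
      exact max_lt hδ (hst.trans_lt hn))
    rw [dist_eq_norm] at h1
    exact h1.trans_le (hmin (show (x, t) ∈ A ×ˢ Icc (0 : ℝ) 1 from ⟨hx, ht⟩))
  · refine ⟨1, one_pos, fun x hx s hs => absurd ⟨(x, s), hx, hs⟩ hne⟩

theorem HasLog.homotopy {A : Set X} (hA : IsCompact A) {h : X → ℝ → ℂ}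
    (hc : ContinuousOn (fun q : X × ℝ => h q.1 q.2) (A ×ˢ Icc 0 1))
    (h0 : ∀ x ∈ A, ∀ t ∈ Icc (0 : ℝ) 1, h x t ≠ 0) (hl : HasLog (fun x => h x 0) A) :
    HasLog (fun x => h x 1) A := by
  obtain ⟨n, hn, hsub⟩ := exists_subdivision hA hc h0
  have hn' : (0 : ℝ) < n := by exact_mod_cast hn
  have hcs : ∀ t ∈ Icc (0 : ℝ) 1, ContinuousOn (fun x => h x t) A := fun t ht =>
    hc.comp (continuousOn_id.prodMk continuousOn_const) fun x hx => ⟨hx, ht⟩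
  have hmem : ∀ k : ℕ, k ≤ n → (k : ℝ) / n ∈ Icc (0 : ℝ) 1 := fun k hk =>
    ⟨by positivity, by rw [div_le_one hn']; exact_mod_cast hk⟩
  have key : ∀ k : ℕ, k ≤ n → HasLog (fun x => h x ((k : ℝ) / n)) A := by
    intro k
    induction k with
    | zero => intro _; simpa using hl
    | succ k ih =>
      intro hk
      refine (ih (by omega)).of_near (hcs _ (hmem k (by omega))) (hcs _ (hmem _ hk))
        fun x hx => hsub x hx _ (hmem _ hk) _ (hmem k (by omega)) ?_
      rw [← sub_div]; push_cast; rw [add_sub_cancel_left, abs_of_pos (by positivity)]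
  have := key n le_rfl
  rwa [div_self hn'.ne'] at this

theorem exists_continuous_extension {A : Set X} (hA : IsClosed A) {f : X → ℂ}
    (hf : ContinuousOn f A) : ∃ g : X → ℂ, Continuous g ∧ EqOn g f A := by
  obtain ⟨g, hg⟩ := ContinuousMap.exists_restrict_eq hA ⟨A.domRestrict f, hf.domRestrict⟩
  exact ⟨g, g.continuous, fun x hx => by
    exact DFunLike.congr_fun hg ⟨x, hx⟩⟩

/-- One step of the extension of a nonvanishing function over a one-dimensional space. -/
theorem extend_step {B C : Set X} (hB : IsClosed B) (hfin : (B ∩ closure (C \ B)).Finite)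
    {f : X → ℂ} (hf : ContinuousOn f B) (h0 : ∀ x ∈ B, f x ≠ 0) :
    ∃ g : X → ℂ, ContinuousOn g (B ∪ C) ∧ (∀ x ∈ B ∪ C, g x ≠ 0) ∧ EqOn g f B := by
  classical
  obtain ⟨θ, hθ, he⟩ := hasLog_of_finite hfin fun x hx => h0 x hx.1
  obtain ⟨θ', hc', he'⟩ := exists_continuous_extension hfin.isClosed hθ
  refine ⟨fun x => if x ∈ B then f x else Complex.exp (θ' x), ?_, ?_, fun x hx => by simp [hx]⟩
  · have h1 : B ∪ C ⊆ B ∪ closure (C \ B) := by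
      rintro x (hx | hx)
      · exact Or.inl hx
      · by_cases hxB : x ∈ B
        · exact Or.inl hxB
        · exact Or.inr (subset_closure ⟨hx, hxB⟩)
    refine ContinuousOn.mono ?_ h1
    refine ContinuousOn.union_of_isClosed ?_ ?_ hB isClosed_closure
    · exact hf.congr fun x hx => by simp [hx]
    · refine (hc'.cexp.continuousOn (s := closure (C \ B))).congr fun x hx => ?_
      by_cases hxB : x ∈ B
      · simp only [hxB, if_true]
        rw [he' ⟨hxB, hx⟩, he x ⟨hxB, hx⟩]
      · simp [hxB]
  · intro x _
    by_cases hxB : x ∈ B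
    · simpa [hxB] using h0 x hxB
    · simp [hxB]

/-- A nonvanishing function on a closed subset of a compact one-dimensional space extends. -/
theorem exists_nonvanishing_extension {S A : Set X} (hS : IsCompact S) (hA : IsClosed A)
    (hAS : A ⊆ S)
    (rim : ∀ ξ ∈ S, ∀ ε > 0, ∃ r, 0 < r ∧ r < ε ∧ {x | x ∈ S ∧ dist ξ x = r}.Finite)
    {m : X → ℂ} (hm : ContinuousOn m A) (h0 : ∀ x ∈ A, m x ≠ 0) :
    ∃ g : X → ℂ, ContinuousOn g S ∧ (∀ x ∈ S, g x ≠ 0) ∧ EqOn g m A := by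
  classical
  obtain ⟨M, hMc, hMe⟩ := exists_continuous_extension hA hm
  have hr : ∀ ξ : X, ∃ r > 0, ξ ∈ S → {x | x ∈ S ∧ dist ξ x = r}.Finite ∧
      (M ξ ≠ 0 → ∀ x, dist ξ x ≤ r → M x ≠ 0) ∧ (M ξ = 0 → ∀ x ∈ A, r < dist ξ x) := by
    intro ξ
    by_cases hξ : ξ ∈ S
    · by_cases hM : M ξ = 0
      · have hξA : ξ ∉ A := fun h => h0 ξ h (by rw [← hMe h, hM])
        obtain ⟨ε, hε, hb⟩ := Metric.isOpen_iff.mp hA.isOpen_compl ξ hξA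
        obtain ⟨r, hr, hrε, hf⟩ := rim ξ hξ ε hε
        refine ⟨r, hr, fun _ => ⟨hf, fun h => absurd hM h, fun _ x hx => ?_⟩⟩
        by_contra hcon
        exact hb (show x ∈ ball ξ ε by rw [mem_ball, dist_comm]; linarith) hx
      · obtain ⟨ε, hε, hb⟩ := Metric.isOpen_iff.mp (isOpen_ne_fun hMc continuous_const) ξ hM
        obtain ⟨r, hr, hrε, hf⟩ := rim ξ hξ ε hε
        exact ⟨r, hr, fun _ => ⟨hf, fun _ x hx => hb (show x ∈ ball ξ ε by
          rw [mem_ball, dist_comm]; linarith), fun h => absurd h hM⟩⟩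
    · exact ⟨1, one_pos, fun h => absurd h hξ⟩
  choose r hrpos hr using hr
  obtain ⟨t, htS, htcov⟩ := hS.elim_nhds_subcover (fun ξ => ball ξ (r ξ))
    fun ξ _ => ball_mem_nhds ξ (hrpos ξ)
  have hclosed : ∀ ξ, IsClosed (S ∩ {x | dist ξ x ≤ r ξ}) := fun ξ =>
    hS.isClosed.inter (isClosed_le (continuous_const.dist continuous_id) continuous_const)
  -- the frontier of a finite union of closed balls is finite
  have front : ∀ u : Finset X, u ⊆ t →
      ((⋃ ξ ∈ u, S ∩ {x | dist ξ x ≤ r ξ}) ∩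
        closure (S \ ⋃ ξ ∈ u, S ∩ {x | dist ξ x ≤ r ξ})).Finite := by
    intro u hu
    have hf : (⋃ ξ ∈ u, {x | x ∈ S ∧ dist ξ x = r ξ}).Finite :=
      u.finite_toSet.biUnion fun ξ hξ => (hr ξ (htS ξ (hu hξ))).1
    refine hf.subset ?_
    rintro x ⟨hx, hxc⟩
    simp only [mem_iUnion] at hx
    obtain ⟨ξ, hξ, hxS, hxr⟩ := hx
    refine mem_biUnion hξ ⟨hxS, le_antisymm hxr ?_⟩
    have hcl : IsClosed {x | r ξ ≤ dist ξ x} :=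
      isClosed_le continuous_const (continuous_const.dist continuous_id)
    refine closure_minimal ?_ hcl hxc
    rintro y ⟨hyS, hy⟩
    by_contra hcon
    exact hy (mem_biUnion hξ ⟨hyS, show dist ξ y ≤ r ξ from (not_le.mp hcon).le⟩)
  have uclosed : ∀ u : Finset X, IsClosed (⋃ ξ ∈ u, S ∩ {x | dist ξ x ≤ r ξ}) := fun u =>
    u.finite_toSet.isClosed_biUnion fun ξ _ => hclosed ξ
  set t₀ := t.filter fun ξ => M ξ ≠ 0 with ht₀
  have key : ∀ v : Finset X, v ⊆ t → ∃ g : X → ℂ,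
      ContinuousOn g (⋃ ξ ∈ t₀ ∪ v, S ∩ {x | dist ξ x ≤ r ξ}) ∧
      (∀ x ∈ (⋃ ξ ∈ t₀ ∪ v, S ∩ {x | dist ξ x ≤ r ξ}), g x ≠ 0) ∧
      EqOn g M (⋃ ξ ∈ t₀, S ∩ {x | dist ξ x ≤ r ξ}) := by
    intro v
    induction v using Finset.induction_on with
    | empty =>
      intro _
      refine ⟨M, hMc.continuousOn, ?_, fun x _ => rfl⟩
      intro x hx
      simp only [Finset.union_empty, mem_iUnion] at hx
      obtain ⟨ξ, hξ, hxS, hxr⟩ := hx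
      obtain ⟨hξt, hξM⟩ := Finset.mem_filter.mp hξ
      exact (hr ξ (htS ξ hξt)).2.1 hξM x hxr
    | insert a v hav ih =>
      intro hsub
      have hv : v ⊆ t := fun x hx => hsub (Finset.mem_insert_of_mem hx)
      obtain ⟨g, hg, hg0, hgM⟩ := ih hv
      have hu : t₀ ∪ v ⊆ t := Finset.union_subset (Finset.filter_subset _ _) hv
      obtain ⟨g', hg', hg0', hgg⟩ := extend_step (C := S ∩ {x | dist a x ≤ r a})
        (uclosed (t₀ ∪ v)) ((front (t₀ ∪ v) hu).subset (inter_subset_inter_right _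
          (closure_mono (sdiff_subset_sdiff_left inter_subset_left)))) hg hg0
      have hset : (⋃ ξ ∈ t₀ ∪ insert a v, S ∩ {x | dist ξ x ≤ r ξ}) =
          (⋃ ξ ∈ t₀ ∪ v, S ∩ {x | dist ξ x ≤ r ξ}) ∪ (S ∩ {x | dist a x ≤ r a}) := by
        rw [Finset.union_insert, Finset.set_biUnion_insert, union_comm]
      rw [hset]
      refine ⟨g', hg', hg0', fun x hx => ?_⟩
      rw [hgg (biUnion_subset_biUnion_left (fun ξ hξ => Finset.mem_union_left v hξ) hx), hgM hx]
  obtain ⟨g, hg, hg0, hgM⟩ := key t le_rfl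
  have hcov : S ⊆ ⋃ ξ ∈ t₀ ∪ t, S ∩ {x | dist ξ x ≤ r ξ} := by
    intro x hx
    obtain ⟨ξ, hξ, hxξ⟩ := mem_iUnion₂.mp (htcov hx)
    refine mem_biUnion (Finset.mem_union_right t₀ hξ) ⟨hx, ?_⟩
    rw [mem_ball, dist_comm] at hxξ
    exact hxξ.le
  refine ⟨g, hg.mono hcov, fun x hx => hg0 x (hcov hx), fun x hx => ?_⟩
  obtain ⟨ξ, hξ, hxξ⟩ := mem_iUnion₂.mp (htcov (hAS hx))
  rw [mem_ball, dist_comm] at hxξ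
  have hξM : M ξ ≠ 0 := fun h => absurd ((hr ξ (htS ξ hξ)).2.2 h x hx) (not_lt.mpr hxξ.le)
  rw [← hMe hx]
  exact hgM (mem_biUnion (Finset.mem_filter.mpr ⟨hξ, hξM⟩) ⟨hAS hx, hxξ.le⟩)

end Log

section Membrane

variable {X : Type*} [MetricSpace X]

/-- Every nonvanishing function on `K` has a logarithm on `T`: the cohomological way of saying
that the curve `T` bounds in `K`. -/
def Fills (K T : Set X) : Prop :=
  ∀ m : X → ℂ, ContinuousOn m K → (∀ x ∈ K, m x ≠ 0) → HasLog m T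

/-- A compact set carrying a nonvanishing function without logarithm which is
trivial away from any prescribed point. -/
structure CircleLike (T : Set X) : Prop where
  compact : IsCompact T
  wrap : ∀ z ∈ T, ∀ ε > 0, ∃ m : X → ℂ, ContinuousOn m T ∧ (∀ x ∈ T, m x ≠ 0) ∧
    (∀ x ∈ T, ε ≤ dist z x → m x = 1) ∧ ¬ HasLog m T

/-- A minimal compact set filled by the curve `T`. -/
structure Membrane (D T : Set X) : Prop where
  compact : IsCompact D
  subset : T ⊆ D
  fills : Fills D T
  circ : CircleLike T
  minimal : ∀ K, IsCompact K → T ⊆ K → Fills K T → K ⊆ D → D ⊆ K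

theorem exists_membrane {K T : Set X} (hK : IsCompact K) (hT : CircleLike T) (hTK : T ⊆ K)
    (hf : Fills K T) : ∃ D, D ⊆ K ∧ Membrane D T := by
  obtain ⟨D, hDK, hmin⟩ := zorn_superset_nonempty {D : Set X | IsCompact D ∧ T ⊆ D ∧ Fills D T}
    (fun c hc hchain hne => by
      refine ⟨⋂₀ c, ⟨?_, subset_sInter fun s hs => (hc hs).2.1, fun m hm h0 => ?_⟩,
        fun s hs => sInter_subset_of_mem hs⟩
      · obtain ⟨s, hs⟩ := hne
        exact (hc hs).1.of_isClosed_subset (isClosed_sInter fun s hs => (hc hs).1.isClosed)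
          (sInter_subset_of_mem hs)
      · have hcl : IsClosed (⋂₀ c) := isClosed_sInter fun s hs => (hc hs).1.isClosed
        obtain ⟨M, hM, hMe⟩ := exists_continuous_extension hcl hm
        have hU : IsOpen {x | M x ≠ 0} := isOpen_ne_fun hM continuous_const
        have : Nonempty c := hne.to_subtype
        obtain ⟨⟨s, hs⟩, hsU⟩ := exists_subset_nhds_of_isCompact (V := fun s : c => (s : Set X))
          (U := {x | M x ≠ 0}) (by
            intro a b
            rcases hchain.total a.2 b.2 with h | h
            · exact ⟨a, le_rfl, h⟩
            · exact ⟨b, h, le_rfl⟩) (fun s => (hc s.2).1) (by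
            intro x hx
            rw [← sInter_eq_iInter] at hx
            exact hU.mem_nhds (show M x ≠ 0 by rw [hMe hx]; exact h0 x hx))
        have hT : T ⊆ ⋂₀ c := subset_sInter fun s hs => (hc hs).2.1
        exact ((hc hs).2.2 M hM.continuousOn fun x hx => hsU hx).congr
          fun x hx => (hMe (hT hx)).symm) K ⟨hK, hTK, hf⟩
  exact ⟨D, hDK, hmin.prop.1, hmin.prop.2.1, hmin.prop.2.2, hT,
    fun K' h1 h2 h3 h4 => hmin.le_of_le ⟨h1, h2, h3⟩ h4⟩

namespace Membrane

variable {D T : Set X}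

theorem exists_near (h : Membrane D T) {z : X} (hz : z ∈ T) {ε : ℝ} (hε : 0 < ε) :
    ∃ w ∈ D \ T, dist z w < ε := by
  classical
  by_contra hcon
  push Not at hcon
  obtain ⟨m, hm, h0, h1, hlog⟩ := h.circ.wrap z hz ε hε
  have hT : ∀ x ∈ D, x ∉ T → ε ≤ dist z x := fun x hx hxT => hcon x ⟨hx, hxT⟩
  refine hlog (HasLog.congr (h.fills (fun x => if x ∈ T then m x else 1) ?_ ?_)
    fun x hx => by simp [hx])
  · have hsub : D ⊆ T ∪ {x | ε ≤ dist z x} := fun x hx => by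
      by_cases hxT : x ∈ T
      · exact Or.inl hxT
      · exact Or.inr (hT x hx hxT)
    refine ContinuousOn.mono (ContinuousOn.union_of_isClosed ?_ ?_ h.circ.compact.isClosed
      (isClosed_le continuous_const (continuous_const.dist continuous_id))) hsub
    · exact hm.congr fun x hx => by simp [hx]
    · refine (continuousOn_const (c := (1 : ℂ))).congr fun x hx => ?_
      by_cases hxT : x ∈ T
      · simp [hxT, h1 x hxT hx]
      · simp [hxT]
  · intro x _
    by_cases hxT : x ∈ T
    · simp [hxT, h0 x hxT]
    · simp [hxT]

theorem exists_obstruction (h : Membrane D T) {w : X} (hw : w ∈ D) {δ : ℝ} (hδ : 0 < δ)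
    (hd : ∀ x ∈ T, δ < dist w x) :
    ∃ m : X → ℂ, ContinuousOn m (D ∩ {x | dist w x = δ}) ∧
      (∀ x ∈ D ∩ {x | dist w x = δ}, m x ≠ 0) ∧ ¬ HasLog m (D ∩ {x | dist w x = δ}) := by
  classical
  have hdc : Continuous fun x : X => dist w x := continuous_const.dist continuous_id
  have hcl : IsClosed {x : X | δ ≤ dist w x} := isClosed_le continuous_const hdc
  have hnf : ¬ Fills (D ∩ {x | δ ≤ dist w x}) T := fun hf => by
    have := h.minimal _ (h.compact.inter_right hcl) (fun x hx => ⟨h.subset hx, (hd x hx).le⟩) hf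
      inter_subset_left hw
    have h2 : δ ≤ dist w w := this.2
    rw [dist_self] at h2
    linarith
  unfold Fills at hnf
  push Not at hnf
  obtain ⟨m, hm, h0, hlog⟩ := hnf
  have hsub : D ∩ {x | dist w x = δ} ⊆ D ∩ {x | δ ≤ dist w x} :=
    fun x hx => ⟨hx.1, hx.2.ge⟩
  refine ⟨m, hm.mono hsub, fun x hx => h0 x (hsub hx), fun ⟨θ, hθ, he⟩ => hlog ?_⟩
  have hclA : IsClosed (D ∩ {x | dist w x = δ}) :=
    h.compact.isClosed.inter (isClosed_eq hdc continuous_const)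
  obtain ⟨θ', hθ', he'⟩ := exists_continuous_extension hclA hθ
  refine HasLog.congr (h.fills (fun x => if δ ≤ dist w x then m x else Complex.exp (θ' x)) ?_ ?_)
    fun x hx => by simp [(hd x hx).le]
  · have hsub' : D ⊆ (D ∩ {x | δ ≤ dist w x}) ∪ (D ∩ {x | dist w x ≤ δ}) := fun x hx =>
      (le_total δ (dist w x)).imp (fun h => ⟨hx, h⟩) fun h => ⟨hx, h⟩
    refine ContinuousOn.mono (ContinuousOn.union_of_isClosed ?_ ?_
      (h.compact.isClosed.inter hcl)
      (h.compact.isClosed.inter (isClosed_le hdc continuous_const))) hsub'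
    · exact hm.congr fun x hx => by
        have : δ ≤ dist w x := hx.2
        simp [this]
    · refine (hθ'.cexp.continuousOn (s := D ∩ {x | dist w x ≤ δ})).congr fun x hx => ?_
      by_cases hxw : δ ≤ dist w x
      · have hxA : x ∈ D ∩ {x | dist w x = δ} := ⟨hx.1, le_antisymm hx.2 hxw⟩
        simp only [hxw, if_true]
        rw [he' hxA, he x hxA]
      · simp [hxw]
  · intro x hx
    by_cases hxw : δ ≤ dist w x
    · simpa [hxw] using h0 x ⟨hx, hxw⟩
    · simp [hxw]

end Membrane

variable [CAT0 X] {O : Set X}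

/-- Radial retraction of a punctured ball to its boundary sphere. -/
theorem LocalCone.exists_retraction {w : X} {δ : ℝ} (h : LocalCone O w δ) :
    ∃ r : X → X, ContinuousOn r (closedBall w δ \ {w}) ∧
      ∀ x, x ≠ w → dist w x ≤ δ → dist w (r x) = δ ∧ Btw w x (r x) := by
  classical
  have hex : ∀ x, ∃ ξ, x ≠ w → dist w x ≤ δ → dist w ξ = δ ∧ Btw w x ξ := by
    intro x
    by_cases hx : x ≠ w ∧ dist w x ≤ δ
    · obtain ⟨ξ, h1⟩ := h.ext x hx.1 hx.2
      exact ⟨ξ, fun _ _ => h1⟩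
    · exact ⟨x, fun h1 h2 => absurd ⟨h1, h2⟩ hx⟩
  choose r hr using hex
  refine ⟨r, ?_, hr⟩
  intro x hx
  have hx1 : x ≠ w := hx.2
  have hx2 : dist w x ≤ δ := by rw [dist_comm]; exact hx.1
  have hmem : ∀ᶠ y in nhdsWithin x (closedBall w δ \ {w}), r y ∈ closedBall w δ := by
    filter_upwards [self_mem_nhdsWithin] with y hy
    rw [mem_closedBall, dist_comm, (hr y hy.2 (by rw [dist_comm]; exact hy.1)).1]
  refine h.compact.tendsto_nhds_of_unique_mapClusterPt hmem ?_
  intro ζ _ hζ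
  rw [mapClusterPt_iff_ultrafilter] at hζ
  obtain ⟨U, hU, hUζ⟩ := hζ
  have hid : Tendsto (fun y : X => y) U (nhds x) := (hU.trans nhdsWithin_le_nhds)
  have hmemU : ∀ᶠ y in (U : Filter X), y ∈ closedBall w δ \ {w} := hU self_mem_nhdsWithin
  have hd : dist w ζ = δ := by
    refine tendsto_nhds_unique_of_eventuallyEq (tendsto_const_nhds.dist hUζ)
      (tendsto_const_nhds (x := δ)) ?_
    filter_upwards [hmemU] with y hy
    exact (hr y hy.2 (by rw [dist_comm]; exact hy.1)).1
  have hb : Btw w x ζ := by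
    refine tendsto_nhds_unique_of_eventuallyEq ((tendsto_const_nhds.dist hid).add (hid.dist hUζ))
      (tendsto_const_nhds.dist hUζ) ?_
    filter_upwards [hmemU] with y hy
    exact (hr y hy.2 (by rw [dist_comm]; exact hy.1)).2
  exact h.ext_unique x ζ (r x) hx1 hb (hr x hx1 hx2).2 hd (hr x hx1 hx2).1

theorem dist_btw_le {w x y z : X} {δ : ℝ} (hx : dist w x ≤ δ) (hy : dist w y ≤ δ)
    (hb : Btw x z y) : dist w z ≤ δ :=
  ((sConv_dist w).le_max le_rfl hb).trans (max_le hx hy)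

theorem hasLog_of_star {w y : X} {δ : ℝ} {M : X → ℂ}
    (hM : ContinuousOn M (closedBall w δ \ {w})) (h0 : ∀ x ∈ closedBall w δ \ {w}, M x ≠ 0)
    {B : Set X} (hB : IsCompact B) (hBw : ∀ x ∈ B, dist w x ≤ δ) (hy : dist w y ≤ δ)
    (hstar : ∀ x ∈ B, ¬ Btw y w x) : HasLog M B := by
  by_cases hne : B.Nonempty
  swap
  · rw [not_nonempty_iff_eq_empty.mp hne]
    exact hasLog_of_finite finite_empty fun x hx => absurd hx (notMem_empty x)
  obtain ⟨b, hb⟩ := hne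
  have hmem : ∀ x ∈ B, ∀ t, pt y x t ∈ closedBall w δ \ {w} := by
    intro x hx t
    refine ⟨?_, ?_⟩
    · rw [mem_closedBall, dist_comm]
      exact dist_btw_le hy (hBw x hx) (btw_pt y x t)
    · intro h
      rw [mem_singleton_iff] at h
      exact hstar x hx (h ▸ btw_pt y x t)
  have hl := HasLog.homotopy hB (h := fun x t => M (pt y x t)) ?_ ?_ ?_
  · exact hl.congr fun x _ => by simp only [pt_one]
  · refine hM.comp (Continuous.pt continuous_const continuous_fst continuous_snd).continuousOn ?_
    exact fun q hq => hmem q.1 hq.1 q.2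
  · exact fun x hx t _ => h0 _ (hmem x hx t)
  · refine (hasLog_const (c := M y) ?_ B).congr fun x _ => by simp only [pt_zero]
    have := hmem b hb 0
    rw [pt_zero] at this
    exact h0 y this

theorem Membrane.exists_obstruction_ball {D T : Set X} (h : Membrane D T) {w : X} (hw : w ∈ D)
    {δ : ℝ} (hd : ∀ x ∈ T, δ < dist w x) (hc : LocalCone O w δ) :
    ∃ M : X → ℂ, ContinuousOn M (closedBall w δ \ {w}) ∧
      (∀ x ∈ closedBall w δ \ {w}, M x ≠ 0) ∧ ¬ HasLog M (D ∩ {x | dist w x = δ}) := by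
  obtain ⟨m, hm, h0, hlog⟩ := h.exists_obstruction hw hc.pos hd
  have hdc : Continuous fun x : X => dist w x := continuous_const.dist continuous_id
  have hS : IsCompact {x | dist w x = δ} :=
    hc.compact.of_isClosed_subset (isClosed_eq hdc continuous_const) fun x hx => by
      rw [mem_closedBall, dist_comm]; exact le_of_eq hx
  obtain ⟨g, hg, hg0, hgm⟩ := exists_nonvanishing_extension hS
    (h.compact.isClosed.inter (isClosed_eq hdc continuous_const)) inter_subset_right
    hc.rim hm h0
  obtain ⟨r, hrc, hr⟩ := hc.exists_retraction
  have hmem : MapsTo r (closedBall w δ \ {w}) {x | dist w x = δ} := fun x hx =>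
    (hr x hx.2 (by rw [dist_comm]; exact hx.1)).1
  refine ⟨fun x => g (r x), hg.comp hrc hmem, fun x hx => hg0 _ (hmem hx), fun hl => hlog ?_⟩
  refine hl.congr fun x hx => ?_
  have hxw : x ≠ w := by
    rintro rfl
    have := hx.2
    rw [mem_ofPred_eq, dist_self] at this
    exact hc.pos.ne this
  obtain ⟨h1, h2⟩ := hr x hxw (le_of_eq hx.2)
  have h3 : dist w x = δ := hx.2
  have : x = r x := by
    unfold Btw at h2
    rw [h1, h3] at h2
    exact dist_eq_zero.mp (by linarith)
  simp only
  rw [← this, hgm hx]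

theorem Btw.concat {y y' w x : X} (h : Btw y y' w) (h' : Btw y' w x) (hne : y' ≠ w) :
    Btw y w x := by
  have hs := CAT0.stewart y y' w x h'
  have hb : 0 < dist y' w := dist_pos.mpr hne
  unfold Btw at *
  have h2 := dist_triangle y w x
  refine le_antisymm ?_ h2
  by_contra hcon
  push Not at hcon
  have hc0 : 0 ≤ dist w x := dist_nonneg
  have ha0 : 0 ≤ dist y y' := dist_nonneg
  rw [← h', ← h] at hs
  rw [← h] at hcon
  have hlt : dist y x ^ 2 < (dist y y' + dist y' w + dist w x) ^ 2 :=
    pow_lt_pow_left₀ hcon dist_nonneg two_ne_zero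
  have h3 := mul_lt_mul_of_pos_left hlt hb
  linarith [h3, hs]

namespace Membrane

variable {D T : Set X} (H : TwoCx O) (h : Membrane D T)
include H h

/-- Small good radii at an interior point of the membrane. -/
theorem exists_radius {w : X} (hw : w ∉ T) :
    ∃ δ₀ > 0, ∀ δ, 0 < δ → δ ≤ δ₀ → LocalCone O w δ ∧ ∀ x ∈ T, δ < dist w x := by
  obtain ⟨δ₀, h0, hc⟩ := H.localCone w
  obtain ⟨ε, hε, hb⟩ := Metric.isOpen_iff.mp h.circ.compact.isClosed.isOpen_compl w hw
  refine ⟨min δ₀ (ε / 2), by positivity, fun δ hδ hle =>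
    ⟨hc δ hδ (hle.trans (min_le_left _ _)), fun x hx => ?_⟩⟩
  by_contra hcon
  have h2 := hle.trans (min_le_right _ _)
  exact hb (show x ∈ ball w ε by rw [mem_ball, dist_comm]; linarith) hx

theorem extend_through {w y : X} (hw : w ∈ D) (hy : y ≠ w) {δ : ℝ}
    (hc : LocalCone O w δ) (hd : ∀ x ∈ T, δ < dist w x) :
    ∃ x ∈ D, dist w x = δ ∧ Btw y w x := by
  obtain ⟨M, hM, h0, hlog⟩ := h.exists_obstruction_ball hw hd hc
  have hdc : Continuous fun x : X => dist w x := continuous_const.dist continuous_id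
  have hA : IsCompact (D ∩ {x | dist w x = δ}) :=
    h.compact.inter_right (isClosed_eq hdc continuous_const)
  have hpos : 0 < dist w y := dist_pos.mpr (Ne.symm hy)
  obtain ⟨y', hb', hy'⟩ := exists_btw_dist w y (s := min δ (dist w y))
    (le_min hc.pos.le hpos.le) (min_le_right _ _)
  have hne : y' ≠ w := by
    rintro rfl
    rw [dist_self] at hy'
    linarith [lt_min hc.pos hpos]
  by_contra hcon
  push Not at hcon
  refine hlog (hasLog_of_star hM h0 hA (fun x hx => le_of_eq hx.2) (y := y')
    (hy' ▸ min_le_left _ _) fun x hx hb => ?_)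
  exact hcon x hx.1 hx.2 (Btw.concat hb'.symm hb hne)

theorem not_finite {w : X} (hw : w ∈ D) {δ : ℝ} (hc : LocalCone O w δ)
    (hd : ∀ x ∈ T, δ < dist w x) : ¬ (D ∩ {x | dist w x = δ}).Finite := by
  obtain ⟨m, -, h0, hlog⟩ := h.exists_obstruction hw hc.pos hd
  exact fun hf => hlog (hasLog_of_finite hf h0)

/-- Points of the membrane in open faces are dense in it. -/
theorem exists_near_face {w : X} (hw : w ∈ D) {ε : ℝ} (hε : 0 < ε) :
    ∃ x ∈ D, x ∉ T ∧ x ∈ O ∧ dist w x < ε := by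
  have main : ∀ w ∈ D \ T, ∀ ε > 0, ∃ x ∈ D, x ∉ T ∧ x ∈ O ∧ dist w x < ε := by
    intro w hw ε hε
    obtain ⟨δ₀, h0, hδ⟩ := exists_radius H h hw.2
    have hpos : 0 < min δ₀ (ε / 2) := by positivity
    obtain ⟨hc, hd⟩ := hδ (min δ₀ (ε / 2)) hpos (min_le_left _ _)
    by_contra hcon
    push Not at hcon
    refine not_finite H h hw.1 hc hd (hc.sing.subset ?_)
    rintro x ⟨hx, hxd⟩
    have hxd' : dist w x = min δ₀ (ε / 2) := hxd
    refine ⟨hxd, fun hxO => ?_⟩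
    have hxT : x ∉ T := fun hxT => by linarith [hd x hxT]
    have := hcon x hx hxT hxO
    rw [hxd'] at this
    linarith [min_le_right δ₀ (ε / 2)]
  by_cases hwT : w ∈ T
  · obtain ⟨w', hw', hd⟩ := h.exists_near hwT (half_pos hε)
    obtain ⟨x, h1, h2, h3, h4⟩ := main w' hw' (ε / 2) (half_pos hε)
    exact ⟨x, h1, h2, h3, by linarith [dist_triangle w w' x]⟩
  · exact main w ⟨hw, hwT⟩ ε hε

/-- Geodesics entering the membrane extend inside it up to its boundary curve. -/
theorem extend_to_boundary {y w : X} (hw : w ∈ D) (hy : y ≠ w) :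
    ∃ a ∈ T, Btw y w a ∧ seg w a ⊆ D := by
  have hptc : ∀ t, Continuous fun x : X => pt w x t := fun t =>
    Continuous.pt continuous_const continuous_id continuous_const
  have hScl : ∀ ε : ℝ, IsClosed {x : X | Btw y w x ∧ ∀ t : ℝ, infDist (pt w x t) D ≤ ε} := by
    intro ε
    have h1 : IsClosed {x : X | Btw y w x} :=
      isClosed_eq (continuous_const.add (continuous_const.dist continuous_id))
        (continuous_const.dist continuous_id)
    have h2 : IsClosed {x : X | ∀ t : ℝ, infDist (pt w x t) D ≤ ε} := by
      rw [ofPred_forall]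
      exact isClosed_iInter fun t => isClosed_le ((continuous_infDist_pt D).comp (hptc t))
        continuous_const
    exact h1.inter h2
  have step : ∀ n : ℕ, ∃ a ∈ T, Btw y w a ∧ ∀ t : ℝ, infDist (pt w a t) D ≤ 1 / ((n : ℝ) + 1) := by
    intro n
    set ε : ℝ := 1 / ((n : ℝ) + 1) with hεdef
    have hε : 0 < ε := by positivity
    have hne : (D ∩ {x : X | Btw y w x ∧ ∀ t : ℝ, infDist (pt w x t) D ≤ ε}).Nonempty :=
      ⟨w, hw, btw_right y w, fun t => by rw [pt_self, infDist_zero_of_mem hw]; exact hε.le⟩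
    obtain ⟨x, ⟨hxD, hbx, hxt⟩, hmax⟩ := (h.compact.inter_right (hScl ε)).exists_isMaxOn hne
      (continuous_const.dist continuous_id (f := fun _ => y)).continuousOn
    refine ⟨x, ?_, hbx, hxt⟩
    by_contra hxT
    obtain ⟨δ₀, h0, hδ⟩ := exists_radius H h hxT
    obtain ⟨hc, hd⟩ := hδ (min δ₀ ε) (by positivity) (min_le_left _ _)
    have hyx : y ≠ x := by
      rintro rfl
      exact hy (hbx.eq_of_same).symm
    obtain ⟨x', hx'D, hx'd, hb'⟩ := extend_through H h hxD hyx hc hd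
    have hbw : Btw y w x' := hb'.outer' hbx
    have hbx' : Btw w x x' := hb'.inner' hbx
    have hx'mem : x' ∈ D ∩ {x : X | Btw y w x ∧ ∀ t : ℝ, infDist (pt w x t) D ≤ ε} := by
      refine ⟨hx'D, hbw, fun t => ?_⟩
      rcases (btw_pt w x' t).total hbx' with hz | hz
      · obtain ⟨s, -, -, hs⟩ := hz.exists_pt
        rw [hs]; exact hxt s
      · have h1 : dist x (pt w x' t) ≤ dist x x' := ((btw_pt w x' t).inner' hz).left_le
        calc infDist (pt w x' t) D ≤ dist (pt w x' t) x := infDist_le_dist_of_mem hxD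
          _ = dist x (pt w x' t) := dist_comm _ _
          _ ≤ dist x x' := h1
          _ ≤ ε := by rw [hx'd]; exact min_le_right _ _
    have h1 : dist y x' ≤ dist y x := hmax hx'mem
    have h2 : dist y x + dist x x' = dist y x' := hb'
    rw [hx'd] at h2
    linarith [hc.pos]
  choose a haT hab hat using step
  obtain ⟨a₀, ha₀, φ, hφ, hlim⟩ := h.circ.compact.tendsto_subseq haT
  refine ⟨a₀, ha₀, btw_of_tendsto tendsto_const_nhds tendsto_const_nhds hlim
    (Eventually.of_forall fun n => hab (φ n)), fun z hz => ?_⟩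
  obtain ⟨t, -, -, rfl⟩ := Btw.exists_pt hz
  have hlim2 : Tendsto (fun n => infDist (pt w (a (φ n)) t) D) atTop
      (nhds (infDist (pt w a₀ t) D)) :=
    (((continuous_infDist_pt D).comp (hptc t)).tendsto a₀).comp hlim
  have hle : infDist (pt w a₀ t) D ≤ 0 :=
    le_of_tendsto_of_tendsto' hlim2
      ((tendsto_one_div_add_atTop_nhds_zero_nat (𝕜 := ℝ)).comp hφ.tendsto_atTop)
      fun n => hat (φ n) t
  exact (h.compact.isClosed.mem_iff_infDist_zero ⟨w, hw⟩).mpr (le_antisymm hle infDist_nonneg)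

end Membrane

end Membrane

section Chord

variable {X : Type*} [MetricSpace X] [CAT0 X] {O : Set X}

namespace Membrane

variable {D T : Set X} (H : TwoCx O) (h : Membrane D T)
include H h

theorem exists_local_chord {w : X} (hw : w ∈ D) {δ : ℝ} (hc : LocalCone O w δ)
    (hd : ∀ x ∈ T, δ < dist w x) {G : X → ℝ} (hG : Continuous G) {c : ℝ} (hc0 : 0 < c)
    (hGc : SConv c G) :
    ∃ x₁ ∈ D, ∃ x₂ ∈ D, dist w x₁ = δ ∧ dist w x₂ = δ ∧ Btw x₁ w x₂ ∧ G w ≤ G x₁ ∧ G w ≤ G x₂ := by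
  have hne : ∀ x, dist w x = δ → x ≠ w := by
    rintro x hx rfl
    rw [dist_self] at hx
    exact hc.pos.ne hx
  by_contra hcon
  push Not at hcon
  have hno : ∀ x ∈ D, dist w x = δ → G x ≠ G w := by
    intro x hx hxd he
    obtain ⟨x', hx', hxd', hb⟩ := extend_through H h hw (hne x hxd) hc hd
    have h1 := hGc.lt_max hc0 hb (hne x hxd).symm (hne x' hxd').symm
    rw [he, lt_max_iff] at h1
    rcases h1 with h1 | h1
    · exact lt_irrefl _ h1
    · exact absurd (hcon x hx x' hx' hxd hxd' hb he.ge) (not_lt.mpr h1.le)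
  obtain ⟨M, hM, h0, hlog⟩ := h.exists_obstruction_ball hw hd hc
  have hdc : Continuous fun x : X => dist w x := continuous_const.dist continuous_id
  have hA : IsCompact (D ∩ {x | dist w x = δ}) :=
    h.compact.inter_right (isClosed_eq hdc continuous_const)
  have hP : IsCompact ((D ∩ {x | dist w x = δ}) ∩ {x | G w ≤ G x}) :=
    hA.inter_right (isClosed_le continuous_const hG)
  have hN : IsCompact ((D ∩ {x | dist w x = δ}) ∩ {x | G x ≤ G w}) :=
    hA.inter_right (isClosed_le hG continuous_const)
  have hpart : ∀ B : Set X, IsCompact B → B ⊆ D ∩ {x | dist w x = δ} →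
      (∀ x ∈ B, ∀ y ∈ B, ¬ Btw x w y) → HasLog M B := by
    intro B hB hBs hanti
    rcases B.eq_empty_or_nonempty with rfl | ⟨y, hy⟩
    · exact hasLog_of_finite finite_empty fun x hx => absurd hx (notMem_empty x)
    · exact hasLog_of_star hM h0 hB (fun x hx => le_of_eq (hBs hx).2) (le_of_eq (hBs hy).2)
        fun x hx => hanti y hy x hx
  have hun : D ∩ {x | dist w x = δ} = ((D ∩ {x | dist w x = δ}) ∩ {x | G w ≤ G x}) ∪
      ((D ∩ {x | dist w x = δ}) ∩ {x | G x ≤ G w}) := by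
    rw [← inter_union_distrib_left]
    refine (inter_eq_left.mpr fun x _ => le_total (G w) (G x)).symm
  refine hlog ?_
  rw [hun]
  refine HasLog.union hP.isClosed hN.isClosed ?_ (hpart _ hP inter_subset_left ?_)
    (hpart _ hN inter_subset_left ?_)
  · rw [disjoint_left]
    rintro x ⟨⟨hx, hxd⟩, h1⟩ ⟨-, h2⟩
    exact hno x hx hxd (le_antisymm h2 h1)
  · rintro x ⟨⟨hx, hxd⟩, h1⟩ y ⟨⟨hy, hyd⟩, h2⟩ hb
    exact absurd (hcon x hx y hy hxd hyd hb h1) (not_lt.mpr h2)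
  · rintro x ⟨⟨hx, hxd⟩, h1⟩ y ⟨⟨hy, hyd⟩, h2⟩ hb
    exact absurd ((hGc.lt_max hc0 hb (hne x hxd).symm (hne y hyd).symm).trans_le (max_le h1 h2))
      (lt_irrefl _)

/-- Through every interior point of the membrane there is a chord along which a strongly convex
function is minimal at that point. -/
theorem exists_chord {w : X} (hw : w ∈ D \ T) {G : X → ℝ} (hG : Continuous G) {c : ℝ}
    (hc0 : 0 < c) (hGc : SConv c G) :
    ∃ a ∈ T, ∃ b ∈ T, Btw a w b ∧ seg a b ⊆ D ∧ c * dist w a ^ 2 ≤ G a - G w ∧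
      c * dist w b ^ 2 ≤ G b - G w := by
  obtain ⟨δ₀, hδ₀, hrad⟩ := exists_radius H h hw.2
  have slope : ∀ (x a : X) (δ : ℝ), 0 < δ → dist w x = δ → Btw w x a → G w ≤ G x →
      c * (dist w a - δ) * dist w a ≤ G a - G w := by
    intro x a δ hδ hx hb hGx
    have h1 := hGc w x a hb
    have h2 : dist x a = dist w a - δ := by unfold Btw at hb; linarith
    rw [h2, hx] at h1
    have h3 := mul_le_mul_of_nonneg_left hGx (dist_nonneg (x := w) (y := a))
    have h4 : δ * (c * (dist w a - δ) * dist w a) ≤ δ * (G a - G w) := by linarith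
    exact le_of_mul_le_mul_left h4 hδ
  have step : ∀ n : ℕ, ∃ a ∈ T, ∃ b ∈ T, Btw a w b ∧
      (∀ t : ℝ, infDist (pt a b t) D ≤ 1 / ((n : ℝ) + 1)) ∧
      c * (dist w a - 1 / ((n : ℝ) + 1)) * dist w a ≤ G a - G w ∧
      c * (dist w b - 1 / ((n : ℝ) + 1)) * dist w b ≤ G b - G w := by
    intro n
    have hε : (0 : ℝ) < 1 / ((n : ℝ) + 1) := by positivity
    set ε : ℝ := 1 / ((n : ℝ) + 1)
    set δ := min δ₀ ε
    have hδ : 0 < δ := lt_min hδ₀ hε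
    have hδε : δ ≤ ε := min_le_right _ _
    obtain ⟨hc, hd⟩ := hrad δ hδ (min_le_left _ _)
    obtain ⟨x₁, h1, x₂, h2, hd1, hd2, hb, hG1, hG2⟩ :=
      exists_local_chord H h hw.1 hc hd hG hc0 hGc
    have h12 : x₁ ≠ x₂ := by
      rintro rfl
      have := hb.eq_of_same
      rw [← this, dist_self] at hd1
      linarith
    obtain ⟨a, haT, hab, haD⟩ := extend_to_boundary H h h2 h12
    have hax : a ≠ x₁ := by
      rintro rfl
      exact h12 hab.eq_of_same.symm
    obtain ⟨b, hbT, hbb, hbD⟩ := extend_to_boundary H h h1 hax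
    have hwa : Btw w x₂ a := hab.inner' hb
    have hwb : Btw w x₁ b := hbb.inner' (hab.outer' hb).symm
    have hawb : Btw a w b := hbb.outer' (hab.outer' hb).symm
    have near : ∀ x e : X, x ∈ D → dist w x = δ → Btw w x e → seg x e ⊆ D → ∀ z, Btw w z e →
        infDist z D ≤ ε := by
      intro x e hx hxd hbe hD z hz
      rcases hz.total hbe with hz' | hz'
      · calc infDist z D ≤ dist z w := infDist_le_dist_of_mem hw.1
          _ = dist w z := dist_comm _ _
          _ ≤ dist w x := hz'.left_le
          _ ≤ ε := by rw [hxd]; exact hδε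
      · rw [infDist_zero_of_mem (hD (hz.inner' hz'))]
        exact hε.le
    have weaken : ∀ e : X, c * (dist w e - δ) * dist w e ≤ G e - G w →
        c * (dist w e - ε) * dist w e ≤ G e - G w := fun e he => by
      refine le_trans ?_ he
      have h0 : 0 ≤ dist w e := dist_nonneg
      gcongr
    refine ⟨a, haT, b, hbT, hawb, fun t => ?_, weaken a (slope x₂ a δ hδ hd2 hwa hG2),
      weaken b (slope x₁ b δ hδ hd1 hwb hG1)⟩
    rcases (btw_pt a b t).total hawb with hz | hz
    · exact near x₂ a h2 hd2 hwa haD _ hz.symm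
    · exact near x₁ b h1 hd1 hwb hbD _ ((btw_pt a b t).inner' hz)
  choose a haT b hbT hab habD haG hbG using step
  obtain ⟨⟨a₀, b₀⟩, ⟨ha₀, hb₀⟩, φ, hφ, hlim⟩ :=
    (h.circ.compact.prod h.circ.compact).tendsto_subseq (x := fun n => (a n, b n))
      fun n => ⟨haT n, hbT n⟩
  have hla : Tendsto (fun n => a (φ n)) atTop (nhds a₀) :=
    (continuous_fst.tendsto (a₀, b₀)).comp hlim
  have hlb : Tendsto (fun n => b (φ n)) atTop (nhds b₀) :=
    (continuous_snd.tendsto (a₀, b₀)).comp hlim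
  have hzero : Tendsto (fun n => 1 / ((φ n : ℝ) + 1)) atTop (nhds 0) :=
    (tendsto_one_div_add_atTop_nhds_zero_nat (𝕜 := ℝ)).comp hφ.tendsto_atTop
  have hineq : ∀ (u : ℕ → X) (u₀ : X), Tendsto (fun n => u (φ n)) atTop (nhds u₀) →
      (∀ n, c * (dist w (u n) - 1 / ((n : ℝ) + 1)) * dist w (u n) ≤ G (u n) - G w) →
      c * dist w u₀ ^ 2 ≤ G u₀ - G w := by
    intro u u₀ hu hle
    have hdw : Tendsto (fun n => dist w (u (φ n))) atTop (nhds (dist w u₀)) :=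
      tendsto_const_nhds.dist hu
    have h1 := ((hdw.sub hzero).const_mul c).mul hdw
    have h2 := ((hG.tendsto u₀).comp hu).sub_const (G w)
    have := le_of_tendsto_of_tendsto' h1 h2 fun n => hle (φ n)
    linarith
  refine ⟨a₀, ha₀, b₀, hb₀, btw_of_tendsto hla tendsto_const_nhds hlb
    (Eventually.of_forall fun n => hab (φ n)), fun z hz => ?_, hineq a a₀ hla haG,
    hineq b b₀ hlb hbG⟩
  obtain ⟨t, -, -, rfl⟩ := Btw.exists_pt hz
  have hlim2 : Tendsto (fun n => infDist (pt (a (φ n)) (b (φ n)) t) D) atTop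
      (nhds (infDist (pt a₀ b₀ t) D)) :=
    ((continuous_infDist_pt D).tendsto _).comp (Tendsto.pt hla hlb tendsto_const_nhds)
  have hle : infDist (pt a₀ b₀ t) D ≤ 0 :=
    le_of_tendsto_of_tendsto' hlim2 hzero fun n => habD (φ n) t
  exact (h.compact.isClosed.mem_iff_infDist_zero ⟨w, hw.1⟩).mpr (le_antisymm hle infDist_nonneg)

/-- A strongly convex function on a membrane bounded by finitely many sides is
controlled by its values at the vertices. -/
theorem le_of_vertices_strong {ι : Type*} [Finite ι] {S : ι → Set X} (hS : ∀ i, IsClosed (S i))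
    (hTS : T = ⋃ i, S i) (hside : ∀ i, ∀ a ∈ S i, ∀ b ∈ S i, seg a b ⊆ D → seg a b ⊆ S i)
    {G : X → ℝ} (hG : Continuous G) {c : ℝ} (hc0 : 0 < c) (hGc : SConv c G) {A : ℝ}
    (hA : ∀ i j, i ≠ j → ∀ x ∈ S i, x ∈ S j → G x ≤ A) : ∀ x ∈ D, G x ≤ A := by
  intro x hx
  obtain ⟨z, hz, hmax⟩ := h.compact.exists_isMaxOn ⟨x, hx⟩ hG.continuousOn
  refine (hmax hx).trans ?_
  show G z ≤ A
  have hzT : z ∈ T := by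
    by_contra hzT
    obtain ⟨a, ha, b, hb, -, -, hGa, -⟩ := exists_chord H h ⟨hz, hzT⟩ hG hc0 hGc
    have h1 : G a ≤ G z := hmax (h.subset ha)
    have h2 : 0 < dist z a := dist_pos.mpr fun he => hzT (he ▸ ha)
    have h3 : 0 < c * dist z a ^ 2 := by positivity
    linarith
  obtain ⟨i, hi⟩ := mem_iUnion.mp (hTS ▸ hzT)
  by_contra hcon
  have honly : ∀ j, j ≠ i → z ∉ S j := fun j hj hzj => hcon (hA j i hj z hzj hi)
  have hopen : IsOpen (⋂ j ∈ {j | j ≠ i}, (S j)ᶜ) :=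
    (Set.toFinite {j | j ≠ i}).isOpen_biInter fun j _ => (hS j).isOpen_compl
  obtain ⟨ε, hε, hball⟩ := Metric.isOpen_iff.mp hopen z (mem_iInter₂.mpr honly)
  have hin : ∀ y ∈ T, dist z y < ε → y ∈ S i := by
    intro y hy hd
    obtain ⟨j, hj⟩ := mem_iUnion.mp (hTS ▸ hy)
    by_cases hji : j = i
    · exact hji ▸ hj
    · exact absurd hj (mem_iInter₂.mp (hball (by rw [mem_ball, dist_comm]; exact hd)) j hji)
  have hη : 0 < c * (ε / 2) ^ 2 := by positivity
  obtain ⟨ρ, hρ, hGρ⟩ := Metric.continuousAt_iff.mp (hG.continuousAt (x := z)) _ hη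
  obtain ⟨w, hw, hdw⟩ := h.exists_near hzT (lt_min hρ (half_pos hε))
  obtain ⟨a, ha, b, hb, hab, hD, hGa, hGb⟩ := exists_chord H h hw hG hc0 hGc
  have hGw : G z - G w < c * (ε / 2) ^ 2 := by
    have := hGρ (x := w) (by rw [dist_comm]; exact hdw.trans_le (min_le_left _ _))
    rw [Real.dist_eq, abs_lt] at this
    linarith
  have short : ∀ e ∈ T, c * dist w e ^ 2 ≤ G e - G w → e ∈ S i := by
    intro e he hGe
    refine hin e he ?_
    have h1 : G e ≤ G z := hmax (h.subset he)
    have h2 : dist w e ^ 2 < (ε / 2) ^ 2 := lt_of_mul_lt_mul_left (by linarith) hc0.le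
    have h3 : dist w e < ε / 2 := lt_of_pow_lt_pow_left₀ 2 (half_pos hε).le h2
    have h4 := hdw.trans_le (min_le_right _ _)
    linarith [dist_triangle z w e]
  exact hw.2 (hTS ▸ mem_iUnion.mpr ⟨i, hside i a (short a ha hGa) b (short b hb hGb) hD hab⟩)

theorem le_of_vertices {ι : Type*} [Finite ι] {S : ι → Set X} (hS : ∀ i, IsClosed (S i))
    (hTS : T = ⋃ i, S i) (hside : ∀ i, ∀ a ∈ S i, ∀ b ∈ S i, seg a b ⊆ D → seg a b ⊆ S i)
    {G : X → ℝ} (hG : Continuous G) (hGc : SConv 0 G) {A : ℝ}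
    (hA : ∀ i j, i ≠ j → ∀ x ∈ S i, x ∈ S j → G x ≤ A) : ∀ x ∈ D, G x ≤ A := by
  intro x hx
  have hdc : Continuous fun y : X => dist x y := continuous_const.dist continuous_id
  obtain ⟨K, hK⟩ := (h.compact.image hdc).bddAbove
  refine le_of_forall_pos_le_add fun η hη => ?_
  set k := η / (K ^ 2 + 1)
  have hk : 0 < k := by positivity
  have hkK : k * K ^ 2 ≤ η := by
    have : k * (K ^ 2 + 1) = η := div_mul_cancel₀ η (by positivity)
    linarith
  have hconv : SConv k fun y => G y + k * dist x y ^ 2 := by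
    have := hGc.add ((sConv_sq x).const_mul hk.le)
    rwa [mul_one, zero_add] at this
  have := le_of_vertices_strong H h hS hTS hside (hG.add ((hdc.pow 2).const_mul k)) hk hconv
    (A := A + η) ?_ x hx
  · simpa using this
  · intro i j hij y hyi hyj
    have hyD : y ∈ D := h.subset (hTS ▸ mem_iUnion.mpr ⟨i, hyi⟩)
    have h1 : dist x y ≤ K := hK (mem_image_of_mem _ hyD)
    have h2 : dist x y ^ 2 ≤ K ^ 2 := pow_le_pow_left₀ dist_nonneg h1 2
    have h3 := mul_le_mul_of_nonneg_left h2 hk.le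
    show G y + k * dist x y ^ 2 ≤ A + η
    linarith [hA i j hij y hyi hyj]

end Membrane

end Chord

section Loops

variable {X : Type*} [MetricSpace X]

theorem log_increment_unique {θ θ' : ℝ → ℂ} {a b : ℝ} (hab : a ≤ b) (h : ContinuousOn θ (Icc a b))
    (h' : ContinuousOn θ' (Icc a b))
    (he : ∀ t ∈ Icc a b, Complex.exp (θ t) = Complex.exp (θ' t)) :
    θ b - θ a = θ' b - θ' a := by
  have hdiff : ∀ t ∈ Icc a b, ∃ n : ℤ, θ t - θ' t = n * (2 * Real.pi * Complex.I) := fun t ht => by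
    obtain ⟨n, hn⟩ := Complex.exp_eq_exp_iff_exists_int.mp (he t ht)
    exact ⟨n, by rw [hn]; ring⟩
  let T : Set ℝ := range ((↑) : ℤ → ℝ)
  have : DiscreteTopology T :=
    (Int.isClosedEmbedding_coe_real.isEmbedding.toHomeomorph).symm.isEmbedding.discreteTopology
  have hpi : (2 * Real.pi) ≠ 0 := by positivity
  have him : ∀ (n : ℤ), ((n : ℂ) * (2 * Real.pi * Complex.I)).im / (2 * Real.pi) = n := fun n => by
    have : ((n : ℂ) * (2 * Real.pi * Complex.I)).im = n * (2 * Real.pi) := by simp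
    rw [this]; field_simp
  have hc : ContinuousOn (fun t => (θ t - θ' t).im / (2 * Real.pi)) (Icc a b) :=
    (Complex.continuous_im.comp_continuousOn (h.sub h')).div_const _
  have hm : MapsTo (fun t => (θ t - θ' t).im / (2 * Real.pi)) (Icc a b) T := fun t ht => by
    obtain ⟨n, hn⟩ := hdiff t ht
    exact ⟨n, by simp only [hn, him]⟩
  have key := isPreconnected_Icc.constant_of_mapsTo ⟨this⟩ hc hm (left_mem_Icc.mpr hab)
    (right_mem_Icc.mpr hab)
  obtain ⟨n, hn⟩ := hdiff a (left_mem_Icc.mpr hab)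
  obtain ⟨k, hk⟩ := hdiff b (right_mem_Icc.mpr hab)
  simp only [hn, hk, him] at key
  have hnk : n = k := by exact_mod_cast key
  subst hnk
  linear_combination hk - hn

theorem continuousOn_image_of_comp {Y : Type*} [TopologicalSpace Y] {γ : ℝ → X} {K : Set ℝ}
    (hK : IsCompact K) (hγ : ContinuousOn γ K) {F : X → Y} (hF : ContinuousOn (F ∘ γ) K) :
    ContinuousOn F (γ '' K) := by
  rw [continuousOn_iff_isClosed]
  intro t ht
  obtain ⟨u, hu, hut⟩ := (continuousOn_iff_isClosed.mp hF) t ht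
  refine ⟨γ '' (u ∩ K), ((hK.inter_left hu).image_of_continuousOn
    (hγ.mono inter_subset_right)).isClosed, ?_⟩
  ext x
  constructor
  · rintro ⟨hx, s, hs, rfl⟩
    exact ⟨⟨s, by rw [← hut]; exact ⟨hx, hs⟩, rfl⟩, s, hs, rfl⟩
  · rintro ⟨⟨s, hs, rfl⟩, -⟩
    rw [← hut] at hs
    exact ⟨hs.1, s, hs.2, rfl⟩

namespace SCC

variable (γ : SCC X)

theorem isCompact_img : IsCompact γ.img := isCompact_Icc.image_of_continuousOn γ.contOn

theorem exists_wrap_of_mem_Ioo {t₀ : ℝ} (ht₀ : t₀ ∈ Ioo (0 : ℝ) 1) {ε : ℝ} (hε : 0 < ε) :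
    ∃ m : X → ℂ, ContinuousOn m γ.img ∧ (∀ x ∈ γ.img, m x ≠ 0) ∧
    (∀ x ∈ γ.img, ε ≤ dist (γ.toFun t₀) x → m x = 1) ∧ ¬ HasLog m γ.img := by
  obtain ⟨ζ, hζ, hball⟩ := Metric.continuousWithinAt_iff.mp (γ.contOn t₀ ⟨ht₀.1.le, ht₀.2.le⟩) ε hε
  obtain ⟨η, hη, hη1, hη2, hη3⟩ : ∃ η > 0, η < ζ ∧ η < t₀ ∧ η < 1 - t₀ := by
    refine ⟨min ζ (min t₀ (1 - t₀)) / 2, ?_, ?_, ?_, ?_⟩ <;>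
    [have h1 := ht₀.1; have h1 := ht₀.1; have h1 := ht₀.1; have h1 := ht₀.1] <;>
    have h2 := ht₀.2 <;>
    have h3 : 0 < min ζ (min t₀ (1 - t₀)) := lt_min hζ (lt_min h1 (by linarith)) <;>
    have h4 : min ζ (min t₀ (1 - t₀)) ≤ ζ := min_le_left _ _ <;>
    have h5 : min ζ (min t₀ (1 - t₀)) ≤ t₀ := (min_le_right _ _).trans (min_le_left _ _) <;>
    have h6 : min ζ (min t₀ (1 - t₀)) ≤ 1 - t₀ := (min_le_right _ _).trans (min_le_right _ _) <;>
    linarith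
  let u : ℝ → ℝ := fun t => max 0 (min 1 ((t - (t₀ - η)) / (2 * η)))
  have huc : Continuous u := by fun_prop
  have hu0 : ∀ t ≤ t₀ - η, u t = 0 := fun t ht =>
    max_eq_left ((min_le_right _ _).trans (div_nonpos_of_nonpos_of_nonneg (by linarith)
      (by linarith)))
  have hu1 : ∀ t, t₀ + η ≤ t → u t = 1 := fun t ht => by
    have : 1 ≤ (t - (t₀ - η)) / (2 * η) := by rw [le_div_iff₀ (by linarith)]; linarith
    simp only [u, min_eq_left this]
    norm_num
  let e : ℝ → ℂ := fun t => Complex.exp (2 * Real.pi * Complex.I * u t)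
  have hec : Continuous e := by fun_prop
  have he0 : ∀ t ≤ t₀ - η, e t = 1 := fun t ht => by simp [e, hu0 t ht]
  have he1 : ∀ t, t₀ + η ≤ t → e t = 1 := fun t ht => by
    simp [e, hu1 t ht, Complex.exp_two_pi_mul_I]
  have hm : ∀ t ∈ Icc (0 : ℝ) 1, e (Function.invFunOn γ.toFun (Ico 0 1) (γ.toFun t)) = e t := by
    intro t ht
    rcases ht.2.lt_or_eq with h | h
    · rw [(γ.inj.leftInvOn_invFunOn) ⟨ht.1, h⟩]
    · have h0 : (0 : ℝ) ∈ Ico (0 : ℝ) 1 := ⟨le_rfl, one_pos⟩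
      rw [h, ← γ.loop, (γ.inj.leftInvOn_invFunOn) h0, he0 0 (by linarith), he1 1 (by linarith)]
  refine ⟨fun x => e (Function.invFunOn γ.toFun (Ico 0 1) x), ?_, fun _ _ => Complex.exp_ne_zero _,
    ?_, ?_⟩
  · exact continuousOn_image_of_comp isCompact_Icc γ.contOn
      (hec.continuousOn.congr fun t ht => hm t ht)
  · rintro x ⟨t, ht, rfl⟩ hd
    simp only
    rw [hm t ht]
    by_contra hne
    have h1 : t₀ - η < t := by by_contra h; exact hne (he0 t (not_lt.mp h))
    have h2 : t < t₀ + η := by by_contra h; exact hne (he1 t (not_lt.mp h))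
    have := hball ht (by rw [Real.dist_eq, abs_lt]; constructor <;> linarith)
    rw [dist_comm] at this
    linarith
  · rintro ⟨θ, hθ, hexp⟩
    have := log_increment_unique (θ := θ ∘ γ.toFun)
      (θ' := fun t => 2 * Real.pi * Complex.I * u t) zero_le_one
      (hθ.comp γ.contOn (mapsTo_image _ _)) (by fun_prop)
      (fun t ht => by
        rw [Function.comp, hexp _ ⟨t, ht, rfl⟩]
        exact hm t ht)
    simp only [Function.comp, γ.loop, sub_self, hu0 0 (by linarith), hu1 1 (by linarith)] at this
    simp [Real.pi_ne_zero] at this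

theorem circleLike : CircleLike γ.img where
  compact := γ.isCompact_img
  wrap := by
    have key : ∀ t ∈ Icc (0 : ℝ) 1, ∀ ε > 0, ∃ t' ∈ Ioo (0 : ℝ) 1,
        dist (γ.toFun t) (γ.toFun t') < ε := by
      intro t ht ε hε
      obtain ⟨ζ, hζ, hball⟩ := Metric.continuousWithinAt_iff.mp (γ.contOn t ht) ε hε
      have : t ∈ closure (Ioo (0 : ℝ) 1) := by rw [closure_Ioo zero_ne_one]; exact ht
      obtain ⟨t', ht', hd⟩ := Metric.mem_closure_iff.mp this ζ hζ
      exact ⟨t', ht', by rw [dist_comm]; exact hball ⟨ht'.1.le, ht'.2.le⟩ (by rwa [dist_comm])⟩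
    rintro z ⟨t, ht, rfl⟩ ε hε
    obtain ⟨t', ht', hd⟩ := key t ht (ε / 2) (half_pos hε)
    obtain ⟨m, h1, h2, h3, h4⟩ := γ.exists_wrap_of_mem_Ioo ht' (half_pos hε)
    refine ⟨m, h1, h2, fun x hx hdx => h3 x hx ?_, h4⟩
    linarith [dist_triangle (γ.toFun t) (γ.toFun t') x]

/-- A simple closed curve cannot be decomposed into two closed sets meeting in a single point. -/
theorem subset_singleton_of_union {A B : Set X} {x : X} (hA : IsClosed A) (hB : IsClosed B)
    (hT : γ.img = A ∪ B) (hx : A ∩ B ⊆ {x}) : A ⊆ {x} ∨ B ⊆ {x} := by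
  have hpre : ∀ t₀ ∈ Icc (0 : ℝ) 1, IsPreconnected (γ.img \ {γ.toFun t₀}) := by
    have main : ∀ t₀ ∈ Ico (0 : ℝ) 1, IsPreconnected (γ.img \ {γ.toFun t₀}) := by
      intro t₀ ht₀
      have hc : ContinuousOn γ.toFun (Icc 0 1) := γ.contOn
      rcases ht₀.1.eq_or_lt with h0 | h0
      · have : γ.img \ {γ.toFun t₀} = γ.toFun '' Ioo 0 1 := by
          ext y
          constructor
          · rintro ⟨⟨t, ht, rfl⟩, hne⟩
            refine ⟨t, ⟨ht.1.lt_of_ne ?_, ht.2.lt_of_ne ?_⟩, rfl⟩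
            · rintro rfl; exact hne (by rw [mem_singleton_iff, h0])
            · rintro rfl; exact hne (by rw [mem_singleton_iff, ← h0, γ.loop])
          · rintro ⟨t, ht, rfl⟩
            refine ⟨⟨t, ⟨ht.1.le, ht.2.le⟩, rfl⟩, fun h => ?_⟩
            have := γ.inj ⟨ht.1.le, ht.2⟩ ht₀ h
            linarith [ht.1]
        rw [this]
        exact isPreconnected_Ioo.image _ (hc.mono Ioo_subset_Icc_self)
      · have : γ.img \ {γ.toFun t₀} = γ.toFun '' Ico 0 t₀ ∪ γ.toFun '' Ioc t₀ 1 := by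
          ext y
          constructor
          · rintro ⟨⟨t, ht, rfl⟩, hne⟩
            rcases lt_trichotomy t t₀ with h | h | h
            · exact Or.inl ⟨t, ⟨ht.1, h⟩, rfl⟩
            · exact absurd (by rw [h]; rfl) hne
            · exact Or.inr ⟨t, ⟨h, ht.2⟩, rfl⟩
          · rintro (⟨t, ht, rfl⟩ | ⟨t, ht, rfl⟩)
            · refine ⟨⟨t, ⟨ht.1, ht.2.le.trans ht₀.2.le⟩, rfl⟩, fun h => ?_⟩
              have := γ.inj ⟨ht.1, ht.2.trans ht₀.2⟩ ht₀ h
              linarith [ht.2]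
            · refine ⟨⟨t, ⟨ht₀.1.trans ht.1.le, ht.2⟩, rfl⟩, fun h => ?_⟩
              rcases ht.2.eq_or_lt with h1 | h1
              · rw [mem_singleton_iff, h1, ← γ.loop] at h
                have := γ.inj ⟨le_rfl, one_pos⟩ ht₀ h
                linarith
              · have := γ.inj ⟨ht₀.1.trans ht.1.le, h1⟩ ht₀ h
                linarith [ht.1]
        rw [this]
        refine IsPreconnected.union (γ.toFun 0) ⟨0, ⟨le_rfl, h0⟩, rfl⟩ ⟨1, ⟨ht₀.2, le_rfl⟩, γ.loop.symm⟩
          (isPreconnected_Ico.image _ (hc.mono fun t ht => ⟨ht.1, ht.2.le.trans ht₀.2.le⟩))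
          (isPreconnected_Ioc.image _ (hc.mono fun t ht => ⟨ht₀.1.trans ht.1.le, ht.2⟩))
    intro t₀ ht₀
    rcases ht₀.2.eq_or_lt with h | h
    · rw [h, ← γ.loop]; exact main 0 ⟨le_rfl, one_pos⟩
    · exact main t₀ ⟨ht₀.1, h⟩
  have hpre' : IsPreconnected (γ.img \ {x}) := by
    by_cases hxT : x ∈ γ.img
    · obtain ⟨t, ht, rfl⟩ := hxT; exact hpre t ht
    · rw [sdiff_singleton_eq_self hxT]
      exact isPreconnected_Icc.image _ γ.contOn
  by_contra hcon
  rw [not_or] at hcon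
  obtain ⟨a, ha, hax⟩ := not_subset.mp hcon.1
  obtain ⟨b, hb, hbx⟩ := not_subset.mp hcon.2
  have := isPreconnected_closed_iff.mp hpre' A B hA hB (by rw [hT]; exact sdiff_subset)
    ⟨a, ⟨by rw [hT]; exact Or.inl ha, hax⟩, ha⟩ ⟨b, ⟨by rw [hT]; exact Or.inr hb, hbx⟩, hb⟩
  obtain ⟨y, ⟨_, hy⟩, hyAB⟩ := this
  exact hy (hx hyAB)

theorem not_subset_singleton (x : X) : ¬ γ.img ⊆ {x} := fun h => by
  have h1 : γ.toFun 0 = x := h ⟨0, ⟨le_rfl, zero_le_one⟩, rfl⟩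
  have h2 : γ.toFun (1 / 2) = x := h ⟨1 / 2, by norm_num, rfl⟩
  have := γ.inj (by norm_num) (by norm_num : (1 / 2 : ℝ) ∈ Ico (0 : ℝ) 1) (h1.trans h2.symm)
  norm_num at this

end SCC

/-- `A` is a simple arc from `x` to `y`. -/
def IsArc (A : Set X) (x y : X) : Prop :=
  ∃ f : ℝ → X, ContinuousOn f (Icc 0 1) ∧ InjOn f (Icc 0 1) ∧ f 0 = x ∧ f 1 = y ∧ f '' Icc 0 1 = A

namespace IsArc

variable {A B : Set X} {x y z : X}

theorem isCompact (h : IsArc A x y) : IsCompact A := by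
  obtain ⟨f, hc, -, -, -, rfl⟩ := h
  exact isCompact_Icc.image_of_continuousOn hc

theorem isPreconnected (h : IsArc A x y) : IsPreconnected A := by
  obtain ⟨f, hc, -, -, -, rfl⟩ := h
  exact isPreconnected_Icc.image _ hc

theorem left_mem (h : IsArc A x y) : x ∈ A := by
  obtain ⟨f, -, -, rfl, -, rfl⟩ := h
  exact ⟨0, by norm_num, rfl⟩

theorem right_mem (h : IsArc A x y) : y ∈ A := by
  obtain ⟨f, -, -, -, rfl, rfl⟩ := h
  exact ⟨1, by norm_num, rfl⟩

theorem symm (h : IsArc A x y) : IsArc A y x := by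
  obtain ⟨f, hc, hi, h0, h1, rfl⟩ := h
  have hm : MapsTo (fun t : ℝ => 1 - t) (Icc 0 1) (Icc 0 1) := fun t ht =>
    ⟨by linarith [ht.2], by linarith [ht.1]⟩
  refine ⟨fun t => f (1 - t), hc.comp (by fun_prop) hm, ?_, by simpa using h1, by simpa using h0, ?_⟩
  · intro s hs t ht h
    have := hi (hm hs) (hm ht) h
    linarith
  · ext y
    constructor
    · rintro ⟨t, ht, rfl⟩
      exact ⟨1 - t, hm ht, rfl⟩
    · rintro ⟨t, ht, rfl⟩
      exact ⟨1 - t, hm ht, by simp⟩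

theorem of_Icc {f : ℝ → X} {a b : ℝ} (hab : a < b) (hc : ContinuousOn f (Icc a b))
    (hi : InjOn f (Icc a b)) : IsArc (f '' Icc a b) (f a) (f b) := by
  have hm : MapsTo (fun t : ℝ => a + t * (b - a)) (Icc 0 1) (Icc a b) := fun t ht =>
    ⟨by nlinarith [ht.1], by nlinarith [ht.2]⟩
  refine ⟨fun t => f (a + t * (b - a)), hc.comp (by fun_prop) hm, ?_, by simp, by simp, ?_⟩
  · intro s hs t ht h
    have := hi (hm hs) (hm ht) h
    have h2 : (s - t) * (b - a) = 0 := by linarith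
    rcases mul_eq_zero.mp h2 with h | h <;> linarith
  · ext y
    constructor
    · rintro ⟨t, ht, rfl⟩
      exact ⟨_, hm ht, rfl⟩
    · rintro ⟨t, ht, rfl⟩
      refine ⟨(t - a) / (b - a), ⟨div_nonneg (by linarith [ht.1]) (by linarith), ?_⟩, ?_⟩
      · rw [div_le_one (by linarith)]; linarith [ht.2]
      · have : b - a ≠ 0 := by linarith
        simp only
        congr 1
        field_simp
        ring

/-- Two functions on consecutive intervals glue to a function on the union. -/
theorem exists_glue (hA : IsArc A x y) (hB : IsArc B y z) : ∃ f : ℝ → X, ContinuousOn f (Icc 0 2) ∧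
    InjOn f (Icc 0 1) ∧ InjOn f (Icc 1 2) ∧ f 0 = x ∧ f 1 = y ∧ f 2 = z ∧ f '' Icc 0 1 = A ∧
    f '' Icc 1 2 = B := by
  classical
  obtain ⟨f, hfc, hfi, f0, f1, rfl⟩ := hA
  obtain ⟨g, hgc, hgi, g0, g1, rfl⟩ := hB
  let k : ℝ → X := fun t => if t ≤ 1 then f t else g (t - 1)
  have kf : ∀ t ∈ Icc (0 : ℝ) 1, k t = f t := fun t ht => if_pos ht.2
  have kg : ∀ t ∈ Icc (1 : ℝ) 2, k t = g (t - 1) := fun t ht => by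
    rcases ht.1.eq_or_lt with h | h
    · rw [kf t ⟨by linarith, by linarith⟩, ← h, f1, sub_self, g0]
    · exact if_neg (not_le.mpr h)
  have hm : MapsTo (fun t : ℝ => t - 1) (Icc 1 2) (Icc 0 1) := fun t ht =>
    ⟨by linarith [ht.1], by linarith [ht.2]⟩
  have hcg : ContinuousOn (fun t : ℝ => g (t - 1)) (Icc 1 2) := hgc.comp (by fun_prop) hm
  refine ⟨k, ?_, ?_, ?_, ?_, ?_, ?_, ?_, ?_⟩
  · have : Icc (0 : ℝ) 2 = Icc 0 1 ∪ Icc 1 2 := (Icc_union_Icc_eq_Icc (by norm_num) (by norm_num)).symm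
    rw [this]
    exact (hfc.congr kf).union_of_isClosed (hcg.congr kg) isClosed_Icc isClosed_Icc
  · exact hfi.congr fun t ht => (kf t ht).symm
  · intro s hs t ht h
    rw [kg s hs, kg t ht] at h
    have := hgi (hm hs) (hm ht) h
    linarith
  · rw [kf 0 (by norm_num), f0]
  · rw [kf 1 (by norm_num), f1]
  · rw [kg 2 (by norm_num)]; norm_num [g1]
  · exact image_congr kf
  · rw [image_congr kg]
    ext y
    constructor
    · rintro ⟨t, ht, rfl⟩
      exact ⟨_, hm ht, rfl⟩
    · rintro ⟨t, ht, rfl⟩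
      exact ⟨t + 1, ⟨by linarith [ht.1], by linarith [ht.2]⟩, by simp⟩

theorem trans (hA : IsArc A x y) (hB : IsArc B y z) (hAB : A ∩ B ⊆ {y}) : IsArc (A ∪ B) x z := by
  obtain ⟨f, hc, hi1, hi2, h0, h1, h2, rfl, rfl⟩ := hA.exists_glue hB
  have : Icc (0 : ℝ) 2 = Icc 0 1 ∪ Icc 1 2 := (Icc_union_Icc_eq_Icc (by norm_num) (by norm_num)).symm
  rw [← h0, ← h2, ← image_union, ← this]
  refine of_Icc (by norm_num) hc ?_
  have key : ∀ s ∈ Icc (0 : ℝ) 1, ∀ t ∈ Icc (1 : ℝ) 2, f s = f t → s = t := by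
    intro s hs t ht h
    have hy : f s = y := hAB ⟨⟨s, hs, rfl⟩, ⟨t, ht, h.symm⟩⟩
    have e1 := hi1 hs (by norm_num : (1 : ℝ) ∈ Icc (0 : ℝ) 1) (hy.trans h1.symm)
    have e2 := hi2 ht (by norm_num : (1 : ℝ) ∈ Icc (1 : ℝ) 2) ((h.symm.trans hy).trans h1.symm)
    rw [e1, e2]
  intro s hs t ht h
  rw [this] at hs ht
  rcases hs with hs | hs <;> rcases ht with ht | ht
  · exact hi1 hs ht h
  · exact key s hs t ht h
  · exact (key t ht s hs h.symm).symm
  · exact hi2 hs ht h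

/-- Two arcs with only their endpoints in common form a simple closed curve. -/
theorem exists_scc (hA : IsArc A x y) (hB : IsArc B x y) (hAB : A ∩ B ⊆ {x, y}) :
    ∃ γ : SCC X, γ.img = A ∪ B := by
  obtain ⟨f, hc, hi1, hi2, h0, h1, h2, rfl, rfl⟩ := hA.exists_glue hB.symm
  have hm : MapsTo (fun t : ℝ => 2 * t) (Icc 0 1) (Icc 0 2) := fun t ht =>
    ⟨by linarith [ht.1], by linarith [ht.2]⟩
  have key : ∀ s ∈ Icc (0 : ℝ) 1, ∀ t ∈ Ico (1 : ℝ) 2, f s = f t → s = t := by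
    intro s hs t ht h
    have ht' : t ∈ Icc (1 : ℝ) 2 := ⟨ht.1, ht.2.le⟩
    rcases hAB ⟨⟨s, hs, rfl⟩, ⟨t, ht', h.symm⟩⟩ with hy | hy
    · have e2 := hi2 ht' (by norm_num : (2 : ℝ) ∈ Icc (1 : ℝ) 2) ((h.symm.trans hy).trans h2.symm)
      linarith [ht.2]
    · have e1 := hi1 hs (by norm_num : (1 : ℝ) ∈ Icc (0 : ℝ) 1) (hy.trans h1.symm)
      have e2 := hi2 ht' (by norm_num : (1 : ℝ) ∈ Icc (1 : ℝ) 2) ((h.symm.trans hy).trans h1.symm)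
      rw [e1, e2]
  refine ⟨⟨fun t => f (2 * t), hc.comp (by fun_prop) hm, ?_, ?_⟩, ?_⟩
  · norm_num [h0, h2]
  · intro s hs t ht h
    have : 2 * s = 2 * t := by
      rcases le_total (2 * s) 1 with h1 | h1 <;> rcases le_total (2 * t) 1 with h2 | h2
      · exact hi1 ⟨by linarith [hs.1], h1⟩ ⟨by linarith [ht.1], h2⟩ h
      · exact key _ ⟨by linarith [hs.1], h1⟩ _ ⟨h2, by linarith [ht.2]⟩ h
      · exact (key _ ⟨by linarith [ht.1], h2⟩ _ ⟨h1, by linarith [hs.2]⟩ h.symm).symm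
      · exact hi2 ⟨h1, by linarith [hs.2]⟩ ⟨h2, by linarith [ht.2]⟩ h
    linarith
  · rw [← image_union, Icc_union_Icc_eq_Icc (by norm_num) (by norm_num)]
    ext y
    constructor
    · rintro ⟨t, ht, rfl⟩
      exact ⟨_, hm ht, rfl⟩
    · rintro ⟨t, ht, rfl⟩
      exact ⟨t / 2, ⟨by linarith [ht.1], by linarith [ht.2]⟩, by simp only; congr 1; ring⟩

theorem exists_scc_triangle {C : Set X} (hA : IsArc A x y) (hB : IsArc B y z) (hC : IsArc C x z)
    (hAB : A ∩ B ⊆ {y}) (hAC : A ∩ C ⊆ {x}) (hBC : B ∩ C ⊆ {z}) :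
    ∃ γ : SCC X, γ.img = A ∪ B ∪ C :=
  (hA.trans hB hAB).exists_scc hC <| by
    rintro u ⟨hu | hu, hC⟩
    · exact Or.inl (hAC ⟨hu, hC⟩)
    · exact Or.inr (hBC ⟨hu, hC⟩)

end IsArc

theorem isArc_seg [CAT0 X] {x y : X} (h : x ≠ y) : IsArc (seg x y) x y := by
  rw [seg_eq_image]
  have hc : Continuous fun t => pt x y t := Continuous.pt continuous_const continuous_const continuous_id
  refine ⟨fun t => pt x y t, hc.continuousOn, ?_, pt_zero x y, pt_one x y, rfl⟩
  intro s hs t ht he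
  have h1 := dist_left_pt x y hs.1 hs.2
  have h2 := dist_left_pt x y ht.1 ht.2
  simp only at he
  rw [he, h2] at h1
  exact (mul_right_cancel₀ (dist_pos.mpr h).ne' h1).symm

end Loops

section Homology

open unitInterval

/-- The function `f` on the unit interval has a continuous logarithm with total increment `c`. -/
def LogIncrement (f : unitInterval → ℂ) (c : ℂ) : Prop :=
  ∃ θ : unitInterval → ℂ, Continuous θ ∧ (∀ t, Complex.exp (θ t) = f t) ∧ θ 1 - θ 0 = c

theorem LogIncrement.unique {f : unitInterval → ℂ} {c c' : ℂ} (h : LogIncrement f c)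
    (h' : LogIncrement f c') : c = c' := by
  obtain ⟨θ, hc, he, rfl⟩ := h
  obtain ⟨θ', hc', he', rfl⟩ := h'
  have := log_increment_unique (θ := IccExtend zero_le_one θ) (θ' := IccExtend zero_le_one θ')
    zero_le_one (hc.Icc_extend' (h := zero_le_one)).continuousOn
    (hc'.Icc_extend' (h := zero_le_one)).continuousOn
    (fun t ht => by rw [IccExtend_of_mem _ _ ht, IccExtend_of_mem _ _ ht, he, he'])
  simpa using this

theorem LogIncrement.const {f : unitInterval → ℂ} {a : ℂ} (ha : a ≠ 0) (hf : ∀ t, f t = a) :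
    LogIncrement f 0 :=
  ⟨fun _ => Complex.log a, continuous_const, fun t => by rw [hf, Complex.exp_log ha], sub_self _⟩

theorem LogIncrement.symm {f : unitInterval → ℂ} {c : ℂ} (h : LogIncrement f c) :
    LogIncrement (fun t => f (σ t)) (-c) := by
  obtain ⟨θ, hc, he, rfl⟩ := h
  exact ⟨fun t => θ (σ t), hc.comp continuous_symm, fun t => he _, by simp⟩

theorem exists_logIncrement {f : unitInterval → ℂ} (hf : Continuous f) (h0 : ∀ t, f t ≠ 0) :
    ∃ c, LogIncrement f c := by
  have key : HasLog (fun s : unitInterval => IccExtend zero_le_one f (s.1 * 1)) univ := by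
    refine HasLog.homotopy (h := fun (s : unitInterval) t => IccExtend zero_le_one f (s.1 * t)) isCompact_univ ?_ ?_ ?_
    · exact (hf.Icc_extend' (h := zero_le_one)).comp_continuousOn (by fun_prop)
    · intro s _ t _
      exact h0 _
    · simp only [mul_zero]
      exact hasLog_const (h0 _) _
  obtain ⟨θ, hc, he⟩ := key
  refine ⟨_, θ, continuousOn_univ.mp hc, fun t => ?_, rfl⟩
  rw [he t (mem_univ _)]
  simp only
  rw [mul_one, IccExtend_val]

theorem logIncrement_homotopy {h : unitInterval × unitInterval → ℂ} (hc : Continuous h)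
    (h0 : ∀ s, h s ≠ 0) {a b : ℂ} (ha : ∀ s, h (s, 0) = a) (hb : ∀ s, h (s, 1) = b) {c : ℂ}
    (hl : LogIncrement (fun t => h (0, t)) c) : LogIncrement (fun t => h (1, t)) c := by
  have key : HasLog (fun s : unitInterval × unitInterval =>
      h (projIcc 0 1 zero_le_one (s.1.1 * 1), projIcc 0 1 zero_le_one (s.2.1 * 1))) univ := by
    refine HasLog.homotopy (h := fun (s : unitInterval × unitInterval) t =>
      h (projIcc 0 1 zero_le_one (s.1.1 * t), projIcc 0 1 zero_le_one (s.2.1 * t)))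
      isCompact_univ ?_ ?_ ?_
    · refine (hc.comp (Continuous.prodMk ?_ ?_)).continuousOn
      · exact continuous_projIcc.comp (by fun_prop)
      · exact continuous_projIcc.comp (by fun_prop)
    · intro s _ t _
      exact h0 _
    · simp only [mul_zero]
      exact hasLog_const (h0 _) _
  obtain ⟨θ, hθ, he⟩ := key
  rw [continuousOn_univ] at hθ
  have he' : ∀ s t : unitInterval, Complex.exp (θ (s, t)) = h (s, t) := fun s t => by
    rw [he _ (mem_univ _)]
    simp only
    rw [mul_one, mul_one, projIcc_val, projIcc_val]
  have ha0 : a ≠ 0 := ha 0 ▸ h0 _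
  have hb0 : b ≠ 0 := hb 0 ▸ h0 _
  have e1 := LogIncrement.unique (c := θ (1, 0) - θ (0, 0))
    ⟨fun s => θ (s, 0), by fun_prop, fun s => he' s 0, rfl⟩ (LogIncrement.const ha0 ha)
  have e2 := LogIncrement.unique (c := θ (1, 1) - θ (0, 1))
    ⟨fun s => θ (s, 1), by fun_prop, fun s => he' s 1, rfl⟩ (LogIncrement.const hb0 hb)
  have e3 := LogIncrement.unique hl ⟨fun t => θ (0, t), by fun_prop, fun s => he' 0 s, rfl⟩
  refine ⟨fun t => θ (1, t), by fun_prop, fun s => he' 1 s, ?_⟩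
  rw [e3]
  linear_combination e2 - e1

theorem LogIncrement.trans {B : Type*} [TopologicalSpace B] {x y z : B} {p : Path x y}
    {q : Path y z} {m : B → ℂ} {c c' : ℂ} (h : LogIncrement (fun t => m (p t)) c)
    (h' : LogIncrement (fun t => m (q t)) c') : LogIncrement (fun t => m (p.trans q t)) (c + c') := by
  obtain ⟨θ, hc, he, rfl⟩ := h
  obtain ⟨θ', hc', he', rfl⟩ := h'
  have hy : Complex.exp (θ 1 - θ' 0) = 1 := by
    have h1 := he 1
    have h2 := he' 0
    simp only [Path.target, Path.source] at h1 h2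
    rw [Complex.exp_sub, h1, ← h2, div_self (Complex.exp_ne_zero _)]
  let P : Path (θ 0) (θ 1) := ⟨⟨θ, hc⟩, rfl, rfl⟩
  let Q : Path (θ 1) (θ' 1 + (θ 1 - θ' 0)) :=
    ⟨⟨fun t => θ' t + (θ 1 - θ' 0), by fun_prop⟩, by simp, rfl⟩
  have hP : ∀ t, Complex.exp (P t) = m (p t) := he
  have hQ : ∀ t, Complex.exp (Q t) = m (q t) := fun t => by
    change Complex.exp (θ' t + (θ 1 - θ' 0)) = _
    rw [Complex.exp_add, hy, mul_one, he']
  refine ⟨P.trans Q, (P.trans Q).continuous, fun t => ?_, ?_⟩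
  · simp only [Path.trans_apply]
    split_ifs
    · exact hP _
    · exact hQ _
  · rw [Path.target, Path.source]; ring

variable {X : Type*} [MetricSpace X]

/-- The path lies in the compact subset `K` of `E`, and every nonvanishing function on `K` has
zero logarithmic increment along it. -/
def TrivialIn {E : Set X} {x : E} (K : Set X) (p : Path x x) : Prop :=
  IsCompact K ∧ K ⊆ E ∧ (∀ t, (p t : X) ∈ K) ∧
    ∀ m : X → ℂ, ContinuousOn m K → (∀ x ∈ K, m x ≠ 0) → LogIncrement (fun t => m (p t)) 0

theorem continuous_comp_path {E K : Set X} {m : X → ℂ} (hm : ContinuousOn m K) {x y : E}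
    (p : Path x y) (hp : ∀ t, (p t : X) ∈ K) : Continuous fun t => m (p t) :=
  hm.comp_continuous (continuous_subtype_val.comp p.continuous) hp

theorem isCompact_path {E : Set X} {x y : E} (p : Path x y) :
    IsCompact (range fun t => (p t : X)) :=
  isCompact_range (continuous_subtype_val.comp p.continuous)

theorem exists_trivialIn_of_homotopic {E : Set X} {x : E} {p q : Path x x} {K : Set X}
    (h : TrivialIn K p) (hpq : p.Homotopic q) : ∃ K', TrivialIn K' q := by
  obtain ⟨hK, hKE, hp, hm⟩ := h
  obtain ⟨H⟩ := hpq
  have hHc : Continuous fun s => (H s : X) := continuous_subtype_val.comp H.continuous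
  refine ⟨K ∪ range fun s => (H s : X), hK.union (isCompact_range hHc), ?_, fun t => ?_, ?_⟩
  · rintro _ (hz | ⟨s, rfl⟩)
    exacts [hKE hz, (H s).2]
  · exact Or.inr ⟨(1, t), by simp⟩
  · intro m hmc hm0
    have h1 := hm m (hmc.mono subset_union_left) fun z hz => hm0 z (Or.inl hz)
    have := logIncrement_homotopy (h := fun s => m (H s)) (a := m x) (b := m x)
      (hmc.comp_continuous hHc fun s => Or.inr ⟨s, rfl⟩) (fun s => hm0 _ (Or.inr ⟨s, rfl⟩))
      (fun s => by simp) (fun s => by simp) (c := 0) (by simpa using h1)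
    simpa using this

theorem exists_trivialIn {E : Set X} {x : E} (p : Path x x) (h : loopClassH1 p = 1) :
    ∃ K, TrivialIn K p := by
  let P : FundamentalGroup E x → Prop := fun g => ∃ (q : Path x x) (K : Set X),
    FundamentalGroup.fromPath (X := TopCat.of E) ⟦q⟧ = g ∧ TrivialIn K q
  have hsurj : ∀ g : FundamentalGroup E x, ∃ q : Path x x,
      FundamentalGroup.fromPath (X := TopCat.of E) ⟦q⟧ = g := by
    intro g
    obtain ⟨q, hq⟩ := Quotient.exists_rep (FundamentalGroup.toPath (X := TopCat.of E) g)
    exact ⟨q, by rw [hq]⟩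
  have hmem : FundamentalGroup.fromPath (X := TopCat.of E) ⟦p⟧ ∈ commutator (FundamentalGroup E x) := by
    rw [← Abelianization.ker_of]
    exact h
  rw [commutator_eq_closure] at hmem
  have hP : P (FundamentalGroup.fromPath (X := TopCat.of E) ⟦p⟧) := by
    generalize FundamentalGroup.fromPath (X := TopCat.of E) ⟦p⟧ = g at hmem
    induction hmem using Subgroup.closure_induction with
    | mem g hg =>
      obtain ⟨g₁, g₂, rfl⟩ := hg
      obtain ⟨q₁, rfl⟩ := hsurj g₁
      obtain ⟨q₂, rfl⟩ := hsurj g₂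
      let r : Path x x := q₂.symm.trans (q₁.symm.trans (q₂.trans q₁))
      let K := (range fun t => (q₁ t : X)) ∪ (range fun t => (q₂ t : X))
      have m1 : ∀ t, (q₁ t : X) ∈ K := fun t => Or.inl ⟨t, rfl⟩
      have m2 : ∀ t, (q₂ t : X) ∈ K := fun t => Or.inr ⟨t, rfl⟩
      refine ⟨r, K, rfl, (isCompact_path q₁).union (isCompact_path q₂), ?_, ?_, ?_⟩
      · rintro _ (⟨t, rfl⟩ | ⟨t, rfl⟩) <;> exact Subtype.coe_prop _
      · intro t
        simp only [r, Path.trans_apply, Path.symm_apply]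
        split_ifs <;> first | exact m1 _ | exact m2 _
      · intro m hmc hm0
        obtain ⟨c₁, h1⟩ := exists_logIncrement (continuous_comp_path hmc q₁ m1)
          fun t => hm0 _ (m1 t)
        obtain ⟨c₂, h2⟩ := exists_logIncrement (continuous_comp_path hmc q₂ m2)
          fun t => hm0 _ (m2 t)
        have h1' : LogIncrement (fun t => m (q₁.symm t)) (-c₁) := h1.symm
        have h2' : LogIncrement (fun t => m (q₂.symm t)) (-c₂) := h2.symm
        have := h2'.trans (m := fun z : E => m z) (h1'.trans (m := fun z : E => m z)
          (h2.trans (m := fun z : E => m z) h1))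
        have e : -c₂ + (-c₁ + (c₂ + c₁)) = 0 := by ring
        rw [e] at this
        exact this
    | one =>
      refine ⟨Path.refl x, {(x : X)}, rfl, isCompact_singleton, by simp, by simp, ?_⟩
      intro m _ hm0
      exact LogIncrement.const (hm0 x rfl) fun t => by simp
    | mul g₁ g₂ _ _ h1 h2 =>
      obtain ⟨q₁, K₁, rfl, c1, s1, m1, l1⟩ := h1
      obtain ⟨q₂, K₂, rfl, c2, s2, m2, l2⟩ := h2
      refine ⟨q₂.trans q₁, K₁ ∪ K₂, rfl, c1.union c2, union_subset s1 s2, ?_, ?_⟩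
      · intro t
        simp only [Path.trans_apply]
        split_ifs
        exacts [Or.inr (m2 _), Or.inl (m1 _)]
      · intro m hmc hm0
        have := (l2 m (hmc.mono subset_union_right) fun z hz => hm0 z (Or.inr hz)).trans
          (m := fun z : E => m z)
          (l1 m (hmc.mono subset_union_left) fun z hz => hm0 z (Or.inl hz))
        rwa [add_zero] at this
    | inv g _ h1 =>
      obtain ⟨q₁, K₁, rfl, c1, s1, m1, l1⟩ := h1
      refine ⟨q₁.symm, K₁, rfl, c1, s1, fun t => m1 _, fun m hmc hm0 => ?_⟩
      have := (l1 m hmc hm0).symm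
      rwa [neg_zero] at this
  obtain ⟨q, K, hq, hK⟩ := hP
  refine exists_trivialIn_of_homotopic hK ?_
  exact Quotient.exact hq

theorem SCC.exists_fills {E : Set X} (hE : H1Trivial E) (γ : SCC X) (h : γ.img ⊆ E) :
    ∃ K, IsCompact K ∧ K ⊆ E ∧ γ.img ⊆ K ∧ Fills K γ.img := by
  obtain ⟨K, hK, hKE, hp, hm⟩ := exists_trivialIn (γ.pathIn E h) (hE _ _)
  have hp' : ∀ t ∈ Icc (0 : ℝ) 1, γ.toFun t ∈ K := fun t ht => hp ⟨t, ht⟩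
  refine ⟨K, hK, hKE, ?_, fun m hmc hm0 => ?_⟩
  · rintro _ ⟨t, ht, rfl⟩
    exact hp' t ht
  · obtain ⟨θ, hθ, he, h01⟩ := hm m hmc hm0
    let Θ : ℝ → ℂ := IccExtend zero_le_one θ
    have hΘ : ∀ t ∈ Icc (0 : ℝ) 1,
        Θ (Function.invFunOn γ.toFun (Ico 0 1) (γ.toFun t)) = Θ t := by
      intro t ht
      rcases ht.2.lt_or_eq with h | h
      · rw [(γ.inj.leftInvOn_invFunOn) ⟨ht.1, h⟩]
      · have h0 : (0 : ℝ) ∈ Ico (0 : ℝ) 1 := ⟨le_rfl, one_pos⟩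
        rw [h, ← γ.loop, (γ.inj.leftInvOn_invFunOn) h0]
        simp only [Θ, IccExtend_left, IccExtend_right]
        exact (sub_eq_zero.mp h01).symm
    refine ⟨fun x => Θ (Function.invFunOn γ.toFun (Ico 0 1) x), ?_, ?_⟩
    · exact continuousOn_image_of_comp isCompact_Icc γ.contOn
        ((hθ.Icc_extend' (h := zero_le_one)).continuousOn.congr fun t ht => hΘ t ht)
    · rintro _ ⟨t, ht, rfl⟩
      simp only
      rw [hΘ t ht]
      simp only [Θ]
      rw [IccExtend_of_mem _ _ ht, he]
      rfl

/-- A curve in a set with trivial first homology bounds a membrane in the set. -/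
theorem SCC.exists_membrane {E : Set X} (hE : H1Trivial E) (γ : SCC X) (h : γ.img ⊆ E) :
    ∃ D ⊆ E, Membrane D γ.img := by
  obtain ⟨K, hK, hKE, hT, hf⟩ := γ.exists_fills hE h
  obtain ⟨D, hD, hM⟩ := Cat2Cx.exists_membrane hK γ.circleLike hT hf
  exact ⟨D, hD.trans hKE, hM⟩

/-- A curve in a `CAT(0)` space bounds a membrane. -/
theorem SCC.exists_membrane_of_cat0 [CAT0 X] (γ : SCC X) : ∃ D, Membrane D γ.img := by
  have hc : Continuous fun q : X × ℝ => pt (γ.toFun 0) q.1 q.2 :=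
    Continuous.pt continuous_const continuous_fst continuous_snd
  let K := (fun q : X × ℝ => pt (γ.toFun 0) q.1 q.2) '' (γ.img ×ˢ Icc 0 1)
  have hK : IsCompact K := (γ.isCompact_img.prod isCompact_Icc).image hc
  have hf : Fills K γ.img := by
    intro m hmc hm0
    have := HasLog.homotopy (h := fun x t => m (pt (γ.toFun 0) x t)) γ.isCompact_img
      (hmc.comp hc.continuousOn fun q hq => ⟨q, hq, rfl⟩)
      (fun x hx t ht => hm0 _ ⟨(x, t), ⟨hx, ht⟩, rfl⟩) ?_
    · simpa only [pt_one] using this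
    · simp only [pt_zero]
      refine hasLog_const (hm0 _ ⟨(γ.toFun 0, 0), ⟨⟨0, by norm_num, rfl⟩, by norm_num⟩, ?_⟩) _
      exact pt_zero _ _
  obtain ⟨D, -, hM⟩ := Cat2Cx.exists_membrane hK γ.circleLike
    (fun x hx => ⟨(x, 1), ⟨hx, by norm_num⟩, pt_one _ _⟩) hf
  exact ⟨D, hM⟩

end Homology

section PathMetric

variable {X : Type*} [MetricSpace X] {E : Set X} {x y z : X}

/-- The extended-real infimum of the lengths of the paths in `E` joining two points. -/
noncomputable def pathEDist (E : Set X) (x y : X) : ENNReal :=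
  ⨅ g : {g : ℝ → X // IsPathIn E g x y}, eVariationOn g.1 (Icc 0 1)

theorem pathDistIn_eq (E : Set X) (x y : X) : pathDistIn E x y = (pathEDist E x y).toReal := rfl

theorem RectConnected.pathEDist_ne_top (hE : RectConnected E) (hx : x ∈ E) (hy : y ∈ E) :
    pathEDist E x y ≠ ⊤ := by
  obtain ⟨g, hg, ht⟩ := hE x hx y hy
  exact ne_top_of_le_ne_top ht (iInf_le (fun g : {g : ℝ → X // IsPathIn E g x y} =>
    eVariationOn g.1 (Icc 0 1)) ⟨g, hg⟩)

theorem edist_le_pathEDist (E : Set X) (x y : X) : edist x y ≤ pathEDist E x y := by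
  refine le_iInf fun g => ?_
  have := eVariationOn.edist_le g.1 (left_mem_Icc.2 (zero_le_one' ℝ))
    (right_mem_Icc.2 (zero_le_one' ℝ))
  rwa [g.2.2.1, g.2.2.2.1] at this

theorem RectConnected.dist_le (hE : RectConnected E) (hx : x ∈ E) (hy : y ∈ E) :
    dist x y ≤ pathDistIn E x y := by
  rw [pathDistIn_eq, dist_edist]
  exact ENNReal.toReal_mono (hE.pathEDist_ne_top hx hy) (edist_le_pathEDist E x y)

theorem pathDistIn_nonneg (E : Set X) (x y : X) : 0 ≤ pathDistIn E x y := ENNReal.toReal_nonneg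

theorem pathEDist_symm_le (E : Set X) (x y : X) : pathEDist E x y ≤ pathEDist E y x := by
  refine le_iInf fun g => ?_
  have hm : MapsTo (fun t : ℝ => 1 - t) (Icc 0 1) (Icc 0 1) := fun t ht =>
    ⟨by linarith [ht.2], by linarith [ht.1]⟩
  have hp : IsPathIn E (g.1 ∘ fun t : ℝ => 1 - t) x y :=
    ⟨g.2.1.comp (by fun_prop) hm, by simp [g.2.2.2.1], by simp [g.2.2.1], g.2.2.2.2.comp hm⟩
  refine (iInf_le (fun g : {g : ℝ → X // IsPathIn E g x y} =>
    eVariationOn g.1 (Icc 0 1)) ⟨_, hp⟩).trans ?_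
  exact eVariationOn.comp_le_of_antitoneOn _ _ (fun a _ b _ h => by
    show 1 - b ≤ 1 - a; linarith) hm

theorem pathDistIn_comm (E : Set X) (x y : X) : pathDistIn E x y = pathDistIn E y x := by
  rw [pathDistIn_eq, pathDistIn_eq, le_antisymm (pathEDist_symm_le E x y) (pathEDist_symm_le E y x)]

theorem pathEDist_triangle (E : Set X) (x y z : X) :
    pathEDist E x z ≤ pathEDist E x y + pathEDist E y z := by
  refine ENNReal.le_iInf_add_iInf fun g h => ?_
  set φ : ℝ → ℝ := fun t => 2 * t
  set ψ : ℝ → ℝ := fun t => 2 * t - 1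
  have hφ : MapsTo φ (Icc 0 (1 / 2)) (Icc 0 1) := fun t ht =>
    ⟨by show 0 ≤ 2 * t; linarith [ht.1], by show 2 * t ≤ 1; linarith [ht.2]⟩
  have hψ : MapsTo ψ (Icc (1 / 2) 1) (Icc 0 1) := fun t ht =>
    ⟨by show 0 ≤ 2 * t - 1; linarith [ht.1], by show 2 * t - 1 ≤ 1; linarith [ht.2]⟩
  set k : ℝ → X := fun t => if t ≤ 1 / 2 then g.1 (φ t) else h.1 (ψ t)
  have e₁ : EqOn k (g.1 ∘ φ) (Icc 0 (1 / 2)) := fun t ht => if_pos ht.2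
  have e₂ : EqOn k (h.1 ∘ ψ) (Icc (1 / 2) 1) := fun t ht => by
    rcases ht.1.eq_or_lt with rfl | h'
    · simp [k, φ, ψ, g.2.2.2.1, h.2.2.1]
    · exact if_neg (not_le.2 h')
  have hU : Icc (0 : ℝ) 1 = Icc 0 (1 / 2) ∪ Icc (1 / 2) 1 :=
    (Icc_union_Icc_eq_Icc (by norm_num) (by norm_num)).symm
  have hp : IsPathIn E k x z := by
    refine ⟨?_, ?_, ?_, ?_⟩
    · rw [hU]
      refine ContinuousOn.union_of_isClosed ?_ ?_ isClosed_Icc isClosed_Icc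
      · exact (g.2.1.comp (by fun_prop) hφ).congr e₁
      · exact (h.2.1.comp (by fun_prop) hψ).congr e₂
    · rw [e₁ ⟨le_rfl, by norm_num⟩]; simp [φ, g.2.2.1]
    · rw [e₂ ⟨by norm_num, le_rfl⟩]; norm_num [ψ, h.2.2.2.1]
    · rw [hU]
      rintro t (ht | ht)
      · rw [e₁ ht]; exact g.2.2.2.2 (hφ ht)
      · rw [e₂ ht]; exact h.2.2.2.2 (hψ ht)
  refine (iInf_le (fun g : {g : ℝ → X // IsPathIn E g x z} =>
    eVariationOn g.1 (Icc 0 1)) ⟨_, hp⟩).trans ?_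
  have hs := eVariationOn.Icc_add_Icc k (s := univ) (a := (0 : ℝ)) (b := 1 / 2) (c := 1)
    (by norm_num) (by norm_num) (mem_univ _)
  simp only [univ_inter] at hs
  simp only [← hs]
  rw [eVariationOn.eq_of_eqOn e₁, eVariationOn.eq_of_eqOn e₂]
  refine add_le_add (eVariationOn.comp_le_of_monotoneOn _ _ (fun a _ b _ h => ?_) hφ)
    (eVariationOn.comp_le_of_monotoneOn _ _ (fun a _ b _ h => ?_) hψ)
  · show 2 * a ≤ 2 * b; linarith
  · show 2 * a - 1 ≤ 2 * b - 1; linarith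

theorem RectConnected.pathDistIn_triangle (hE : RectConnected E) (hx : x ∈ E) (hy : y ∈ E)
    (hz : z ∈ E) : pathDistIn E x z ≤ pathDistIn E x y + pathDistIn E y z := by
  simp only [pathDistIn_eq]
  rw [← ENNReal.toReal_add (hE.pathEDist_ne_top hx hy) (hE.pathEDist_ne_top hy hz)]
  exact ENNReal.toReal_mono (ENNReal.add_ne_top.2 ⟨hE.pathEDist_ne_top hx hy,
    hE.pathEDist_ne_top hy hz⟩) (pathEDist_triangle E x y z)

theorem RectConnected.pathDistIn_of_seg [CAT0 X] (hE : RectConnected E) (h : seg x y ⊆ E) :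
    pathDistIn E x y = dist x y := by
  refine le_antisymm ?_ (hE.dist_le (h (left_mem_seg x y)) (h (right_mem_seg x y)))
  have hp : IsPathIn E (pt x y) x y :=
    ⟨(Continuous.pt continuous_const continuous_const continuous_id).continuousOn, pt_zero x y,
      pt_one x y, fun t _ => h (pt_mem_seg x y t)⟩
  have hl : LipschitzOnWith (nndist x y) (pt x y) (Icc 0 1) := by
    refine LipschitzOnWith.of_dist_le_mul fun s hs t ht => ?_
    rw [dist_pt_param x y hs.1 hs.2 ht.1 ht.2, Real.dist_eq, coe_nndist, mul_comm]
  have h₁ : eVariationOn (pt x y) (Icc 0 1) ≤ edist x y := by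
    have := hl.comp_eVariationOn_le (g := id) (mapsTo_id _)
    have h2 := (monotone_id.monotoneOn (s := univ)).eVariationOn_eq (mem_univ (0 : ℝ))
      (mem_univ (1 : ℝ))
    simp only [univ_inter, id, sub_zero, ENNReal.ofReal_one] at h2
    refine this.trans ((mul_le_mul_right h2.le _).trans ?_)
    rw [mul_one, edist_nndist]
  rw [pathDistIn_eq, dist_edist]
  exact ENNReal.toReal_mono (edist_ne_top _ _) ((iInf_le (fun g : {g : ℝ → X // IsPathIn E g x y}
    => eVariationOn g.1 (Icc 0 1)) ⟨_, hp⟩).trans h₁)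

/-- A unit-speed geodesic of `E` with its induced path metric. -/
structure YG (E : Set X) (f : ℝ → X) (a b : ℝ) : Prop where
  le : a ≤ b
  mem : ∀ s ∈ Icc a b, f s ∈ E
  geo : ∀ s ∈ Icc a b, ∀ t ∈ Icc a b, pathDistIn E (f s) (f t) = |s - t|

variable {f g : ℝ → X} {a b c s t L : ℝ}

theorem YG.mono (h : YG E f a b) (hac : a ≤ s) (hst : s ≤ t) (htb : t ≤ b) : YG E f s t :=
  ⟨hst, fun _ hu => h.mem _ (Icc_subset_Icc hac htb hu), fun _ hu _ hv =>
    h.geo _ (Icc_subset_Icc hac htb hu) _ (Icc_subset_Icc hac htb hv)⟩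

theorem YG.dist_le (h : YG E f a b) (hE : RectConnected E) (hs : s ∈ Icc a b)
    (ht : t ∈ Icc a b) : dist (f s) (f t) ≤ |s - t| :=
  (hE.dist_le (h.mem s hs) (h.mem t ht)).trans (h.geo s hs t ht).le

theorem YG.continuousOn (h : YG E f a b) (hE : RectConnected E) : ContinuousOn f (Icc a b) := by
  refine (LipschitzOnWith.of_dist_le_mul (K := 1) fun s hs t ht => ?_).continuousOn
  rw [NNReal.coe_one, one_mul, Real.dist_eq]
  exact h.dist_le hE hs ht

theorem RectConnected.pathDistIn_self (_hE : RectConnected E) (hx : x ∈ E) :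
    pathDistIn E x x = 0 := by
  have hp : IsPathIn E (fun _ => x) x x := ⟨continuousOn_const, rfl, rfl, fun _ _ => hx⟩
  have h0 : eVariationOn (fun _ : ℝ => x) (Icc 0 1) = 0 :=
    eVariationOn.constant_on (subsingleton_of_subset_singleton (a := x) (by simp))
  have := (iInf_le (fun g : {g : ℝ → X // IsPathIn E g x x} =>
    eVariationOn g.1 (Icc 0 1)) ⟨_, hp⟩)
  simp only [h0, nonpos_iff_eq_zero] at this
  rw [pathDistIn_eq, pathEDist, this, ENNReal.toReal_zero]

theorem YG.injOn (h : YG E f a b) (hE : RectConnected E) : InjOn f (Icc a b) := by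
  intro s hs t ht he
  have := h.geo s hs t ht
  rw [← he, hE.pathDistIn_self (h.mem s hs)] at this
  linarith [abs_eq_zero.1 this.symm]

theorem YG.isArc (h : YG E f a b) (hE : RectConnected E) (hab : a < b) :
    IsArc (f '' Icc a b) (f a) (f b) :=
  .of_Icc hab (h.continuousOn hE) (h.injOn hE)

theorem YG.isCompact (h : YG E f a b) (hE : RectConnected E) : IsCompact (f '' Icc a b) :=
  isCompact_Icc.image_of_continuousOn (h.continuousOn hE)

theorem YG.image_subset (h : YG E f a b) : f '' Icc a b ⊆ E := by
  rintro _ ⟨s, hs, rfl⟩; exact h.mem s hs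

theorem YG.isPreconnected (h : YG E f a b) (hE : RectConnected E) :
    IsPreconnected (f '' Icc a b) :=
  isPreconnected_Icc.image _ (h.continuousOn hE)

/-- The reversed geodesic. -/
theorem YG.reverse (h : YG E f 0 L) : YG E (fun s => f (L - s)) 0 L := by
  have hm : ∀ s ∈ Icc 0 L, L - s ∈ Icc 0 L := fun s hs => ⟨by linarith [hs.2], by linarith [hs.1]⟩
  refine ⟨h.le, fun s hs => h.mem _ (hm s hs), fun s hs t ht => ?_⟩
  rw [h.geo _ (hm s hs) _ (hm t ht), abs_sub_comm]
  congr 1; ring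

theorem image_reverse {Z : Type*} (f : ℝ → Z) (L : ℝ) : (fun s => f (L - s)) '' Icc 0 L = f '' Icc 0 L := by
  have : (fun s => L - s) '' Icc 0 L = Icc 0 L := by simp
  conv_rhs => rw [← this, image_image]

variable [CAT0 X]

theorem seg_subset_of_connected {A : Set X} {u v : X} (hA : IsPreconnected A) (hu : u ∈ A)
    (hv : v ∈ A) (h : A ⊆ seg u v) : seg u v ⊆ A := by
  intro w hw
  have hI := (hA.image (fun x => dist u x) (by fun_prop)).ordConnected.out
    (mem_image_of_mem _ hu) (mem_image_of_mem _ hv)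
  obtain ⟨w', hw', he⟩ := hI (a := dist u w) ⟨by simp, hw.left_le⟩
  rwa [← Btw.unique (h hw') hw he]

/-- `S` contains every `X`-segment of `E` joining two of its points. -/
def SideIn (E S : Set X) : Prop := ∀ u ∈ S, ∀ v ∈ S, seg u v ⊆ E → seg u v ⊆ S

theorem sideIn_seg (E : Set X) (x y : X) : SideIn E (seg x y) := by
  intro u hu v hv _ w hw
  rcases Btw.total hu hv with h | h
  · exact Btw.outer' hv (h.outer hw)
  · exact Btw.outer' hu (h.outer hw.symm)

theorem YG.seg_eq (h : YG E f a b) (hE : RectConnected E) (hs : a ≤ s) (hst : s ≤ t) (ht : t ≤ b)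
    (hseg : seg (f s) (f t) ⊆ E) : seg (f s) (f t) = f '' Icc s t := by
  have hg := h.mono hs hst ht
  have hd : dist (f s) (f t) = t - s := by
    rw [← hE.pathDistIn_of_seg hseg, hg.geo s ⟨le_rfl, hst⟩ t ⟨hst, le_rfl⟩, abs_sub_comm,
      abs_of_nonneg (by linarith)]
  have hsub : f '' Icc s t ⊆ seg (f s) (f t) := by
    rintro _ ⟨u, hu, rfl⟩
    have h1 := hg.dist_le hE ⟨le_rfl, hst⟩ hu
    have h2 := hg.dist_le hE hu ⟨hst, le_rfl⟩
    rw [abs_sub_comm, abs_of_nonneg (by linarith [hu.1])] at h1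
    rw [abs_sub_comm, abs_of_nonneg (by linarith [hu.2])] at h2
    have h3 := dist_triangle (f s) (f u) (f t)
    show dist (f s) (f u) + dist (f u) (f t) = dist (f s) (f t)
    linarith
  exact (seg_subset_of_connected (hg.isPreconnected hE) ⟨s, ⟨le_rfl, hst⟩, rfl⟩
    ⟨t, ⟨hst, le_rfl⟩, rfl⟩ hsub).antisymm hsub

theorem YG.sideIn (h : YG E f a b) (hE : RectConnected E) : SideIn E (f '' Icc a b) := by
  rintro _ ⟨s, hs, rfl⟩ _ ⟨t, ht, rfl⟩ hseg
  rcases le_total s t with hst | hst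
  · rw [h.seg_eq hE hs.1 hst ht.2 hseg]
    exact image_mono (Icc_subset_Icc hs.1 ht.2)
  · rw [seg_comm] at hseg ⊢
    rw [h.seg_eq hE ht.1 hst hs.2 hseg]
    exact image_mono (Icc_subset_Icc ht.1 hs.2)

theorem bigon_false {O A B : Set X} {u v : X} (H : TwoCx O) (hH1 : H1Trivial E) (hA : IsArc A u v)
    (hB : IsArc B u v) (huv : u ≠ v) (hAB : A ∩ B ⊆ {u, v}) (hAE : A ⊆ E) (hBE : B ⊆ E)
    (sA : SideIn E A) (sB : SideIn E B) : False := by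
  obtain ⟨γ, hγ⟩ := hA.exists_scc hB hAB
  obtain ⟨D, hDE, hD⟩ := γ.exists_membrane hH1 (hγ ▸ union_subset hAE hBE)
  have hG : SConv 0 fun x : X => dist u x + dist x v := by
    simpa using (sConv_dist u).add (sConv_dist' v)
  have hull := hD.le_of_vertices H (ι := Bool) (S := fun i => cond i A B)
    (by rintro (_ | _); exacts [hB.isCompact.isClosed, hA.isCompact.isClosed])
    (by rw [hγ, union_eq_iUnion])
    (by
      rintro (_ | _) a ha b hb h
      exacts [sB a ha b hb (h.trans hDE), sA a ha b hb (h.trans hDE)])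
    (by fun_prop) hG (A := dist u v) (by
      have key : ∀ x ∈ A ∩ B, dist u x + dist x v ≤ dist u v := by
        intro x hx
        rcases hAB hx with rfl | rfl <;> simp
      rintro (_ | _) (_ | _) hij x hx hx'
      exacts [absurd rfl hij, key x ⟨hx', hx⟩, key x ⟨hx, hx'⟩, absurd rfl hij])
  have hT : γ.img ⊆ seg u v := fun x hx =>
    le_antisymm (hull x (hD.subset hx)) (dist_triangle u x v)
  rw [hγ] at hT
  have h1 := seg_subset_of_connected hA.isPreconnected hA.left_mem hA.right_mem
    (subset_union_left.trans hT)
  have h2 := seg_subset_of_connected hB.isPreconnected hB.left_mem hB.right_mem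
    (subset_union_right.trans hT)
  have hm := pt_mem_seg u v (1 / 2)
  have hd := dist_left_pt u v (t := 1 / 2) (by norm_num) (by norm_num)
  have hp := dist_pos.2 huv
  rcases hAB ⟨h1 hm, h2 hm⟩ with h | h <;> rw [h] at hd
  · rw [dist_self] at hd; linarith
  · linarith

theorem YG.unique {O : Set X} (H : TwoCx O) (hH1 : H1Trivial E) (hE : RectConnected E)
    (hf : YG E f 0 L) (hg : YG E g 0 L) (h0 : f 0 = g 0) (hL : f L = g L) :
    ∀ s ∈ Icc 0 L, f s = g s := by
  intro s₀ hs₀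
  by_contra hne
  set K := {s | s ∈ Icc 0 L ∧ f s = g s}
  have hK : IsClosed K := by
    have := (hf.continuousOn hE).prodMk (hg.continuousOn hE)
    exact this.preimage_isClosed_of_isClosed isClosed_Icc isClosed_diagonal
  have hK₁ : IsCompact (K ∩ Icc 0 s₀) := isCompact_Icc.inter_left hK
  have hK₂ : IsCompact (K ∩ Icc s₀ L) := isCompact_Icc.inter_left hK
  obtain ⟨hm₁, hu₁⟩ := hK₁.isGreatest_sSup ⟨0, ⟨⟨le_rfl, hf.le⟩, h0⟩, le_rfl, hs₀.1⟩
  obtain ⟨hm₂, hu₂⟩ := hK₂.isLeast_sInf ⟨L, ⟨⟨hf.le, le_rfl⟩, hL⟩, hs₀.2, le_rfl⟩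
  set s₁ := sSup (K ∩ Icc 0 s₀)
  set s₂ := sInf (K ∩ Icc s₀ L)
  have h1 : s₁ < s₀ := lt_of_le_of_ne hm₁.2.2 fun h => hne (h ▸ hm₁.1.2)
  have h2 : s₀ < s₂ := lt_of_le_of_ne hm₂.2.1 fun h => hne (h ▸ hm₂.1.2)
  have hf' := hf.mono hm₁.1.1.1 (h1.trans h2).le hm₂.1.1.2
  have hg' := hg.mono hm₁.1.1.1 (h1.trans h2).le hm₂.1.1.2
  have hB := hg'.isArc hE (h1.trans h2)
  rw [← hm₁.1.2, ← hm₂.1.2] at hB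
  refine bigon_false H hH1 (hf'.isArc hE (h1.trans h2)) hB ?_ ?_ hf'.image_subset hg'.image_subset
    (hf'.sideIn hE) (hg'.sideIn hE)
  · intro h
    have := hf.injOn hE hm₁.1.1 hm₂.1.1 h
    linarith
  · rintro _ ⟨⟨s, hs, rfl⟩, t, ht, hts⟩
    have hs' : s ∈ Icc 0 L := Icc_subset_Icc hm₁.1.1.1 hm₂.1.1.2 hs
    have ht' : t ∈ Icc 0 L := Icc_subset_Icc hm₁.1.1.1 hm₂.1.1.2 ht
    have e1 := hf.geo 0 ⟨le_rfl, hf.le⟩ s hs'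
    have e2 := hg.geo 0 ⟨le_rfl, hf.le⟩ t ht'
    rw [← h0, hts, e1] at e2
    simp only [zero_sub, abs_neg, abs_of_nonneg hs'.1, abs_of_nonneg ht'.1] at e2
    subst e2
    rcases le_total s s₀ with h | h
    · left; rw [le_antisymm (hu₁ ⟨⟨hs', hts.symm⟩, hs'.1, h⟩) hs.1]
    · right; rw [mem_singleton_iff, le_antisymm hs.2 (hu₂ ⟨⟨hs', hts.symm⟩, h, hs'.2⟩)]

end PathMetric

set_option linter.unusedSectionVars false

section Triangles

variable {X : Type*} [MetricSpace X] [CAT0 X] {E O T : Set X} {f g σ τ ρ : ℝ → X} {a b c s t : ℝ}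

theorem YG.ne (h : YG E f a b) (hE : RectConnected E) (hs : s ∈ Icc a b) (ht : t ∈ Icc a b)
    (hst : s ≠ t) : f s ≠ f t := fun he => hst (h.injOn hE hs ht he)

theorem YG.param_eq (hf : YG E f 0 a) (hg : YG E g 0 b) (h0 : f 0 = g 0) (hs : s ∈ Icc 0 a)
    (ht : t ∈ Icc 0 b) (h : f s = g t) : s = t := by
  have e1 := hf.geo 0 ⟨le_rfl, hf.le⟩ s hs
  have e2 := hg.geo 0 ⟨le_rfl, hg.le⟩ t ht
  rw [← h0, ← h, e1] at e2
  simpa only [zero_sub, abs_neg, abs_of_nonneg hs.1, abs_of_nonneg ht.1] using e2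

/-- A simple closed curve is not a union of an initial arc and a set meeting it only in the end
point of that arc. -/
theorem SCC.not_split (γ : SCC X) {B : Set X} (hE : RectConnected E) (hf : YG E f 0 a)
    (ha : 0 < a) (hB : IsClosed B) (hT : γ.img = f '' Icc 0 a ∪ B) (hx : f '' Icc 0 a ∩ B ⊆ {f a})
    (hy : ∃ y ∈ B, y ≠ f a) : False := by
  obtain ⟨y, hyB, hy⟩ := hy
  rcases γ.subset_singleton_of_union (hf.isCompact hE).isClosed hB hT hx with h | h
  · exact hf.ne hE ⟨le_rfl, hf.le⟩ ⟨hf.le, le_rfl⟩ ha.ne (h ⟨0, ⟨le_rfl, hf.le⟩, rfl⟩)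
  · exact hy (h hyB)

theorem SCC.not_geodesic (γ : SCC X) (hE : RectConnected E) (hf : YG E f 0 a)
    (hT : γ.img = f '' Icc 0 a) : False := by
  rcases hf.le.eq_or_lt with rfl | ha
  · exact γ.not_subset_singleton (f 0) (by rw [hT]; simp)
  · have ha2 : 0 < a / 2 := by linarith
    have h1 := hf.mono le_rfl ha2.le (by linarith)
    have h2 := hf.mono ha2.le (by linarith) le_rfl
    refine γ.not_split hE h1 ha2 (h2.isCompact hE).isClosed ?_ ?_ ⟨f a, ⟨a, ⟨by linarith, le_rfl⟩,
      rfl⟩, hf.ne hE ⟨hf.le, le_rfl⟩ ⟨ha2.le, by linarith⟩ (by linarith)⟩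
    · rw [hT, ← image_union, Icc_union_Icc_eq_Icc ha2.le (by linarith)]
    · rintro _ ⟨⟨s, hs, rfl⟩, t, ht, hts⟩
      have := hf.injOn hE ⟨ha2.le.trans ht.1, ht.2⟩ ⟨hs.1, hs.2.trans (by linarith)⟩ hts
      rw [mem_singleton_iff, show s = a / 2 by linarith [hs.2, ht.1]]

/-- If two geodesics of a simple closed curve share an initial arc, then that arc is met by the
remainder of the curve. -/
theorem SCC.not_common_arc (γ : SCC X) {C : Set X} (H : TwoCx O) (hH1 : H1Trivial E)
    (hE : RectConnected E) (hf : YG E f 0 a)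
    (hg : YG E g 0 b) (h0 : f 0 = g 0) (hs : 0 < s) (hsa : s ≤ a) (hsb : s ≤ b) (hfg : f s = g s)
    (hT : γ.img = f '' Icc 0 a ∪ g '' Icc 0 b ∪ C) (hC : IsClosed C)
    (hd : ∀ t ∈ Icc 0 s, f t ∉ C) : False := by
  have heq : ∀ t ∈ Icc 0 s, f t = g t :=
    (hf.mono le_rfl hs.le hsa).unique H hH1 hE (hg.mono le_rfl hs.le hsb) h0 hfg
  have hs2 : 0 < s / 2 := by linarith
  have h1 := hf.mono le_rfl hs2.le (by linarith)
  have h2 := hf.mono hs2.le (by linarith) le_rfl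
  have h3 := hg.mono hs2.le (by linarith) le_rfl
  refine γ.not_split hE h1 hs2 (((h2.isCompact hE).isClosed.union (h3.isCompact hE).isClosed).union
    hC) ?_ ?_ ⟨f a, Or.inl (Or.inl ⟨a, ⟨by linarith, le_rfl⟩, rfl⟩),
      hf.ne hE ⟨hf.le, le_rfl⟩ ⟨hs2.le, by linarith⟩ (by linarith)⟩
  · have e1 : g '' Icc 0 (s / 2) = f '' Icc 0 (s / 2) :=
      image_congr fun t ht => (heq t ⟨ht.1, by linarith [ht.2]⟩).symm
    rw [hT, ← Icc_union_Icc_eq_Icc (b := s / 2) hs2.le (by linarith : s / 2 ≤ a),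
      ← Icc_union_Icc_eq_Icc (b := s / 2) hs2.le (by linarith : s / 2 ≤ b), image_union,
      image_union, e1]
    ext x
    simp only [mem_union]
    tauto
  · rintro _ ⟨⟨u, hu, rfl⟩, (⟨t, ht, htu⟩ | ⟨t, ht, htu⟩) | hu'⟩
    · have := hf.injOn hE ⟨hs2.le.trans ht.1, ht.2⟩ ⟨hu.1, hu.2.trans (by linarith)⟩ htu
      rw [mem_singleton_iff, show u = s / 2 by linarith [hu.2, ht.1]]
    · have := hf.param_eq hg h0 ⟨hu.1, hu.2.trans (by linarith)⟩ ⟨hs2.le.trans ht.1, ht.2⟩ htu.symm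
      rw [mem_singleton_iff, show u = s / 2 by linarith [hu.2, ht.1]]
    · exact absurd hu' (hd u ⟨hu.1, hu.2.trans (by linarith)⟩)

theorem SCC.not_bipod (γ : SCC X) (H : TwoCx O) (hH1 : H1Trivial E) (hE : RectConnected E)
    (hf : YG E f 0 a) (hg : YG E g 0 b) (h0 : f 0 = g 0)
    (hT : γ.img = f '' Icc 0 a ∪ g '' Icc 0 b) : False := by
  by_cases h : ∃ s, 0 < s ∧ s ≤ a ∧ s ≤ b ∧ f s = g s
  · obtain ⟨s, hs, hsa, hsb, hfg⟩ := h
    exact γ.not_common_arc H hH1 hE hf hg h0 hs hsa hsb hfg (C := ∅) (by simpa using hT)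
      isClosed_empty fun _ _ => id
  · push Not at h
    have hx : f '' Icc 0 a ∩ g '' Icc 0 b ⊆ {f 0} := by
      rintro _ ⟨⟨s, hs, rfl⟩, t, ht, hts⟩
      have := hf.param_eq hg h0 hs ht hts.symm
      subst this
      rcases hs.1.eq_or_lt with h' | h'
      · rw [← h']; rfl
      · exact absurd hts.symm (h s h' hs.2 ht.2)
    rcases γ.subset_singleton_of_union (hf.isCompact hE).isClosed (hg.isCompact hE).isClosed hT hx
      with h | h
    · refine γ.not_geodesic hE hg (hT.trans (union_eq_right.2 (h.trans ?_)))
      rw [singleton_subset_iff, h0]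
      exact ⟨0, ⟨le_rfl, hg.le⟩, rfl⟩
    · refine γ.not_geodesic hE hf (hT.trans (union_eq_left.2 (h.trans ?_)))
      rw [singleton_subset_iff]
      exact ⟨0, ⟨le_rfl, hf.le⟩, rfl⟩

/-- A triangle with geodesic sides: `σ`, `τ` issue from a common vertex, `ρ` joins their ends. -/
structure YTri (E T : Set X) (σ τ ρ : ℝ → X) (a b c : ℝ) : Prop where
  left : YG E σ 0 a
  right : YG E τ 0 b
  base : YG E ρ 0 c
  apex : σ 0 = τ 0
  left_end : σ a = ρ 0
  right_end : τ b = ρ c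
  union : T = σ '' Icc 0 a ∪ τ '' Icc 0 b ∪ ρ '' Icc 0 c

theorem YTri.rotate (h : YTri E T σ τ ρ a b c) :
    YTri E T (fun s => σ (a - s)) ρ τ a c b where
  left := h.left.reverse
  right := h.base
  base := h.right
  apex := by simp [h.left_end]
  left_end := by simp [h.apex]
  right_end := h.right_end.symm
  union := by rw [h.union, image_reverse, union_right_comm]

theorem YTri.swap (h : YTri E T σ τ ρ a b c) :
    YTri E T τ σ (fun s => ρ (c - s)) b a c where
  left := h.right
  right := h.left
  base := h.base.reverse
  apex := h.apex.symm
  left_end := by simp [h.right_end]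
  right_end := by simp [h.left_end]
  union := by rw [h.union, image_reverse, union_comm (τ '' _)]

variable {γ : SCC X}

theorem YTri.subset_base (h : YTri E T σ τ ρ a b c) (H : TwoCx O) (hH1 : H1Trivial E)
    (hE : RectConnected E) (hp : σ 0 ∈ ρ '' Icc 0 c) : σ '' Icc 0 a ⊆ ρ '' Icc 0 c := by
  obtain ⟨u, hu, hup⟩ := hp
  have h1 := (h.base.mono le_rfl hu.1 hu.2).reverse
  have hua : u = a := by
    have e1 := h.left.geo 0 ⟨le_rfl, h.left.le⟩ a ⟨h.left.le, le_rfl⟩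
    have e2 := h.base.geo u hu 0 ⟨le_rfl, h.base.le⟩
    rw [hup, ← h.left_end, e1] at e2
    simpa [abs_of_nonneg h.left.le, abs_of_nonneg hu.1] using e2.symm
  subst hua
  have := h.left.unique H hH1 hE h1 (by simp [hup]) (by simp [h.left_end])
  rintro _ ⟨s, hs, rfl⟩
  rw [this s hs]
  exact ⟨u - s, ⟨by linarith [hs.2], by linarith [hs.1, hu.2]⟩, rfl⟩

theorem YTri.apex_notMem (h : YTri E γ.img σ τ ρ a b c) (H : TwoCx O) (hH1 : H1Trivial E)
    (hE : RectConnected E) : σ 0 ∉ ρ '' Icc 0 c := by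
  intro hp
  have h1 := h.subset_base H hH1 hE hp
  have h2 := h.swap.subset_base H hH1 hE (by rwa [image_reverse, ← h.apex])
  rw [image_reverse] at h2
  exact γ.not_geodesic hE h.base (h.union.trans (union_eq_right.2 (union_subset h1 h2)))

theorem YTri.inter (h : YTri E γ.img σ τ ρ a b c) (H : TwoCx O) (hH1 : H1Trivial E)
    (hE : RectConnected E) : σ '' Icc 0 a ∩ τ '' Icc 0 b ⊆ {σ 0} := by
  rintro _ ⟨⟨s, hs, rfl⟩, t, ht, hts⟩
  have := h.left.param_eq h.right h.apex hs ht hts.symm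
  subst this
  rcases hs.1.eq_or_lt with h' | h'
  · rw [← h']; rfl
  exfalso
  have hp := h.apex_notMem H hH1 hE
  have hC := (h.base.isCompact hE).isClosed
  have hev : ∀ᶠ x in nhdsWithin 0 (Icc 0 a), σ x ∉ ρ '' Icc 0 c :=
    (h.left.continuousOn hE) 0 ⟨le_rfl, h.left.le⟩ (hC.isOpen_compl.mem_nhds hp)
  obtain ⟨η, hη, hη'⟩ := Metric.mem_nhdsWithin_iff.1 hev
  have hm : 0 < min s (η / 2) := lt_min h' (by linarith)
  have heq := (h.left.mono le_rfl h'.le hs.2).unique H hH1 hE (h.right.mono le_rfl h'.le ht.2)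
    h.apex hts.symm
  refine γ.not_common_arc H hH1 hE h.left h.right h.apex hm ((min_le_left _ _).trans hs.2)
    ((min_le_left _ _).trans ht.2) (heq _ ⟨hm.le, min_le_left _ _⟩) h.union hC fun t ht' => ?_
  refine hη' ⟨?_, ht'.1, (ht'.2.trans (min_le_left _ _)).trans hs.2⟩
  rw [mem_ball, Real.dist_eq, sub_zero, abs_of_nonneg ht'.1]
  linarith [ht'.2.trans (min_le_right _ _)]

/-- A simple geodesic triangle, with its incidences. -/
structure SimpleTri (E T : Set X) (σ τ ρ : ℝ → X) (a b c : ℝ) : Prop extends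
    YTri E T σ τ ρ a b c where
  apex_notMem : σ 0 ∉ ρ '' Icc 0 c
  inter_apex : σ '' Icc 0 a ∩ τ '' Icc 0 b ⊆ {σ 0}
  inter_left : σ '' Icc 0 a ∩ ρ '' Icc 0 c ⊆ {σ a}
  inter_right : τ '' Icc 0 b ∩ ρ '' Icc 0 c ⊆ {τ b}
  left_pos : 0 < a
  right_pos : 0 < b

theorem YTri.simple (h : YTri E γ.img σ τ ρ a b c) (H : TwoCx O) (hH1 : H1Trivial E)
    (hE : RectConnected E) : SimpleTri E γ.img σ τ ρ a b c where
  toYTri := h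
  apex_notMem := h.apex_notMem H hH1 hE
  inter_apex := h.inter H hH1 hE
  inter_left := by simpa [image_reverse] using h.rotate.inter H hH1 hE
  inter_right := by simpa [image_reverse] using h.swap.rotate.inter H hH1 hE
  left_pos := by
    refine lt_of_le_of_ne h.left.le fun ha => h.apex_notMem H hH1 hE ?_
    rw [congrArg σ ha, h.left_end]
    exact ⟨0, ⟨le_rfl, h.base.le⟩, rfl⟩
  right_pos := by
    refine lt_of_le_of_ne h.right.le fun ha => h.apex_notMem H hH1 hE ?_
    rw [h.apex, congrArg τ ha, h.right_end]
    exact ⟨c, ⟨h.base.le, le_rfl⟩, rfl⟩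

theorem IsGeodesicFromTo.yg {p q : X} (h : IsGeodesicFromTo (pathDistIn E) E f p q) :
    YG E f 0 (pathDistIn E p q) :=
  ⟨h.2.2.1.1, fun _ hs => h.2.2.2 hs, h.2.2.1.2⟩

theorem geodSeg_eq (H : TwoCx O) (hH1 : H1Trivial E) (hE : RectConnected E) {p q : X}
    (h : IsGeodesicFromTo (pathDistIn E) E f p q) :
    geodSeg (pathDistIn E) E p q = f '' Icc 0 (pathDistIn E p q) := by
  refine Subset.antisymm (iUnion₂_subset fun g hg => ?_) (subset_biUnion_of_mem (u := fun f : ℝ → X =>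
    f '' Icc 0 (pathDistIn E p q)) h)
  rintro _ ⟨s, hs, rfl⟩
  exact ⟨s, hs, h.yg.unique H hH1 hE (IsGeodesicFromTo.yg hg) (h.1.trans hg.1.symm)
    (h.2.1.trans hg.2.1.symm) s hs⟩

theorem geodSeg_comm (E : Set X) (p q : X) :
    geodSeg (pathDistIn E) E p q ⊆ geodSeg (pathDistIn E) E q p := by
  refine iUnion₂_subset fun g hg => ?_
  have hY := (IsGeodesicFromTo.yg hg).reverse
  have : IsGeodesicFromTo (pathDistIn E) E (fun s => g (pathDistIn E p q - s)) q p := by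
    rw [IsGeodesicFromTo, pathDistIn_comm E q p]
    exact ⟨by simp [hg.2.1], by simp [hg.1], ⟨hY.le, hY.geo⟩, fun s hs => hY.mem s hs⟩
  rw [← image_reverse]
  intro x hx
  simp only [geodSeg, mem_iUnion]
  exact ⟨_, this, by rwa [pathDistIn_comm E q p]⟩

theorem SCC.not_two_sides (γ : SCC X) (H : TwoCx O) (hH1 : H1Trivial E) (hE : RectConnected E)
    {p q r : X} : γ.img ≠ geodSeg (pathDistIn E) E p q ∪ geodSeg (pathDistIn E) E p r := by
  intro hT
  have hne : ∃ x, x ∈ γ.img := ⟨γ.toFun 0, 0, ⟨le_rfl, zero_le_one⟩, rfl⟩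
  by_cases h1 : ∃ f, IsGeodesicFromTo (pathDistIn E) E f p q
  · obtain ⟨f, hf⟩ := h1
    by_cases h2 : ∃ f, IsGeodesicFromTo (pathDistIn E) E f p r
    · obtain ⟨g, hg⟩ := h2
      rw [geodSeg_eq H hH1 hE hf, geodSeg_eq H hH1 hE hg] at hT
      exact γ.not_bipod H hH1 hE hf.yg hg.yg (hf.1.trans hg.1.symm) hT
    · have : geodSeg (pathDistIn E) E p r = ∅ := by
        simp only [geodSeg, iUnion_eq_empty]
        exact fun f hf => absurd ⟨f, hf⟩ h2
      rw [geodSeg_eq H hH1 hE hf, this, union_empty] at hT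
      exact γ.not_geodesic hE hf.yg hT
  · have : geodSeg (pathDistIn E) E p q = ∅ := by
      simp only [geodSeg, iUnion_eq_empty]
      exact fun f hf => absurd ⟨f, hf⟩ h1
    rw [this, empty_union] at hT
    obtain ⟨x, hx⟩ := hne
    rw [hT] at hx
    simp only [geodSeg, mem_iUnion] at hx
    obtain ⟨g, hg, -⟩ := hx
    rw [geodSeg_eq H hH1 hE hg] at hT
    exact γ.not_geodesic hE (IsGeodesicFromTo.yg hg) hT

theorem IsYTriangle.exists_simpleTri {p q r : X} (h : IsYTriangle E γ.img p q r) (H : TwoCx O)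
    (hH1 : H1Trivial E) (hE : RectConnected E) :
    ∃ σ τ ρ c, IsGeodesicFromTo (pathDistIn E) E σ p q ∧ IsGeodesicFromTo (pathDistIn E) E τ p r ∧
      SimpleTri E γ.img σ τ ρ (pathDistIn E p q) (pathDistIn E p r) c := by
  obtain ⟨-, -, -, hT⟩ := h
  have hc : ∀ x y, geodSeg (pathDistIn E) E x y = geodSeg (pathDistIn E) E y x := fun x y =>
    (geodSeg_comm E x y).antisymm (geodSeg_comm E y x)
  have hemp : ∀ x y, (¬ ∃ f, IsGeodesicFromTo (pathDistIn E) E f x y) →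
      geodSeg (pathDistIn E) E x y = ∅ := fun x y h' => by
    simp only [geodSeg, iUnion_eq_empty]
    exact fun f hf => absurd ⟨f, hf⟩ h'
  have e1 : ∃ f, IsGeodesicFromTo (pathDistIn E) E f p q := by
    by_contra h'
    rw [hemp _ _ h', empty_union, hc q r] at hT
    exact γ.not_two_sides H hH1 hE hT
  have e2 : ∃ f, IsGeodesicFromTo (pathDistIn E) E f p r := by
    by_contra h'
    rw [hc r p, hemp _ _ h', union_empty, hc p q] at hT
    exact γ.not_two_sides H hH1 hE hT
  have e3 : ∃ f, IsGeodesicFromTo (pathDistIn E) E f q r := by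
    by_contra h'
    rw [hemp _ _ h', union_empty, hc r p] at hT
    exact γ.not_two_sides H hH1 hE hT
  obtain ⟨σ, hσ⟩ := e1
  obtain ⟨τ, hτ⟩ := e2
  obtain ⟨ρ, hρ⟩ := e3
  refine ⟨σ, τ, ρ, _, hσ, hτ, YTri.simple ⟨hσ.yg, hτ.yg, hρ.yg, hσ.1.trans hτ.1.symm,
    hσ.2.1.trans hρ.1.symm, hτ.2.1.trans hρ.2.1.symm, ?_⟩ H hH1 hE⟩
  rw [hT, hc r p, geodSeg_eq H hH1 hE hσ, geodSeg_eq H hH1 hE hτ, geodSeg_eq H hH1 hE hρ,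
    union_right_comm]

end Triangles

section Disks

variable {X : Type*} [MetricSpace X] [CAT0 X] {E O A B C D : Set X} {x y z a b u v w : X}

/-- A triangle in `E` with apex `x`, sides `A`, `B` and base `C`, filled by the membrane `D`. -/
structure TriDisk (E A B C : Set X) (x y z : X) (D : Set X) : Prop where
  arcA : IsArc A x y
  arcB : IsArc B x z
  arcC : IsArc C y z
  sideA : SideIn E A
  sideB : SideIn E B
  sideC : SideIn E C
  interAB : A ∩ B ⊆ {x}
  interAC : A ∩ C ⊆ {y}
  interBC : B ∩ C ⊆ {z}
  mem : Membrane D (A ∪ B ∪ C)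
  sub : D ⊆ E

theorem IsArc.ne (h : IsArc A x y) : x ≠ y := by
  obtain ⟨f, -, hi, rfl, rfl, -⟩ := h
  exact fun he => zero_ne_one (hi ⟨le_rfl, zero_le_one⟩ ⟨zero_le_one, le_rfl⟩ he)

theorem TriDisk.exists_of_H1 (hH1 : H1Trivial E) (arcA : IsArc A x y) (arcB : IsArc B x z)
    (arcC : IsArc C y z) (sideA : SideIn E A) (sideB : SideIn E B) (sideC : SideIn E C)
    (interAB : A ∩ B ⊆ {x}) (interAC : A ∩ C ⊆ {y}) (interBC : B ∩ C ⊆ {z}) (hA : A ⊆ E)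
    (hB : B ⊆ E) (hC : C ⊆ E) : ∃ D, TriDisk E A B C x y z D := by
  obtain ⟨γ, hγ⟩ := arcA.exists_scc_triangle arcC arcB interAC interAB
    (by rwa [inter_comm])
  obtain ⟨D, hDE, hD⟩ := γ.exists_membrane hH1
    (by rw [hγ]; exact union_subset (union_subset hA hC) hB)
  exact ⟨D, arcA, arcB, arcC, sideA, sideB, sideC, interAB, interAC, interBC,
    by rwa [hγ, union_right_comm] at hD, hDE⟩

theorem TriDisk.exists_segs (hxy : x ≠ y) (hxz : x ≠ z) (hyz : y ≠ z)
    (h1 : seg x y ∩ seg x z ⊆ {x}) (h2 : seg x y ∩ seg y z ⊆ {y})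
    (h3 : seg x z ∩ seg y z ⊆ {z}) :
    ∃ D, TriDisk univ (seg x y) (seg x z) (seg y z) x y z D := by
  obtain ⟨γ, hγ⟩ := (isArc_seg hxy).exists_scc_triangle (isArc_seg hyz) (isArc_seg hxz) h2 h1
    (by rwa [inter_comm])
  obtain ⟨D, hD⟩ := γ.exists_membrane_of_cat0
  exact ⟨D, isArc_seg hxy, isArc_seg hxz, isArc_seg hyz, sideIn_seg _ _ _, sideIn_seg _ _ _,
    sideIn_seg _ _ _, h1, h2, h3, by rwa [hγ, union_right_comm] at hD, subset_univ _⟩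

theorem SimpleTri.exists_triDisk {γ : SCC X} {σ τ ρ : ℝ → X} {a b c : ℝ}
    (h : SimpleTri E γ.img σ τ ρ a b c) (hH1 : H1Trivial E) (hE : RectConnected E)
    (hc : 0 < c) : ∃ D, TriDisk E (σ '' Icc 0 a) (τ '' Icc 0 b) (ρ '' Icc 0 c) (σ 0) (σ a) (τ b) D := by
  have h1 := h.right.isArc hE h.right_pos
  have h2 := h.base.isArc hE hc
  rw [← h.apex] at h1
  rw [← h.left_end, ← h.right_end] at h2
  exact TriDisk.exists_of_H1 hH1 (h.left.isArc hE h.left_pos) h1 h2 (h.left.sideIn hE)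
    (h.right.sideIn hE) (h.base.sideIn hE) h.inter_apex h.inter_left h.inter_right
    h.left.image_subset h.right.image_subset h.base.image_subset

variable (H : TwoCx O) (h : TriDisk E A B C x y z D)
include H h

theorem TriDisk.hull {G : X → ℝ} (hG : Continuous G) (hc : SConv 0 G) {M : ℝ} (hx : G x ≤ M)
    (hy : G y ≤ M) (hz : G z ≤ M) : ∀ w ∈ D, G w ≤ M := by
  have kAB : ∀ w, w ∈ A → w ∈ B → G w ≤ M := fun w h1 h2 => (h.interAB ⟨h1, h2⟩ : w = x) ▸ hx
  have kAC : ∀ w, w ∈ A → w ∈ C → G w ≤ M := fun w h1 h2 => (h.interAC ⟨h1, h2⟩ : w = y) ▸ hy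
  have kBC : ∀ w, w ∈ B → w ∈ C → G w ≤ M := fun w h1 h2 => (h.interBC ⟨h1, h2⟩ : w = z) ▸ hz
  refine h.mem.le_of_vertices H (S := ![A, B, C]) ?_ ?_ ?_ hG hc ?_
  · intro i
    fin_cases i
    exacts [h.arcA.isCompact.isClosed, h.arcB.isCompact.isClosed, h.arcC.isCompact.isClosed]
  · ext w
    simp [Fin.exists_fin_succ, or_assoc]
  · intro i
    fin_cases i
    exacts [fun a ha b hb hs => h.sideA a ha b hb (hs.trans h.sub),
      fun a ha b hb hs => h.sideB a ha b hb (hs.trans h.sub),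
      fun a ha b hb hs => h.sideC a ha b hb (hs.trans h.sub)]
  · intro i j hij w hi hj
    fin_cases i <;> fin_cases j
    exacts [absurd rfl hij, kAB w hi hj, kAC w hi hj, kAB w hj hi, absurd rfl hij, kBC w hi hj,
      kAC w hj hi, kBC w hj hi, absurd rfl hij]

omit H in
theorem TriDisk.apex_notMem : x ∉ C := fun hx => h.arcA.ne (h.interAC ⟨h.arcA.left_mem, hx⟩)

theorem TriDisk.apex_notMem_seg : x ∉ seg y z := by
  intro hx
  have hG : SConv 0 fun w : X => dist y w + dist w z := by
    simpa using (sConv_dist y).add (sConv_dist' z)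
  have hD := h.hull H (by fun_prop) hG (M := dist y z) hx.le (by simp) (by simp)
  exact h.apex_notMem (seg_subset_of_connected h.arcC.isPreconnected h.arcC.left_mem
    h.arcC.right_mem (fun w hw => le_antisymm (hD w (h.mem.subset (Or.inr hw)))
      (dist_triangle y w z)) hx)

theorem TriDisk.exists_strict : ∃ (G : X → ℝ) (c : ℝ), Continuous G ∧ 0 < c ∧ SConv c G ∧
    G y < G x ∧ G z < G x := by
  have hx := h.apex_notMem_seg H
  have hlt : dist y z < dist y x + dist x z :=
    lt_of_le_of_ne (dist_triangle y x z) fun he => hx he.symm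
  set κ := dist y x + dist x z - dist y z
  set M := dist x y ^ 2 + dist x z ^ 2 + 1
  have hκ : 0 < κ := sub_pos.2 hlt
  have hM : 0 < M := by positivity
  have hM1 : κ / M * dist x y ^ 2 < κ := by
    rw [div_mul_eq_mul_div, div_lt_iff₀ hM]
    refine mul_lt_mul_of_pos_left ?_ hκ
    have := sq_nonneg (dist x z)
    simp only [M]; linarith
  have hM2 : κ / M * dist x z ^ 2 < κ := by
    rw [div_mul_eq_mul_div, div_lt_iff₀ hM]
    refine mul_lt_mul_of_pos_left ?_ hκ
    have := sq_nonneg (dist x y)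
    simp only [M]; linarith
  refine ⟨fun w => (dist y w + dist w z) + κ / M * dist x w ^ 2, κ / M, by fun_prop, by positivity,
    ?_, ?_, ?_⟩
  · simpa using ((sConv_dist y).add (sConv_dist' z)).add ((sConv_sq x).const_mul
      (div_pos hκ hM).le)
  · simp only [dist_self]
    simp only [κ] at hM1 ⊢
    linarith
  · simp only [dist_self]
    simp only [κ] at hM2 ⊢
    linarith

variable {G : X → ℝ} {c : ℝ}

theorem TriDisk.cap (hG : Continuous G) (hc : 0 ≤ c) (hGc : SConv c G) (hy : G y < G x)
    (hz : G z < G x) : ∃ ε > 0, ∀ w ∈ D, G w + ε * dist x w ≤ G x := by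
  have h1 : SConv 0 G := fun a w b hb => by
    have := hGc a w b hb
    have h2 : 0 ≤ c * (dist a w * dist w b * dist a b) := by positivity
    linarith
  set M := dist x y + dist x z + 1
  have hM : 0 < M := by positivity
  set κ := min (G x - G y) (G x - G z)
  have hκ : 0 < κ := lt_min (by linarith) (by linarith)
  refine ⟨κ / M, div_pos hκ hM, h.hull H (by fun_prop) ?_ (by simp) ?_ ?_⟩
  · simpa using h1.add ((sConv_dist x).const_mul (div_pos hκ hM).le)
  · have : κ / M * dist x y ≤ κ := by
      rw [div_mul_eq_mul_div, div_le_iff₀ hM]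
      refine mul_le_mul_of_nonneg_left ?_ hκ.le
      have := dist_nonneg (x := x) (y := z)
      simp only [M]; linarith
    linarith [min_le_left (G x - G y) (G x - G z)]
  · have : κ / M * dist x z ≤ κ := by
      rw [div_mul_eq_mul_div, div_le_iff₀ hM]
      refine mul_le_mul_of_nonneg_left ?_ hκ.le
      have := dist_nonneg (x := x) (y := y)
      simp only [M]; linarith
    linarith [min_le_right (G x - G y) (G x - G z)]

/-- Points of the disk close to the apex lie on short chords cutting off the apex, tangent to the
level sets of a given strongly convex function. -/
theorem TriDisk.cap_chord (hG : Continuous G) (hc : 0 < c) (hGc : SConv c G) (hy : G y < G x)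
    (hz : G z < G x) {η : ℝ} (hη : 0 < η) : ∃ θ > 0, ∀ w ∈ D \ (A ∪ B ∪ C), dist x w < θ →
      ∃ a ∈ A, ∃ b ∈ B, Btw a w b ∧ seg a b ⊆ D ∧ x ∉ seg a b ∧ dist x a < η ∧ dist x b < η ∧
        G w ≤ G a ∧ G w ≤ G b := by
  obtain ⟨ε, hε, hcap⟩ := h.cap H hG hc.le hGc hy hz
  obtain ⟨η', hη', hball⟩ := Metric.isOpen_iff.1 h.arcC.isCompact.isClosed.isOpen_compl x
    h.apex_notMem
  set η₁ := min η η'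
  have hη₁ : 0 < η₁ := lt_min hη hη'
  have hcont := Metric.continuous_iff.1 hG x (ε * η₁) (by positivity)
  obtain ⟨θ, hθ, hθ'⟩ := hcont
  refine ⟨θ, hθ, fun w hw hwx => ?_⟩
  have hGw : G x - G w < ε * η₁ := by
    have := hθ' w (by rwa [dist_comm])
    rw [Real.dist_eq, abs_lt] at this
    linarith
  obtain ⟨a, ha, b, hb, hab, hs, hGa, hGb⟩ := h.mem.exists_chord H hw hG hc hGc
  have hGa' : G w ≤ G a := by nlinarith [sq_nonneg (dist w a)]
  have hGb' : G w ≤ G b := by nlinarith [sq_nonneg (dist w b)]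
  have near : ∀ e ∈ D, G w ≤ G e → dist x e < η₁ := fun e he hwe => by
    have := hcap e he
    exact lt_of_mul_lt_mul_left (by linarith) hε.le
  have hna := near a (h.mem.subset ha) hGa'
  have hnb := near b (h.mem.subset hb) hGb'
  have hC : ∀ e, dist x e < η₁ → e ∉ C := fun e he =>
    hball (by rw [mem_ball, dist_comm]; exact he.trans_le (min_le_right _ _))
  have strict : ∀ e ∈ D, e ≠ x → G e < G x := fun e he hne => by
    have := hcap e he
    have : 0 < ε * dist x e := mul_pos hε (dist_pos.2 hne.symm)
    linarith
  have hx : ∀ a ∈ A, ∀ b ∈ B, seg a b ⊆ D → w ∈ seg a b → x ∉ seg a b := by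
    intro a ha b hb hs hws hxs
    have h1 : a ≠ x := by
      rintro rfl
      exact hw.2 (Or.inl (Or.inr (h.sideB a h.arcB.left_mem b hb (hs.trans h.sub) hws)))
    have h2 : b ≠ x := by
      rintro rfl
      exact hw.2 (Or.inl (Or.inl (h.sideA a ha b h.arcA.left_mem (hs.trans h.sub) hws)))
    have := hGc.le_max hc.le hxs
    exact absurd this (not_le.2 (max_lt (strict a (hs (left_mem_seg a b)) h1)
      (strict b (hs (right_mem_seg a b)) h2)))
  rcases ha with (ha | ha) | ha
  · rcases hb with (hb | hb) | hb
    · exact absurd (Or.inl (Or.inl (h.sideA a ha b hb (hs.trans h.sub) hab))) hw.2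
    · exact ⟨a, ha, b, hb, hab, hs, hx a ha b hb hs hab, hna.trans_le (min_le_left _ _),
        hnb.trans_le (min_le_left _ _), hGa', hGb'⟩
    · exact absurd hb (hC b hnb)
  · rcases hb with (hb | hb) | hb
    · rw [seg_comm] at hs
      exact ⟨b, hb, a, ha, hab.symm, hs, hx b hb a ha hs hab.symm, hnb.trans_le (min_le_left _ _),
        hna.trans_le (min_le_left _ _), hGb', hGa'⟩
    · exact absurd (Or.inl (Or.inr (h.sideB a ha b hb (hs.trans h.sub) hab))) hw.2
    · exact absurd hb (hC b hnb)
  · exact absurd ha (hC a hna)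

/-- There are chords of the disk between the sides at the apex, as short as we like. -/
theorem TriDisk.exists_short_chord {η : ℝ} (hη : 0 < η) : ∃ a ∈ A, ∃ b ∈ B, seg a b ⊆ D ∧
    x ∉ seg a b ∧ dist x a < η ∧ dist x b < η := by
  obtain ⟨G, c, hG, hc, hGc, hy, hz⟩ := h.exists_strict H
  obtain ⟨θ, hθ, key⟩ := h.cap_chord H hG hc hGc hy hz hη
  obtain ⟨w, hw, hd⟩ := h.mem.exists_near (Or.inl (Or.inl h.arcA.left_mem)) hθ
  obtain ⟨a, ha, b, hb, -, hs, hx, h1, h2, -, -⟩ := key w hw hd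
  exact ⟨a, ha, b, hb, hs, hx, h1, h2⟩

omit H h in
/-- A segment from a closed set to another one contains a segment meeting each of them only in an
end point. -/
theorem exists_subchord (hA : IsClosed A) (hB : IsClosed B) (ha : a ∈ A) (hb : b ∈ B) :
    ∃ a' ∈ A, ∃ b' ∈ B, seg a' b' ⊆ seg a b ∧
      A ∩ seg a' b' ⊆ {a'} ∧ B ∩ seg a' b' ⊆ {b'} := by
  obtain ⟨b', ⟨hb's, hb'B⟩, hmin⟩ := ((isCompact_seg a b).inter_right hB).exists_isMinOn
    ⟨b, right_mem_seg a b, hb⟩ (f := fun w => dist a w) (by fun_prop)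
  obtain ⟨a', ⟨ha's, ha'A⟩, hmax⟩ := ((isCompact_seg a b').inter_right hA).exists_isMaxOn
    ⟨a, left_mem_seg a b', ha⟩ (f := fun w => dist a w) (by fun_prop)
  have hsub : seg a' b' ⊆ seg a b' := seg_subset_of_mem_right ha's
  have hsub' : seg a' b' ⊆ seg a b := hsub.trans (seg_subset_of_mem_left hb's)
  refine ⟨a', ha'A, b', hb'B, hsub', ?_, ?_⟩
  · rintro w ⟨hwA, hw⟩
    have h1 : dist a w ≤ dist a a' := hmax ⟨hsub hw, hwA⟩
    have h2 : Btw a a' w := Btw.inner ha's hw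
    have h3 := h2.left_le
    exact (Btw.unique (hsub hw) ha's (le_antisymm h1 h3))
  · rintro w ⟨hwB, hw⟩
    have h1 : dist a b' ≤ dist a w := hmin ⟨hsub' hw, hwB⟩
    exact Btw.unique (hsub hw) (right_mem_seg a b') (le_antisymm (Btw.left_le (hsub hw)) h1)

end Disks

section Rays

variable {X : Type*} [MetricSpace X] {p x y z w : X}

/-- `x` and `y` lie on a common segment issuing from `p`. -/
def Comp (p x y : X) : Prop := Btw p x y ∨ Btw p y x

theorem Comp.symm (h : Comp p x y) : Comp p y x := Or.symm h

theorem Comp.btw (h : Comp p x y) (hd : dist p x ≤ dist p y) : Btw p x y := by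
  refine h.elim id fun h' => ?_
  have h1 : dist y x = 0 := by
    have := dist_nonneg (x := y) (y := x)
    unfold Btw at h'; linarith
  rw [dist_eq_zero.1 h1]
  exact btw_right p x

theorem isClosed_comp : IsClosed {q : X × X | Comp p q.1 q.2} :=
  (isClosed_btw.preimage (f := fun q : X × X => (p, q.1, q.2)) (by fun_prop)).union
    (isClosed_btw.preimage (f := fun q : X × X => (p, q.2, q.1)) (by fun_prop))

theorem isClosed_exists_mem {Z W : Type*} [MetricSpace Z] [MetricSpace W] {K : Set W}
    {R : Set (Z × W)} (hK : IsCompact K) (hR : IsClosed R) :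
    IsClosed {z | ∃ c ∈ K, (z, c) ∈ R} := by
  refine isClosed_of_closure_subset fun z hz => ?_
  obtain ⟨u, hu, hlim⟩ := mem_closure_iff_seq_limit.1 hz
  choose c hc hR' using hu
  obtain ⟨e, he, φ, hφ, hlim'⟩ := hK.tendsto_subseq hc
  exact ⟨e, he, hR.mem_of_tendsto ((hlim.comp hφ.tendsto_atTop).prodMk_nhds hlim')
    (Eventually.of_forall fun n => hR' _)⟩

variable [CAT0 X] {O D T : Set X} {a b a' b' e u v : X} {δ : ℝ}

theorem isClosed_seg_subset (hD : IsClosed D) : IsClosed {q : X × X | seg q.1 q.2 ⊆ D} := by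
  have : {q : X × X | seg q.1 q.2 ⊆ D} = ⋂ t : ℝ, {q : X × X | pt q.1 q.2 t ∈ D} := by
    ext q
    simp only [mem_iInter]
    refine ⟨fun h t => h (pt_mem_seg _ _ t), fun h z hz => ?_⟩
    obtain ⟨t, -, -, rfl⟩ := Btw.exists_pt hz
    exact h t
  rw [this]
  exact isClosed_iInter fun t => hD.preimage
    (Continuous.pt continuous_fst continuous_snd continuous_const)

omit [CAT0 X] in
theorem Comp.apex_notMem (h : Comp p a b) (ha : a ≠ p) (hb : b ≠ p) : p ∉ seg a b := by
  intro hp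
  have hp : Btw a p b := hp
  rcases h with h | h
  · exact ha (hp.symm.antisymm h.symm).symm
  · exact hb (hp.antisymm h.symm).symm

omit [CAT0 X] in
theorem Comp.mem_seg (h : Comp p a b) (hz : z ∈ seg a b) : Comp p a z ∧ Comp p b z := by
  have hz : Btw a z b := hz
  rcases h with h | h
  · exact ⟨Or.inl (h.inner hz), Or.inr (h.outer hz)⟩
  · exact ⟨Or.inr (h.outer hz.symm), Or.inl (h.inner hz.symm)⟩

theorem Comp.notMem_seg (h : Comp p a a') (ha' : a' ≠ p) (hp : p ∉ seg a b) :
    p ∉ seg a' b := by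
  intro hp'
  have hp' : Btw a' p b := hp'
  rcases h with h | h
  · exact hp (Btw.inner' hp' h.symm)
  · exact hp (Btw.concat h.symm hp' ha')

theorem LocalCone.comp (L : LocalCone O p δ) (hu : u ≠ p) (h : Btw p u v) (h' : Btw p u w)
    (hv : dist p v ≤ δ) (hw : dist p w ≤ δ) : Comp p v w := by
  have ne : ∀ v, Btw p u v → v ≠ p := by
    rintro v h rfl
    exact hu h.eq_of_same
  obtain ⟨ξ, hξ, h1⟩ := L.ext v (ne v h) hv
  obtain ⟨ξ', hξ', h1'⟩ := L.ext w (ne w h') hw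
  obtain rfl := L.ext_unique u ξ ξ' hu (h1.outer' h) (h1'.outer' h') hξ hξ'
  exact h1.total h1'

theorem LocalCone.comp_trans (L : LocalCone O p δ) (hu : u ≠ p) (h : Comp p v u) (h' : Comp p u w)
    (hv : dist p v ≤ δ) (hw : dist p w ≤ δ) : Comp p v w := by
  rcases h with h | h <;> rcases h' with h' | h'
  · exact Or.inl (h'.outer' h)
  · exact h.total h'
  · exact L.comp hu h h' hv hw
  · exact Or.inr (h.outer' h')

theorem Membrane.extend_inward (H : TwoCx O) (h : Membrane D T) (L : LocalCone O p δ)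
    (hwD : w ∈ D) (hwO : w ∈ O) (hw : dist p w < δ) :
    seg p w ⊆ D ∨ ∃ a ∈ T, a ≠ p ∧ Btw p a w ∧ seg a w ⊆ D := by
  by_cases hwp : w = p
  · left
    rw [hwp, seg_self, ← hwp]
    exact singleton_subset_iff.2 hwD
  obtain ⟨ξ, hξ, hb⟩ := L.ext w hwp hw.le
  have hne : ξ ≠ w := by rintro rfl; exact hw.ne hξ
  obtain ⟨a, ha, hba, hs⟩ := h.extend_to_boundary H hwD hne
  have key : ∀ y, Btw p y w → y ≠ p → dist w y ≤ dist w a → y ∈ seg w a := by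
    intro y hy hyp hd
    obtain ⟨y', hy', hd'⟩ := exists_btw_dist w a dist_nonneg hd
    have e1 : Btw ξ w y := (hb.inner' hy).symm
    have e2 : Btw ξ w y' := hba.inner hy'
    have : y = y' := H.nonBranching.along hne e1 e2 (by unfold Btw at e1 e2; linarith)
      fun v hv => by
        have hv' : Btw y v w := Btw.symm hv
        refine L.radial w hwO hw.le v ?_ (hy.outer hv')
        rintro rfl
        exact hyp (hv'.symm.antisymm hy.symm).symm
    rw [this]; exact hy'
  by_cases hd : dist w a < dist w p
  · right
    obtain ⟨y, hy, hyd⟩ := exists_btw_dist w p dist_nonneg hd.le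
    have hyp : y ≠ p := by rintro rfl; exact hd.ne hyd.symm
    have : y = a := Btw.unique (key y hy.symm hyp hyd.le) (right_mem_seg w a) hyd
    subst this
    exact ⟨y, ha, hyp, hy.symm, by rwa [seg_comm]⟩
  · left
    push Not at hd
    have hsub : ∀ y ∈ seg p w, y ≠ p → y ∈ D := fun y hy hyp =>
      hs (key y hy hyp (by have := Btw.right_le hy; rw [dist_comm y w, dist_comm p w] at this; linarith))
    have hp : p ∈ D := by
      have ht : Tendsto (fun n : ℕ => pt p w (1 / ((n : ℝ) + 1))) atTop (nhds (pt p w 0)) :=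
        Tendsto.pt tendsto_const_nhds tendsto_const_nhds tendsto_one_div_add_atTop_nhds_zero_nat
      rw [pt_zero] at ht
      refine h.compact.isClosed.mem_of_tendsto ht (Eventually.of_forall fun n => ?_)
      refine hsub _ (pt_mem_seg _ _ _) fun he => ?_
      have h1 : 1 / ((n : ℝ) + 1) ≤ 1 := by
        rw [div_le_one (by positivity)]
        have : (0 : ℝ) ≤ n := n.cast_nonneg
        linarith
      have := dist_left_pt p w (t := 1 / ((n : ℝ) + 1)) (by positivity) h1
      rw [he, dist_self] at this
      have h2 : 0 < 1 / ((n : ℝ) + 1) * dist p w :=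
        mul_pos (by positivity) (dist_pos.2 (Ne.symm hwp))
      linarith
    intro y hy
    by_cases hyp : y = p
    · rwa [hyp]
    · exact hsub y hy hyp

variable (H : TwoCx O) (L : LocalCone O p δ)
include H L

/-- A thin triangle with one side on a ray from `p` is swept out radially. -/
theorem comp_of_triDisk (hr : Comp p a b) (ha : a ≠ p) (hb : b ≠ p) (hpa : p ∉ seg a e)
    (hpb : p ∉ seg b e) (h : TriDisk univ (seg a b) (seg a e) (seg b e) a b e D)
    (had : dist p a < δ) (hbd : dist p b < δ) (hed : dist p e < δ) (hz : z ∈ seg a e) :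
    ∃ z' ∈ seg b e, Comp p z z' := by
  have hball : ∀ w ∈ D, dist p w < δ := fun w hw =>
    (h.hull H (by fun_prop) (sConv_dist p) (M := max (dist p a) (max (dist p b) (dist p e)))
      (le_max_left _ _) ((le_max_left _ _).trans (le_max_right _ _))
      ((le_max_right _ _).trans (le_max_right _ _)) w hw).trans_lt
      (max_lt had (max_lt hbd hed))
  have hpD : p ∉ D := by
    intro hp
    have strict : ∀ {a b : X}, p ∉ seg a e → Btw p a b →
        dist b a + dist a e < dist b p + dist p e := by
      intro a b hpa hab
      have h1 : dist a e < dist a p + dist p e :=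
        lt_of_le_of_ne (dist_triangle _ _ _) fun he => hpa he.symm
      unfold Btw at hab
      rw [dist_comm b a, dist_comm b p]
      rw [dist_comm a p] at h1
      linarith
    have conv : ∀ b : X, SConv 0 fun w : X => dist b w + dist w e := fun b => by
      simpa using (sConv_dist b).add (sConv_dist' e)
    rcases hr with hr | hr
    · have s := strict hpa hr
      have := h.hull H (by fun_prop) (conv b) (M := dist b a + dist a e) le_rfl
        (by simpa using dist_triangle b a e) (by simpa using dist_triangle b a e) p hp
      linarith
    · have s := strict hpb hr
      have := h.hull H (by fun_prop) (conv a) (M := dist a b + dist b e)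
        (by simpa using dist_triangle a b e) le_rfl (by simpa using dist_triangle a b e) p hp
      linarith
  have hclosed := isClosed_exists_mem (isCompact_seg b e) (isClosed_comp (p := p))
  refine hclosed.closure_subset (_root_.mem_closure_iff.2 ?_)
  intro U hU hzU
  by_contra hcon
  obtain ⟨ε, hε, hεU⟩ := Metric.isOpen_iff.1 hU z hzU
  obtain ⟨w, hwD, hwT, hwO, hwz⟩ := h.mem.exists_near_face H
    (h.mem.subset (Or.inl (Or.inr hz))) hε
  have bad : ∀ s ∈ seg b e, ¬ Comp p w s := fun s hs hc =>
    hcon ⟨w, hεU (by rwa [mem_ball, dist_comm]), s, hs, hc⟩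
  have bad' : ∀ s ∈ seg a b, ¬ Comp p w s := by
    intro s hs hc
    have hsp : s ≠ p := by rintro rfl; exact hr.apex_notMem ha hb hs
    exact bad b (left_mem_seg b e) (L.comp_trans hsp hc (hr.mem_seg hs).2.symm
      (hball w hwD).le hbd.le)
  have hT : ∀ s ∈ seg a b ∪ seg a e ∪ seg b e, Comp p w s → s ∈ seg a e := by
    rintro s ((hs | hs) | hs) hc
    exacts [absurd hc (bad' s hs), hs, absurd hc (bad s hs)]
  have hwp : p ≠ w := by rintro rfl; exact hpD hwD
  obtain ⟨a1, ha1, hb1, -⟩ := h.mem.extend_to_boundary H hwD hwp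
  rcases h.mem.extend_inward H L hwD hwO (hball w hwD) with hs | ⟨a2, ha2, -, hb2, -⟩
  · exact hpD (hs (left_mem_seg p w))
  · have m1 := hT a1 ha1 (Or.inl hb1)
    have m2 := hT a2 ha2 (Or.inr hb2)
    have hw : w ∈ seg a2 a1 := hb1.inner' hb2
    exact hwT (Or.inl (Or.inr (sideIn_seg univ a e a2 m2 a1 m1 (subset_univ _) hw)))

theorem Comp.exists_mem_seg (hr : Comp p a b) (ha : a ≠ p) (hb : b ≠ p) (hp : p ∉ seg a e)
    (had : dist p a < δ) (hbd : dist p b < δ) (hed : dist p e < δ) (hz : z ∈ seg a e) :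
    ∃ z' ∈ seg b e, Comp p z z' := by
  by_contra hcon
  push Not at hcon
  have hp' := hr.notMem_seg hb hp
  have hzR : z ∉ seg a b := fun h => hcon b (left_mem_seg b e) (hr.mem_seg h).2.symm
  have hzS : z ∉ seg b e := fun h => hcon z h (Or.inl (btw_right p z))
  set K := seg a b ∪ seg b e with hK
  have hKc : IsClosed K := (isClosed_seg _ _).union (isClosed_seg _ _)
  have hzK : z ∉ K := fun h => h.elim hzR hzS
  obtain ⟨zu, hzu, u, huK, hu1, -, hu2⟩ := exists_subchord (a := z) (b := a) isClosed_singleton hKc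
    (mem_singleton z) (Or.inl (left_mem_seg a b))
  rw [mem_singleton_iff.1 hzu] at hu1 hu2
  obtain ⟨zv, hzv, v, hvK, hv1, -, hv2⟩ := exists_subchord (a := z) (b := e) isClosed_singleton hKc
    (mem_singleton z) (Or.inr (right_mem_seg b e))
  rw [mem_singleton_iff.1 hzv] at hv1 hv2
  have hz : Btw a z e := hz
  have hza : Btw z u a := hu1 (right_mem_seg z u)
  have hze : Btw z v e := hv1 (right_mem_seg z v)
  have huz : u ≠ z := by rintro rfl; exact hzK huK
  have hvz : v ≠ z := by rintro rfl; exact hzK hvK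
  have huv : Btw u z v := (hz.inner' hza.symm).inner hze
  have huve : Btw u z e := hz.inner' hza.symm
  have split : ∀ w ∈ seg u v, w ∈ seg z u ∨ w ∈ seg z v := by
    intro w hw
    rcases Btw.total hw huv with h | h
    · exact Or.inl h.symm
    · exact Or.inr (Btw.inner' hw h)
  have hKuv : ∀ w ∈ seg u v, w ∈ K → w = u ∨ w = v := fun w hw hwK =>
    (split w hw).imp (fun h => hu2 ⟨hwK, h⟩) fun h => hv2 ⟨hwK, h⟩
  have hsub : seg u v ⊆ seg a e := fun w hw =>
    sideIn_seg univ a e u (hz.outer' hza.symm) v (hz.outer hze) (subset_univ _) hw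
  have hnR : ¬ (u ∈ seg a b ∧ v ∈ seg a b) := fun h =>
    hzR (sideIn_seg univ a b u h.1 v h.2 (subset_univ _) huv)
  have hnS : ¬ (u ∈ seg b e ∧ v ∈ seg b e) := fun h =>
    hzS (sideIn_seg univ b e u h.1 v h.2 (subset_univ _) huv)
  have main : ∀ u v, u ∈ seg a b → u ∉ seg b e → v ∈ seg b e → v ∉ seg a b → z ∈ seg u v →
      seg u v ⊆ seg a e → (∀ w ∈ seg u v, w ∈ K → w = u ∨ w = v) → False := by
    clear * - hr ha hb hp hp' had hbd hed hcon H L hK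
    intro u v hu hu' hv hv' hzs hsub hKuv
    obtain ⟨k, ⟨hk1, hk2⟩, hmax⟩ := ((isCompact_seg b u).inter (isCompact_seg b v)).exists_isMaxOn
      ⟨b, left_mem_seg b u, left_mem_seg b v⟩ (f := fun w => dist b w) (by fun_prop)
    have hkR : k ∈ seg a b := by
      rw [seg_comm]; rw [seg_comm] at hu; exact seg_subset_of_mem_left hu hk1
    have hkS : k ∈ seg b e := seg_subset_of_mem_left hv hk2
    have hR : seg u k ⊆ seg a b := fun w hw => sideIn_seg univ a b u hu k hkR (subset_univ _) hw
    have hS : seg k v ⊆ seg b e := fun w hw => sideIn_seg univ b e k hkS v hv (subset_univ _) hw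
    have huk : u ≠ k := by rintro rfl; exact hu' hkS
    have hkv : k ≠ v := by rintro rfl; exact hv' hkR
    have huv : u ≠ v := by rintro rfl; exact hv' hu
    obtain ⟨D, hD⟩ := TriDisk.exists_segs (x := u) (y := k) (z := v) huk huv hkv
      (fun w ⟨h1, h2⟩ => (hKuv w h2 (Or.inl (hR h1))).resolve_right
        (by rintro rfl; exact hv' (hR h1)))
      (fun w ⟨h1, h2⟩ => by
        have m1 : w ∈ seg b u := seg_subset_of_mem_right hk1 (by rwa [seg_comm])
        have m2 : w ∈ seg b v := seg_subset_of_mem_right hk2 h2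
        have e1 : dist b w ≤ dist b k := hmax ⟨m1, m2⟩
        have h2 : Btw k w v := h2
        have e2 := (Btw.inner hk2 h2).left_le
        exact Btw.unique m2 hk2 (le_antisymm e1 e2))
      (fun w ⟨h1, h2⟩ => (hKuv w h1 (Or.inr (hS h2))).resolve_left
        (by rintro rfl; exact hu' (hS h2)))
    have ne : ∀ s ∈ seg a b, s ≠ p := by rintro s hs rfl; exact hr.apex_notMem ha hb hs
    have dd : ∀ s ∈ seg a b, dist p s < δ := fun s hs =>
      ((sConv_dist p).le_max le_rfl hs).trans_lt (max_lt had hbd)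
    have dd' : ∀ s ∈ seg b e, dist p s < δ := fun s hs =>
      ((sConv_dist p).le_max le_rfl hs).trans_lt (max_lt hbd hed)
    have huk' : Comp p u k := L.comp_trans hb (hr.mem_seg hu).2.symm (hr.mem_seg hkR).2
      (dd u hu).le (dd k hkR).le
    obtain ⟨z', hz', hc⟩ := comp_of_triDisk H L huk' (ne u hu) (ne k hkR) (fun h => hp (hsub h))
      (fun h => hp' (hS h)) hD (dd u hu) (dd k hkR) (dd' v hv) hzs
    exact hcon z' (hS hz') hc
  rcases huK with hu | hu <;> rcases hvK with hv | hv
  · exact hnR ⟨hu, hv⟩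
  · exact main u v hu (fun h => hnS ⟨h, hv⟩) hv (fun h => hnR ⟨hu, h⟩) huv hsub hKuv
  · exact main v u hv (fun h => hnS ⟨hu, h⟩) hu (fun h => hnR ⟨h, hv⟩) huv.symm
      (by rwa [seg_comm]) fun w hw hwK => (hKuv w (by rwa [seg_comm]) hwK).symm
  · exact hnS ⟨hu, hv⟩

/-- Segments between the same pair of rays sweep out the same set of directions. -/
theorem Comp.exists_mem_seg₂ (ha : Comp p a a') (hb : Comp p b b') (hap : a ≠ p) (hap' : a' ≠ p)
    (hbp : b ≠ p) (hbp' : b' ≠ p) (hp : p ∉ seg a b) (had : dist p a < δ) (had' : dist p a' < δ)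
    (hbd : dist p b < δ) (hbd' : dist p b' < δ) (hz : z ∈ seg a b) :
    ∃ z' ∈ seg a' b', Comp p z z' := by
  obtain ⟨w, hw, hc⟩ := ha.exists_mem_seg H L hap hap' hp had had' hbd hz
  have hp' : p ∉ seg b a' := by rw [seg_comm]; exact ha.notMem_seg hap' hp
  rw [seg_comm] at hw
  obtain ⟨z', hz', hc'⟩ := hb.exists_mem_seg H L hbp hbp' hp' hbd hbd' had' hw
  have hp'' : p ∉ seg b' a' := hb.notMem_seg hbp' hp'
  have bd : ∀ {c e y}, y ∈ seg c e → dist p c < δ → dist p e < δ → dist p y ≤ δ :=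
    fun hs h1 h2 => (((sConv_dist p).le_max le_rfl hs).trans_lt (max_lt h1 h2)).le
  refine ⟨z', by rwa [seg_comm], L.comp_trans ?_ hc hc' (bd hz had hbd) (bd hz' hbd' had')⟩
  rintro rfl
  exact hp' hw

omit H L in
/-- The union of the segments from `p` to points of the segment from `a` to `b`. -/
def coneOver (p a b : X) : Set X := {w | ∃ c ∈ seg a b, Btw p w c}

omit H L in
theorem isCompact_coneOver : IsCompact (coneOver p a b) := by
  have : coneOver p a b = (fun q : X × ℝ => pt p q.1 q.2) '' (seg a b ×ˢ Icc (0 : ℝ) 1) := by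
    ext w
    constructor
    · rintro ⟨c, hc, hb⟩
      obtain ⟨t, h0, h1, rfl⟩ := hb.exists_pt
      exact ⟨(c, t), ⟨hc, h0, h1⟩, rfl⟩
    · rintro ⟨⟨c, t⟩, ⟨hc, -⟩, rfl⟩
      exact ⟨c, hc, btw_pt _ _ _⟩
  rw [this]
  exact ((isCompact_seg a b).prod isCompact_Icc).image
    (Continuous.pt continuous_const continuous_fst continuous_snd)

theorem seg_subset_coneOver_right (hp : p ∉ seg a b) (had : dist p a < δ) (hbd : dist p b < δ)
    (hw : Btw p w a) : seg w b ⊆ coneOver p a b := by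
  by_cases hwp : w = p
  · subst hwp
    exact fun u hu => ⟨b, right_mem_seg a b, hu⟩
  have hap : a ≠ p := by rintro rfl; exact hp (left_mem_seg _ _)
  have hpw : p ∉ seg w b := Comp.notMem_seg (Or.inr hw) hwp hp
  intro u hu
  by_contra hcon
  set P := {u | ∃ c ∈ seg a b, Btw p u c} with hPdef
  set Q := {u | ∃ c ∈ seg a b, Btw p c u} with hQdef
  have hP : IsClosed P := isClosed_exists_mem (isCompact_seg a b)
    (isClosed_btw.preimage (f := fun q : X × X => (p, q.1, q.2)) (by fun_prop))
  have hQ : IsClosed Q := isClosed_exists_mem (isCompact_seg a b)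
    (isClosed_btw.preimage (f := fun q : X × X => (p, q.2, q.1)) (by fun_prop))
  have cover : seg w b ⊆ P ∪ Q := by
    intro v hv
    obtain ⟨c, hc, h | h⟩ := Comp.exists_mem_seg H L (Or.inl hw) hwp hap hpw
      (hw.left_le.trans_lt had) had hbd hv
    exacts [Or.inl ⟨c, hc, h⟩, Or.inr ⟨c, hc, h⟩]
  have hsub : seg w u ⊆ seg w b := seg_subset_of_mem_left hu
  have huQ : u ∈ Q := (cover hu).resolve_left hcon
  obtain ⟨v, hv, ⟨c, hc, hvc⟩, c', hc', hvc'⟩ := isPreconnected_closed_iff.1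
    (isPreconnected_seg w u) P Q hP hQ (hsub.trans cover)
    ⟨w, left_mem_seg w u, a, left_mem_seg a b, hw⟩ ⟨u, right_mem_seg w u, huQ⟩
  have hvab : v ∈ seg a b := sideIn_seg univ a b c' hc' c hc (subset_univ _) (hvc.inner' hvc')
  have huab : u ∈ seg a b := seg_subset_of_mem_right hvab (Btw.inner' hu hv)
  exact hcon ⟨u, huab, btw_right p u⟩

theorem seg_subset_coneOver (hp : p ∉ seg a b) (had : dist p a < δ) (hbd : dist p b < δ)
    (hu : u ∈ coneOver p a b) (hv : v ∈ coneOver p a b) : seg u v ⊆ coneOver p a b := by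
  obtain ⟨c, hc, huc⟩ := hu
  obtain ⟨e, he, hve⟩ := hv
  have hce : seg c e ⊆ seg a b := fun w hw => sideIn_seg univ a b c hc e he (subset_univ _) hw
  have bd : ∀ y ∈ seg a b, dist p y < δ := fun y hy =>
    ((sConv_dist p).le_max le_rfl hy).trans_lt (max_lt had hbd)
  have up : ∀ c ∈ seg a b, ∀ e ∈ seg a b, coneOver p c e ⊆ coneOver p a b :=
    fun c hc e he w ⟨y, hy, h⟩ => ⟨y, sideIn_seg univ a b c hc e he (subset_univ _) hy, h⟩
  have h1 : seg u e ⊆ coneOver p c e := seg_subset_coneOver_right H L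
    (fun h => hp (hce h)) (bd c hc) (bd e he) huc
  by_cases hpu : p ∈ seg u e
  · have hpu : Btw u p e := hpu
    intro w hw
    by_cases hvp : v = p
    · subst hvp
      exact ⟨c, hc, huc.outer' (Btw.symm hw)⟩
    have hpv : Btw u p v := hpu.inner hve
    rcases Btw.total hw hpv with h | h
    · exact ⟨c, hc, huc.outer' h.symm⟩
    · exact ⟨e, he, hve.outer' (Btw.inner' hw h)⟩
  · have h2 : seg v u ⊆ coneOver p e u := seg_subset_coneOver_right H L
      (by rwa [seg_comm]) (bd e he) (huc.left_le.trans_lt (bd c hc)) hve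
    intro w hw
    rw [seg_comm] at hw
    obtain ⟨y, hy, hwy⟩ := h2 hw
    rw [seg_comm] at hy
    obtain ⟨y', hy', hyy'⟩ := h1 hy
    exact ⟨y', hce hy', hyy'.outer' hwy⟩

omit H L in
theorem sConv_infDist {N : Set X} (hN : IsCompact N) (hne : N.Nonempty)
    (hconv : ∀ u ∈ N, ∀ v ∈ N, seg u v ⊆ N) : SConv 0 fun w => infDist w N := by
  intro x z y hz
  obtain ⟨u, hu, hxu⟩ := hN.exists_infDist_eq_dist hne x
  obtain ⟨v, hv, hyv⟩ := hN.exists_infDist_eq_dist hne y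
  obtain ⟨t, h0, h1, rfl⟩ := hz.exists_pt
  have h2 : infDist (pt x y t) N ≤ (1 - t) * dist x u + t * dist y v :=
    (infDist_le_dist_of_mem (hconv u hu v hv (pt_mem_seg u v t))).trans
      (dist_pt_pt x y u v h0 h1)
  simp only [dist_left_pt x y h0 h1, dist_pt_right x y h0 h1, hxu, hyv]
  have := mul_le_mul_of_nonneg_left h2 (dist_nonneg (x := x) (y := y))
  linarith

end Rays

section Wedges

variable {X : Type*} [MetricSpace X] [CAT0 X] {E O A B C D : Set X} {p x y z u v w : X} {a b : ℝ}
  {σ τ : ℝ → X} {δ : ℝ}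

theorem Comp.of_mem_seg (h : Comp p x y) (hu : u ∈ seg x y) (hv : v ∈ seg x y) : Comp p u v := by
  rcases h with h | h
  · exact (h.outer hu).total (h.outer hv)
  · exact (h.outer (Btw.symm hu)).total (h.outer (Btw.symm hv))

omit [CAT0 X] in
theorem TriDisk.symm (h : TriDisk E A B C x y z D) : TriDisk E B A C x z y D :=
  ⟨h.arcB, h.arcA, h.arcC.symm, h.sideB, h.sideA, h.sideC, by rw [inter_comm]; exact h.interAB,
    h.interBC, h.interAC, by rw [union_comm B A]; exact h.mem, h.sub⟩

theorem TriDisk.not_btw (H : TwoCx O) (h : TriDisk E A B C x y z D) : ¬ Btw x y z := by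
  intro hb
  have hD : ∀ w ∈ D, w ∈ seg x z := fun w hw =>
    le_antisymm (h.hull H (by fun_prop) (G := fun w => dist x w + dist w z) (M := dist x z)
      (by simpa using (sConv_dist x).add (sConv_dist' z)) (by simp) hb.le (by simp) w hw)
      (dist_triangle x w z)
  have hB : seg x z ⊆ B := seg_subset_of_connected h.arcB.isPreconnected h.arcB.left_mem
    h.arcB.right_mem fun w hw => hD w (h.mem.subset (Or.inl (Or.inr hw)))
  exact h.arcA.ne.symm (h.interAB ⟨h.arcA.right_mem, hB hb⟩)

theorem TriDisk.not_comp (H : TwoCx O) (h : TriDisk E A B C x y z D) : ¬ Comp x y z :=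
  fun hc => hc.elim (h.not_btw H) (h.symm.not_btw H)

/-- Two geodesics of the path metric of `E`, issuing from `p`, without further common points. -/
structure Wedge (E : Set X) (p : X) (σ τ : ℝ → X) (a b : ℝ) : Prop where
  left : YG E σ 0 a
  right : YG E τ 0 b
  left_zero : σ 0 = p
  right_zero : τ 0 = p
  inter : σ '' Icc 0 a ∩ τ '' Icc 0 b ⊆ {p}

omit [CAT0 X] in
theorem Wedge.symm (h : Wedge E p σ τ a b) : Wedge E p τ σ b a :=
  ⟨h.right, h.left, h.right_zero, h.left_zero, by rw [inter_comm]; exact h.inter⟩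

omit [CAT0 X] in
theorem Wedge.mono (h : Wedge E p σ τ a b) {s t : ℝ} (hs : s ∈ Icc 0 a) (ht : t ∈ Icc 0 b) :
    Wedge E p σ τ s t :=
  ⟨h.left.mono le_rfl hs.1 hs.2, h.right.mono le_rfl ht.1 ht.2, h.left_zero, h.right_zero,
    (inter_subset_inter (image_mono (Icc_subset_Icc_right hs.2))
      (image_mono (Icc_subset_Icc_right ht.2))).trans h.inter⟩

omit [CAT0 X] in
theorem YG.ne_zero (h : YG E σ 0 a) (hE : RectConnected E) {s : ℝ} (hs : s ∈ Icc 0 a)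
    (h0 : s ≠ 0) : σ s ≠ σ 0 :=
  fun he => h0 (h.injOn hE hs ⟨le_rfl, h.le⟩ he)

variable (hH1 : H1Trivial E) (hE : RectConnected E)
include hH1 hE

theorem Wedge.exists_disk (h : Wedge E p σ τ a b) {s t : ℝ} (hs : s ∈ Icc 0 a)
    (ht : t ∈ Icc 0 b) (hst : seg (σ s) (τ t) ⊆ E) (hp : p ∉ seg (σ s) (τ t)) :
    ∃ s', 0 < s' ∧ s' ≤ s ∧ ∃ t', 0 < t' ∧ t' ≤ t ∧ seg (σ s') (τ t') ⊆ seg (σ s) (τ t) ∧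
      ∃ D, TriDisk E (σ '' Icc 0 s') (τ '' Icc 0 t') (seg (σ s') (τ t')) p (σ s') (τ t') D := by
  have hw := h.mono hs ht
  obtain ⟨_, ⟨s', hs', rfl⟩, _, ⟨t', ht', rfl⟩, hsub, hA, hB⟩ := exists_subchord
    (hw.left.isCompact hE).isClosed (hw.right.isCompact hE).isClosed
    ⟨s, ⟨hs.1, le_rfl⟩, rfl⟩ ⟨t, ⟨ht.1, le_rfl⟩, rfl⟩
  have hs0 : 0 < s' := by
    refine hs'.1.lt_of_ne ?_
    rintro rfl
    exact hp (hsub (by rw [h.left_zero]; exact left_mem_seg _ _))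
  have ht0 : 0 < t' := by
    refine ht'.1.lt_of_ne ?_
    rintro rfl
    exact hp (hsub (by rw [h.right_zero]; exact right_mem_seg _ _))
  have hw' := hw.mono hs' ht'
  have hne : σ s' ≠ τ t' := by
    intro he
    have hm : σ s' ∈ τ '' Icc 0 t := he ▸ ⟨t', ht', rfl⟩
    have : σ s' = p := hw.inter ⟨⟨s', hs', rfl⟩, hm⟩
    exact hp (hsub (this ▸ left_mem_seg _ _))
  have arcA := hw'.left.isArc hE hs0
  have arcB := hw'.right.isArc hE ht0
  rw [h.left_zero] at arcA
  rw [h.right_zero] at arcB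
  refine ⟨s', hs0, hs'.2, t', ht0, ht'.2, hsub, TriDisk.exists_of_H1 hH1 arcA arcB (isArc_seg hne)
    (hw'.left.sideIn hE) (hw'.right.sideIn hE) (sideIn_seg _ _ _) hw'.inter
    ((inter_subset_inter_left _ (image_mono (Icc_subset_Icc_right hs'.2))).trans hA)
    ((inter_subset_inter_left _ (image_mono (Icc_subset_Icc_right ht'.2))).trans hB)
    hw'.left.image_subset hw'.right.image_subset (hsub.trans hst)⟩

theorem Wedge.not_comp (H : TwoCx O) (h : Wedge E p σ τ a b) {s t : ℝ} (hs : s ∈ Icc 0 a)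
    (ht : t ∈ Icc 0 b) (hsp : σ s ≠ p) (htp : τ t ≠ p) (hst : seg (σ s) (τ t) ⊆ E) :
    ¬ Comp p (σ s) (τ t) := by
  intro hc
  obtain ⟨s', -, -, t', -, -, hsub, D, hD⟩ := h.exists_disk hH1 hE hs ht hst
    (hc.apex_notMem hsp htp)
  exact hD.not_comp H (hc.of_mem_seg (hsub (left_mem_seg _ _)) (hsub (right_mem_seg _ _)))

/-- The tip of a wedge is filled by small triangles. -/
theorem Wedge.exists_small_disk (H : TwoCx O) (h : Wedge E p σ τ a b)
    (hD : TriDisk E (σ '' Icc 0 a) (τ '' Icc 0 b) C p y z D) {η : ℝ} (hη : 0 < η) :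
    ∃ s', 0 < s' ∧ s' ≤ a ∧ s' < η ∧ ∃ t', 0 < t' ∧ t' ≤ b ∧ t' < η ∧ ∃ D',
      TriDisk E (σ '' Icc 0 s') (τ '' Icc 0 t') (seg (σ s') (τ t')) p (σ s') (τ t') D' ∧
      D' ⊆ ball p η := by
  have small : ∀ (f : ℝ → X) (c : ℝ), YG E f 0 c → f 0 = p → ∃ θ > 0, ∀ s ∈ Icc 0 c,
      dist p (f s) < θ → s < η := by
    intro f c hf h0
    rcases lt_or_ge c η with hc | hc
    · exact ⟨1, one_pos, fun s hs _ => hs.2.trans_lt hc⟩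
    obtain ⟨m, hm, hmin⟩ := (isCompact_Icc (a := η) (b := c)).exists_isMinOn ⟨η, le_rfl, hc⟩
      (f := fun s => dist p (f s)) (continuous_dist.comp_continuousOn (continuousOn_const.prodMk
        ((hf.continuousOn hE).mono (Icc_subset_Icc_left hη.le))))
    refine ⟨dist p (f m), dist_pos.2 ?_, fun s hs hd => ?_⟩
    · rw [← h0]
      exact (hf.ne_zero hE ⟨hη.le.trans hm.1, hm.2⟩ (hη.trans_le hm.1).ne').symm
    · by_contra hcon
      exact absurd (hmin ⟨not_lt.1 hcon, hs.2⟩) (not_le.2 hd)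
  obtain ⟨θ₁, hθ₁, key₁⟩ := small σ a h.left h.left_zero
  obtain ⟨θ₂, hθ₂, key₂⟩ := small τ b h.right h.right_zero
  obtain ⟨_, ⟨s, hs, rfl⟩, _, ⟨t, ht, rfl⟩, hsub, hp, h1, h2⟩ :=
    hD.exists_short_chord H (lt_min hη (lt_min hθ₁ hθ₂))
  obtain ⟨s', hs0, hs', t', ht0, ht', hsub', D', hD'⟩ := h.exists_disk hH1 hE hs ht
    (hsub.trans hD.sub) hp
  have b1 := h1.trans_le (min_le_right _ _)
  have b2 := h2.trans_le (min_le_right _ _)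
  have hball : ∀ w ∈ seg (σ s) (τ t), dist p w < η := fun w hw =>
    ((sConv_dist p).le_max le_rfl hw).trans_lt
      (max_lt (h1.trans_le (min_le_left _ _)) (h2.trans_le (min_le_left _ _)))
  refine ⟨s', hs0, hs'.trans hs.2, hs'.trans_lt (key₁ s hs (b1.trans_le (min_le_left _ _))),
    t', ht0, ht'.trans ht.2, ht'.trans_lt (key₂ t ht (b2.trans_le (min_le_right _ _))), D', hD',
    fun w hw => ?_⟩
  have m1 := hball _ (hsub' (left_mem_seg _ _))
  have m2 := hball _ (hsub' (right_mem_seg _ _))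
  rw [mem_ball, dist_comm]
  exact (hD'.hull H (by fun_prop) (sConv_dist p)
    (M := max (dist p (σ s')) (dist p (τ t'))) (by simp)
    (le_max_left _ _) (le_max_right _ _) w hw).trans_lt (max_lt m1 m2)

/-- Points of a triangular disk can be joined radially to its base within the disk. -/
theorem Wedge.radial (H : TwoCx O) (L : LocalCone O p δ) (W : Wedge E p σ τ a b)
    (h : TriDisk E (σ '' Icc 0 a) (τ '' Icc 0 b) (seg y z) p y z D) (hD : D ⊆ ball p δ)
    (hx : x ∈ D) : ∃ c ∈ seg y z, Btw p x c ∧ seg x c ⊆ D := by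
  have hyD : y ∈ D := h.mem.subset (Or.inr (left_mem_seg y z))
  have hzD : z ∈ D := h.mem.subset (Or.inr (right_mem_seg y z))
  have hball : ∀ w ∈ D, dist p w < δ := fun w hw => by
    have := hD hw; rwa [mem_ball, dist_comm] at this
  have hpD : p ∈ D := h.mem.subset (Or.inl (Or.inl h.arcA.left_mem))
  have hpC := h.apex_notMem
  have hN : D ⊆ coneOver p y z := by
    have hne : (coneOver p y z).Nonempty := ⟨p, y, left_mem_seg y z, btw_left p y⟩
    have hcl := (isCompact_coneOver (p := p) (a := y) (b := z)).isClosed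
    intro w hw
    have zero : ∀ w ∈ coneOver p y z, infDist w (coneOver p y z) ≤ 0 := fun w hw =>
      (infDist_zero_of_mem hw).le
    have := h.hull H (continuous_infDist_pt _) (sConv_infDist isCompact_coneOver hne
      fun u hu v hv => seg_subset_coneOver H L hpC (hball y hyD) (hball z hzD) hu hv) (M := 0)
      (zero p ⟨y, left_mem_seg y z, btw_left p y⟩) (zero y ⟨y, left_mem_seg y z, btw_right p y⟩)
      (zero z ⟨z, right_mem_seg y z, btw_right p z⟩) w hw
    exact (hcl.mem_iff_infDist_zero hne).2 (le_antisymm this infDist_nonneg)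
  have hclosed := isClosed_exists_mem (isCompact_seg y z) (R := {q : X × X | Btw p q.1 q.2} ∩
    {q : X × X | seg q.1 q.2 ⊆ D}) ((isClosed_btw.preimage
      (f := fun q : X × X => (p, q.1, q.2)) (by fun_prop)).inter
      (isClosed_seg_subset h.mem.compact.isClosed))
  refine hclosed.closure_subset (_root_.mem_closure_iff.2 ?_)
  intro U hU hzU
  obtain ⟨ε, hε, hεU⟩ := Metric.isOpen_iff.1 hU x hzU
  obtain ⟨w, hwD, hwT, hwO, hwz⟩ := h.mem.exists_near_face H hx hε
  refine ⟨w, hεU (by rwa [mem_ball, dist_comm]), ?_⟩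
  have hwp : p ≠ w := by rintro rfl; exact hwT (Or.inl (Or.inl h.arcA.left_mem))
  obtain ⟨a1, ha1, hb1, hs1⟩ := h.mem.extend_to_boundary H hwD hwp
  have ha1p : a1 ≠ p := by
    rintro rfl
    exact hwp hb1.eq_of_same.symm
  have join : ∀ e, Btw p e w → seg e w ⊆ D → seg e a1 ⊆ E := by
    intro e he hs u hu
    have hb : Btw e w a1 := hb1.inner' he
    rcases Btw.total hu hb with h' | h'
    · exact h.sub (hs h')
    · exact h.sub (hs1 (Btw.inner' hu h'))
  have inward := h.mem.extend_inward H L hwD hwO (hball w hwD)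
  have inC : ∀ a2 ∈ seg y z, Btw p a2 w → False := by
    intro a2 ha2 hb2
    obtain ⟨c, hc, hac⟩ := hN (hs1 (right_mem_seg w a1))
    exact hwT (Or.inr (sideIn_seg univ y z a2 ha2 c hc (subset_univ _)
      ((hac.outer' hb1).inner' hb2)))
  rcases ha1 with (ha1 | ha1) | ha1
  · exfalso
    rcases inward with hs | ⟨a2, (ha2 | ha2) | ha2, ha2p, hb2, hs2⟩
    · exact hwT (Or.inl (Or.inl (h.sideA p h.arcA.left_mem a1 ha1 (join p (btw_left p w) hs) hb1)))
    · exact hwT (Or.inl (Or.inl (h.sideA a2 ha2 a1 ha1 (join a2 hb2 hs2) (hb1.inner' hb2))))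
    · have hj := join a2 hb2 hs2
      obtain ⟨s, hs, rfl⟩ := ha1
      obtain ⟨t, ht, rfl⟩ := ha2
      rw [seg_comm] at hj
      exact W.not_comp hH1 hE H hs ht ha1p ha2p hj (Or.inr (hb1.outer' hb2))
    · exact inC a2 ha2 hb2
  · exfalso
    rcases inward with hs | ⟨a2, (ha2 | ha2) | ha2, ha2p, hb2, hs2⟩
    · exact hwT (Or.inl (Or.inr (h.sideB p h.arcB.left_mem a1 ha1 (join p (btw_left p w) hs) hb1)))
    · have hj := join a2 hb2 hs2
      obtain ⟨s, hs, rfl⟩ := ha2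
      obtain ⟨t, ht, rfl⟩ := ha1
      exact W.not_comp hH1 hE H hs ht ha2p ha1p hj (Or.inl (hb1.outer' hb2))
    · exact hwT (Or.inl (Or.inr (h.sideB a2 ha2 a1 ha1 (join a2 hb2 hs2) (hb1.inner' hb2))))
    · exact inC a2 ha2 hb2
  · exact ⟨a1, ha1, hb1, hs1⟩

end Wedges

section Directions

/-- A path in a compact set of graph type which is eventually constant once it takes a value
frequently converges. -/
theorem exists_tendsto_of_finite_spheres {Z : Type*} [MetricSpace Z] {K : Set Z} (hK : IsCompact K)
    {f : ℝ → Z} {a : ℝ} (ha : 0 < a) (hf : ContinuousOn f (Ioc 0 a)) (hm : ∀ s ∈ Ioc 0 a, f s ∈ K)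
    (hfin : ∀ ξ ∈ K, ∀ ε > 0, ∃ r, 0 < r ∧ r < ε ∧ {x | x ∈ K ∧ dist ξ x = r}.Finite)
    (hfreq : ∀ ζ, (∃ᶠ s in nhdsWithin 0 (Ioi 0), f s = ζ) →
      ∀ᶠ s in nhdsWithin 0 (Ioi 0), f s = ζ) :
    ∃ ξ ∈ K, Tendsto f (nhdsWithin 0 (Ioi 0)) (nhds ξ) := by
  set l : Filter ℝ := nhdsWithin 0 (Ioi 0) with hl
  have hIoc : ∀ c, 0 < c → ∀ᶠ s in l, s ∈ Ioc 0 c := fun c hc => Ioc_mem_nhdsGT hc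
  have hmem : ∀ᶠ s in l, f s ∈ K := (hIoc a ha).mono hm
  obtain ⟨ξ, hξ, hcl⟩ := hK (f := map f l) (le_principal_iff.2 hmem)
  have hcl : MapClusterPt ξ l f := hcl
  refine ⟨ξ, hξ, hK.tendsto_nhds_of_unique_mapClusterPt hmem fun ξ' _ hcl' => ?_⟩
  by_contra hne
  obtain ⟨r, hr0, hr, hF⟩ := hfin ξ hξ (dist ξ ξ') (dist_pos.2 (Ne.symm hne))
  have hfr : ∃ᶠ s in l, ∃ ζ ∈ {x | x ∈ K ∧ dist ξ x = r}, f s = ζ := by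
    intro hno
    obtain ⟨c, hc0, hc⟩ := mem_nhdsGT_iff_exists_Ioc_subset.1 hno
    set e := min c a
    have he : 0 < e := lt_min hc0 ha
    obtain ⟨s, hs, hse⟩ := ((hcl.frequently (ball_mem_nhds ξ hr0)).and_eventually (hIoc e he)).exists
    obtain ⟨s', hs', hse'⟩ := ((hcl'.frequently (ball_mem_nhds ξ' (sub_pos.2 hr))).and_eventually
      (hIoc e he)).exists
    have hsub : uIcc s s' ⊆ Ioc 0 e := ordConnected_Ioc.uIcc_subset hse hse'
    have hcont : ContinuousOn (fun s => dist ξ (f s)) (uIcc s s') :=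
      continuous_dist.comp_continuousOn (continuousOn_const.prodMk
        (hf.mono (hsub.trans (Ioc_subset_Ioc_right (min_le_right _ _)))))
    have h1 : dist ξ (f s) < r := by rw [dist_comm]; exact hs
    have h2 : r < dist ξ (f s') := by
      have h3 : dist (f s') ξ' < dist ξ ξ' - r := hs'
      linarith [dist_triangle ξ (f s') ξ']
    obtain ⟨v, hv, hvr⟩ := intermediate_value_uIcc hcont (mem_uIcc_of_le h1.le h2.le)
    have hv' := hsub hv
    exact hc ⟨hv'.1, hv'.2.trans (min_le_left _ _)⟩
      ⟨f v, ⟨hm v ⟨hv'.1, hv'.2.trans (min_le_right _ _)⟩, hvr⟩, rfl⟩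
  obtain ⟨ζ, hζ, hζf⟩ : ∃ ζ ∈ {x | x ∈ K ∧ dist ξ x = r}, ∃ᶠ s in l, f s = ζ := by
    by_contra hcon
    push Not at hcon
    refine hfr (((hF.eventually_all (l := l) (p := fun ζ s => f s ≠ ζ)).2 fun ζ hζ => ?_).mono ?_)
    · simpa using hcon ζ hζ
    · rintro s hs ⟨ζ, hζ, he⟩
      exact hs ζ hζ he
  obtain ⟨s, hs, hse⟩ := ((hcl.frequently (ball_mem_nhds ξ hr0)).and_eventually (hfreq ζ hζf)).exists
  rw [hse, dist_comm] at hs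
  exact hs.ne hζ.2

variable {X : Type*} [MetricSpace X] [CAT0 X] {E O D : Set X} {p x y z ξ : X} {a b : ℝ}
  {σ τ dir : ℝ → X} {δ : ℝ}

/-- `dir s` is the point at distance `δ` from `p` in the direction of `σ s`. -/
structure DirOf (p : X) (δ : ℝ) (σ dir : ℝ → X) (a : ℝ) : Prop where
  dist_eq : ∀ s ∈ Ioc 0 a, dist p (dir s) = δ
  btw : ∀ s ∈ Ioc 0 a, Btw p (σ s) (dir s)

theorem YG.btw_of_seg_subset (hf : YG E σ 0 a) (hE : RectConnected E) (h0 : σ 0 = p) {s s' : ℝ}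
    (hs : s ≤ a) (hseg : seg p (σ s) ⊆ E) (h0' : 0 ≤ s') (hs' : s' ≤ s) : Btw p (σ s') (σ s) := by
  rw [← h0] at hseg ⊢
  have := hf.seg_eq hE le_rfl (h0'.trans hs') hs hseg
  have hm : σ s' ∈ seg (σ 0) (σ s) := this ▸ mem_image_of_mem σ ⟨h0', hs'⟩
  exact hm

omit [CAT0 X] in
theorem exists_dirOf (L : LocalCone O p δ) (hne : ∀ s ∈ Ioc 0 a, σ s ≠ p)
    (hd : ∀ s ∈ Ioc 0 a, dist p (σ s) ≤ δ) : ∃ dir, DirOf p δ σ dir a := by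
  have : ∀ s, ∃ ξ, s ∈ Ioc 0 a → dist p ξ = δ ∧ Btw p (σ s) ξ := fun s => by
    by_cases hs : s ∈ Ioc 0 a
    · obtain ⟨ξ, h⟩ := L.ext _ (hne s hs) (hd s hs)
      exact ⟨ξ, fun _ => h⟩
    · exact ⟨p, fun h => absurd h hs⟩
  choose dir h using this
  exact ⟨dir, fun s hs => (h s hs).1, fun s hs => (h s hs).2⟩

omit [CAT0 X] in
theorem LocalCone.isCompact_sphere (L : LocalCone O p δ) : IsCompact {x | dist p x = δ} :=
  L.compact.of_isClosed_subset (isClosed_eq (by fun_prop) continuous_const)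
    fun x (hx : dist p x = δ) => by rw [mem_closedBall, dist_comm]; exact hx.le

omit [CAT0 X] in
theorem DirOf.continuousOn (hdir : DirOf p δ σ dir a) (L : LocalCone O p δ)
    (hσ : ContinuousOn σ (Ioc 0 a)) (hne : ∀ s ∈ Ioc 0 a, σ s ≠ p) :
    ContinuousOn dir (Ioc 0 a) := by
  intro s hs
  refine L.isCompact_sphere.tendsto_nhds_of_unique_mapClusterPt
    (eventually_mem_nhdsWithin.mono hdir.dist_eq) fun ξ hξ hcl => ?_
  obtain ⟨U, hU, hlim⟩ := mapClusterPt_iff_ultrafilter.1 hcl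
  exact L.ext_unique (σ s) ξ (dir s) (hne s hs)
    (btw_of_tendsto tendsto_const_nhds ((hσ s hs).mono_left hU) hlim
      (Eventually.filter_mono hU (eventually_mem_nhdsWithin.mono hdir.btw)))
    (hdir.btw s hs) hξ (hdir.dist_eq s hs)

omit [CAT0 X] in
theorem exists_pos_le_dist {K : Set X} (hK : IsClosed K) (hp : p ∉ K) :
    ∃ μ > 0, ∀ c ∈ K, μ ≤ dist p c := by
  obtain ⟨μ, hμ, h⟩ := Metric.isOpen_iff.1 hK.isOpen_compl p hp
  refine ⟨μ, hμ, fun c hc => ?_⟩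
  by_contra hlt
  exact h (by rw [mem_ball, dist_comm]; exact not_le.1 hlt) hc

theorem LocalCone.btw_rim (L : LocalCone O p δ) {u c : X} (hu : u ≠ p) (hξ : dist p ξ = δ)
    (h : Btw p u ξ) (h' : Btw p u c) (hc : dist p c ≤ δ) : Btw p c ξ :=
  (L.comp hu h' h hc hξ.le).btw (hc.trans hξ.ge)

omit [CAT0 X] in
theorem YG.tendsto_zero (hf : YG E σ 0 a) (hE : RectConnected E) (h0 : σ 0 = p) (ha : 0 < a) :
    Tendsto σ (nhdsWithin 0 (Ioi 0)) (nhds p) := by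
  have h1 := hf.continuousOn hE 0 ⟨le_rfl, ha.le⟩
  rw [ContinuousWithinAt, h0] at h1
  refine h1.mono_left ?_
  rw [← nhdsWithin_Ioc_eq_nhdsGT ha]
  exact nhdsWithin_mono _ Ioc_subset_Icc_self

/-- A side of a triangular disk has a limit direction at the apex, and the disk contains a segment
in this direction reaching the base. -/
theorem Wedge.exists_limit_direction (hH1 : H1Trivial E) (hE : RectConnected E) (H : TwoCx O)
    (L : LocalCone O p δ) (W : Wedge E p σ τ a b) (ha : 0 < a)
    (h : TriDisk E (σ '' Icc 0 a) (τ '' Icc 0 b) (seg y z) p y z D) (hD : D ⊆ ball p δ)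
    (hdir : DirOf p δ σ dir a) :
    ∃ ξ, dist p ξ = δ ∧ Tendsto dir (nhdsWithin 0 (Ioi 0)) (nhds ξ) ∧
      ∃ m ∈ seg y z, Btw p m ξ ∧ seg p m ⊆ D := by
  have hball : ∀ w ∈ D, dist p w < δ := fun w hw => by
    have := hD hw; rwa [mem_ball, dist_comm] at this
  have hne : ∀ s ∈ Ioc 0 a, σ s ≠ p := fun s hs => by
    rw [← W.left_zero]
    exact W.left.ne_zero hE ⟨hs.1.le, hs.2⟩ hs.1.ne'
  have hσD : ∀ s ∈ Ioc 0 a, σ s ∈ D := fun s hs =>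
    h.mem.subset (Or.inl (Or.inl ⟨s, ⟨hs.1.le, hs.2⟩, rfl⟩))
  have hσ0 := W.left.tendsto_zero hE W.left_zero ha
  have hIoc : ∀ᶠ s in nhdsWithin (0 : ℝ) (Ioi 0), s ∈ Ioc 0 a := Ioc_mem_nhdsGT ha
  have hrad : ∀ s ∈ Ioc 0 a, ∃ c ∈ seg y z, Btw p (σ s) c ∧ seg (σ s) c ⊆ D ∧ Btw p c (dir s) := by
    intro s hs
    obtain ⟨c, hc, hb, hsub⟩ := W.radial hH1 hE H L h hD (hσD s hs)
    exact ⟨c, hc, hb, hsub, L.btw_rim (hne s hs) (hdir.dist_eq s hs) (hdir.btw s hs) hb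
      (hball c (hsub (right_mem_seg _ _))).le⟩
  obtain ⟨μ₀, hμ₀, hμC⟩ := exists_pos_le_dist (isClosed_seg y z) h.apex_notMem
  have hpD : p ∈ D := h.mem.subset (Or.inl (Or.inl h.arcA.left_mem))
  have hsmall : ∀ η > 0, ∀ᶠ s in nhdsWithin (0 : ℝ) (Ioi 0), dist p (σ s) < η := fun η hη => by
    filter_upwards [hσ0 (ball_mem_nhds p hη)] with s hs
    rw [dist_comm]; exact hs
  obtain ⟨ξ, hξ, hlim⟩ := exists_tendsto_of_finite_spheres L.isCompact_sphere ha
    (hdir.continuousOn L ((W.left.continuousOn hE).mono Ioc_subset_Icc_self) hne) hdir.dist_eq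
    L.rim (fun ζ hfr => by
      set μ := min μ₀ δ
      have hμ : 0 < μ := lt_min hμ₀ L.pos
      obtain ⟨s₀, hs₀, hs₀I⟩ := (hfr.and_eventually hIoc).exists
      have hζ : dist p ζ = δ := hs₀ ▸ hdir.dist_eq s₀ hs₀I
      obtain ⟨v, hv, hvd⟩ := exists_btw_dist p ζ hμ.le (hζ ▸ min_le_right μ₀ δ)
      have hvD : seg p v ⊆ D := by
        intro e he
        by_cases hep : e = p
        · rwa [hep]
        obtain ⟨s, hs, hsI, hsd⟩ := (hfr.and_eventually (hIoc.and
          (hsmall (dist p e) (dist_pos.2 (Ne.symm hep))))).exists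
        obtain ⟨c, hc, hbc, hsub, hcd⟩ := hrad s hsI
        have hb := hdir.btw s hsI
        rw [hs] at hcd hb
        have heζ : Btw p e ζ := hv.outer' he
        have hec : Btw p e c := heζ.order hcd
          ((Btw.left_le he).trans (hvd.le.trans ((min_le_left _ _).trans (hμC c hc))))
        exact hsub (hec.inner' (hb.order heζ hsd.le))
      obtain ⟨s₁, hs₁, hs₁I, hs₁d⟩ := (hfr.and_eventually (hIoc.and (hsmall μ hμ))).exists
      have hb₁ := hdir.btw s₁ hs₁I
      rw [hs₁] at hb₁
      have hsub : seg p (σ s₁) ⊆ E :=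
        (seg_subset_of_mem_left (hb₁.order hv (hs₁d.le.trans hvd.ge))).trans (hvD.trans h.sub)
      filter_upwards [Ioc_mem_nhdsGT hs₁I.1] with s hs
      have hsI : s ∈ Ioc 0 a := ⟨hs.1, hs.2.trans hs₁I.2⟩
      exact L.ext_unique (σ s) _ _ (hne s hsI) (hdir.btw s hsI) (hb₁.outer'
        (W.left.btw_of_seg_subset hE W.left_zero hs₁I.2 hsub hs.1.le hs.2))
        (hdir.dist_eq s hsI) hζ)
  refine ⟨ξ, hξ, hlim, ?_⟩
  have hclosed := isClosed_exists_mem (isCompact_seg y z)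
    (R := {q : (X × X) × X | Btw p q.1.1 q.2 ∧ seg q.1.1 q.2 ⊆ D ∧ Btw p q.2 q.1.2})
    ((isClosed_btw.preimage (f := fun q : (X × X) × X => (p, q.1.1, q.2)) (by fun_prop)).inter
      (((isClosed_seg_subset h.mem.compact.isClosed).preimage
        (f := fun q : (X × X) × X => (q.1.1, q.2)) (by fun_prop)).inter
      (isClosed_btw.preimage (f := fun q : (X × X) × X => (p, q.2, q.1.2)) (by fun_prop))))
  obtain ⟨m, hm, -, h2, h3⟩ := hclosed.mem_of_tendsto (hσ0.prodMk_nhds hlim)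
    (hIoc.mono fun s hs => hrad s hs)
  exact ⟨m, hm, h3, h2⟩

end Directions

section Tangent

variable {X : Type*} [MetricSpace X] [CAT0 X] {E O D : Set X} {p m y z ξ : X} {a b : ℝ}
  {σ τ dir : ℝ → X} {δ u v : ℝ}

/-- The point at distance `u` from `p` on the segment of length `δ` from `p` to `ξ`. -/
noncomputable def ray (p ξ : X) (δ u : ℝ) : X := pt p ξ (u / δ)

theorem ray_zero (p ξ : X) (δ : ℝ) : ray p ξ δ 0 = p := by rw [ray, zero_div, pt_zero]

theorem btw_ray (p ξ : X) (δ u : ℝ) : Btw p (ray p ξ δ u) ξ := btw_pt _ _ _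

theorem dist_ray (hδ : 0 < δ) (hξ : dist p ξ = δ) (h0 : 0 ≤ u) (h1 : u ≤ δ) :
    dist p (ray p ξ δ u) = u := by
  rw [ray, dist_left_pt _ _ (by positivity) ((div_le_one hδ).2 h1), hξ]
  field_simp

theorem dist_ray_ray (hδ : 0 < δ) (hξ : dist p ξ = δ) (h0 : 0 ≤ u) (h1 : u ≤ δ) (h0' : 0 ≤ v)
    (h1' : v ≤ δ) : dist (ray p ξ δ u) (ray p ξ δ v) = |u - v| := by
  rw [ray, ray, dist_pt_param _ _ (by positivity) ((div_le_one hδ).2 h1) (by positivity)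
    ((div_le_one hδ).2 h1'), hξ, ← sub_div, abs_div, abs_of_pos hδ]
  field_simp

theorem Btw.eq_ray (h : Btw p m ξ) (hδ : 0 < δ) (hξ : dist p ξ = δ) :
    m = ray p ξ δ (dist p m) := by
  have := h.left_le
  refine h.unique (btw_ray p ξ δ _) ?_
  rw [dist_ray hδ hξ dist_nonneg (this.trans hξ.le)]

theorem ray_mem_seg (h : Btw p m ξ) (hδ : 0 < δ) (hξ : dist p ξ = δ) (h0 : 0 ≤ u)
    (h1 : u ≤ dist p m) : ray p ξ δ u ∈ seg p m :=
  (btw_ray p ξ δ u).order h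
    (by rwa [dist_ray hδ hξ h0 (h1.trans (h.left_le.trans hξ.le))])

theorem YG.of_ray (hE : RectConnected E) (hδ : 0 < δ) (hξ : dist p ξ = δ) (h : Btw p m ξ)
    (hm : seg p m ⊆ E) : YG E (ray p ξ δ) 0 (dist p m) := by
  have hmδ : dist p m ≤ δ := h.left_le.trans hξ.le
  have hmem : ∀ s ∈ Icc 0 (dist p m), ray p ξ δ s ∈ seg p m := fun s hs =>
    ray_mem_seg h hδ hξ hs.1 hs.2
  refine ⟨dist_nonneg, fun s hs => hm (hmem s hs), ?_⟩
  have main : ∀ s ∈ Icc 0 (dist p m), ∀ t ∈ Icc 0 (dist p m), s ≤ t →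
      pathDistIn E (ray p ξ δ s) (ray p ξ δ t) = |s - t| := by
    intro s hs t ht hst
    rw [← dist_ray_ray hδ hξ hs.1 (hs.2.trans hmδ) ht.1 (ht.2.trans hmδ)]
    refine hE.pathDistIn_of_seg fun w hw => hm ?_
    have h1 : Btw p (ray p ξ δ s) (ray p ξ δ t) := (btw_ray p ξ δ s).order (btw_ray p ξ δ t)
      (by rwa [dist_ray hδ hξ hs.1 (hs.2.trans hmδ), dist_ray hδ hξ ht.1 (ht.2.trans hmδ)])
    exact (hmem t ht).outer' (h1.outer hw)
  intro s hs t ht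
  rcases le_total s t with hst | hst
  · exact main s hs t ht hst
  · rw [pathDistIn_comm, abs_sub_comm]
    exact main t ht s hs hst

theorem dist_ray_ray_left (hδ : 0 < δ) (ξ ξ' : X) (h0 : 0 ≤ u) (h1 : u ≤ δ) :
    dist (ray p ξ δ u) (ray p ξ' δ u) ≤ u / δ * dist ξ ξ' :=
  dist_pt_pt_left _ _ _ (by positivity) ((div_le_one hδ).2 h1)

/-- Near the apex, the side of a triangular disk is joined to the ray in its limit direction by
short chords inside the disk. -/
theorem Wedge.exists_chord_to_ray (hE : RectConnected E) (H : TwoCx O)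
    (L : LocalCone O p δ) (W : Wedge E p σ (ray p ξ δ) a b) (ha : 0 < a) (hb : 0 < b) (hbδ : b ≤ δ)
    (h : TriDisk E (σ '' Icc 0 a) (ray p ξ δ '' Icc 0 b) (seg (σ a) (ray p ξ δ b)) p (σ a)
      (ray p ξ δ b) D) (hD : D ⊆ ball p δ) (hξ : dist p ξ = δ) (hdir : DirOf p δ σ dir a)
    (hlim : Tendsto dir (nhdsWithin 0 (Ioi 0)) (nhds ξ)) (hda : dist (dir a) ξ < δ) :
    ∀ᶠ s in nhdsWithin 0 (Ioi 0), ∃ ρ ∈ Icc 0 b, ρ ≤ dist p (σ s) ∧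
      seg (σ s) (ray p ξ δ ρ) ⊆ D ∧ p ∉ seg (σ s) (ray p ξ δ ρ) := by
  have hδ := L.pos
  have hball : ∀ w ∈ D, dist p w < δ := fun w hw => by
    have := hD hw; rwa [mem_ball, dist_comm] at this
  have hσD : ∀ s ∈ Ioc 0 a, σ s ∈ D := fun s hs =>
    h.mem.subset (Or.inl (Or.inl ⟨s, ⟨hs.1.le, hs.2⟩, rfl⟩))
  have hσ0 := W.left.tendsto_zero hE W.left_zero ha
  have hne : ∀ s ∈ Ioc 0 a, σ s ≠ p := fun s hs => by
    rw [← W.left_zero]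
    exact W.left.ne_zero hE ⟨hs.1.le, hs.2⟩ hs.1.ne'
  have haI : a ∈ Ioc 0 a := ⟨ha, le_rfl⟩
  have hrayξ : ∀ u, 0 ≤ u → u ≤ δ → dist ξ (ray p ξ δ u) = δ - u := fun u h0 h1 => by
    have h2 : dist p (ray p ξ δ u) + dist (ray p ξ δ u) ξ = dist p ξ := btw_ray p ξ δ u
    rw [dist_ray hδ hξ h0 h1, hξ, dist_comm _ ξ] at h2
    linarith
  have hGy : dist ξ (σ a) ^ 2 < dist ξ p ^ 2 := by
    rw [dist_comm ξ p, hξ]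
    have h1 := (hball _ (hσD a haI)).le
    have h0 : 0 < dist p (σ a) := dist_pos.2 (hne a haI).symm
    have h2 := dist_ray_ray_left (p := p) hδ (dir a) ξ dist_nonneg h1
    rw [← (hdir.btw a haI).eq_ray hδ (hdir.dist_eq a haI)] at h2
    have h3 : dist p (σ a) / δ * dist (dir a) ξ < dist p (σ a) := by
      rw [div_mul_eq_mul_div, div_lt_iff₀ hδ]
      exact mul_lt_mul_of_pos_left hda h0
    have h4 := dist_triangle_right ξ (σ a) (ray p ξ δ (dist p (σ a)))
    rw [hrayξ _ h0.le h1] at h4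
    exact pow_lt_pow_left₀ (by linarith) dist_nonneg two_ne_zero
  have hGz : dist ξ (ray p ξ δ b) ^ 2 < dist ξ p ^ 2 := by
    rw [dist_comm ξ p, hξ]
    refine pow_lt_pow_left₀ ?_ dist_nonneg two_ne_zero
    rw [hrayξ b hb.le hbδ]
    linarith
  obtain ⟨θ, hθ, hchord⟩ := h.cap_chord H (G := fun w => dist ξ w ^ 2) (by fun_prop) one_pos
    (sConv_sq ξ) hGy hGz one_pos
  have hclosed := isClosed_exists_mem ((W.left.isCompact hE).prod (W.right.isCompact hE))
    (R := {q : X × (X × X) | Btw q.2.1 q.1 q.2.2 ∧ seg q.2.1 q.2.2 ⊆ D ∧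
      dist ξ q.1 ≤ dist ξ q.2.2})
    ((isClosed_btw.preimage (f := fun q : X × (X × X) => (q.2.1, q.1, q.2.2)) (by fun_prop)).inter
      (((isClosed_seg_subset h.mem.compact.isClosed).preimage
        (f := fun q : X × (X × X) => q.2) (by fun_prop)).inter
      (isClosed_le (f := fun q : X × (X × X) => dist ξ q.1) (g := fun q => dist ξ q.2.2)
        (by fun_prop) (by fun_prop))))
  filter_upwards [Ioc_mem_nhdsGT ha, hσ0 (ball_mem_nhds p (half_pos hθ)),
    hσ0 (ball_mem_nhds p hb)] with s hs hsθ hsb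
  have hsθ : dist p (σ s) < θ / 2 := by rw [dist_comm]; exact hsθ
  have hsb : dist p (σ s) < b := by rw [dist_comm]; exact hsb
  obtain ⟨⟨a', b'⟩, ⟨ha', ⟨ρ, hρ, hρb⟩⟩, h1, h2, h3⟩ : σ s ∈ {w | ∃ c ∈ (σ '' Icc 0 a) ×ˢ
      (ray p ξ δ '' Icc 0 b), (w, c) ∈ {q : X × (X × X) | Btw q.2.1 q.1 q.2.2 ∧
        seg q.2.1 q.2.2 ⊆ D ∧ dist ξ q.1 ≤ dist ξ q.2.2}} := by
    rw [← hclosed.closure_eq, Metric.mem_closure_iff]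
    intro ε hε
    obtain ⟨w, hw, hwd⟩ := h.mem.exists_near (z := σ s)
      (Or.inl (Or.inl ⟨s, ⟨hs.1.le, hs.2⟩, rfl⟩)) (lt_min hε (half_pos hθ))
    obtain ⟨a', ha', b', hb', hbtw, hsub, -, -, -, -, hG⟩ := hchord w hw
      (by linarith [dist_triangle p (σ s) w, min_le_right ε (θ / 2)])
    exact ⟨w, ⟨(a', b'), ⟨ha', hb'⟩, hbtw, hsub, le_of_sq_le_sq hG dist_nonneg⟩,
      hwd.trans_le (min_le_left _ _)⟩
  simp only at hρb h1 h2 h3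
  subst hρb
  have hρs : ρ ≤ dist p (σ s) := by
    rw [hrayξ ρ hρ.1 (hρ.2.trans hbδ)] at h3
    have := dist_triangle p (σ s) ξ
    rw [hξ, dist_comm _ ξ] at this
    linarith
  have hsub : seg (σ s) (ray p ξ δ ρ) ⊆ D := (seg_subset_of_mem_right h1).trans h2
  refine ⟨ρ, hρ, hρs, hsub, fun hp => ?_⟩
  have hsubE : seg p (σ s) ⊆ E := by
    rw [seg_comm]
    exact (seg_subset_of_mem_left hp).trans (hsub.trans h.sub)
  have hconst : ∀ᶠ s' in nhdsWithin (0 : ℝ) (Ioi 0), dir s' = dir s := by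
    filter_upwards [Ioc_mem_nhdsGT hs.1] with s' hs'
    have hsI : s' ∈ Ioc 0 a := ⟨hs'.1, hs'.2.trans hs.2⟩
    exact L.ext_unique (σ s') _ _ (hne s' hsI) (hdir.btw s' hsI) ((hdir.btw s hs).outer'
      (W.left.btw_of_seg_subset hE W.left_zero hs.2 hsubE hs'.1.le hs'.2))
      (hdir.dist_eq s' hsI) (hdir.dist_eq s hs)
  have hξs : ξ = dir s := tendsto_nhds_unique hlim (tendsto_const_nhds.congr'
    (hconst.mono fun _ h => h.symm))
  have hb' := hdir.btw s hs
  rw [← hξs] at hb'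
  exact hne s hs (W.inter ⟨⟨s, ⟨hs.1.le, hs.2⟩, rfl⟩, dist p (σ s), ⟨dist_nonneg, hsb.le⟩,
    (hb'.eq_ray hδ hξ).symm⟩)

/-- A side of a triangular disk is tangent at the apex, in the path metric, to the ray in its limit
direction, if this ray is the other side. -/
theorem Wedge.tangent (hH1 : H1Trivial E) (hE : RectConnected E) (H : TwoCx O)
    (L : LocalCone O p δ) (W : Wedge E p σ (ray p ξ δ) a b) (ha : 0 < a) (hb : 0 < b) (hbδ : b ≤ δ)
    (h : TriDisk E (σ '' Icc 0 a) (ray p ξ δ '' Icc 0 b) (seg (σ a) (ray p ξ δ b)) p (σ a)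
      (ray p ξ δ b) D) (hD : D ⊆ ball p δ) (hξ : dist p ξ = δ) (hdir : DirOf p δ σ dir a)
    (hlim : Tendsto dir (nhdsWithin 0 (Ioi 0)) (nhds ξ)) (hda : dist (dir a) ξ < δ) {η : ℝ}
    (hη : 0 < η) :
    ∀ᶠ s in nhdsWithin 0 (Ioi 0), pathDistIn E (σ s) (ray p ξ δ s) ≤ η * s := by
  have hδ := L.pos
  have hball : ∀ w ∈ D, dist p w < δ := fun w hw => by
    have := hD hw; rwa [mem_ball, dist_comm] at this
  have hσD : ∀ s ∈ Ioc 0 a, σ s ∈ D := fun s hs =>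
    h.mem.subset (Or.inl (Or.inl ⟨s, ⟨hs.1.le, hs.2⟩, rfl⟩))
  have hσ0 := W.left.tendsto_zero hE W.left_zero ha
  have hne : ∀ s ∈ Ioc 0 a, σ s ≠ p := fun s hs => by
    rw [← W.left_zero]
    exact W.left.ne_zero hE ⟨hs.1.le, hs.2⟩ hs.1.ne'
  obtain ⟨μ, hμ, hμC⟩ := exists_pos_le_dist (isClosed_seg (σ a) (ray p ξ δ b)) h.apex_notMem
  obtain ⟨K, hK0, hK1, hKη⟩ : ∃ K : ℝ, 0 < K ∧ K ≤ 1 ∧ 6 * K ≤ η :=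
    ⟨min 1 (η / 6), by positivity, min_le_left _ _, by linarith [min_le_right 1 (η / 6)]⟩
  have hr : 0 < min δ (min b μ) / 2 := half_pos (lt_min hδ (lt_min hb hμ))
  filter_upwards [Ioc_mem_nhdsGT ha, Ioc_mem_nhdsGT hb, hσ0 (ball_mem_nhds p hr),
    hlim (ball_mem_nhds ξ (by positivity : 0 < δ * K / 2)),
    W.exists_chord_to_ray hE H L ha hb hbδ h hD hξ hdir hlim hda] with s hs hsb hsr hsd hch
  obtain ⟨ρ, hρ, hρs, hsub, hp⟩ := hch
  have hsd : dist (dir s) ξ < δ * K / 2 := hsd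
  have hsr : dist p (σ s) < min δ (min b μ) / 2 := by rw [dist_comm]; exact hsr
  have hς : 0 < dist p (σ s) := dist_pos.2 (hne s hs).symm
  have hςs : dist p (σ s) ≤ s := by
    have := W.left.dist_le hE ⟨le_rfl, ha.le⟩ ⟨hs.1.le, hs.2⟩
    rw [W.left_zero, zero_sub, abs_neg, abs_of_pos hs.1] at this
    exact this
  set ς := dist p (σ s) with hςdef
  obtain ⟨ς₂, hς₂⟩ : ∃ ς₂, ς₂ = (1 + K) * ς := ⟨_, rfl⟩
  have hKς : 0 < K * ς := mul_pos hK0 hς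
  have hKς1 : K * ς ≤ ς := mul_le_of_le_one_left hς.le hK1
  have hς2' : ς₂ = ς + K * ς := by rw [hς₂]; ring
  have hlt : ς₂ < min δ (min b μ) := by linarith
  have hς₂δ : ς₂ < δ := hlt.trans_le (min_le_left _ _)
  have hς₂b : ς₂ ≤ b := hlt.le.trans ((min_le_right _ _).trans (min_le_left _ _))
  have hς₂μ : ς₂ ≤ μ := hlt.le.trans ((min_le_right _ _).trans (min_le_right _ _))
  have hς₂0 : 0 ≤ ς₂ := by linarith
  have hy1 : dist p (ray p (dir s) δ ς₂) = ς₂ := dist_ray hδ (hdir.dist_eq s hs) hς₂0 hς₂δ.le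
  have hb1 : dist p (ray p ξ δ ς₂) = ς₂ := dist_ray hδ hξ hς₂0 hς₂δ.le
  have hyb := dist_ray_ray_left (p := p) hδ (dir s) ξ hς₂0 hς₂δ.le
  have hyb' : ς₂ / δ * dist (dir s) ξ ≤ K * ς := by
    rw [div_mul_eq_mul_div, div_le_iff₀ hδ]
    calc ς₂ * dist (dir s) ξ ≤ (2 * ς) * (δ * K / 2) :=
          mul_le_mul (by linarith) hsd.le dist_nonneg (by linarith)
      _ = K * ς * δ := by ring
  set y := ray p (dir s) δ ς₂ with hy
  set b₂ := ray p ξ δ ς₂ with hb₂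
  have hpσy : Btw p (σ s) y := (hdir.btw s hs).order (btw_ray p (dir s) δ ς₂)
    (by rw [hy1]; linarith)
  have hzlow : ∀ z ∈ seg y b₂, ς ≤ dist p z := fun z hz => by
    have h1 : dist y z ≤ dist y b₂ := Btw.left_le hz
    linarith [dist_triangle_right p y z]
  have hpσ : seg (σ s) y ⊆ E := by
    obtain ⟨c, hc, hbc, hcD⟩ := W.radial hH1 hE H L h hD (hσD s hs)
    have h1 := L.btw_rim (hne s hs) (hdir.dist_eq s hs) (hdir.btw s hs) hbc
      (hball c (hcD (right_mem_seg _ _))).le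
    have h2 : Btw p y c := (btw_ray p (dir s) δ ς₂).order h1 (by
      rw [← hy, hy1]; exact hς₂μ.trans (hμC c hc))
    exact (seg_subset_of_mem_left (h2.inner' hpσy)).trans (hcD.trans h.sub)
  have hρp : ray p ξ δ ρ ≠ p := fun he => hp (by rw [he]; exact right_mem_seg _ _)
  have hyp : y ≠ p := fun he => by rw [he, dist_self] at hy1; linarith
  have hb₂p : b₂ ≠ p := fun he => by rw [he, dist_self] at hb1; linarith
  have hρd : dist p (ray p ξ δ ρ) = ρ := dist_ray hδ hξ hρ.1 (hρ.2.trans hbδ)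
  have hyb₂ : seg y b₂ ⊆ E := by
    intro z hz
    have hpyb : p ∉ seg y b₂ := fun hpz => by
      have := hzlow p hpz
      rw [dist_self] at this
      linarith
    obtain ⟨z', hz', hcomp⟩ := Comp.exists_mem_seg₂ H L (p := p) (a := y) (a' := σ s) (b := b₂)
      (b' := ray p ξ δ ρ) (Or.inr hpσy) ((btw_ray p ξ δ ς₂).total (btw_ray p ξ δ ρ)) hyp (hne s hs)
      hb₂p hρp hpyb (by rw [hy1]; exact hς₂δ) (hball _ (hσD s hs)) (by rw [hb1]; exact hς₂δ)
      (by rw [hρd]; linarith) hz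
    have hz'ς : dist p z' ≤ ς := ((sConv_dist p).le_max le_rfl hz').trans
      (max_le le_rfl (by rw [hρd]; exact hρs))
    have hz'z : Btw p z' z := hcomp.symm.btw (hz'ς.trans (hzlow z hz))
    have hz'p : z' ≠ p := fun he => hp (he ▸ hz')
    obtain ⟨c, hc, hbc, hcD⟩ := W.radial hH1 hE H L h hD (hsub hz')
    have hzς : dist p z ≤ ς₂ := ((sConv_dist p).le_max le_rfl hz).trans
      (max_le hy1.le hb1.le)
    have hzc : Btw p z c := (L.comp hz'p hz'z hbc (hzς.trans hς₂δ.le)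
      (hball c (hcD (right_mem_seg _ _))).le).btw (hzς.trans (hς₂μ.trans (hμC c hc)))
    exact h.sub (hcD (hzc.inner' hz'z))
  have e1 : pathDistIn E (σ s) y = K * ς := by
    rw [hE.pathDistIn_of_seg hpσ]
    have : dist p (σ s) + dist (σ s) y = dist p y := hpσy
    rw [hy1] at this
    linarith
  have e2 : pathDistIn E y b₂ ≤ K * ς := by
    rw [hE.pathDistIn_of_seg hyb₂]
    exact hyb.trans hyb'
  have e3 : pathDistIn E b₂ (ray p ξ δ ς) = K * ς := by
    rw [W.right.geo ς₂ ⟨hς₂0, hς₂b⟩ ς ⟨hς.le, by linarith⟩, hς2', add_sub_cancel_left,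
      abs_of_pos hKς]
  have hσE : σ s ∈ E := W.left.mem s ⟨hs.1.le, hs.2⟩
  have hyE : y ∈ E := hpσ (right_mem_seg _ _)
  have hb₂E : b₂ ∈ E := hyb₂ (right_mem_seg _ _)
  have hςE : ray p ξ δ ς ∈ E := W.right.mem ς ⟨hς.le, by linarith⟩
  have e4 : pathDistIn E (σ s) (ray p ξ δ ς) ≤ 3 * (K * ς) := by
    have := hE.pathDistIn_triangle hσE hyE hςE
    have := hE.pathDistIn_triangle hyE hb₂E hςE
    linarith
  have e5 : s ≤ ς + 3 * (K * ς) := by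
    have h1 := W.left.geo 0 ⟨le_rfl, ha.le⟩ s ⟨hs.1.le, hs.2⟩
    have h2 := W.right.geo 0 ⟨le_rfl, hb.le⟩ ς ⟨hς.le, by linarith⟩
    rw [zero_sub, abs_neg, abs_of_pos hs.1, W.left_zero] at h1
    rw [zero_sub, abs_neg, abs_of_pos hς, W.right_zero] at h2
    have hpE : p ∈ E := W.left_zero ▸ W.left.mem 0 ⟨le_rfl, ha.le⟩
    have := hE.pathDistIn_triangle hpE hςE hσE
    rw [pathDistIn_comm E (ray p ξ δ ς) (σ s)] at this
    linarith
  have e6 := W.right.geo ς ⟨hς.le, by linarith⟩ s ⟨hsb.1.le, hsb.2⟩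
  rw [abs_sub_comm, abs_of_nonneg (by linarith)] at e6
  have e7 := hE.pathDistIn_triangle hσE hςE (W.right.mem s ⟨hsb.1.le, hsb.2⟩)
  have e8 : K * ς ≤ K * s := mul_le_mul_of_nonneg_left hςs hK0.le
  have e9 : 6 * K * s ≤ η * s := mul_le_mul_of_nonneg_right hKη hs.1.le
  linarith

/-- A geodesic for the path metric is tangent, in the path metric, to the ray in its limit
direction, as soon as the ray is joined to it by a segment inside the set. -/
theorem YG.tangent (hH1 : H1Trivial E) (hE : RectConnected E) (H : TwoCx O)
    (L : LocalCone O p δ) (hf : YG E σ 0 a) (h0 : σ 0 = p) (ha : 0 < a) (hξ : dist p ξ = δ)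
    (hdir : DirOf p δ σ dir a) (hlim : Tendsto dir (nhdsWithin 0 (Ioi 0)) (nhds ξ))
    (hm : Btw p m ξ) (hmE : seg p m ⊆ E) (hmp : m ≠ p) (ham : seg (σ a) m ⊆ E)
    (hp : p ∉ seg (σ a) m) {η : ℝ} (hη : 0 < η) :
    ∀ᶠ s in nhdsWithin 0 (Ioi 0), pathDistIn E (σ s) (ray p ξ δ s) ≤ η * s := by
  have hδ := L.pos
  have hmδ : dist p m ≤ δ := hm.left_le.trans hξ.le
  have hm0 : 0 < dist p m := dist_pos.2 hmp.symm
  have hg := YG.of_ray hE hδ hξ hm hmE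
  have hr0 := ray_zero p ξ δ
  by_cases hmeet : σ '' Icc 0 a ∩ ray p ξ δ '' Icc 0 (dist p m) ⊆ {p}
  · have W : Wedge E p σ (ray p ξ δ) a (dist p m) := ⟨hf, hg, h0, hr0, hmeet⟩
    have hmr := hm.eq_ray hδ hξ
    rw [hmr] at ham hp
    obtain ⟨s₁, hs₁, hs₁a, t₁, ht₁, ht₁m, -, D₁, hD₁⟩ := W.exists_disk hH1 hE
      (s := a) (t := dist p m) ⟨ha.le, le_rfl⟩ ⟨hm0.le, le_rfl⟩ ham hp
    obtain ⟨θ, hθ, hθd⟩ : ∃ θ > 0, ∀ s, 0 < s → s < θ → dist (dir s) ξ < δ := by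
      obtain ⟨c, hc, hcs⟩ := mem_nhdsGT_iff_exists_Ioo_subset.1 (hlim (ball_mem_nhds ξ hδ))
      exact ⟨c, hc, fun s h1 h2 => hcs ⟨h1, h2⟩⟩
    have W₁ := W.mono ⟨hs₁.le, hs₁a⟩ ⟨ht₁.le, ht₁m⟩
    obtain ⟨s₂, hs₂, hs₂a, hs₂θ, t₂, ht₂, ht₂m, -, D₂, hD₂, hsub⟩ := W₁.exists_small_disk hH1 hE H hD₁
      (lt_min hθ hδ)
    exact (W₁.mono ⟨hs₂.le, hs₂a⟩ ⟨ht₂.le, ht₂m⟩).tangent hH1 hE H L hs₂ ht₂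
      (ht₂m.trans (ht₁m.trans hmδ)) hD₂ (hsub.trans (ball_subset_ball (min_le_right _ _))) hξ
      ⟨fun s hs => hdir.dist_eq s ⟨hs.1, hs.2.trans (hs₂a.trans hs₁a)⟩,
        fun s hs => hdir.btw s ⟨hs.1, hs.2.trans (hs₂a.trans hs₁a)⟩⟩ hlim
      (hθd s₂ hs₂ (hs₂θ.trans_le (min_le_left _ _))) hη
  · obtain ⟨w, ⟨⟨s, hs, hsw⟩, t, ht, htw⟩, hwp⟩ := not_subset.1 hmeet
    have hst : s = t := hf.param_eq hg (h0.trans hr0.symm) hs ht (hsw.trans htw.symm)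
    subst hst
    have hs0 : 0 < s := hs.1.lt_of_ne fun he => hwp (by rw [← hsw, ← he]; exact h0)
    have hu := YG.unique H hH1 hE (hf.mono le_rfl hs.1 hs.2) (hg.mono le_rfl ht.1 ht.2)
      (h0.trans hr0.symm) (hsw.trans htw.symm)
    filter_upwards [Ioc_mem_nhdsGT hs0] with u hu'
    have hI : u ∈ Icc 0 s := ⟨hu'.1.le, hu'.2⟩
    rw [← hu u hI, hE.pathDistIn_self (hf.mem u ⟨hu'.1.le, hu'.2.trans hs.2⟩)]
    exact mul_nonneg hη.le hu'.1.le

end Tangent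

section PathAngles

variable {X : Type*} [MetricSpace X] {E O D : Set X} {p m n ξ ζ : X} {a b : ℝ}
  {σ τ α β : ℝ → X} {δ : ℝ}

theorem euclCompAngle_le_of_dist_le {s t c η : ℝ} (hs : 0 < s) (ht : 0 < t) (hc : 0 ≤ c)
    (hη : 0 < η) (h : c ≤ η * min s t + |s - t|) :
    euclCompAngle s t c ≤ Real.arccos (1 - η - η ^ 2 / 2) := by
  refine Real.antitone_arccos ?_
  rw [le_div_iff₀ (by positivity)]
  wlog hst : s ≤ t generalizing s t
  · have := this ht hs (by rwa [min_comm, abs_sub_comm]) (not_le.1 hst).le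
    linarith
  rw [min_eq_left hst, abs_sub_comm, abs_of_nonneg (by linarith)] at h
  have h1 : c ^ 2 ≤ (η * s + (t - s)) ^ 2 := pow_le_pow_left₀ hc h 2
  have h2 : 0 ≤ η ^ 2 * (s * (t - s)) := by
    have := sub_nonneg.2 hst
    positivity
  have h3 : 0 ≤ η * s ^ 2 := by positivity
  linarith

/-- Two geodesics for the path metric which are tangent to first order form a zero angle. -/
theorem YG.angle_eq_zero (hE : RectConnected E) (hf : YG E σ 0 a) (hg : YG E τ 0 b) (ha : 0 < a)
    (hb : 0 < b) (h0 : σ 0 = p) (h0' : τ 0 = p)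
    (h : ∀ η > 0, ∀ᶠ s in nhdsWithin (0 : ℝ) (Ioi 0), pathDistIn E (σ s) (τ s) ≤ η * s) :
    upperAngleWrt (pathDistIn E) p σ τ = 0 := by
  refine le_antisymm ?_ (upperAngle_nonneg _ _ _ _)
  have key : ∀ η > 0, upperAngleWrt (pathDistIn E) p σ τ ≤ Real.arccos (1 - η - η ^ 2 / 2) := by
    intro η hη
    obtain ⟨e, he, hes⟩ := mem_nhdsGT_iff_exists_Ioo_subset.1 (h η hη)
    have he : 0 < e := he
    refine upperAngle_le (lt_min he (lt_min ha hb)) fun s t hs hs' ht ht' => ?_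
    have hse := hs'.trans_le (min_le_left _ _)
    have hte := ht'.trans_le (min_le_left _ _)
    have hsa : s ∈ Icc 0 a := ⟨hs.le, (hs'.trans_le ((min_le_right _ _).trans (min_le_left _ _))).le⟩
    have hsb : s ∈ Icc 0 b := ⟨hs.le, (hs'.trans_le ((min_le_right _ _).trans (min_le_right _ _))).le⟩
    have hta : t ∈ Icc 0 a := ⟨ht.le, (ht'.trans_le ((min_le_right _ _).trans (min_le_left _ _))).le⟩
    have htb : t ∈ Icc 0 b := ⟨ht.le, (ht'.trans_le ((min_le_right _ _).trans (min_le_right _ _))).le⟩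
    have e1 := hf.geo 0 ⟨le_rfl, ha.le⟩ s hsa
    have e2 := hg.geo 0 ⟨le_rfl, hb.le⟩ t htb
    rw [h0, zero_sub, abs_neg, abs_of_pos hs] at e1
    rw [h0', zero_sub, abs_neg, abs_of_pos ht] at e2
    rw [e1, e2]
    refine euclCompAngle_le_of_dist_le hs ht (pathDistIn_nonneg _ _ _) hη ?_
    have q1 : pathDistIn E (σ s) (τ s) ≤ η * s := hes ⟨hs, hse⟩
    have q2 : pathDistIn E (σ t) (τ t) ≤ η * t := hes ⟨ht, hte⟩
    rcases le_total s t with hst | hst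
    · have := hE.pathDistIn_triangle (hf.mem s hsa) (hg.mem s hsb) (hg.mem t htb)
      rw [hg.geo s hsb t htb] at this
      rw [min_eq_left hst]
      linarith
    · have := hE.pathDistIn_triangle (hf.mem s hsa) (hf.mem t hta) (hg.mem t htb)
      rw [hf.geo s hsa t hta] at this
      rw [min_eq_right hst]
      linarith
  have hlim : Tendsto (fun η : ℝ => Real.arccos (1 - η - η ^ 2 / 2)) (nhdsWithin 0 (Ioi 0))
      (nhds 0) := by
    have hc : Continuous fun η : ℝ => Real.arccos (1 - η - η ^ 2 / 2) :=
      Real.continuous_arccos.comp (by fun_prop)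
    have := (hc.tendsto 0).mono_left (nhdsWithin_le_nhds (s := Ioi 0))
    simpa using this
  exact ge_of_tendsto hlim (eventually_mem_nhdsWithin.mono key)

/-- The angle for the path metric only depends on the tangency classes of the sides. -/
theorem YG.angle_congr (hE : RectConnected E) {a' b' : ℝ} (hσ : YG E σ 0 a) (hα : YG E α 0 a')
    (hτ : YG E τ 0 b) (hβ : YG E β 0 b') (ha : 0 < a) (ha' : 0 < a') (hb : 0 < b) (hb' : 0 < b')
    (hσ0 : σ 0 = p) (hα0 : α 0 = p) (hτ0 : τ 0 = p) (hβ0 : β 0 = p)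
    (h : ∀ η > 0, ∀ᶠ s in nhdsWithin (0 : ℝ) (Ioi 0), pathDistIn E (σ s) (α s) ≤ η * s)
    (h' : ∀ η > 0, ∀ᶠ s in nhdsWithin (0 : ℝ) (Ioi 0), pathDistIn E (τ s) (β s) ≤ η * s) :
    upperAngleWrt (pathDistIn E) p σ τ = upperAngleWrt (pathDistIn E) p α β := by
  have dist0 : ∀ (f : ℝ → X) (c : ℝ), YG E f 0 c → f 0 = p → ∀ s, 0 < s → s < c →
      pathDistIn E p (f s) = s := fun f c hf h0 s hs hsc => by
    have := hf.geo 0 ⟨le_rfl, hf.le⟩ s ⟨hs.le, hsc.le⟩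
    rwa [h0, zero_sub, abs_neg, abs_of_pos hs] at this
  have tri : ∀ (f g k : ℝ → X) (c c' c'' : ℝ), YG E f 0 c → YG E g 0 c' → YG E k 0 c'' → 0 < c →
      0 < c' → 0 < c'' → f 0 = p → g 0 = p → k 0 = p →
      upperAngleWrt (pathDistIn E) p f g ≤
        upperAngleWrt (pathDistIn E) p f k + upperAngleWrt (pathDistIn E) p k g := by
    intro f g k c c' c'' hf hg hk hc hc' hc'' hf0 hg0 hk0
    have m1 : min c (min c' c'') ≤ c := min_le_left _ _
    have m2 : min c (min c' c'') ≤ c' := (min_le_right _ _).trans (min_le_left _ _)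
    have m3 : min c (min c' c'') ≤ c'' := (min_le_right _ _).trans (min_le_right _ _)
    refine upperAngle_triangle (lt_min hc (lt_min hc' hc''))
      (fun s h1 h2 => dist0 f c hf hf0 s h1 (h2.trans_le m1))
      (fun s h1 h2 => dist0 g c' hg hg0 s h1 (h2.trans_le m2))
      (fun s h1 h2 => dist0 k c'' hk hk0 s h1 (h2.trans_le m3))
      (fun _ _ _ _ _ _ => pathDistIn_nonneg _ _ _) fun s r t hs hs' hr hr' ht ht' => ?_
    exact hE.pathDistIn_triangle (hf.mem s ⟨hs.le, hs'.le.trans m1⟩)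
      (hk.mem r ⟨hr.le, hr'.le.trans m3⟩) (hg.mem t ⟨ht.le, ht'.le.trans m2⟩)
  have z1 := hσ.angle_eq_zero hE hα ha ha' hσ0 hα0 h
  have z2 := hα.angle_eq_zero hE hσ ha' ha hα0 hσ0 (by simpa only [pathDistIn_comm] using h)
  have z3 := hτ.angle_eq_zero hE hβ hb hb' hτ0 hβ0 h'
  have z4 := hβ.angle_eq_zero hE hτ hb' hb hβ0 hτ0 (by simpa only [pathDistIn_comm] using h')
  apply le_antisymm
  · have t1 := tri σ τ α _ _ _ hσ hτ hα ha hb ha' hσ0 hτ0 hα0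
    have t2 := tri α τ β _ _ _ hα hτ hβ ha' hb hb' hα0 hτ0 hβ0
    linarith
  · have t1 := tri α β σ _ _ _ hα hβ hσ ha' hb' ha hα0 hβ0 hσ0
    have t2 := tri σ β τ _ _ _ hσ hβ hτ ha hb' hb hσ0 hβ0 hτ0
    linarith

variable [CAT0 X]

theorem seg_convex {x y u v w : X} (hu : u ∈ seg x y) (hv : v ∈ seg x y)
    (hw : w ∈ seg u v) : w ∈ seg x y := by
  rcases Btw.total hu hv with h | h
  · exact Btw.outer' hv (h.outer hw)
  · exact Btw.outer' hu (h.outer (Btw.symm hw))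

/-- A triangular disk whose sides at the apex are segments is star-shaped about the apex. -/
theorem Wedge.star_shaped (hH1 : H1Trivial E) (hE : RectConnected E) (H : TwoCx O)
    (L : LocalCone O p δ) (hξ : dist p ξ = δ) (hζ : dist p ζ = δ)
    (W : Wedge E p (ray p ξ δ) (ray p ζ δ) a b) (ha : a ≤ δ) (hb : b ≤ δ)
    (h : TriDisk E (ray p ξ δ '' Icc 0 a) (ray p ζ δ '' Icc 0 b) (seg (ray p ξ δ a) (ray p ζ δ b))
      p (ray p ξ δ a) (ray p ζ δ b) D) (hD : D ⊆ ball p δ) {w : X} (hw : w ∈ D) :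
    seg p w ⊆ D := by
  have hδ := L.pos
  have hball : ∀ w ∈ D, dist p w < δ := fun w hw => by
    have := hD hw; rwa [mem_ball, dist_comm] at this
  have hclosed : IsClosed {w | seg p w ⊆ D} :=
    (isClosed_seg_subset h.mem.compact.isClosed).preimage (f := fun w : X => (p, w)) (by fun_prop)
  suffices w ∈ closure {w | seg p w ⊆ D} by rwa [hclosed.closure_eq] at this
  rw [Metric.mem_closure_iff]
  intro ε hε
  obtain ⟨x, hxD, hxT, hxO, hwx⟩ := h.mem.exists_near_face H hw hε
  refine ⟨x, ?_, hwx⟩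
  rcases h.mem.extend_inward H L hxD hxO (hball x hxD) with h1 | ⟨a₂, ha₂, ha₂p, ha₂x, -⟩
  · exact h1
  exfalso
  obtain ⟨c, hc, hxc, hcD⟩ := W.radial hH1 hE H L h hD hxD
  have hcd := (hball c (hcD (right_mem_seg _ _))).le
  have side : ∀ (ω : X) (e : ℝ), 0 ≤ e → e ≤ δ → dist p ω = δ → a₂ ∈ ray p ω δ '' Icc 0 e →
      ray p ω δ e ∈ seg (ray p ξ δ a) (ray p ζ δ b) →
      x ∈ ray p ω δ '' Icc 0 e ∨ x ∈ seg (ray p ξ δ a) (ray p ζ δ b) := by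
    rintro ω e he0 heδ hω ⟨u, -, hu⟩ hm
    have hu' : Btw p a₂ ω := hu ▸ btw_ray p ω δ u
    have hxω : Btw p x ω := L.btw_rim ha₂p hω hu' ha₂x (hball x hxD).le
    have hed : dist p (ray p ω δ e) = e := dist_ray hδ hω he0 heδ
    rcases le_total (dist p x) e with hxe | hxe
    · exact Or.inl ⟨dist p x, ⟨dist_nonneg, hxe⟩, (hxω.eq_ray hδ hω).symm⟩
    · refine Or.inr (seg_convex hm hc (hxc.inner' ((btw_ray p ω δ e).order hxω ?_)))
      rwa [hed]
  rcases ha₂ with (ha₂ | ha₂) | ha₂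
  · exact (side ξ a W.left.le ha hξ ha₂ (left_mem_seg _ _)).elim
      (fun h1 => hxT (Or.inl (Or.inl h1))) fun h1 => hxT (Or.inr h1)
  · exact (side ζ b W.right.le hb hζ ha₂ (right_mem_seg _ _)).elim
      (fun h1 => hxT (Or.inl (Or.inr h1))) fun h1 => hxT (Or.inr h1)
  · exact hxT (Or.inr (seg_convex ha₂ hc (hxc.inner' ha₂x)))

/-- Along two segments issuing from `p` in `E` joined by a segment in `E`, the path metric agrees
near `p` with the ambient metric. -/
theorem exists_pathDistIn_ray_eq (hH1 : H1Trivial E) (hE : RectConnected E) (H : TwoCx O)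
    (L : LocalCone O p δ) (hξ : dist p ξ = δ) (hζ : dist p ζ = δ) (hm : Btw p m ξ) (hn : Btw p n ζ)
    (hmE : seg p m ⊆ E) (hnE : seg p n ⊆ E) (hmn : seg m n ⊆ E) (hp : p ∉ seg m n) :
    ∃ e > 0, ∀ s t, 0 < s → s < e → 0 < t → t < e →
      pathDistIn E (ray p ξ δ s) (ray p ζ δ t) = dist (ray p ξ δ s) (ray p ζ δ t) := by
  have hδ := L.pos
  have hmp : m ≠ p := fun he => hp (by rw [he]; exact left_mem_seg _ _)
  have hnp : n ≠ p := fun he => hp (by rw [he]; exact right_mem_seg _ _)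
  have hm0 : 0 < dist p m := dist_pos.2 hmp.symm
  have hn0 : 0 < dist p n := dist_pos.2 hnp.symm
  have hmδ : dist p m ≤ δ := hm.left_le.trans hξ.le
  have hnδ : dist p n ≤ δ := hn.left_le.trans hζ.le
  have hα := YG.of_ray hE hδ hξ hm hmE
  have hβ := YG.of_ray hE hδ hζ hn hnE
  by_cases hne : ξ = ζ
  · subst hne
    refine ⟨dist p m, hm0, fun s t hs hs' ht ht' => ?_⟩
    rw [hα.geo s ⟨hs.le, hs'.le⟩ t ⟨ht.le, ht'.le⟩,
      dist_ray_ray hδ hξ hs.le (hs'.le.trans hmδ) ht.le (ht'.le.trans hmδ)]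
  have W : Wedge E p (ray p ξ δ) (ray p ζ δ) (dist p m) (dist p n) := by
    refine ⟨hα, hβ, ray_zero _ _ _, ray_zero _ _ _, ?_⟩
    rintro _ ⟨⟨s, -, rfl⟩, t, -, ht⟩
    by_contra hwp
    exact hne (L.ext_unique _ _ _ hwp (btw_ray p ξ δ s) (ht ▸ btw_ray p ζ δ t) hξ hζ)
  rw [hm.eq_ray hδ hξ, hn.eq_ray hδ hζ] at hmn hp
  obtain ⟨s₁, hs₁, hs₁m, t₁, ht₁, ht₁n, -, D₁, hD₁⟩ := W.exists_disk hH1 hE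
    ⟨hm0.le, le_rfl⟩ ⟨hn0.le, le_rfl⟩ hmn hp
  have W₁ := W.mono ⟨hs₁.le, hs₁m⟩ ⟨ht₁.le, ht₁n⟩
  obtain ⟨s₂, hs₂, hs₂m, -, t₂, ht₂, ht₂n, -, D₂, hD₂, hsub⟩ := W₁.exists_small_disk hH1 hE H hD₁ hδ
  have W₂ := W₁.mono ⟨hs₂.le, hs₂m⟩ ⟨ht₂.le, ht₂n⟩
  have hs₂δ : s₂ ≤ δ := hs₂m.trans (hs₁m.trans hmδ)
  have ht₂δ : t₂ ≤ δ := ht₂n.trans (ht₁n.trans hnδ)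
  have hball : ∀ w ∈ D₂, dist p w < δ := fun w hw => by
    have := hsub hw; rwa [mem_ball, dist_comm] at this
  have hbase : seg (ray p ξ δ s₂) (ray p ζ δ t₂) ⊆ D₂ := fun w hw => hD₂.mem.subset (Or.inr hw)
  refine ⟨min s₂ t₂, lt_min hs₂ ht₂, fun s t hs hs' ht ht' => hE.pathDistIn_of_seg ?_⟩
  have hs'' := hs'.trans_le (min_le_left _ _)
  have ht'' := ht'.trans_le (min_le_right _ _)
  refine (seg_subset_coneOver H L hD₂.apex_notMem (hball _ (hbase (left_mem_seg _ _)))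
    (hball _ (hbase (right_mem_seg _ _))) ?_ ?_).trans ?_
  · refine ⟨_, left_mem_seg _ _, (btw_ray p ξ δ s).order (btw_ray p ξ δ s₂) ?_⟩
    rw [dist_ray hδ hξ hs.le (hs''.le.trans hs₂δ), dist_ray hδ hξ hs₂.le hs₂δ]
    exact hs''.le
  · refine ⟨_, right_mem_seg _ _, (btw_ray p ζ δ t).order (btw_ray p ζ δ t₂) ?_⟩
    rw [dist_ray hδ hζ ht.le (ht''.le.trans ht₂δ), dist_ray hδ hζ ht₂.le ht₂δ]
    exact ht''.le
  · rintro w ⟨c, hc, hwc⟩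
    exact hD₂.sub (W₂.star_shaped hH1 hE H L hξ hζ hs₂δ ht₂δ hD₂ hsub (hbase hc) hwc)

end PathAngles

section LimitSegments

variable {X : Type*} [MetricSpace X] [CAT0 X] {E O D : Set X} {p q r y z ξ : X} {a b : ℝ}
  {σ τ dir : ℝ → X} {δ : ℝ}

theorem isLimitSegment_ray (hH1 : H1Trivial E) (hE : RectConnected E) (H : TwoCx O)
    (L : LocalCone O p δ) (hσ : IsGeodesicFromTo (pathDistIn E) E σ p q) (ha : 0 < a)
    (haq : a ≤ pathDistIn E p q) (hξ : dist p ξ = δ) (hdir : DirOf p δ σ dir a)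
    (hlim : Tendsto dir (nhdsWithin 0 (Ioi 0)) (nhds ξ)) {ε : ℝ} (hε : 0 < ε) (hεδ : ε ≤ δ) :
    IsLimitSegment E p q ε (ray p ξ δ) := by
  have hδ := L.pos
  refine ⟨hε, ray_zero _ _ _, ⟨hε.le, fun s hs t ht => dist_ray_ray hδ hξ hs.1 (hs.2.trans hεδ) ht.1
    (ht.2.trans hεδ)⟩, fun σ' hσ' ε' hε' => ?_⟩
  have hf := hσ.yg.mono le_rfl ha.le haq
  have hev : ∀ᶠ t in nhdsWithin (0 : ℝ) (Ioi 0), t ∈ Ioc 0 a ∧ dist (σ t) p < ε ∧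
      dist (dir t) ξ < ε' := by
    filter_upwards [Ioc_mem_nhdsGT ha, hf.tendsto_zero hE hσ.1 ha (ball_mem_nhds p hε),
      hlim (ball_mem_nhds ξ hε')] with t h1 h2 h3
    exact ⟨h1, h2, h3⟩
  obtain ⟨t₀, ht₀, hsub⟩ := mem_nhdsGT_iff_exists_Ioc_subset.1 hev
  refine ⟨t₀, ht₀, fun t ht htt₀ htq g hg hg0 hgt s hs => ?_⟩
  obtain ⟨htI, htd, htξ⟩ := hsub ⟨ht, htt₀⟩
  have heq : σ' t = σ t := hσ'.yg.unique H hH1 hE hσ.yg (hσ'.1.trans hσ.1.symm)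
    (hσ'.2.1.trans hσ.2.1.symm) t ⟨ht.le, htq⟩
  rw [heq] at hgt
  have hne : σ t ≠ p := by
    rw [← hσ.1]
    exact hσ.yg.ne_zero hE ⟨ht.le, htq⟩ ht.ne'
  have hgd : ∀ u ∈ Icc 0 ε, dist p (g u) = u := fun u hu => by
    have := hg.2 0 ⟨le_rfl, hε.le⟩ u hu
    simp only at this
    rwa [hg0, zero_sub, abs_neg, abs_of_nonneg hu.1] at this
  have hgb : ∀ u ∈ Icc 0 ε, Btw p (g u) (g ε) := fun u hu => by
    have := hg.2 u hu ε ⟨hε.le, le_rfl⟩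
    simp only at this
    rw [Btw, hgd u hu, hgd ε ⟨hε.le, le_rfl⟩, this, abs_sub_comm,
      abs_of_nonneg (by linarith [hu.2])]
    ring
  have hσI : dist p (σ t) ∈ Icc 0 ε := ⟨dist_nonneg, by rw [dist_comm]; exact htd.le⟩
  have hb : Btw p (g ε) (dir t) := L.btw_rim hne (hdir.dist_eq t htI) (hdir.btw t htI)
    (hgt ▸ hgb _ hσI) (by rw [hgd ε ⟨hε.le, le_rfl⟩]; exact hεδ)
  have hgs := (hb.outer' (hgb s hs)).eq_ray hδ (hdir.dist_eq t htI)
  rw [hgd s hs] at hgs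
  rw [hgs]
  have hsδ : s ≤ δ := hs.2.trans hεδ
  calc dist (ray p (dir t) δ s) (ray p ξ δ s) ≤ s / δ * dist (dir t) ξ :=
        dist_ray_ray_left hδ _ _ hs.1 hsδ
    _ ≤ 1 * dist (dir t) ξ := mul_le_mul_of_nonneg_right ((div_le_one hδ).2 hsδ) dist_nonneg
    _ ≤ ε' := by rw [one_mul]; exact htξ.le

/-- A side of a triangular disk has a limit direction at the apex, the disk contains a segment
in this direction, and the side is tangent to it in the path metric. -/
theorem Wedge.exists_tangent_ray (hH1 : H1Trivial E) (hE : RectConnected E) (H : TwoCx O)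
    (L : LocalCone O p δ) (W : Wedge E p σ τ a b) (ha : 0 < a)
    (h : TriDisk E (σ '' Icc 0 a) (τ '' Icc 0 b) (seg (σ a) z) p (σ a) z D)
    (hD : D ⊆ ball p δ) :
    ∃ dir ξ m, DirOf p δ σ dir a ∧ dist p ξ = δ ∧ Tendsto dir (nhdsWithin 0 (Ioi 0)) (nhds ξ) ∧
      m ∈ seg (σ a) z ∧ Btw p m ξ ∧ seg p m ⊆ E ∧ m ≠ p ∧
      ∀ η > 0, ∀ᶠ s in nhdsWithin (0 : ℝ) (Ioi 0), pathDistIn E (σ s) (ray p ξ δ s) ≤ η * s := by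
  have hσD : ∀ s ∈ Ioc 0 a, σ s ∈ D := fun s hs =>
    h.mem.subset (Or.inl (Or.inl ⟨s, ⟨hs.1.le, hs.2⟩, rfl⟩))
  obtain ⟨dir, hdir⟩ := exists_dirOf (σ := σ) (a := a) L
    (fun s hs => by
      rw [← W.left_zero]
      exact W.left.ne_zero hE ⟨hs.1.le, hs.2⟩ hs.1.ne')
    (fun s hs => by
      have := hD (hσD s hs)
      rw [mem_ball, dist_comm] at this
      exact this.le)
  obtain ⟨ξ, hξ, hlim, m, hm, hmξ, hmD⟩ := W.exists_limit_direction hH1 hE H L ha h hD hdir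
  have hp : p ∉ seg (σ a) m := fun hp => h.apex_notMem (seg_subset_of_mem_left hm hp)
  have hmE : seg (σ a) m ⊆ E := fun w hw =>
    h.sub (h.mem.subset (Or.inr (seg_subset_of_mem_left hm hw)))
  have hmp : m ≠ p := fun he => hp (he ▸ right_mem_seg _ _)
  exact ⟨dir, ξ, m, hdir, hξ, hlim, hm, hmξ, hmD.trans h.sub, hmp, fun η hη =>
    W.left.tangent hH1 hE H L W.left_zero ha hξ hdir hlim hmξ (hmD.trans h.sub) hmp hmE hp hη⟩

theorem exists_limit_segments (hH1 : H1Trivial E) (hE : RectConnected E) (H : TwoCx O)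
    {γ : SCC X} (hT : IsYTriangle E γ.img p q r) :
    ∃ ε₀ > 0, ∀ ε, 0 < ε → ε ≤ ε₀ →
      ∃ Rq Rr : ℝ → X, IsLimitSegment E p q ε Rq ∧ IsLimitSegment E p r ε Rr ∧
        ∀ σ τ : ℝ → X, IsGeodesicFromTo (pathDistIn E) E σ p q →
          IsGeodesicFromTo (pathDistIn E) E τ p r →
          upperAngleWrt (pathDistIn E) p σ τ = upperAngleWrt (xDist X) p Rq Rr := by
  obtain ⟨σ, τ, ρ, c, hσ, hτ, h⟩ := hT.exists_simpleTri H hH1 hE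
  have hc : 0 < c := by
    refine h.base.le.lt_of_ne ?_
    rintro rfl
    have h1 : σ (pathDistIn E p q) ∈ τ '' Icc 0 (pathDistIn E p r) := by
      rw [h.left_end]
      exact ⟨_, ⟨h.right_pos.le, le_rfl⟩, h.right_end⟩
    exact h.left.ne_zero hE ⟨h.left_pos.le, le_rfl⟩ h.left_pos.ne'
      (h.inter_apex ⟨⟨_, ⟨h.left_pos.le, le_rfl⟩, rfl⟩, h1⟩)
  obtain ⟨D₀, hD₀⟩ := h.exists_triDisk hH1 hE hc
  rw [hσ.1] at hD₀
  have W₀ : Wedge E p σ τ (pathDistIn E p q) (pathDistIn E p r) :=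
    ⟨hσ.yg, hτ.yg, hσ.1, hτ.1, by simpa only [hσ.1] using h.inter_apex⟩
  obtain ⟨δ, hδ, hL⟩ := H.localCone p
  have L := hL δ hδ le_rfl
  obtain ⟨a, ha, haq, -, b, hb, hbr, -, D, hD, hsub⟩ := W₀.exists_small_disk hH1 hE H hD₀ hδ
  have W := W₀.mono ⟨ha.le, haq⟩ ⟨hb.le, hbr⟩
  obtain ⟨dir, ξ, m, hdir, hξ, hlim, hm, hmξ, hmE, hmp, htan⟩ :=
    W.exists_tangent_ray hH1 hE H L ha hD hsub
  have hD' := hD.symm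
  rw [seg_comm] at hD'
  obtain ⟨dir', ζ, n, hdir', hζ, hlim', hn, hnζ, hnE, hnp, htan'⟩ :=
    W.symm.exists_tangent_ray hH1 hE H L hb hD' hsub
  rw [seg_comm] at hn
  have hmn : seg m n ⊆ seg (σ a) (τ b) := fun w hw => seg_convex hm hn hw
  obtain ⟨e, he, hdist⟩ := exists_pathDistIn_ray_eq hH1 hE H L hξ hζ hmξ hnζ hmE hnE
    (fun w hw => hD.sub (hD.mem.subset (Or.inr (hmn hw)))) fun hp => hD.apex_notMem (hmn hp)
  refine ⟨δ, hδ, fun ε hε hεδ => ⟨ray p ξ δ, ray p ζ δ,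
    isLimitSegment_ray hH1 hE H L hσ ha haq hξ hdir hlim hε hεδ,
    isLimitSegment_ray hH1 hE H L hτ hb hbr hζ hdir' hlim' hε hεδ, fun σ' τ' hσ' hτ' => ?_⟩⟩
  have hα := YG.of_ray hE hδ hξ hmξ hmE
  have hβ := YG.of_ray hE hδ hζ hnζ hnE
  have hm0 : 0 < dist p m := dist_pos.2 hmp.symm
  have hn0 : 0 < dist p n := dist_pos.2 hnp.symm
  have u1 := hσ'.yg.unique H hH1 hE hσ.yg (hσ'.1.trans hσ.1.symm) (hσ'.2.1.trans hσ.2.1.symm)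
  have u2 := hτ'.yg.unique H hH1 hE hτ.yg (hτ'.1.trans hτ.1.symm) (hτ'.2.1.trans hτ.2.1.symm)
  have c1 : upperAngleWrt (pathDistIn E) p σ' τ' = upperAngleWrt (pathDistIn E) p σ τ := by
    refine upperAngle_congr (lt_min h.left_pos h.right_pos) fun s t hs hs' ht ht' => ?_
    rw [u1 s ⟨hs.le, hs'.le.trans (min_le_left _ _)⟩, u2 t ⟨ht.le, ht'.le.trans (min_le_right _ _)⟩]
    exact ⟨rfl, rfl, rfl⟩
  have c2 := YG.angle_congr hE W.left hα W.right hβ ha hm0 hb hn0 W.left_zero (ray_zero _ _ _)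
    W.right_zero (ray_zero _ _ _) htan htan'
  rw [c1, c2]
  have ray_dist : ∀ (ω x : X), dist p ω = δ → Btw p x ω → YG E (ray p ω δ) 0 (dist p x) →
      ∀ s, 0 < s → s < dist p x → pathDistIn E p (ray p ω δ s) = xDist X p (ray p ω δ s) := by
    intro ω x hω hx hf s hs hsx
    have h1 := hf.geo 0 ⟨le_rfl, hf.le⟩ s ⟨hs.le, hsx.le⟩
    rw [ray_zero, zero_sub, abs_neg, abs_of_pos hs] at h1
    rw [h1]
    exact (dist_ray hδ hω hs.le (hsx.le.trans (hx.left_le.trans hω.le))).symm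
  refine upperAngle_congr (lt_min he (lt_min hm0 hn0)) fun s t hs hs' ht ht' => ⟨?_, ?_, ?_⟩
  · exact ray_dist ξ m hξ hmξ hα s hs
      (hs'.trans_le ((min_le_right _ _).trans (min_le_left _ _)))
  · exact ray_dist ζ n hζ hnζ hβ t ht
      (ht'.trans_le ((min_le_right _ _).trans (min_le_right _ _)))
  · exact hdist s t hs (hs'.trans_le (min_le_left _ _)) ht (ht'.trans_le (min_le_left _ _))

end LimitSegments

end Cat2Cx

end

open Cat2Cx in
/-- **Theorem (limit_segment_theorem).**  Let `T` be a simple geodesic triangle in `Y` with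
vertices `p, q, r`.  For all sufficiently small `ε > 0` both limit segments `R_q^ε` and
`R_r^ε` of `T` at `p` exist, and `∠_p^Y(q,r) = ∠_p^X(R_q^ε, R_r^ε)`. -/
theorem limit_segments_exist_and_realize_angle
    {κ : ℝ} (hκ : κ ≤ 0) {X : Type*} [MetricSpace X]
    (PC : PolyComplex2 κ X) (hX : IsCATSpace κ X)
    (E : Set X) (hEclosed : IsClosed E) (hErc : RectConnected E) (hH1 : H1Trivial ↥E)
    (γT : SCC X) (p q r : X) (hT : IsYTriangle E γT.img p q r) :
    ∃ ε₀ > 0, ∀ ε, 0 < ε → ε ≤ ε₀ →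
      ∃ Rq Rr : ℝ → X, IsLimitSegment E p q ε Rq ∧ IsLimitSegment E p r ε Rr ∧
        ∀ σ τ : ℝ → X, IsGeodesicFromTo (pathDistIn E) E σ p q →
          IsGeodesicFromTo (pathDistIn E) E τ p r →
          upperAngleWrt (pathDistIn E) p σ τ = upperAngleWrt (xDist X) p Rq Rr := by
  have := cat0_of_isCATSpace hκ hX
  exact exists_limit_segments hH1 hErc (PolyComplex2.twoCx hκ PC) hT
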